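/- For any non-constant homogeneous polynomial f ∈ ℂ[x₀,…,x_n], the complement D(f) is homotopy equivalent to a CW complex obtained from D(f) ∩ H by attaching d(f) cells of dimension n, where H is a generic hyperplane in ℙⁿ (i.e., transversal to a stratification of the projective hypersurface V(f)). In particular, d(f) = (−1)ⁿ · χ(D(f) \ H), where χ denotes the topological Euler characteristic. -/

import Mathlib

open MvPolynomial CategoryTheory
open scoped BigOperators unitInterval

noncomputable section

/-! ### Projective space, hypersurfaces and the degree of the gradient map -/

/-- `ℙⁿ(ℂ)`, realized as the projectivization of `ℂ^{n+1}`. -/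
abbrev Proj (n : ℕ) := Projectivization ℂ (Fin (n + 1) → ℂ)

instance (n : ℕ) : TopologicalSpace (Proj n) :=
  inferInstanceAs (TopologicalSpace (Quotient _))

variable {n : ℕ}

/-- The projective zero set `V(f)` of a homogeneous polynomial `f`. -/
def projZeros (f : MvPolynomial (Fin (n + 1)) ℂ) : Set (Proj n) :=
  {x | eval x.rep f = 0}

/-- The principal open set `D(f) = {x ∈ ℙⁿ : f(x) ≠ 0}`. -/
def principalOpen (f : MvPolynomial (Fin (n + 1)) ℂ) : Set (Proj n) :=
  {x | eval x.rep f ≠ 0}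

/-- The gradient vector `(f₀(x), …, f_n(x))` of `f` at (a representative of) `x`. -/
def gradVec (f : MvPolynomial (Fin (n + 1)) ℂ) (x : Proj n) : Fin (n + 1) → ℂ :=
  fun i => eval x.rep (pderiv i f)

/-- The singular locus of the projective hypersurface `V(f)`. -/
def singularLocus (f : MvPolynomial (Fin (n + 1)) ℂ) : Set (Proj n) :=
  {x | eval x.rep f = 0 ∧ ∀ i, eval x.rep (pderiv i f) = 0}

/-- Zariski-closed subsets of `ℙⁿ`: common zero sets of families of homogeneous
polynomials. -/
def IsZariskiClosed (S : Set (Proj n)) : Prop :=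
  ∃ T : Set (MvPolynomial (Fin (n + 1)) ℂ),
    (∀ g ∈ T, ∃ m, g.IsHomogeneous m) ∧ S = {x | ∀ g ∈ T, eval x.rep g = 0}

/-- `U` is a Zariski open and dense subset of `ℙⁿ` (dense: it meets every nonempty
Zariski open set). -/
def IsZariskiOpenDense (U : Set (Proj n)) : Prop :=
  IsZariskiClosed Uᶜ ∧
    ∀ W : Set (Proj n), IsZariskiClosed Wᶜ → W.Nonempty → (U ∩ W).Nonempty

/-- The fiber over `u` of the gradient map `φ_f = grad f : D(f) → ℙⁿ`. -/
def gradFiber (f : MvPolynomial (Fin (n + 1)) ℂ) (u : Proj n) : Set (Proj n) :=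
  {x | x ∈ principalOpen f ∧
       ∃ h : gradVec f x ≠ 0, Projectivization.mk ℂ (gradVec f x) h = u}

/-- `d(f) = k`: there is a Zariski open and dense subset `U ⊆ ℙⁿ` over which every
fiber of the gradient map has exactly `k` points.  (If the gradient map is not
dominant this holds precisely for `k = 0`, taking for `U` the complement of the
closure of the image, so this single definition covers both cases.) -/
def HasGradDegree (f : MvPolynomial (Fin (n + 1)) ℂ) (k : ℕ) : Prop :=
  ∃ U : Set (Proj n), IsZariskiOpenDense U ∧
    ∀ u ∈ U, (gradFiber f u).Finite ∧ (gradFiber f u).ncard = k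

/-- The hyperplane of `ℙⁿ` with coefficient vector `c`. -/
def hyperplane (c : Fin (n + 1) → ℂ) : Set (Proj n) :=
  {x | ∑ i, c i * x.rep i = 0}

/-! ### Singular homology -/

/-- The singular homology functor in degree `k` with coefficients in `R`: the
composite of the singular simplicial set functor, the levelwise free `R`-module
functor, the alternating face map complex, and homology. -/
def singularHomologyFunctor (R : Type) [CommRing R] (k : ℕ) :
    TopCat.{0} ⥤ ModuleCat.{0} R :=
  TopCat.toSSet ⋙ ((SimplicialObject.whiskering _ _).obj (ModuleCat.free R)) ⋙
    AlgebraicTopology.alternatingFaceMapComplex (ModuleCat R) ⋙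
    HomologicalComplex.homologyFunctor (ModuleCat R) (ComplexShape.down ℕ) k

/-- The `k`-th singular homology `H_k(X; R)` of a topological space. -/
def sHomology (R : Type) [CommRing R] (k : ℕ) (X : Type) [TopologicalSpace X] :
    ModuleCat R :=
  (singularHomologyFunctor R k).obj (TopCat.of X)

/-- The `k`-th Betti number `b_k(X) = dim_ℚ H_k(X; ℚ)`. -/
def betti (k : ℕ) (X : Type) [TopologicalSpace X] : ℕ :=
  Module.finrank ℚ (sHomology ℚ k X)

/-- `X` has a (well-defined) topological Euler characteristic, equal to `e`. -/
def HasEulerChar (X : Type) [TopologicalSpace X] (e : ℤ) : Prop :=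
  (∀ k, FiniteDimensional ℚ (sHomology ℚ k X)) ∧
    ∃ N : ℕ, (∀ k, N ≤ k → betti k X = 0) ∧
      e = ∑ k ∈ Finset.range N, (-1 : ℤ) ^ k * betti k X

/-! ### Bouquets of spheres and attaching cells -/

/-- A base point of the `m`-sphere. -/
def spherePt (m : ℕ) : Metric.sphere (0 : EuclideanSpace ℝ (Fin (m + 1))) 1 :=
  ⟨EuclideanSpace.single 0 1, by simp⟩

/-- A bouquet (wedge) of `k` spheres of dimension `m`: the disjoint union of a
point and `k` copies of `Sᵐ`, with all base points identified.  For `k = 0`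
this is a one-point space. -/
def Bouquet (m k : ℕ) : Type :=
  Quot (fun x y : Unit ⊕ (Fin k × Metric.sphere (0 : EuclideanSpace ℝ (Fin (m + 1))) 1) =>
    ∃ i, x = Sum.inl () ∧ y = Sum.inr (i, spherePt m))

instance (m k : ℕ) : TopologicalSpace (Bouquet m k) :=
  inferInstanceAs (TopologicalSpace (Quot _))

/-- The CW-type space obtained from `A` by attaching `k` cells of dimension `m`
along the attaching maps `φ i : S^{m-1} → A` (each cell is a copy of the closed
`m`-disk, glued along its boundary sphere). -/
def AttachCells (A : Type) [TopologicalSpace A] (m k : ℕ)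
    (φ : Fin k → C(Metric.sphere (0 : EuclideanSpace ℝ (Fin m)) 1, A)) : Type :=
  Quot (fun x y : A ⊕ (Fin k × Metric.closedBall (0 : EuclideanSpace ℝ (Fin m)) 1) =>
    ∃ (i : Fin k) (v : Metric.sphere (0 : EuclideanSpace ℝ (Fin m)) 1),
      x = Sum.inr (i, ⟨v.1, Metric.sphere_subset_closedBall v.2⟩) ∧ y = Sum.inl (φ i v))

instance (A : Type) [TopologicalSpace A] (m k : ℕ)
    (φ : Fin k → C(Metric.sphere (0 : EuclideanSpace ℝ (Fin m)) 1, A)) :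
    TopologicalSpace (AttachCells A m k φ) :=
  inferInstanceAs (TopologicalSpace (Quot _))

/-- The standard topological simplex. -/
abbrev TopSimplex (k : ℕ) := stdSimplex ℝ (Fin (k + 1))

/-- The continuous map of simplices induced by a map on vertices. -/
def simplexMap {k l : ℕ} (g : Fin (k + 1) → Fin (l + 1)) : C(TopSimplex k, TopSimplex l) :=
  ⟨stdSimplex.map g, stdSimplex.continuous_map g⟩

/-- Singular chains with rational coefficients. -/
abbrev SingChain (X : Type) [TopologicalSpace X] (k : ℕ) := C(TopSimplex k, X) →₀ ℚ

/-- The boundary of singular chains. -/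
def singBoundary (X : Type) [TopologicalSpace X] (k : ℕ) :
    SingChain X (k + 1) →ₗ[ℚ] SingChain X k :=
  ∑ i : Fin (k + 2), ((-1 : ℚ) ^ (i : ℕ)) •
    Finsupp.lmapDomain ℚ ℚ (fun s => s.comp (simplexMap i.succAbove))

/-- The chain complex computing `sHomology ℚ`. -/
def frozenComplex (X : Type) [TopologicalSpace X] : ChainComplex (ModuleCat ℚ) ℕ :=
  (AlgebraicTopology.alternatingFaceMapComplex (ModuleCat ℚ)).obj
    (((SimplicialObject.whiskering _ _).obj (ModuleCat.free ℚ)).obj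
      (TopCat.toSSet.obj (TopCat.of X)))

def frozenEquiv (X : Type) [TopologicalSpace X] (k : ℕ) :
    (frozenComplex X).X k ≃ₗ[ℚ] SingChain X k :=
  Finsupp.domLCongr (TopCat.toSSetObjEquiv (TopCat.of X) (.op (.mk k)))

lemma frozenEquiv_freeMk (X : Type) [TopologicalSpace X] (k : ℕ)
    (s : (TopCat.toSSet.obj (TopCat.of X)).obj (.op (.mk k))) :
    frozenEquiv X k (ModuleCat.freeMk s) =
      Finsupp.single (TopCat.toSSetObjEquiv (TopCat.of X) (.op (.mk k)) s) 1 :=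
  Finsupp.domLCongr_single _ _ _

lemma frozenEquiv_d (X : Type) [TopologicalSpace X] (k : ℕ) (z : (frozenComplex X).X (k + 1)) :
    frozenEquiv X k ((frozenComplex X).d (k + 1) k z) = singBoundary X k (frozenEquiv X (k + 1) z) := by
  have key : (frozenEquiv X k).toLinearMap ∘ₗ ((frozenComplex X).d (k + 1) k).hom =
      singBoundary X k ∘ₗ (frozenEquiv X (k + 1)).toLinearMap := by
    refine Finsupp.lhom_ext' fun s => LinearMap.ext_ring ?_
    change frozenEquiv X k ((frozenComplex X).d (k + 1) k (ModuleCat.freeMk s)) = 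
      singBoundary X k (frozenEquiv X (k + 1) (ModuleCat.freeMk s))
    have h : (frozenComplex X).d (k + 1) k =
        (∑ i : Fin (k + 2), ((-1 : ℤ) ^ (i : ℕ)) •
          ((ModuleCat.free ℚ).map ((TopCat.toSSet.obj (TopCat.of X)).δ i) :
            (ModuleCat.free ℚ).obj ((TopCat.toSSet.obj (TopCat.of X)).obj (.op (.mk (k + 1)))) ⟶
            (ModuleCat.free ℚ).obj ((TopCat.toSSet.obj (TopCat.of X)).obj (.op (.mk k))))) :=
      AlgebraicTopology.alternatingFaceMapComplex_obj_d (C := ModuleCat ℚ) _ k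
    change frozenEquiv X k (((frozenComplex X).d (k + 1) k).hom (ModuleCat.freeMk s)) = _
    rw [h]
    change frozenEquiv X k ((∑ i : Fin (k + 2), ((-1 : ℤ) ^ (i : ℕ)) •
          ((ModuleCat.free ℚ).map ((TopCat.toSSet.obj (TopCat.of X)).δ i) :
            (ModuleCat.free ℚ).obj ((TopCat.toSSet.obj (TopCat.of X)).obj (.op (.mk (k + 1)))) ⟶
            (ModuleCat.free ℚ).obj ((TopCat.toSSet.obj (TopCat.of X)).obj (.op (.mk k))))).hom
              (ModuleCat.freeMk s)) = _
    rw [frozenEquiv_freeMk, ModuleCat.hom_sum, LinearMap.sum_apply]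
    let e : ((ModuleCat.free ℚ).obj ((TopCat.toSSet.obj (TopCat.of X)).obj (.op (.mk k)))) ≃ₗ[ℚ]
      SingChain X k := frozenEquiv X k
    refine (map_sum e _ _).trans ?_
    simp only [LinearMap.sum_apply, singBoundary, LinearMap.smul_apply,
      Finsupp.lmapDomain_apply, Finsupp.mapDomain_single]
    refine Finset.sum_congr rfl fun i _ => ?_
    rw [ModuleCat.hom_zsmul, LinearMap.smul_apply, map_zsmul,
      ← Int.cast_smul_eq_zsmul ℚ, Int.cast_pow, Int.cast_neg, Int.cast_one]
    congr 1
    refine (congrArg e (ModuleCat.free_map_apply _ s)).trans ?_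
    exact frozenEquiv_freeMk X k _
  exact LinearMap.congr_fun key z

/-- A rational chain complex has finite total Betti number and Euler characteristic `e`. -/
def HasChi (K : ChainComplex (ModuleCat.{0} ℚ) ℕ) (e : ℤ) : Prop :=
  (∀ k, FiniteDimensional ℚ (K.homology k)) ∧
    ∃ N : ℕ, (∀ k, N ≤ k → Module.finrank ℚ (K.homology k) = 0) ∧
      e = ∑ k ∈ Finset.range N, (-1 : ℤ) ^ k * Module.finrank ℚ (K.homology k)

lemma hasEulerChar_iff (X : Type) [TopologicalSpace X] (e : ℤ) :
    HasEulerChar X e ↔ HasChi (frozenComplex X) e := Iff.rfl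

lemma hasChi_of_finrank_eq {K L : ChainComplex (ModuleCat.{0} ℚ) ℕ} {e : ℤ} (h : HasChi K e)
    (f : ∀ k, Nonempty (K.homology k ≃ₗ[ℚ] L.homology k)) : HasChi L e := by
  obtain ⟨hK, N, hN, he⟩ := h
  have hr k := (f k).some.finrank_eq
  exact ⟨fun k => Module.Finite.equiv (f k).some, N, fun k hk => by rw [← hr, hN k hk],
    by simp only [he, hr]⟩

lemma HasChi.eq_sum {K : ChainComplex (ModuleCat.{0} ℚ) ℕ} {e : ℤ} (h : HasChi K e) :
    ∃ N, ∀ M, N ≤ M → (∀ k, M ≤ k → Module.finrank ℚ (K.homology k) = 0) ∧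
      e = ∑ k ∈ Finset.range M, (-1 : ℤ) ^ k * Module.finrank ℚ (K.homology k) := by
  obtain ⟨hK, N, hN, he⟩ := h
  refine ⟨N, fun M hM => ⟨fun k hk => hN k (hM.trans hk), ?_⟩⟩
  rw [he]
  refine Finset.sum_subset (Finset.range_subset_range.2 hM) fun k _ hk => ?_
  rw [hN k (by simpa using hk)]; simp

lemma moduleFinite_of_exact_of_finite {M N P : Type} [AddCommGroup M] [AddCommGroup N]
    [AddCommGroup P] [Module ℚ M] [Module ℚ N] [Module ℚ P] (f : M →ₗ[ℚ] N) (g : N →ₗ[ℚ] P)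
    (h : Function.Exact f g) [Module.Finite ℚ M] [Module.Finite ℚ P] : Module.Finite ℚ N := by
  have h1 : Function.Exact f g.rangeRestrict := by
    intro x
    rw [← h x, Subtype.ext_iff]; rfl
  exact Module.Finite.of_exact h1 g.surjective_rangeRestrict

lemma finrank_eq_of_exact {M N P : Type} [AddCommGroup M] [AddCommGroup N]
    [AddCommGroup P] [Module ℚ M] [Module ℚ N] [Module ℚ P] (f : M →ₗ[ℚ] N) (g : N →ₗ[ℚ] P)
    (h : Function.Exact f g) [Module.Finite ℚ N] :
    Module.finrank ℚ N = Module.finrank ℚ f.range + Module.finrank ℚ g.range := by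
  rw [← LinearMap.finrank_range_add_finrank_ker g, add_comm, LinearMap.exact_iff.1 h]

section
variable {S : ShortComplex (ChainComplex (ModuleCat.{0} ℚ) ℕ)} (hS : S.ShortExact)

include hS in
lemma epi_homologyMap_zero_of_shortExact :
    Function.Surjective (HomologicalComplex.homologyMap S.g 0) := by
  have := hS.epi_g
  have e1 : Epi (HomologicalComplex.opcyclesMap S.g 0) := by
    have : Epi (S.X₂.pOpcycles 0 ≫ HomologicalComplex.opcyclesMap S.g 0) := by
      rw [HomologicalComplex.p_opcyclesMap]; infer_instance
    exact epi_of_epi (S.X₂.pOpcycles 0) _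
  have i2 := S.X₂.isIso_homologyι 0 _ rfl (by simp)
  have i3 := S.X₃.isIso_homologyι 0 _ rfl (by simp)
  have : Epi (HomologicalComplex.homologyMap S.g 0 ≫ S.X₃.homologyι 0) := by
    rw [HomologicalComplex.homologyι_naturality]; infer_instance
  have : Epi (HomologicalComplex.homologyMap S.g 0) := by
    rwa [epi_comp_iff_of_isIso] at this
  exact (ModuleCat.epi_iff_surjective _).1 this

include hS in
lemma shortExact_exact₁ (k : ℕ) : Function.Exact (hS.δ (k + 1) k rfl).hom
    (HomologicalComplex.homologyMap S.f k).hom :=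
  LinearMap.exact_iff.2 (ShortComplex.Exact.moduleCat_range_eq_ker
    (hS.homology_exact₁ (k + 1) k rfl)).symm

include hS in
lemma shortExact_exact₂ (k : ℕ) : Function.Exact (HomologicalComplex.homologyMap S.f k).hom
    (HomologicalComplex.homologyMap S.g k).hom :=
  LinearMap.exact_iff.2 (ShortComplex.Exact.moduleCat_range_eq_ker (hS.homology_exact₂ k)).symm

include hS in
lemma shortExact_exact₃ (k : ℕ) : Function.Exact (HomologicalComplex.homologyMap S.g (k + 1)).hom
    (hS.δ (k + 1) k rfl).hom :=
  LinearMap.exact_iff.2 (ShortComplex.Exact.moduleCat_range_eq_ker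
    (hS.homology_exact₃ (k + 1) k rfl)).symm

include hS in
/-- The ranks in the long exact homology sequence. -/
lemma shortExact_ranks (h1 : ∀ k, FiniteDimensional ℚ (S.X₁.homology k))
    (h2 : ∀ k, FiniteDimensional ℚ (S.X₂.homology k))
    (h3 : ∀ k, FiniteDimensional ℚ (S.X₃.homology k)) :
    ∃ rd rf rg : ℕ → ℕ, ∀ k,
      Module.finrank ℚ (S.X₁.homology k) = rd k + rf k ∧
      Module.finrank ℚ (S.X₂.homology k) = rf k + rg k ∧
      Module.finrank ℚ (S.X₃.homology 0) = rg 0 ∧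
      Module.finrank ℚ (S.X₃.homology (k + 1)) = rg (k + 1) + rd k := by
  refine ⟨fun k => Module.finrank ℚ (hS.δ (k + 1) k rfl).hom.range,
    fun k => Module.finrank ℚ (HomologicalComplex.homologyMap S.f k).hom.range,
    fun k => Module.finrank ℚ (HomologicalComplex.homologyMap S.g k).hom.range, fun k =>
    ⟨finrank_eq_of_exact _ _ (shortExact_exact₁ hS k),
     finrank_eq_of_exact _ _ (shortExact_exact₂ hS k), ?_,
     finrank_eq_of_exact _ _ (shortExact_exact₃ hS k)⟩⟩
  have : (HomologicalComplex.homologyMap S.g 0).hom.range = ⊤ :=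
    LinearMap.range_eq_top.2 (epi_homologyMap_zero_of_shortExact hS)
  exact ((LinearEquiv.ofTop _ this).finrank_eq).symm

include hS in
lemma shortExact_sum (h1 : ∀ k, FiniteDimensional ℚ (S.X₁.homology k))
    (h2 : ∀ k, FiniteDimensional ℚ (S.X₂.homology k))
    (h3 : ∀ k, FiniteDimensional ℚ (S.X₃.homology k)) :
    (∀ k, Module.finrank ℚ (S.X₂.homology k) ≤
      Module.finrank ℚ (S.X₁.homology k) + Module.finrank ℚ (S.X₃.homology k)) ∧
    (∀ k, Module.finrank ℚ (S.X₁.homology k) ≤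
      Module.finrank ℚ (S.X₂.homology k) + Module.finrank ℚ (S.X₃.homology (k + 1))) ∧
    (∀ k, Module.finrank ℚ (S.X₃.homology (k + 1)) ≤
      Module.finrank ℚ (S.X₂.homology (k + 1)) + Module.finrank ℚ (S.X₁.homology k)) ∧
    ∀ N, Module.finrank ℚ (S.X₁.homology N) = 0 →
      ∑ k ∈ Finset.range (N + 1), (-1 : ℤ) ^ k * Module.finrank ℚ (S.X₂.homology k) =
      ∑ k ∈ Finset.range (N + 1), (-1 : ℤ) ^ k * Module.finrank ℚ (S.X₁.homology k) +
      ∑ k ∈ Finset.range (N + 1), (-1 : ℤ) ^ k * Module.finrank ℚ (S.X₃.homology k) := by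
  obtain ⟨rd, rf, rg, h⟩ := shortExact_ranks hS h1 h2 h3
  refine ⟨fun k => ?_, fun k => ?_, fun k => ?_, fun N hN => ?_⟩
  · have := h k
    rcases k with _ | k
    · omega
    · have := h k; omega
  · have := h k; omega
  · have := h k; have := h (k + 1); omega
  · have key : ∀ N : ℕ,
      ∑ k ∈ Finset.range (N + 1), (-1 : ℤ) ^ k * Module.finrank ℚ (S.X₂.homology k) =
      ∑ k ∈ Finset.range (N + 1), (-1 : ℤ) ^ k * Module.finrank ℚ (S.X₁.homology k) +
      ∑ k ∈ Finset.range (N + 1), (-1 : ℤ) ^ k * Module.finrank ℚ (S.X₃.homology k)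
        - (-1) ^ N * rd N := by
      intro N
      induction N with
      | zero =>
        obtain ⟨a, b, c, -⟩ := h 0
        simp only [zero_add, Finset.sum_range_one, pow_zero, one_mul, a, b, c]
        push_cast; ring
      | succ N ih =>
        obtain ⟨a, b, -, -⟩ := h (N + 1)
        obtain ⟨-, -, -, c⟩ := h N
        rw [Finset.sum_range_succ, ih, Finset.sum_range_succ _ (N + 1),
          Finset.sum_range_succ _ (N + 1), a, b, c]
        push_cast; ring
    have : rd N = 0 := by have := h N; omega
    rw [key N, this]; simp

include hS in
lemma HasChi.of_shortExact₂ {a c : ℤ} (h1 : HasChi S.X₁ a) (h3 : HasChi S.X₃ c) :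
    HasChi S.X₂ (a + c) := by
  have i1 := h1.1
  have i3 := h3.1
  have i2 : ∀ k, FiniteDimensional ℚ (S.X₂.homology k) := fun k =>
    moduleFinite_of_exact_of_finite _ _ (shortExact_exact₂ hS k)
  obtain ⟨N1, H1⟩ := h1.eq_sum
  obtain ⟨N3, H3⟩ := h3.eq_sum
  obtain ⟨A, B, C, D⟩ := shortExact_sum hS i1 i2 i3
  have P1 := H1 (N1 + N3 + 1) (by omega)
  have P3 := H3 (N1 + N3 + 1) (by omega)
  refine ⟨i2, N1 + N3 + 1, fun k hk => ?_, ?_⟩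
  · have := A k; have := P1.1 k hk; have := P3.1 k hk; omega
  · rw [P1.2, P3.2, D _ ((H1 (N1 + N3) (by omega)).1 _ le_rfl)]

include hS in
lemma HasChi.of_shortExact₃ {a b : ℤ} (h1 : HasChi S.X₁ a) (h2 : HasChi S.X₂ b) :
    HasChi S.X₃ (b - a) := by
  have i1 := h1.1
  have i2 := h2.1
  have i3 : ∀ k, FiniteDimensional ℚ (S.X₃.homology k) := by
    rintro (_ | k)
    · exact Module.Finite.of_surjective (HomologicalComplex.homologyMap S.g 0).hom
        (epi_homologyMap_zero_of_shortExact hS)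
    · exact moduleFinite_of_exact_of_finite _ _ (shortExact_exact₃ hS k)
  obtain ⟨N1, H1⟩ := h1.eq_sum
  obtain ⟨N3, H3⟩ := h2.eq_sum
  obtain ⟨A, B, C, D⟩ := shortExact_sum hS i1 i2 i3
  have P1 := H1 (N1 + N3 + 1) (by omega)
  have P3 := H3 (N1 + N3 + 1) (by omega)
  refine ⟨i3, N1 + N3 + 1, fun k hk => ?_, ?_⟩
  · obtain ⟨j, rfl⟩ : ∃ j, k = j + 1 := ⟨k - 1, by omega⟩
    have := C j; have := (H1 (N1 + N3) (by omega)).1 j (by omega); have := P3.1 _ hk; omega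
  · rw [P1.2, P3.2, D _ ((H1 (N1 + N3) (by omega)).1 _ le_rfl)]; ring

include hS in
lemma HasChi.of_shortExact₁ {b c : ℤ} (h2 : HasChi S.X₂ b) (h3 : HasChi S.X₃ c) :
    HasChi S.X₁ (b - c) := by
  have i2 := h2.1
  have i3 := h3.1
  have i1 : ∀ k, FiniteDimensional ℚ (S.X₁.homology k) := fun k =>
    moduleFinite_of_exact_of_finite _ _ (shortExact_exact₁ hS k)
  obtain ⟨N1, H1⟩ := h2.eq_sum
  obtain ⟨N3, H3⟩ := h3.eq_sum
  obtain ⟨A, B, C, D⟩ := shortExact_sum hS i1 i2 i3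
  have P1 := H1 (N1 + N3 + 1) (by omega)
  have P3 := H3 (N1 + N3 + 1) (by omega)
  have V : ∀ k, N1 + N3 ≤ k → Module.finrank ℚ (S.X₁.homology k) = 0 := fun k hk => by
    have := B k; have := (H1 (N1 + N3) (by omega)).1 k hk
    have := (H3 (N1 + N3) (by omega)).1 (k + 1) (by omega)
    omega
  refine ⟨i1, N1 + N3 + 1, fun k hk => V k (by omega), ?_⟩
  rw [P1.2, P3.2, D _ (V _ le_rfl)]; ring

end

section
variable {A B C : ℕ → Type} [∀ k, AddCommGroup (A k)] [∀ k, AddCommGroup (B k)]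
  [∀ k, AddCommGroup (C k)] [∀ k, Module ℚ (A k)] [∀ k, Module ℚ (B k)] [∀ k, Module ℚ (C k)]

/-- The chain complex of rational vector spaces with given differentials. -/
def linComplex (d : ∀ k, A (k + 1) →ₗ[ℚ] A k) (h : ∀ k, d k ∘ₗ d (k + 1) = 0) :
    ChainComplex (ModuleCat.{0} ℚ) ℕ :=
  ChainComplex.of (fun k => ModuleCat.of ℚ (A k)) (fun k => ModuleCat.ofHom (d k))
    (fun k => by rw [← ModuleCat.ofHom_comp, h]; rfl)

variable {dA : ∀ k, A (k + 1) →ₗ[ℚ] A k} {hA : ∀ k, dA k ∘ₗ dA (k + 1) = 0}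
  {dB : ∀ k, B (k + 1) →ₗ[ℚ] B k} {hB : ∀ k, dB k ∘ₗ dB (k + 1) = 0}
  {dC : ∀ k, C (k + 1) →ₗ[ℚ] C k} {hC : ∀ k, dC k ∘ₗ dC (k + 1) = 0}

lemma linComplex_d (k : ℕ) : (linComplex dA hA).d (k + 1) k = ModuleCat.ofHom (dA k) := by
  unfold linComplex
  exact ChainComplex.of_d (V := ModuleCat.{0} ℚ) (fun k => ModuleCat.of ℚ (A k))
    (fun k => ModuleCat.ofHom (dA k)) k

/-- The chain map given by linear maps commuting with the differentials. -/
def linComplexMap (f : ∀ k, A k →ₗ[ℚ] B k) (h : ∀ k, dB k ∘ₗ f (k + 1) = f k ∘ₗ dA k) :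
    linComplex dA hA ⟶ linComplex dB hB :=
  ChainComplex.ofHom (fun k => ModuleCat.ofHom (f k)) (fun k => by
    rw [linComplex_d, linComplex_d]
    ext x
    exact LinearMap.congr_fun (h k) x)

lemma linComplexMap_f (f : ∀ k, A k →ₗ[ℚ] B k) (h : ∀ k, dB k ∘ₗ f (k + 1) = f k ∘ₗ dA k) (k : ℕ) :
    (linComplexMap f h : linComplex dA hA ⟶ linComplex dB hB).f k = ModuleCat.ofHom (f k) := rfl

lemma hasChi_congr {K L : ChainComplex (ModuleCat.{0} ℚ) ℕ} (i : K ≅ L) {e : ℤ} (h : HasChi K e) :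
    HasChi L e :=
  hasChi_of_finrank_eq h fun k =>
    ⟨((HomologicalComplex.homologyFunctor _ _ k).mapIso i).toLinearEquiv⟩

/-- Degreewise linear equivalences commuting with differentials preserve Euler characteristics. -/
lemma hasChi_linComplex_congr {K : ChainComplex (ModuleCat.{0} ℚ) ℕ}
    (f : ∀ k, K.X k ≃ₗ[ℚ] A k) (hf : ∀ k x, f k (K.d (k + 1) k x) = dA k (f (k + 1) x)) (e : ℤ) :
    HasChi K e ↔ HasChi (linComplex dA hA) e := by
  let i : K ≅ linComplex dA hA := HomologicalComplex.Hom.isoOfComponents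
    (fun k => (f k).toModuleIso) (by
      rintro _ k rfl
      rw [linComplex_d]
      ext x
      exact (hf k x).symm)
  exact ⟨hasChi_congr i, hasChi_congr i.symm⟩

lemma linComplex_hasChi_zero
    (h0 : ∀ z : A 0, ∃ w, dA 0 w = z) (h : ∀ k (z : A (k + 1)), dA k z = 0 → ∃ w, dA (k + 1) w = z) :
    HasChi (linComplex dA hA) 0 := by
  have key : ∀ k, (linComplex dA hA).ExactAt k := by
    rintro (_ | k)
    · rw [HomologicalComplex.exactAt_iff' _ 1 0 0 (by simp) (by simp), ShortComplex.moduleCat_exact_iff]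
      intro z _
      obtain ⟨w, hw⟩ := h0 z
      refine ⟨w, ?_⟩
      change (linComplex dA hA).d 1 0 w = z
      rw [linComplex_d]; exact hw
    · rw [HomologicalComplex.exactAt_iff' _ (k + 2) (k + 1) k (by simp) (by simp),
        ShortComplex.moduleCat_exact_iff]
      intro z hz
      change (linComplex dA hA).d (k + 1) k z = 0 at hz
      rw [linComplex_d] at hz
      obtain ⟨w, hw⟩ := h k z hz
      refine ⟨w, ?_⟩
      change (linComplex dA hA).d (k + 2) (k + 1) w = z
      rw [linComplex_d]; exact hw
  have key2 : ∀ k, Subsingleton ((linComplex dA hA).homology k) := fun k =>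
    ModuleCat.subsingleton_of_isZero ((key k).isZero_homology)
  exact ⟨fun k => inferInstance, 0, fun k _ => Module.finrank_zero_of_subsingleton, by simp⟩

lemma linComplex_shortExact (f : ∀ k, A k →ₗ[ℚ] B k) (hf : ∀ k, dB k ∘ₗ f (k + 1) = f k ∘ₗ dA k)
    (g : ∀ k, B k →ₗ[ℚ] C k) (hg : ∀ k, dC k ∘ₗ g (k + 1) = g k ∘ₗ dB k)
    (h1 : ∀ k, Function.Injective (f k)) (h2 : ∀ k, Function.Exact (f k) (g k))
    (h3 : ∀ k, Function.Surjective (g k)) :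
    ∃ S : ShortComplex (ChainComplex (ModuleCat.{0} ℚ) ℕ), S.ShortExact ∧
      S.X₁ = linComplex dA hA ∧ S.X₂ = linComplex dB hB ∧ S.X₃ = linComplex dC hC := by
  have w : (linComplexMap f hf : linComplex dA hA ⟶ linComplex dB hB) ≫
      (linComplexMap g hg : linComplex dB hB ⟶ linComplex dC hC) = 0 := by
    ext k x
    rw [HomologicalComplex.comp_f, linComplexMap_f, linComplexMap_f]
    exact (h2 k).apply_apply_eq_zero x
  refine ⟨ShortComplex.mk _ _ w, ?_, rfl, rfl, rfl⟩
  refine HomologicalComplex.shortExact_of_degreewise_shortExact _ fun k => ?_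
  refine ShortComplex.ShortExact.mk' ?_ ?_ ?_
  · rw [ShortComplex.moduleCat_exact_iff]
    intro x hx
    exact (h2 k x).1 hx
  · exact (ModuleCat.mono_iff_injective (ModuleCat.ofHom (f k))).2 (h1 k)
  · exact (ModuleCat.epi_iff_surjective (ModuleCat.ofHom (g k))).2 (h3 k)

end

section linear
variable {m' : ℕ} {m : ℕ}

/-- The affine map of simplices with prescribed values on vertices. -/
def affMap {k : ℕ} (v : Fin (k + 1) → TopSimplex m) : C(TopSimplex k, TopSimplex m) where
  toFun t := ⟨∑ i, t.1 i • (v i).1, (convex_stdSimplex ℝ (Fin (m + 1))).sum_mem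
    (fun i _ => t.2.1 i) t.2.2 (fun i _ => (v i).2)⟩
  continuous_toFun := by
    refine Continuous.subtype_mk (continuous_finsetSum _ fun i _ => ?_) _
    exact ((continuous_apply i).comp continuous_subtype_val).smul continuous_const

lemma affMap_coe {k : ℕ} (v : Fin (k + 1) → TopSimplex m) (t : TopSimplex k) :
    (affMap v t).1 = ∑ i, t.1 i • (v i).1 := rfl

lemma affMap_affMap {k l : ℕ} (v : Fin (k + 1) → TopSimplex m) (w : Fin (l + 1) → TopSimplex k)
    (t : TopSimplex l) : affMap v (affMap w t) = affMap (fun i => affMap v (w i)) t := by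
  apply Subtype.ext
  simp only [affMap_coe, Finset.sum_apply, Finset.sum_smul, Finset.smul_sum, Pi.smul_apply,
    smul_smul, smul_eq_mul]
  rw [Finset.sum_comm]

/-- The vertices of the standard simplex. -/
def simplexVertex (k : ℕ) (i : Fin (k + 1)) : TopSimplex k := stdSimplex.vertex i

lemma affMap_vertex {k : ℕ} (v : Fin (k + 1) → TopSimplex m) (i : Fin (k + 1)) :
    affMap v (simplexVertex k i) = v i := by
  apply Subtype.ext
  rw [affMap_coe, Finset.sum_eq_single i]
  · simp [simplexVertex, stdSimplex.vertex]
  · intro j _ hj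
    simp [simplexVertex, stdSimplex.vertex, hj]
  · simp

lemma affMap_simplexVertex (k : ℕ) : affMap (simplexVertex k) = ContinuousMap.id _ := by
  ext1 t
  apply Subtype.ext
  rw [affMap_coe]
  ext j
  simp [simplexVertex, stdSimplex.vertex, Finset.sum_apply, Pi.single_apply]

lemma simplexMap_eq {k l : ℕ} (g : Fin (k + 1) → Fin (l + 1)) :
    simplexMap g = affMap (fun i => simplexVertex l (g i)) := by
  ext1 t
  apply Subtype.ext
  rw [affMap_coe]
  change (FunOnFinite.linearMap ℝ ℝ g) t.1 = _
  ext j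
  rw [FunOnFinite.linearMap_apply_apply, Finset.sum_filter, Finset.sum_apply]
  refine Finset.sum_congr rfl fun i _ => ?_
  simp [simplexVertex, stdSimplex.vertex, Pi.single_apply, eq_comm]

lemma affMap_comp_simplexMap {k l : ℕ} (v : Fin (l + 1) → TopSimplex m)
    (g : Fin (k + 1) → Fin (l + 1)) : (affMap v).comp (simplexMap g) = affMap (v ∘ g) := by
  ext1 t
  rw [simplexMap_eq, ContinuousMap.comp_apply, affMap_affMap]
  simp only [affMap_vertex]; rfl

/-- The barycenter of a tuple of points. -/
def baryPt {k : ℕ} (v : Fin (k + 1) → TopSimplex m) : TopSimplex m :=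
  affMap v stdSimplex.barycenter

variable (m) in
/-- Linear chains in a simplex. -/
abbrev LinChain (k : ℕ) := (Fin (k + 1) → TopSimplex m) →₀ ℚ

variable (m) in
/-- The boundary of linear chains. -/
def linBdry (k : ℕ) : LinChain m (k + 1) →ₗ[ℚ] LinChain m k :=
  ∑ i : Fin (k + 2), ((-1 : ℚ) ^ (i : ℕ)) • Finsupp.lmapDomain ℚ ℚ (fun v => v ∘ i.succAbove)

lemma linBdry_single {k : ℕ} (v : Fin (k + 2) → TopSimplex m) :
    linBdry m k (Finsupp.single v 1) =
      ∑ i : Fin (k + 2), ((-1 : ℚ) ^ (i : ℕ)) • Finsupp.single (v ∘ i.succAbove) 1 := by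
  simp [linBdry, LinearMap.sum_apply, Finsupp.mapDomain_single]

/-- The cone with a given apex. -/
def linCone (b : TopSimplex m) (k : ℕ) : LinChain m k →ₗ[ℚ] LinChain m (k + 1) :=
  Finsupp.lmapDomain ℚ ℚ (fun v => (Fin.cons b v : Fin (k + 2) → TopSimplex m))

lemma linCone_single (b : TopSimplex m) {k : ℕ} (v : Fin (k + 1) → TopSimplex m) :
    linCone b k (Finsupp.single v 1) = Finsupp.single (Fin.cons b v : Fin (k + 2) → TopSimplex m) 1 := by
  simp [linCone, Finsupp.mapDomain_single]

lemma linBdry_linCone (b : TopSimplex m) (k : ℕ) (z : LinChain m (k + 1)) :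
    linBdry m (k + 1) (linCone b (k + 1) z) = z - linCone b k (linBdry m k z) := by
  have : linBdry m (k + 1) ∘ₗ linCone b (k + 1) = LinearMap.id - linCone b k ∘ₗ linBdry m k := by
    refine Finsupp.lhom_ext' fun v => LinearMap.ext_ring ?_
    simp only [LinearMap.comp_apply, Finsupp.lsingle_apply, LinearMap.sub_apply, LinearMap.id_apply,
      linCone_single, linBdry_single, map_sum, map_smul]
    rw [Fin.sum_univ_succ, sub_eq_add_neg, ← Finset.sum_neg_distrib]
    congr 1
    · simp only [Fin.val_zero, pow_zero, one_smul]
      congr 1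
    · refine Finset.sum_congr rfl fun i _ => ?_
      rw [Fin.val_succ, pow_succ, mul_neg_one, neg_smul]
      congr 3
      ext j : 1
      refine Fin.cases ?_ (fun j => ?_) j <;> simp
  exact LinearMap.congr_fun this z

lemma linBdry_linCone_zero (b : TopSimplex m) (v : Fin 1 → TopSimplex m) :
    linBdry m 0 (linCone b 0 (Finsupp.single v 1)) =
      Finsupp.single v 1 - Finsupp.single (fun _ => b) 1 := by
  rw [linCone_single, linBdry_single, Fin.sum_univ_two]
  simp only [Fin.val_zero, pow_zero, one_smul, Fin.val_one, pow_one, neg_smul, ← sub_eq_add_neg]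
  congr 2
  ext j : 1
  fin_cases j; rfl

lemma linCone_tail {k : ℕ} (v : Fin (k + 2) → TopSimplex m) :
    linCone (v 0) k (Finsupp.single (Fin.tail v) 1) = Finsupp.single v 1 := by
  rw [linCone_single, Fin.cons_self_tail]

lemma linBdry_linCone_bdry (b : TopSimplex m) (z : LinChain m 1) :
    linBdry m 0 (linCone b 0 (linBdry m 0 z)) = linBdry m 0 z := by
  have : linBdry m 0 ∘ₗ linCone b 0 ∘ₗ linBdry m 0 = linBdry m 0 := by
    refine Finsupp.lhom_ext' fun w => LinearMap.ext_ring ?_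
    simp only [LinearMap.comp_apply, Finsupp.lsingle_apply]
    rw [linBdry_single, Fin.sum_univ_two]
    simp only [map_add, map_smul, linBdry_linCone_zero]
    simp only [Fin.val_zero, pow_zero, one_smul, Fin.val_one, pow_one, neg_smul]
    abel
  exact LinearMap.congr_fun this z

lemma linBdry_linBdry (k : ℕ) (z : LinChain m (k + 2)) : linBdry m k (linBdry m (k + 1) z) = 0 := by
  induction k with
  | zero =>
    have : linBdry m 0 ∘ₗ linBdry m 1 = 0 := by
      refine Finsupp.lhom_ext' fun v => LinearMap.ext_ring ?_
      simp only [LinearMap.comp_apply, Finsupp.lsingle_apply, LinearMap.zero_apply]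
      rw [← linCone_tail v, linBdry_linCone, map_sub, linBdry_linCone_bdry, sub_self]
    exact LinearMap.congr_fun this z
  | succ k ih =>
    have : linBdry m (k + 1) ∘ₗ linBdry m (k + 2) = 0 := by
      refine Finsupp.lhom_ext' fun v => LinearMap.ext_ring ?_
      simp only [LinearMap.comp_apply, Finsupp.lsingle_apply, LinearMap.zero_apply]
      rw [← linCone_tail v, linBdry_linCone, map_sub, linBdry_linCone, ih]
      simp
    exact LinearMap.congr_fun this z

variable (m) in
/-- Barycentric subdivision of linear chains. -/
def linSd : ∀ k, LinChain m k →ₗ[ℚ] LinChain m k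
  | 0 => LinearMap.id
  | k + 1 => Finsupp.lsum ℚ fun v => LinearMap.toSpanSingleton ℚ _
      (linCone (baryPt v) k (linSd k (linBdry m k (Finsupp.single v 1))))

lemma linSd_single {k : ℕ} (v : Fin (k + 2) → TopSimplex m) :
    linSd m (k + 1) (Finsupp.single v 1) =
      linCone (baryPt v) k (linSd m k (linBdry m k (Finsupp.single v 1))) := by
  simp [linSd]

variable (m) in
/-- The chain homotopy between the identity and barycentric subdivision. -/
def linSdHtpy : ∀ k, LinChain m k →ₗ[ℚ] LinChain m (k + 1)
  | 0 => 0
  | k + 1 => Finsupp.lsum ℚ fun v => LinearMap.toSpanSingleton ℚ _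
      (linCone (baryPt v) (k + 1) (Finsupp.single v 1 -
        linSdHtpy k (linBdry m k (Finsupp.single v 1))))

lemma linSdHtpy_single {k : ℕ} (v : Fin (k + 2) → TopSimplex m) :
    linSdHtpy m (k + 1) (Finsupp.single v 1) =
      linCone (baryPt v) (k + 1) (Finsupp.single v 1 -
        linSdHtpy m k (linBdry m k (Finsupp.single v 1))) := by
  simp [linSdHtpy]

lemma linBdry_linSd (k : ℕ) (z : LinChain m (k + 1)) :
    linBdry m k (linSd m (k + 1) z) = linSd m k (linBdry m k z) := by
  have : linBdry m k ∘ₗ linSd m (k + 1) = linSd m k ∘ₗ linBdry m k := by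
    refine Finsupp.lhom_ext' fun v => LinearMap.ext_ring ?_
    simp only [LinearMap.comp_apply, Finsupp.lsingle_apply]
    rw [linSd_single]
    cases k with
    | zero => exact linBdry_linCone_bdry _ _
    | succ k => rw [linBdry_linCone, linBdry_linSd k, linBdry_linBdry]; simp
  exact LinearMap.congr_fun this z

lemma linBdry_linSdHtpy (k : ℕ) (z : LinChain m (k + 1)) :
    linBdry m (k + 1) (linSdHtpy m (k + 1) z) =
      z - linSd m (k + 1) z - linSdHtpy m k (linBdry m k z) := by
  have : linBdry m (k + 1) ∘ₗ linSdHtpy m (k + 1) =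
      LinearMap.id - linSd m (k + 1) - linSdHtpy m k ∘ₗ linBdry m k := by
    refine Finsupp.lhom_ext' fun v => LinearMap.ext_ring ?_
    simp only [LinearMap.comp_apply, Finsupp.lsingle_apply, LinearMap.sub_apply, LinearMap.id_apply]
    rw [linSdHtpy_single, linBdry_linCone, linSd_single, sub_right_comm]
    congr 2
    rw [map_sub]
    cases k with
    | zero => simp [linSdHtpy, linSd]
    | succ k => rw [linBdry_linSdHtpy k, linBdry_linBdry]; simp
  exact LinearMap.congr_fun this z

/-- Push-forward of linear chains by an affine map. -/
def linPush (w : Fin (m + 1) → TopSimplex m') (k : ℕ) : LinChain m k →ₗ[ℚ] LinChain m' k :=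
  Finsupp.lmapDomain ℚ ℚ (fun v i => affMap w (v i))

lemma linPush_single (w : Fin (m + 1) → TopSimplex m') {k : ℕ} (v : Fin (k + 1) → TopSimplex m) :
    linPush w k (Finsupp.single v 1) = Finsupp.single (fun i => affMap w (v i)) 1 := by
  simp [linPush, Finsupp.mapDomain_single]

lemma linPush_linBdry (w : Fin (m + 1) → TopSimplex m') (k : ℕ) (z : LinChain m (k + 1)) :
    linPush w k (linBdry m k z) = linBdry m' k (linPush w (k + 1) z) := by
  have : linPush w k ∘ₗ linBdry m k = linBdry m' k ∘ₗ linPush w (k + 1) := by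
    refine Finsupp.lhom_ext' fun v => LinearMap.ext_ring ?_
    simp only [LinearMap.comp_apply, Finsupp.lsingle_apply, linPush_single, linBdry_single,
      map_sum, map_smul]
    rfl
  exact LinearMap.congr_fun this z

lemma linPush_linCone (w : Fin (m + 1) → TopSimplex m') (b : TopSimplex m) (k : ℕ)
    (z : LinChain m k) :
    linPush w (k + 1) (linCone b k z) = linCone (affMap w b) k (linPush w k z) := by
  have : linPush w (k + 1) ∘ₗ linCone b k = linCone (affMap w b) k ∘ₗ linPush w k := by
    refine Finsupp.lhom_ext' fun v => LinearMap.ext_ring ?_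
    simp only [LinearMap.comp_apply, Finsupp.lsingle_apply, linPush_single, linCone_single]
    congr 1
    ext i : 1
    refine Fin.cases ?_ (fun j => ?_) i <;> simp
  exact LinearMap.congr_fun this z

lemma affMap_baryPt (w : Fin (m + 1) → TopSimplex m') {k : ℕ} (v : Fin (k + 1) → TopSimplex m) :
    affMap w (baryPt v) = baryPt (fun i => affMap w (v i)) := affMap_affMap _ _ _

lemma linPush_linSd (w : Fin (m + 1) → TopSimplex m') (k : ℕ) (z : LinChain m k) :
    linPush w k (linSd m k z) = linSd m' k (linPush w k z) := by
  have : linPush w k ∘ₗ linSd m k = linSd m' k ∘ₗ linPush w k := by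
    refine Finsupp.lhom_ext' fun v => LinearMap.ext_ring ?_
    simp only [LinearMap.comp_apply, Finsupp.lsingle_apply]
    cases k with
    | zero => rfl
    | succ k =>
      rw [linSd_single, linPush_linCone, linPush_linSd w k, linPush_linBdry, linPush_single,
        linSd_single, affMap_baryPt]
  exact LinearMap.congr_fun this z

lemma linPush_linSdHtpy (w : Fin (m + 1) → TopSimplex m') (k : ℕ) (z : LinChain m k) :
    linPush w (k + 1) (linSdHtpy m k z) = linSdHtpy m' k (linPush w k z) := by
  have : linPush w (k + 1) ∘ₗ linSdHtpy m k = linSdHtpy m' k ∘ₗ linPush w k := by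
    refine Finsupp.lhom_ext' fun v => LinearMap.ext_ring ?_
    simp only [LinearMap.comp_apply, Finsupp.lsingle_apply]
    cases k with
    | zero => simp [linSdHtpy]
    | succ k =>
      rw [linSdHtpy_single, linPush_linCone, map_sub, linPush_linSdHtpy w k, linPush_linBdry,
        linPush_single, linSdHtpy_single, affMap_baryPt]
  exact LinearMap.congr_fun this z

end linear

section sing
variable (X : Type) [TopologicalSpace X]

variable {X} in
/-- The singular chain defined by a linear chain in the source of a singular simplex. -/
def linReal {m : ℕ} (s : C(TopSimplex m, X)) (k : ℕ) : LinChain m k →ₗ[ℚ] SingChain X k :=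
  Finsupp.lmapDomain ℚ ℚ (fun v => s.comp (affMap v))

variable {X} in
lemma linReal_single {m : ℕ} (s : C(TopSimplex m, X)) {k : ℕ} (v : Fin (k + 1) → TopSimplex m) :
    linReal s k (Finsupp.single v 1) = Finsupp.single (s.comp (affMap v)) 1 := by
  simp [linReal, Finsupp.mapDomain_single]

variable {X} in
lemma singBoundary_single {k : ℕ} (s : C(TopSimplex (k + 1), X)) :
    singBoundary X k (Finsupp.single s 1) = ∑ i : Fin (k + 2), ((-1 : ℚ) ^ (i : ℕ)) •
      Finsupp.single (s.comp (simplexMap i.succAbove)) 1 := by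
  simp [singBoundary, LinearMap.sum_apply, Finsupp.mapDomain_single]

variable {X} in
lemma singBoundary_linReal {m : ℕ} (s : C(TopSimplex m, X)) (k : ℕ) (z : LinChain m (k + 1)) :
    singBoundary X k (linReal s (k + 1) z) = linReal s k (linBdry m k z) := by
  have : singBoundary X k ∘ₗ linReal s (k + 1) = linReal s k ∘ₗ linBdry m k := by
    refine Finsupp.lhom_ext' fun v => LinearMap.ext_ring ?_
    simp only [LinearMap.comp_apply, Finsupp.lsingle_apply, linReal_single, linBdry_single,
      singBoundary_single, map_sum, map_smul, ContinuousMap.comp_assoc, affMap_comp_simplexMap]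
  exact LinearMap.congr_fun this z

variable {X} in
lemma linReal_linPush {m m' : ℕ} (s : C(TopSimplex m', X)) (w : Fin (m + 1) → TopSimplex m')
    (k : ℕ) (z : LinChain m k) :
    linReal s k (linPush w k z) = linReal (s.comp (affMap w)) k z := by
  have : linReal s k ∘ₗ linPush w k = linReal (s.comp (affMap w)) k := by
    refine Finsupp.lhom_ext' fun v => LinearMap.ext_ring ?_
    simp only [LinearMap.comp_apply, Finsupp.lsingle_apply, linPush_single, linReal_single]
    congr 1
    ext t
    simp [affMap_affMap]
  exact LinearMap.congr_fun this z

/-- Barycentric subdivision of singular chains. -/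
def singSd (k : ℕ) : SingChain X k →ₗ[ℚ] SingChain X k :=
  Finsupp.lsum ℚ fun s => LinearMap.toSpanSingleton ℚ _
    (linReal s k (linSd k k (Finsupp.single (simplexVertex k) 1)))

/-- The chain homotopy between the identity and barycentric subdivision of singular chains. -/
def singSdHtpy (k : ℕ) : SingChain X k →ₗ[ℚ] SingChain X (k + 1) :=
  Finsupp.lsum ℚ fun s => LinearMap.toSpanSingleton ℚ _
    (linReal s (k + 1) (linSdHtpy k k (Finsupp.single (simplexVertex k) 1)))

variable {X}

lemma singSd_linReal {m : ℕ} (s : C(TopSimplex m, X)) (k : ℕ) (z : LinChain m k) :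
    singSd X k (linReal s k z) = linReal s k (linSd m k z) := by
  have : singSd X k ∘ₗ linReal s k = linReal s k ∘ₗ linSd m k := by
    refine Finsupp.lhom_ext' fun v => LinearMap.ext_ring ?_
    simp only [LinearMap.comp_apply, Finsupp.lsingle_apply, linReal_single]
    simp only [singSd, Finsupp.lsum_single, LinearMap.toSpanSingleton_apply, one_smul]
    rw [← linReal_linPush, linPush_linSd, linPush_single]
    simp only [affMap_vertex]
  exact LinearMap.congr_fun this z

lemma singSdHtpy_linReal {m : ℕ} (s : C(TopSimplex m, X)) (k : ℕ) (z : LinChain m k) :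
    singSdHtpy X k (linReal s k z) = linReal s (k + 1) (linSdHtpy m k z) := by
  have : singSdHtpy X k ∘ₗ linReal s k = linReal s (k + 1) ∘ₗ linSdHtpy m k := by
    refine Finsupp.lhom_ext' fun v => LinearMap.ext_ring ?_
    simp only [LinearMap.comp_apply, Finsupp.lsingle_apply, linReal_single]
    simp only [singSdHtpy, Finsupp.lsum_single, LinearMap.toSpanSingleton_apply, one_smul]
    rw [← linReal_linPush, linPush_linSdHtpy, linPush_single]
    simp only [affMap_vertex]
  exact LinearMap.congr_fun this z

lemma single_eq_linReal {k : ℕ} (s : C(TopSimplex k, X)) :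
    (Finsupp.single s 1 : SingChain X k) = linReal s k (Finsupp.single (simplexVertex k) 1) := by
  rw [linReal_single, affMap_simplexVertex, ContinuousMap.comp_id]

lemma singBoundary_singSd (k : ℕ) (z : SingChain X (k + 1)) :
    singBoundary X k (singSd X (k + 1) z) = singSd X k (singBoundary X k z) := by
  have : singBoundary X k ∘ₗ singSd X (k + 1) = singSd X k ∘ₗ singBoundary X k := by
    refine Finsupp.lhom_ext' fun s => LinearMap.ext_ring ?_
    simp only [LinearMap.comp_apply, Finsupp.lsingle_apply]
    rw [single_eq_linReal, singSd_linReal, singBoundary_linReal, singBoundary_linReal,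
      singSd_linReal, linBdry_linSd]
  exact LinearMap.congr_fun this z

lemma singBoundary_singSdHtpy (k : ℕ) (z : SingChain X (k + 1)) :
    singBoundary X (k + 1) (singSdHtpy X (k + 1) z) =
      z - singSd X (k + 1) z - singSdHtpy X k (singBoundary X k z) := by
  have : singBoundary X (k + 1) ∘ₗ singSdHtpy X (k + 1) =
      LinearMap.id - singSd X (k + 1) - singSdHtpy X k ∘ₗ singBoundary X k := by
    refine Finsupp.lhom_ext' fun s => LinearMap.ext_ring ?_
    simp only [LinearMap.comp_apply, Finsupp.lsingle_apply, LinearMap.sub_apply, LinearMap.id_apply]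
    rw [single_eq_linReal, singSd_linReal, singBoundary_linReal, singSdHtpy_linReal,
      singBoundary_linReal, singSdHtpy_linReal, linBdry_linSdHtpy, map_sub, map_sub]
  exact LinearMap.congr_fun this z

end sing

lemma map_mem_of_forall_single {α M : Type} [AddCommGroup M] [Module ℚ M] (φ : (α →₀ ℚ) →ₗ[ℚ] M)
    (W : Submodule ℚ M) (z : α →₀ ℚ) (h : ∀ s ∈ z.support, φ (Finsupp.single s 1) ∈ W) :
    φ z ∈ W := by
  rw [← Finsupp.sum_single z, Finsupp.sum, map_sum]
  refine Submodule.sum_mem _ fun s hs => ?_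
  rw [← mul_one (z s), ← smul_eq_mul, ← Finsupp.smul_single, map_smul]
  exact Submodule.smul_mem _ _ (h s hs)

section small
variable {m : ℕ}

/-- Tuples in the hull of `S` whose points have mutual distance at most `D`. -/
def thinTuples (S : Set (Fin (m + 1) → ℝ)) (D : ℝ) (k : ℕ) : Set (Fin (k + 1) → TopSimplex m) :=
  {w | (∀ i, (w i).1 ∈ convexHull ℝ S) ∧ ∀ i j, dist (w i).1 (w j).1 ≤ D}

lemma affMap_mem_hull {k : ℕ} (v : Fin (k + 1) → TopSimplex m) (t : TopSimplex k) :
    (affMap v t).1 ∈ convexHull ℝ (Set.range fun i => (v i).1) :=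
  (convex_convexHull ℝ _).sum_mem (fun i _ => t.2.1 i) t.2.2
    (fun i _ => subset_convexHull ℝ _ ⟨i, rfl⟩)

lemma mem_supported_linCone {b : TopSimplex m} {k : ℕ} {z : LinChain m k}
    {P : Set (Fin (k + 1) → TopSimplex m)} {Q : Set (Fin (k + 2) → TopSimplex m)}
    (hz : z ∈ Finsupp.supported ℚ ℚ P) (h : ∀ v ∈ P, (Fin.cons b v : Fin (k + 2) → TopSimplex m) ∈ Q) :
    linCone b k z ∈ Finsupp.supported ℚ ℚ Q := by
  classical
  rw [Finsupp.mem_supported] at hz ⊢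
  intro w hw
  have := Finsupp.mapDomain_support hw
  simp only [Finset.mem_image] at this
  obtain ⟨v, hv, rfl⟩ := this
  exact h v (hz hv)

lemma dist_baryPt_le {k : ℕ} (v : Fin (k + 1) → TopSimplex m) {D : ℝ}
    (h : ∀ i j, dist (v i).1 (v j).1 ≤ D) {x : Fin (m + 1) → ℝ}
    (hx : x ∈ convexHull ℝ (Set.range fun i => (v i).1)) :
    dist x (baryPt v).1 ≤ (k / (k + 1)) * D := by
  have hc : Convex ℝ {x | dist x (baryPt v).1 ≤ (k / (k + 1)) * D} := convex_closedBall _ _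
  refine convexHull_min ?_ hc hx
  rintro _ ⟨l, rfl⟩
  simp only [Set.mem_ofPred_eq]
  have hk : (0 : ℝ) < k + 1 := by positivity
  have e : (v l).1 - (baryPt v).1 = ∑ j, ((k : ℝ) + 1)⁻¹ • ((v l).1 - (v j).1) := by
    rw [baryPt, affMap_coe, ← Finset.smul_sum, Finset.sum_sub_distrib, smul_sub]
    simp only [stdSimplex.barycenter_apply, Finset.smul_sum, Finset.sum_const, Finset.card_univ,
      Fintype.card_fin]
    congr 1
    · rw [← Nat.cast_smul_eq_nsmul ℝ, smul_smul]
      push_cast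
      rw [inv_mul_cancel₀ hk.ne', one_smul]
    · push_cast; rfl
  rw [dist_eq_norm, e]
  have : ∀ j ∈ Finset.univ, ‖((k : ℝ) + 1)⁻¹ • ((v l).1 - (v j).1)‖ ≤
      if j = l then 0 else ((k : ℝ) + 1)⁻¹ * D := by
    intro j _
    split_ifs with hj
    · simp [hj]
    · rw [norm_smul, Real.norm_of_nonneg (by positivity), ← dist_eq_norm]
      exact mul_le_mul_of_nonneg_left (h _ _) (by positivity)
  refine (norm_sum_le_of_le _ this).trans (le_of_eq ?_)
  rw [Finset.sum_ite, Finset.sum_const_zero, zero_add, Finset.sum_const, Finset.filter_ne',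
    Finset.card_erase_of_mem (Finset.mem_univ _), Finset.card_univ, Fintype.card_fin]
  simp only [add_tsub_cancel_right, nsmul_eq_mul]
  field_simp

lemma linSd_single_mem (k : ℕ) (v : Fin (k + 1) → TopSimplex m) {D : ℝ}
    (h : ∀ i j, dist (v i).1 (v j).1 ≤ D) :
    linSd m k (Finsupp.single v 1) ∈
      Finsupp.supported ℚ ℚ (thinTuples (Set.range fun i => (v i).1) (k / (k + 1) * D) k) := by
  have hD : 0 ≤ D := dist_nonneg.trans (h 0 0)
  induction k with
  | zero =>
    refine Finsupp.single_mem_supported ℚ _ ⟨fun i => subset_convexHull ℝ _ ⟨i, rfl⟩, fun i j => ?_⟩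
    rw [show i = j from (Fin.fin_one_eq_zero i).trans (Fin.fin_one_eq_zero j).symm]; simp
  | succ k ih =>
    rw [linSd_single]
    refine mem_supported_linCone (P := thinTuples (Set.range fun i => (v i).1) (k / (k + 1) * D) k)
      ?_ ?_
    · rw [linBdry_single, map_sum]
      refine Submodule.sum_mem _ fun i _ => ?_
      rw [map_smul]
      refine Submodule.smul_mem _ _ (Finsupp.supported_mono ?_ (ih (v ∘ i.succAbove) fun a b => h _ _))
      rintro w ⟨h1, h2⟩
      exact ⟨fun j => convexHull_mono (by rintro _ ⟨j, rfl⟩; exact ⟨i.succAbove j, rfl⟩) (h1 j), h2⟩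
    · rintro w ⟨h1, h2⟩
      have hle : (k : ℝ) / (k + 1) * D ≤ (↑(k + 1) / (↑(k + 1) + 1)) * D := by
        refine mul_le_mul_of_nonneg_right ?_ hD
        push_cast
        rw [div_le_div_iff₀ (by positivity) (by positivity)]
        nlinarith
      refine ⟨fun i => ?_, fun i j => ?_⟩
      · refine Fin.cases ?_ (fun j => ?_) i
        · exact affMap_mem_hull _ _
        · exact h1 j
      · revert j
        refine Fin.cases ?_ (fun i => ?_) i <;> intro j <;> refine Fin.cases ?_ (fun j => ?_) j
        · simp only [dist_self]; positivity
        · rw [dist_comm]; exact dist_baryPt_le v h (h1 j)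
        · exact dist_baryPt_le v h (h1 i)
        · exact (h2 i j).trans hle

lemma linSd_pow_mem (k N : ℕ) {D : ℝ} (z : LinChain m k)
    (hz : z ∈ Finsupp.supported ℚ ℚ (thinTuples Set.univ D k)) :
    (linSd m k ^ N) z ∈
      Finsupp.supported ℚ ℚ (thinTuples Set.univ ((k / (k + 1)) ^ N * D) k) := by
  induction N with
  | zero => simpa using hz
  | succ N ih =>
    rw [pow_succ' (linSd m k), Module.End.mul_apply, pow_succ', mul_assoc]
    set y := (linSd m k ^ N) z
    refine map_mem_of_forall_single _ _ _ fun v hv => ?_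
    refine Finsupp.supported_mono ?_ (linSd_single_mem k v (ih hv).2)
    exact fun w hw => ⟨fun i => by simp, hw.2⟩

end small

section chains
variable {X : Type} [TopologicalSpace X]

/-- Singular chains with image in a subset. -/
def chainsIn (S : Set X) (k : ℕ) : Submodule ℚ (SingChain X k) :=
  Finsupp.supported ℚ ℚ {s | ∀ t, s t ∈ S}

lemma single_comp_mem_chainsIn {S : Set X} {k l : ℕ} {s : C(TopSimplex k, X)} (hs : ∀ t, s t ∈ S)
    (g : C(TopSimplex l, TopSimplex k)) : Finsupp.single (s.comp g) (1 : ℚ) ∈ chainsIn S l :=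
  Finsupp.single_mem_supported ℚ _ fun t => hs (g t)

lemma chainsIn_map_le {S : Set X} {k l : ℕ} (φ : SingChain X k →ₗ[ℚ] SingChain X l)
    (h : ∀ s : C(TopSimplex k, X), (∀ t, s t ∈ S) → φ (Finsupp.single s 1) ∈ chainsIn S l) :
    ∀ z ∈ chainsIn S k, φ z ∈ chainsIn S l := by
  intro z hz
  exact map_mem_of_forall_single _ _ _ fun s hs => h s (hz hs)

lemma linReal_mem_chainsIn {S : Set X} {m k : ℕ} {s : C(TopSimplex m, X)} (hs : ∀ t, s t ∈ S)
    (z : LinChain m k) : linReal s k z ∈ chainsIn S k := by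
  refine map_mem_of_forall_single _ _ _ fun v _ => ?_
  rw [linReal_single]
  exact single_comp_mem_chainsIn hs _

lemma singBoundary_mem_chainsIn {S : Set X} (k : ℕ) :
    ∀ z ∈ chainsIn S (k + 1), singBoundary X k z ∈ chainsIn S k :=
  chainsIn_map_le _ fun s hs => by
    rw [singBoundary_single]
    exact Submodule.sum_mem _ fun i _ => Submodule.smul_mem _ _ (single_comp_mem_chainsIn hs _)

lemma singSd_mem_chainsIn {S : Set X} (k : ℕ) :
    ∀ z ∈ chainsIn S k, singSd X k z ∈ chainsIn S k :=
  chainsIn_map_le _ fun s hs => by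
    rw [single_eq_linReal, singSd_linReal]
    exact linReal_mem_chainsIn hs _

lemma singSdHtpy_mem_chainsIn {S : Set X} (k : ℕ) :
    ∀ z ∈ chainsIn S k, singSdHtpy X k z ∈ chainsIn S (k + 1) :=
  chainsIn_map_le _ fun s hs => by
    rw [single_eq_linReal, singSdHtpy_linReal]
    exact linReal_mem_chainsIn hs _

/-- Chains which are sums of chains in two given subsets. -/
def smallChains (U V : Set X) (k : ℕ) : Submodule ℚ (SingChain X k) := chainsIn U k ⊔ chainsIn V k

lemma smallChains_map {U V : Set X} {k l : ℕ} (φ : SingChain X k →ₗ[ℚ] SingChain X l)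
    (h : ∀ S : Set X, ∀ z ∈ chainsIn S k, φ z ∈ chainsIn S l) :
    ∀ z ∈ smallChains U V k, φ z ∈ smallChains U V l := by
  intro z hz
  obtain ⟨a, ha, b, hb, rfl⟩ := Submodule.mem_sup.1 hz
  rw [map_add]
  exact Submodule.add_mem_sup (h U a ha) (h V b hb)

lemma singSd_pow_linReal {m : ℕ} (s : C(TopSimplex m, X)) (k N : ℕ) (z : LinChain m k) :
    (singSd X k ^ N) (linReal s k z) = linReal s k ((linSd m k ^ N) z) := by
  induction N with
  | zero => rfl
  | succ N ih => rw [pow_succ', Module.End.mul_apply, ih, singSd_linReal, pow_succ',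
      Module.End.mul_apply]

lemma exists_singSd_pow_single_mem {U V : Set X} (hU : IsOpen U) (hV : IsOpen V)
    (hUV : U ∪ V = Set.univ) {k : ℕ} (s : C(TopSimplex k, X)) :
    ∃ N, (singSd X k ^ N) (Finsupp.single s 1) ∈ smallChains U V k := by
  obtain ⟨δ, hδ, hL⟩ := lebesgue_number_lemma_of_metric (c := fun b : Bool => s ⁻¹' (bif b then U else V))
    (isCompact_univ (X := TopSimplex k))
    (fun b => by cases b; exacts [hV.preimage s.continuous, hU.preimage s.continuous])
    (fun t _ => by
      have : s t ∈ U ∪ V := hUV ▸ Set.mem_univ _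
      rcases this with h | h
      · exact Set.mem_iUnion.2 ⟨true, h⟩
      · exact Set.mem_iUnion.2 ⟨false, h⟩)
  have h1 : (k : ℝ) / (k + 1) < 1 := by rw [div_lt_one (by positivity)]; linarith
  obtain ⟨N, hN⟩ := exists_pow_lt_of_lt_one hδ h1
  refine ⟨N, ?_⟩
  rw [single_eq_linReal, singSd_pow_linReal]
  have hz : (linSd k k ^ N) (Finsupp.single (simplexVertex k) 1) ∈
      Finsupp.supported ℚ ℚ (thinTuples Set.univ ((k / (k + 1)) ^ N * 1) k) := by
    refine linSd_pow_mem k N _ (Finsupp.single_mem_supported ℚ _ ⟨fun i => by simp, fun i j => ?_⟩)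
    exact (Metric.dist_le_diam_of_mem (bounded_stdSimplex _) (simplexVertex k i).2
      (simplexVertex k j).2).trans diam_stdSimplex_le
  rw [mul_one] at hz
  set z := (linSd k k ^ N) (Finsupp.single (simplexVertex k) 1)
  refine map_mem_of_forall_single _ _ _ fun v hv => ?_
  rw [linReal_single]
  obtain ⟨b, hb⟩ := hL (v 0) (Set.mem_univ _)
  have hin : ∀ t, affMap v t ∈ Metric.ball (v 0) δ := by
    intro t
    have hc := (convex_ball (v 0).1 δ)
    refine convexHull_min ?_ hc (affMap_mem_hull v t)
    rintro _ ⟨i, rfl⟩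
    exact ((hz hv).2 i 0).trans_lt hN
  have : ∀ t, s.comp (affMap v) t ∈ bif b then U else V := fun t => hb (hin t)
  cases b
  · exact Submodule.mem_sup_right (Finsupp.single_mem_supported ℚ _ this)
  · exact Submodule.mem_sup_left (Finsupp.single_mem_supported ℚ _ this)

lemma exists_singSd_pow_mem {U V : Set X} (hU : IsOpen U) (hV : IsOpen V)
    (hUV : U ∪ V = Set.univ) {k : ℕ} (z : SingChain X k) :
    ∃ N, (singSd X k ^ N) z ∈ smallChains U V k := by
  have hmono : ∀ (y : SingChain X k) (N M : ℕ), N ≤ M → (singSd X k ^ N) y ∈ smallChains U V k →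
      (singSd X k ^ M) y ∈ smallChains U V k := by
    intro y N M hNM h
    induction M, hNM using Nat.le_induction with
    | base => exact h
    | succ M _ ih =>
      rw [pow_succ', Module.End.mul_apply]
      exact smallChains_map _ (fun S => singSd_mem_chainsIn k) _ ih
  induction z using Finsupp.induction_linear with
  | zero => exact ⟨0, by simp⟩
  | add f g hf hg =>
    obtain ⟨N, hN⟩ := hf
    obtain ⟨M, hM⟩ := hg
    refine ⟨max N M, ?_⟩
    rw [map_add]
    exact Submodule.add_mem _ (hmono _ _ _ (le_max_left _ _) hN) (hmono _ _ _ (le_max_right _ _) hM)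
  | single s c =>
    obtain ⟨N, hN⟩ := exists_singSd_pow_single_mem hU hV hUV s
    refine ⟨N, ?_⟩
    rw [← mul_one c, ← smul_eq_mul, ← Finsupp.smul_single, map_smul]
    exact Submodule.smul_mem _ _ hN

lemma exists_homotopy_singSd_pow (N k : ℕ) :
    ∃ (T' : SingChain X k →ₗ[ℚ] SingChain X (k + 1))
      (T : SingChain X (k + 1) →ₗ[ℚ] SingChain X (k + 2)),
      (∀ z, singBoundary X (k + 1) (T z) = z - (singSd X (k + 1) ^ N) z - T' (singBoundary X k z)) ∧
      (∀ S : Set X, ∀ z ∈ chainsIn S k, T' z ∈ chainsIn S (k + 1)) := by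
  induction N with
  | zero => exact ⟨0, 0, by simp, by simp⟩
  | succ N ih =>
    obtain ⟨T', T, h1, h2⟩ := ih
    have hb : ∀ z, singBoundary X k ((singSd X (k + 1) ^ N) z) =
        (singSd X k ^ N) (singBoundary X k z) := by
      clear h1 h2
      induction N with
      | zero => intro z; rfl
      | succ N ih =>
        intro z
        rw [pow_succ', Module.End.mul_apply, singBoundary_singSd, ih, pow_succ', Module.End.mul_apply]
    refine ⟨T' + singSdHtpy X k ∘ₗ (singSd X k ^ N),
      T + singSdHtpy X (k + 1) ∘ₗ (singSd X (k + 1) ^ N), fun z => ?_, fun S z hz => ?_⟩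
    · simp only [LinearMap.add_apply, LinearMap.comp_apply, map_add]
      rw [h1, singBoundary_singSdHtpy, hb, pow_succ', Module.End.mul_apply]
      abel
    · refine Submodule.add_mem _ (h2 S z hz) (singSdHtpy_mem_chainsIn k _ ?_)
      clear h1 h2 hb
      induction N with
      | zero => exact hz
      | succ N ih =>
        rw [pow_succ', Module.End.mul_apply]
        exact singSd_mem_chainsIn k _ ih

/-- A chain with small boundary is small modulo boundaries. -/
lemma exists_sub_singBoundary_mem_smallChains {U V : Set X} (hU : IsOpen U) (hV : IsOpen V)
    (hUV : U ∪ V = Set.univ) {k : ℕ} (z : SingChain X (k + 1))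
    (hz : singBoundary X k z ∈ smallChains U V k) :
    ∃ w, z - singBoundary X (k + 1) w ∈ smallChains U V (k + 1) := by
  obtain ⟨N, hN⟩ := exists_singSd_pow_mem hU hV hUV z
  obtain ⟨T', T, h1, h2⟩ := exists_homotopy_singSd_pow (X := X) N k
  refine ⟨T z, ?_⟩
  rw [h1, sub_sub, sub_sub_cancel]
  exact Submodule.add_mem _ hN (smallChains_map T' h2 _ hz)

end chains

section
variable {X : Type} [TopologicalSpace X]

lemma singBoundary_singBoundary (k : ℕ) : singBoundary X k ∘ₗ singBoundary X (k + 1) = 0 := by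
  ext1 z
  refine LinearMap.ext_ring ?_
  simp only [LinearMap.comp_apply, LinearMap.zero_apply, Finsupp.lsingle_apply]
  rw [single_eq_linReal, singBoundary_linReal, singBoundary_linReal, linBdry_linBdry, map_zero]

/-- A subcomplex of the singular chain complex. -/
structure SingSub (X : Type) [TopologicalSpace X] where
  carrier : ∀ k, Submodule ℚ (SingChain X k)
  bdry_mem : ∀ k, ∀ z ∈ carrier (k + 1), singBoundary X k z ∈ carrier k

namespace SingSub
variable (W W' : SingSub X)

def bdry (k : ℕ) : W.carrier (k + 1) →ₗ[ℚ] W.carrier k := (singBoundary X k).restrict (W.bdry_mem k)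

lemma bdry_bdry (k : ℕ) : W.bdry k ∘ₗ W.bdry (k + 1) = 0 := by
  ext1 z
  exact Subtype.ext (LinearMap.congr_fun (singBoundary_singBoundary k) z.1)

/-- The Euler characteristic of a subcomplex. -/
def Chi (e : ℤ) : Prop := HasChi (linComplex (A := fun k => W.carrier k) W.bdry W.bdry_bdry) e

def quotBdry (k : ℕ) : (SingChain X (k + 1) ⧸ W.carrier (k + 1)) →ₗ[ℚ]
    (SingChain X k ⧸ W.carrier k) :=
  Submodule.mapQ _ _ (singBoundary X k) (W.bdry_mem k)

lemma quotBdry_quotBdry (k : ℕ) : W.quotBdry k ∘ₗ W.quotBdry (k + 1) = 0 := by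
  ext1
  ext1 z
  refine LinearMap.ext_ring ?_
  have := LinearMap.congr_fun (singBoundary_singBoundary (X := X) k) (Finsupp.single z 1)
  simp only [LinearMap.comp_apply, LinearMap.zero_apply, Finsupp.lsingle_apply] at this ⊢
  simp only [quotBdry, Submodule.mkQ_apply, Submodule.mapQ_apply, this, Submodule.Quotient.mk_zero]

def inSet (S : Set X) : SingSub X := ⟨chainsIn S, singBoundary_mem_chainsIn⟩

def small (U V : Set X) : SingSub X :=
  ⟨smallChains U V, fun k => smallChains_map _ fun _ => singBoundary_mem_chainsIn k⟩

end SingSub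

section ses
variable {A B C : ℕ → Type} [∀ k, AddCommGroup (A k)] [∀ k, AddCommGroup (B k)]
  [∀ k, AddCommGroup (C k)] [∀ k, Module ℚ (A k)] [∀ k, Module ℚ (B k)] [∀ k, Module ℚ (C k)]
  {dA : ∀ k, A (k + 1) →ₗ[ℚ] A k} {hA : ∀ k, dA k ∘ₗ dA (k + 1) = 0}
  {dB : ∀ k, B (k + 1) →ₗ[ℚ] B k} {hB : ∀ k, dB k ∘ₗ dB (k + 1) = 0}
  {dC : ∀ k, C (k + 1) →ₗ[ℚ] C k} {hC : ∀ k, dC k ∘ₗ dC (k + 1) = 0}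

lemma linComplex_hasChi_ses (f : ∀ k, A k →ₗ[ℚ] B k) (hf : ∀ k, dB k ∘ₗ f (k + 1) = f k ∘ₗ dA k)
    (g : ∀ k, B k →ₗ[ℚ] C k) (hg : ∀ k, dC k ∘ₗ g (k + 1) = g k ∘ₗ dB k)
    (h1 : ∀ k, Function.Injective (f k)) (h2 : ∀ k, Function.Exact (f k) (g k))
    (h3 : ∀ k, Function.Surjective (g k)) :
    (∀ a c, HasChi (linComplex dA hA) a → HasChi (linComplex dC hC) c →
      HasChi (linComplex dB hB) (a + c)) ∧
    (∀ a b, HasChi (linComplex dA hA) a → HasChi (linComplex dB hB) b →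
      HasChi (linComplex dC hC) (b - a)) ∧
    (∀ b c, HasChi (linComplex dB hB) b → HasChi (linComplex dC hC) c →
      HasChi (linComplex dA hA) (b - c)) := by
  obtain ⟨S, hS, e1, e2, e3⟩ := linComplex_shortExact (hA := hA) (hB := hB) (hC := hC)
    f hf g hg h1 h2 h3
  rw [← e1, ← e2, ← e3]
  exact ⟨fun a c h1 h3 => h1.of_shortExact₂ hS h3, fun a b h1 h2 => h1.of_shortExact₃ hS h2,
    fun b c h2 h3 => h2.of_shortExact₁ hS h3⟩

end ses

/-- Simplices of a subspace. -/
def simplexSubtypeEquiv (S : Set X) (k : ℕ) :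
    C(TopSimplex k, S) ≃ ({s : C(TopSimplex k, X) | ∀ t, s t ∈ S} : Set C(TopSimplex k, X)) where
  toFun s := ⟨⟨fun t => (s t).1, by fun_prop⟩, fun t => (s t).2⟩
  invFun s := ⟨fun t => ⟨s.1 t, s.2 t⟩, by fun_prop⟩
  left_inv _ := rfl
  right_inv _ := rfl

def chainsInEquiv (S : Set X) (k : ℕ) : SingChain S k ≃ₗ[ℚ] (SingSub.inSet S).carrier k :=
  (Finsupp.domLCongr (simplexSubtypeEquiv S k)).trans
    (Finsupp.supportedEquivFinsupp ({s : C(TopSimplex k, X) | ∀ t, s t ∈ S})).symm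

lemma chainsInEquiv_single (S : Set X) (k : ℕ) (s : C(TopSimplex k, S)) :
    (chainsInEquiv S k (Finsupp.single s 1)).1 = Finsupp.single (simplexSubtypeEquiv S k s).1 1 := by
  have h := Finsupp.domLCongr_single (R := ℚ) (simplexSubtypeEquiv S k) s (1 : ℚ)
  refine Eq.trans ?_ (Finsupp.supportedEquivFinsupp_symm_single (R := ℚ)
    ({s : C(TopSimplex k, X) | ∀ t, s t ∈ S}) (simplexSubtypeEquiv S k s) (1 : ℚ))
  rw [← h]
  rfl

lemma hasEulerChar_coe_iff (S : Set X) (e : ℤ) :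
    HasEulerChar S e ↔ (SingSub.inSet S).Chi e := by
  rw [hasEulerChar_iff]
  refine hasChi_linComplex_congr (fun k => (frozenEquiv S k).trans (chainsInEquiv S k)) (fun k x => ?_) e
  rw [LinearEquiv.trans_apply, frozenEquiv_d, LinearEquiv.trans_apply]
  generalize frozenEquiv S (k + 1) x = y
  have : (chainsInEquiv S k).toLinearMap ∘ₗ singBoundary S k =
      (SingSub.inSet S).bdry k ∘ₗ (chainsInEquiv S (k + 1)).toLinearMap := by
    refine Finsupp.lhom_ext' fun s => LinearMap.ext_ring (Subtype.ext ?_)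
    simp only [LinearMap.comp_apply, Finsupp.lsingle_apply, singBoundary_single, map_sum, map_smul,
      LinearEquiv.coe_coe]
    change _ = singBoundary X k (chainsInEquiv S (k + 1) (Finsupp.single s 1)).1
    rw [chainsInEquiv_single, singBoundary_single]
    rw [AddSubmonoidClass.coe_finsetSum]
    refine Finset.sum_congr rfl fun i _ => ?_
    rw [Submodule.coe_smul, chainsInEquiv_single]
    rfl
  exact LinearMap.congr_fun this y

lemma hasEulerChar_iff_linComplex (e : ℤ) :
    HasEulerChar X e ↔ HasChi (linComplex (singBoundary X) singBoundary_singBoundary) e := by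
  rw [hasEulerChar_iff]
  exact hasChi_linComplex_congr (frozenEquiv X) (frozenEquiv_d X) e

section mv
variable {U V : Set X} (hU : IsOpen U) (hV : IsOpen V) (hUV : U ∪ V = Set.univ)
include hU hV hUV

lemma small_quot_hasChi :
    HasChi (linComplex (A := fun k => SingChain X k ⧸ (SingSub.small U V).carrier k)
      (SingSub.small U V).quotBdry (SingSub.small U V).quotBdry_quotBdry) 0 := by
  refine linComplex_hasChi_zero (fun z => ⟨0, ?_⟩) (fun k z hz => ?_)
  · obtain ⟨z, rfl⟩ := Submodule.Quotient.mk_surjective _ z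
    rw [map_zero, eq_comm, Submodule.Quotient.mk_eq_zero]
    refine map_mem_of_forall_single LinearMap.id _ z fun s _ => ?_
    have : Unique (TopSimplex 0) := inferInstanceAs (Unique (stdSimplex ℝ (Fin 1)))
    have h : s default ∈ U ∪ V := hUV ▸ Set.mem_univ _
    have hs : ∀ t, s t = s default := fun t => congrArg s (Subsingleton.elim _ _)
    rcases h with h | h
    · exact Submodule.mem_sup_left (Finsupp.single_mem_supported ℚ _ fun t => hs t ▸ h)
    · exact Submodule.mem_sup_right (Finsupp.single_mem_supported ℚ _ fun t => hs t ▸ h)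
  · obtain ⟨z, rfl⟩ := Submodule.Quotient.mk_surjective _ z
    rw [SingSub.quotBdry, Submodule.mapQ_apply, Submodule.Quotient.mk_eq_zero] at hz
    obtain ⟨w, hw⟩ := exists_sub_singBoundary_mem_smallChains hU hV hUV z hz
    refine ⟨Submodule.Quotient.mk w, ?_⟩
    rw [SingSub.quotBdry, Submodule.mapQ_apply, eq_comm, Submodule.Quotient.eq]
    exact hw

lemma small_chi_iff (e : ℤ) : (SingSub.small U V).Chi e ↔ HasEulerChar X e := by
  obtain ⟨h1, -, h3⟩ := linComplex_hasChi_ses (hA := (SingSub.small U V).bdry_bdry)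
    (A := fun k => (SingSub.small U V).carrier k)
    (C := fun k => SingChain X k ⧸ (SingSub.small U V).carrier k)
    (hB := singBoundary_singBoundary (X := X)) (hC := (SingSub.small U V).quotBdry_quotBdry)
    (fun k => ((SingSub.small U V).carrier k).subtype) (fun k => rfl)
    (fun k => ((SingSub.small U V).carrier k).mkQ) (fun k => rfl)
    (fun k => Subtype.val_injective)
    (fun k => LinearMap.exact_subtype_mkQ _)
    (fun k => Submodule.mkQ_surjective _)
  rw [hasEulerChar_iff_linComplex]
  constructor
  · intro h
    simpa using h1 _ _ h (small_quot_hasChi hU hV hUV)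
  · intro h
    have := h3 _ _ h (small_quot_hasChi hU hV hUV)
    rwa [sub_zero] at this

lemma exists_mv : 
    (∀ u v w, HasEulerChar U u → HasEulerChar V v → HasEulerChar ↥(U ∩ V) w →
      HasEulerChar X (u + v - w)) ∧
    (∀ e v w, HasEulerChar X e → HasEulerChar V v → HasEulerChar ↥(U ∩ V) w →
      HasEulerChar U (e - v + w)) := by
  let dP : ∀ k, ((SingSub.inSet U).carrier (k + 1) × (SingSub.inSet V).carrier (k + 1)) →ₗ[ℚ]
      ((SingSub.inSet U).carrier k × (SingSub.inSet V).carrier k) :=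
    fun k => ((SingSub.inSet U).bdry k).prodMap ((SingSub.inSet V).bdry k)
  have hP : ∀ k, dP k ∘ₗ dP (k + 1) = 0 := fun k => by
    refine LinearMap.ext fun z => Prod.ext ?_ ?_
    · exact LinearMap.congr_fun (SingSub.bdry_bdry (SingSub.inSet U) k) z.1
    · exact LinearMap.congr_fun (SingSub.bdry_bdry (SingSub.inSet V) k) z.2
  obtain ⟨p1, p2, p3⟩ := linComplex_hasChi_ses (hA := (SingSub.inSet U).bdry_bdry)
    (hB := hP) (hC := (SingSub.inSet V).bdry_bdry)
    (fun k => LinearMap.inl ℚ ((SingSub.inSet U).carrier k) ((SingSub.inSet V).carrier k))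
    (fun k => by ext z <;> simp [dP])
    (fun k => LinearMap.snd ℚ ((SingSub.inSet U).carrier k) ((SingSub.inSet V).carrier k))
    (fun k => rfl) (fun k => LinearMap.inl_injective) (fun k => .inl_snd)
    (fun k => LinearMap.snd_surjective)
  have mU : ∀ k, (SingSub.inSet (U ∩ V)).carrier k ≤ (SingSub.inSet U).carrier k := fun k =>
    Finsupp.supported_mono fun s hs t => (hs t).1
  have mV : ∀ k, (SingSub.inSet (U ∩ V)).carrier k ≤ (SingSub.inSet V).carrier k := fun k =>
    Finsupp.supported_mono fun s hs t => (hs t).2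
  have sU : ∀ k, (SingSub.inSet U).carrier k ≤ (SingSub.small U V).carrier k := fun k => le_sup_left
  have sV : ∀ k, (SingSub.inSet V).carrier k ≤ (SingSub.small U V).carrier k := fun k => le_sup_right
  obtain ⟨q1, q2, q3⟩ := linComplex_hasChi_ses (hA := (SingSub.inSet (U ∩ V)).bdry_bdry)
    (hB := hP) (hC := (SingSub.small U V).bdry_bdry)
    (fun k => (Submodule.inclusion (mU k)).prod (Submodule.inclusion (mV k)))
    (fun k => rfl)
    (fun k => (Submodule.inclusion (sU k)).coprod (-Submodule.inclusion (sV k)))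
    (fun k => by
      refine LinearMap.ext fun z => Subtype.ext ?_
      change singBoundary X k (z.1.1 + -z.2.1) = singBoundary X k z.1.1 + - singBoundary X k z.2.1
      rw [map_add, map_neg])
    (fun k a b hab => Subtype.ext (congrArg (fun z => z.1.1) hab))
    (fun k z => by
      constructor
      · intro h
        have h' : z.1.1 + -z.2.1 = 0 := congrArg Subtype.val h
        have h2 : z.1.1 = z.2.1 := by rwa [← sub_eq_add_neg, sub_eq_zero] at h'
        refine ⟨⟨z.1.1, ?_⟩, ?_⟩
        · intro s hs
          have a1 := z.1.2 hs
          have a2 := z.2.2 (h2 ▸ hs)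
          exact fun t => ⟨a1 t, a2 t⟩
        · exact Prod.ext rfl (Subtype.ext h2)
      · rintro ⟨w, rfl⟩
        refine Subtype.ext ?_
        change w.1 + -w.1 = 0
        simp)
    (fun k z => by
      obtain ⟨a, ha, b, hb, hab⟩ := Submodule.mem_sup.1 z.2
      refine ⟨(⟨a, ha⟩, ⟨-b, Submodule.neg_mem _ hb⟩), Subtype.ext ?_⟩
      change a + - -b = z.1
      rw [neg_neg, hab])
  simp only [hasEulerChar_coe_iff, ← small_chi_iff hU hV hUV]
  constructor
  · intro u v w h1 h2 h3
    exact q2 _ _ h3 (p1 _ _ h1 h2)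
  · intro e v w h1 h2 h3
    have := p3 _ _ (q1 _ _ h3 h1) h2
    rwa [show e - v + w = w + e - v by ring]

end mv
end

section
variable {X Y : Type} [TopologicalSpace X] [TopologicalSpace Y]

lemma singularHomologyFunctor_map_eq {X Y : TopCat.{0}} {f g : X ⟶ Y} (H : TopCat.Homotopy f g) (k : ℕ) :
    (singularHomologyFunctor ℚ k).map f = (singularHomologyFunctor ℚ k).map g :=
  SimplicialObject.Homotopy.map_homology_eq
    (H.toSSet.toSimplicialObjectHomotopy.whiskerRight (ModuleCat.free ℚ)) k

open ContinuousMap in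
/-- The homology of homotopy equivalent spaces. -/
def sHomologyIso (e : X ≃ₕ Y) (k : ℕ) :
    (singularHomologyFunctor ℚ k).obj (TopCat.of X) ≅
      (singularHomologyFunctor ℚ k).obj (TopCat.of Y) where
  hom := (singularHomologyFunctor ℚ k).map (TopCat.ofHom e.toFun)
  inv := (singularHomologyFunctor ℚ k).map (TopCat.ofHom e.invFun)
  hom_inv_id := by
    rw [← Functor.map_comp, ← TopCat.ofHom_comp]
    refine Eq.trans (singularHomologyFunctor_map_eq (g := 𝟙 _) ?_ k) (CategoryTheory.Functor.map_id _ _)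
    exact e.left_inv.some
  inv_hom_id := by
    rw [← Functor.map_comp, ← TopCat.ofHom_comp]
    refine Eq.trans (singularHomologyFunctor_map_eq (g := 𝟙 _) ?_ k) (CategoryTheory.Functor.map_id _ _)
    exact e.right_inv.some

open ContinuousMap in
lemma HasEulerChar.congr (e : X ≃ₕ Y) {z : ℤ} (h : HasEulerChar X z) : HasEulerChar Y z :=
  hasChi_of_finrank_eq h fun k => ⟨(sHomologyIso e k).toLinearEquiv⟩

lemma HasEulerChar.homeo (e : X ≃ₜ Y) {z : ℤ} (h : HasEulerChar X z) : HasEulerChar Y z :=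
  h.congr e.toHomotopyEquiv

lemma hasEulerChar_of_isEmpty [IsEmpty X] : HasEulerChar X 0 := by
  rw [hasEulerChar_iff_linComplex]
  have : ∀ k, IsEmpty C(TopSimplex k, X) := fun k => ⟨fun s => IsEmpty.false (s (simplexVertex k 0))⟩
  exact linComplex_hasChi_zero (fun z => ⟨0, Subsingleton.elim _ _⟩)
    (fun k z _ => ⟨0, Subsingleton.elim _ _⟩)

lemma singBoundary_single_of_unique [Unique X] (k : ℕ) (s : C(TopSimplex (k + 1), X))
    (s' : C(TopSimplex k, X)) :
    singBoundary X k (Finsupp.single s 1) =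
      (∑ i : Fin (k + 2), (-1 : ℚ) ^ (i : ℕ)) • Finsupp.single s' 1 := by
  rw [singBoundary_single, Finset.sum_smul]
  refine Finset.sum_congr rfl fun i _ => ?_
  congr 2
  ext t
  exact Subsingleton.elim _ _

lemma hasEulerChar_of_unique [Unique X] : HasEulerChar X 1 := by
  rw [hasEulerChar_iff_linComplex]
  have hu : ∀ k (s s' : C(TopSimplex k, X)), s = s' := fun k s s' => by
    ext t; exact Subsingleton.elim _ _
  let c : ∀ k, C(TopSimplex k, X) := fun k => ⟨fun _ => default, continuous_const⟩
  have hz : ∀ k (z : SingChain X k), z = z (c k) • Finsupp.single (c k) 1 := by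
    intro k z
    ext s
    rw [hu k s (c k)]; simp
  have hd : ∀ k (z : SingChain X (k + 1)), singBoundary X k z =
      (∑ i : Fin (k + 2), (-1 : ℚ) ^ (i : ℕ)) • z (c (k + 1)) • Finsupp.single (c k) 1 := by
    intro k z
    conv_lhs => rw [hz _ z, map_smul, singBoundary_single_of_unique k _ (c k)]
    rw [smul_comm]
  have hsum : ∀ k : ℕ, (∑ i : Fin k, (-1 : ℚ) ^ (i : ℕ)) = if Even k then 0 else 1 := by
    intro k
    rw [Fin.sum_univ_eq_sum_range (fun i => (-1 : ℚ) ^ i), neg_one_geom_sum]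
  have hex' : ∀ k (z : SingChain X (k + 1)), singBoundary X k z = 0 →
      ∃ w, singBoundary X (k + 1) w = z := by
    intro k z hzz
    rcases Nat.even_or_odd k with he | ho
    · refine ⟨Finsupp.single (c (k + 2)) (z (c (k + 1))), ?_⟩
      rw [hd, hsum, if_neg (by grind), Finsupp.single_eq_same, one_smul]
      exact (hz _ z).symm
    · refine ⟨0, ?_⟩
      rw [hd, hsum, if_neg (by grind), one_smul] at hzz
      have := hz _ z
      have h2 : z (c (k + 1)) * 1 = 0 := by
        simpa using congrArg (fun f : SingChain X k => f (c k)) hzz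
      rw [mul_one] at h2
      rw [h2, zero_smul] at this
      rw [map_zero]; exact this.symm
  have hex : ∀ k, (linComplex (singBoundary X) singBoundary_singBoundary).ExactAt (k + 1) := by
    intro k
    rw [HomologicalComplex.exactAt_iff' _ (k + 2) (k + 1) k (by simp) (by simp),
      ShortComplex.moduleCat_exact_iff]
    intro z hzz
    change (linComplex (singBoundary X) singBoundary_singBoundary).d (k + 1) k z = 0 at hzz
    rw [linComplex_d] at hzz
    change ∃ w, (linComplex (singBoundary X) singBoundary_singBoundary).d (k + 2) (k + 1) w = z
    rw [linComplex_d]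
    exact hex' k z hzz
  have hd0 : (linComplex (singBoundary X) singBoundary_singBoundary).d 1 0 = 0 := by
    rw [linComplex_d]
    ext1
    refine LinearMap.ext fun z => ?_
    change singBoundary X 0 z = 0
    rw [hd, hsum, if_pos (by decide), zero_smul]
  have := HomologicalComplex.isIso_pOpcycles _ 1 0 (by simp) hd0
  have e0 : (linComplex (singBoundary X) singBoundary_singBoundary).homology 0 ≃ₗ[ℚ] SingChain X 0 :=
    ((ChainComplex.isoHomologyι₀ _).trans (asIso (HomologicalComplex.pOpcycles _ 0)).symm).toLinearEquiv
  have huq : Unique C(TopSimplex 0, X) := ⟨⟨c 0⟩, fun s => hu _ _ _⟩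
  have r0 : Module.finrank ℚ ((linComplex (singBoundary X) singBoundary_singBoundary).homology 0) = 1 := by
    rw [e0.finrank_eq, Module.finrank_finsupp_self, Fintype.card_unique]
  have hs : ∀ k, Subsingleton ((linComplex (singBoundary X) singBoundary_singBoundary).homology (k + 1)) :=
    fun k => ModuleCat.subsingleton_of_isZero (hex k).isZero_homology
  refine ⟨fun k => ?_, 1, fun k hk => ?_, ?_⟩
  · rcases k with _ | k
    · exact Module.Finite.equiv e0.symm
    · infer_instance
  · obtain ⟨k, rfl⟩ := Nat.exists_eq_add_of_le' hk
    exact Module.finrank_zero_of_subsingleton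
  · simp [r0]

lemma hasEulerChar_of_contractible [ContractibleSpace X] : HasEulerChar X 1 :=
  (hasEulerChar_of_unique (X := Unit)).congr (ContractibleSpace.hequiv_unit X).some.symm

/-- The preimage of a subset in a larger subset. -/
def preimageValHomeo {S W : Set X} (h : S ⊆ W) : ↥(Subtype.val ⁻¹' S : Set W) ≃ₜ S where
  toFun x := ⟨x.1.1, x.2⟩
  invFun x := ⟨⟨x.1, h x.2⟩, x.2⟩
  left_inv _ := rfl
  right_inv _ := rfl
  continuous_toFun := by fun_prop
  continuous_invFun := by fun_prop

section mv
variable {U V : Set X} (hU : IsOpen U) (hV : IsOpen V)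
include hU hV

lemma HasEulerChar.union {u v w : ℤ} (h1 : HasEulerChar U u) (h2 : HasEulerChar V v)
    (h3 : HasEulerChar ↥(U ∩ V) w) : HasEulerChar ↥(U ∪ V) (u + v - w) := by
  have huv : (Subtype.val ⁻¹' U ∪ Subtype.val ⁻¹' V : Set ↥(U ∪ V)) = Set.univ := 
    Set.eq_univ_of_forall fun x => x.2
  refine (exists_mv (hU.preimage continuous_subtype_val) (hV.preimage continuous_subtype_val) huv).1
    u v w (h1.homeo (preimageValHomeo Set.subset_union_left).symm)
      (h2.homeo (preimageValHomeo Set.subset_union_right).symm) ?_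
  rw [← Set.preimage_inter]
  exact h3.homeo (preimageValHomeo (Set.inter_subset_left.trans Set.subset_union_left)).symm

lemma HasEulerChar.of_union {e v w : ℤ} (h1 : HasEulerChar ↥(U ∪ V) e) (h2 : HasEulerChar V v)
    (h3 : HasEulerChar ↥(U ∩ V) w) : HasEulerChar U (e - v + w) := by
  have huv : (Subtype.val ⁻¹' U ∪ Subtype.val ⁻¹' V : Set ↥(U ∪ V)) = Set.univ := 
    Set.eq_univ_of_forall fun x => x.2
  refine ((exists_mv (hU.preimage continuous_subtype_val) (hV.preimage continuous_subtype_val) huv).2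
    e v w h1 (h2.homeo (preimageValHomeo Set.subset_union_right).symm) ?_).homeo
      (preimageValHomeo Set.subset_union_left)
  rw [← Set.preimage_inter]
  exact h3.homeo (preimageValHomeo (Set.inter_subset_left.trans Set.subset_union_left)).symm

end mv

lemma HasEulerChar.of_eq {S T : Set X} (h : S = T) {a b : ℤ} (hab : a = b) (hS : HasEulerChar S a) :
    HasEulerChar T b := by
  subst h hab; exact hS

lemma hasEulerChar_biUnion_disjoint {ι : Type} (U : ι → Set X) (hU : ∀ i, IsOpen (U i))
    (hd : ∀ i j, i ≠ j → Disjoint (U i) (U j)) (e : ι → ℤ) (h : ∀ i, HasEulerChar (U i) (e i))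
    (s : Finset ι) : HasEulerChar ↥(⋃ i ∈ s, U i) (∑ i ∈ s, e i) := by
  classical
  induction s using Finset.induction_on with
  | empty =>
    have : IsEmpty ↥(⋃ i ∈ (∅ : Finset ι), U i) := by simp
    simpa using hasEulerChar_of_isEmpty (X := ↥(⋃ i ∈ (∅ : Finset ι), U i))
  | insert a s ha ih =>
    have hem : U a ∩ (⋃ i ∈ s, U i) = ∅ := by
      rw [← Set.disjoint_iff_inter_eq_empty, Set.disjoint_iUnion₂_right]
      exact fun i hi => hd a i (fun h => ha (h ▸ hi))
    have : IsEmpty ↥(U a ∩ (⋃ i ∈ s, U i)) := by rw [hem]; infer_instance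
    refine (HasEulerChar.union (hU a) (isOpen_biUnion fun i _ => hU i) (h a) ih hasEulerChar_of_isEmpty).of_eq ?_ ?_
    · rw [Finset.set_biUnion_insert]; rfl
    · rw [Finset.sum_insert ha, sub_zero]

lemma hasEulerChar_biUnion_zero {ι : Type} (U : ι → Set X) (hU : ∀ i, IsOpen (U i)) (s : Finset ι)
    (W : Set X) (hW : IsOpen W)
    (h : ∀ t ⊆ s, t.Nonempty → HasEulerChar ↥((⋂ i ∈ t, U i) ∩ W) 0) :
    HasEulerChar ↥((⋃ i ∈ s, U i) ∩ W) 0 := by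
  classical
  induction s using Finset.induction_on generalizing W with
  | empty =>
    have : IsEmpty ↥((⋃ i ∈ (∅ : Finset ι), U i) ∩ W) := by simp
    exact hasEulerChar_of_isEmpty
  | insert a s ha ih =>
    have h1 := ih W hW fun t ht => h t (ht.trans (Finset.subset_insert _ _))
    have h2 := ih (U a ∩ W) ((hU a).inter hW) fun t ht htn => by
      have := h (insert a t) (Finset.insert_subset_insert _ ht) (Finset.insert_nonempty _ _)
      refine this.of_eq ?_ rfl
      rw [Finset.set_biInter_insert]
      ext; simp; tauto
    have h3 := h {a} (by simp) (by simp)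
    refine (HasEulerChar.union ((hU a).inter hW)
      ((isOpen_biUnion fun i _ => hU i).inter hW) (h3.of_eq (by simp) rfl) h1
      (h2.of_eq ?_ rfl)).of_eq ?_ (by simp)
    · ext; simp; tauto
    · rw [Finset.set_biUnion_insert, Set.union_inter_distrib_right]; rfl

end

open scoped Pointwise

lemma HasEulerChar.prod_of_contractible {Z C : Type} [TopologicalSpace Z] [TopologicalSpace C]
    [ContractibleSpace C] {e : ℤ} (h : HasEulerChar Z e) : HasEulerChar (Z × C) e :=
  (h.homeo (Homeomorph.prodPUnit Z).symm).congr
    ((ContinuousMap.HomotopyEquiv.refl Z).prodCongr (ContractibleSpace.hequiv_unit C).some.symm)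

/-- A product with a subset, as a subset of the product. -/
def prodSubtypeHomeo {Z C : Type} [TopologicalSpace Z] [TopologicalSpace C] (S : Set C) :
    Z × S ≃ₜ {p : Z × C | p.2 ∈ S} where
  toFun p := ⟨(p.1, p.2.1), p.2.2⟩
  invFun p := (p.1.1, ⟨p.1.2, p.2⟩)
  left_inv _ := rfl
  right_inv _ := rfl
  continuous_toFun := by fun_prop
  continuous_invFun := by fun_prop

lemma HasEulerChar.prod_starConvex {Z C : Type} [TopologicalSpace Z] [AddCommGroup C] [Module ℝ C]
    [TopologicalSpace C] [ContinuousAdd C] [ContinuousSMul ℝ C] {S : Set C} {x : C}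
    (hS : StarConvex ℝ x S) (hx : x ∈ S) {e : ℤ} (h : HasEulerChar Z e) :
    HasEulerChar {p : Z × C | p.2 ∈ S} e := by
  have := hS.contractibleSpace ⟨x, hx⟩
  exact (h.prod_of_contractible (C := S)).homeo (prodSubtypeHomeo S)

lemma HasEulerChar.prod_complex_ne_zero {Z : Type} [TopologicalSpace Z] {e : ℤ}
    (h : HasEulerChar Z e) : HasEulerChar {p : Z × ℂ | p.2 ≠ 0} 0 := by
  have o1 : IsOpen {p : Z × ℂ | p.2 ∈ Complex.slitPlane} :=
    Complex.isOpen_slitPlane.preimage continuous_snd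
  have o2 : IsOpen {p : Z × ℂ | p.2 ∈ (-1 : ℝ) • Complex.slitPlane} := 
    (Complex.isOpen_slitPlane.smul₀ (by norm_num)).preimage continuous_snd
  have o3 : IsOpen {p : Z × ℂ | p.2 ∈ {z : ℂ | 0 < z.im}} :=
    (isOpen_lt continuous_const Complex.continuous_im).preimage continuous_snd
  have o4 : IsOpen {p : Z × ℂ | p.2 ∈ {z : ℂ | z.im < 0}} :=
    (isOpen_lt Complex.continuous_im continuous_const).preimage continuous_snd
  have mem2 : ∀ z : ℂ, z ∈ (-1 : ℝ) • Complex.slitPlane ↔ z.re < 0 ∨ z.im ≠ 0 := by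
    intro z
    rw [Set.mem_smul_set_iff_inv_smul_mem₀ (by norm_num), Complex.mem_slitPlane_iff]
    simp
  have h1 := h.prod_starConvex Complex.starConvex_one_slitPlane (Complex.one_mem_slitPlane)
  have h2 := h.prod_starConvex (Complex.starConvex_one_slitPlane.smul (-1 : ℝ))
    (Set.smul_mem_smul_set Complex.one_mem_slitPlane)
  have h3 := h.prod_starConvex ((convex_halfSpace_im_gt 0).starConvex
    (show Complex.I ∈ {z : ℂ | 0 < z.im} by simp)) (by simp)
  have h4 := h.prod_starConvex ((convex_halfSpace_im_lt 0).starConvex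
    (show -Complex.I ∈ {z : ℂ | z.im < 0} by simp)) (by simp)
  have hem : IsEmpty ↥({p : Z × ℂ | p.2 ∈ {z : ℂ | 0 < z.im}} ∩ {p : Z × ℂ | p.2 ∈ {z : ℂ | z.im < 0}}) := by
    refine ⟨fun p => ?_⟩
    have := p.2.1; have := p.2.2
    simp only [Set.mem_ofPred_eq] at *
    linarith
  have h5 := HasEulerChar.union o3 o4 h3 h4 hasEulerChar_of_isEmpty
  refine (HasEulerChar.union o1 o2 h1 h2 (h5.of_eq ?_ rfl)).of_eq ?_ (by ring)
  · ext p
    simp only [Set.mem_union, Set.mem_inter_iff, Set.mem_ofPred_eq, mem2, Complex.mem_slitPlane_iff]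
    grind
  · ext p
    simp only [Set.mem_union, Set.mem_ofPred_eq, mem2, Complex.mem_slitPlane_iff,
      Ne, Complex.ext_iff, Complex.zero_re, Complex.zero_im]
    grind

/-- Splitting off the first coordinate. -/
def finConsHomeo (m : ℕ) : (Fin m → ℝ) × ℝ ≃ₜ (Fin (m + 1) → ℝ) where
  toFun p := Fin.cons p.2 p.1
  invFun x := (Fin.tail x, x 0)
  left_inv p := by simp
  right_inv x := by simp
  continuous_toFun := by fun_prop
  continuous_invFun := by unfold Fin.tail; fun_prop

lemma hasEulerChar_punctured (m : ℕ) : HasEulerChar {x : Fin m → ℝ | x ≠ 0} (1 - (-1) ^ m) := by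
  induction m with
  | zero =>
    have : IsEmpty {x : Fin 0 → ℝ | x ≠ 0} := ⟨fun x => x.2 (Subsingleton.elim _ _)⟩
    simpa using hasEulerChar_of_isEmpty (X := {x : Fin 0 → ℝ | x ≠ 0})
  | succ m ih =>
    suffices h : HasEulerChar {p : (Fin m → ℝ) × ℝ | p ≠ 0} (1 - (-1) ^ (m + 1)) by
      refine h.homeo ((finConsHomeo m).subtype fun p => ?_)
      refine not_congr ?_
      constructor
      · rintro rfl; ext i; refine Fin.cases ?_ ?_ i <;> simp [finConsHomeo]
      · intro h
        rw [← (finConsHomeo m).symm_apply_apply p, h]; rfl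
    have star : ∀ s : ℝ, s ≠ 0 → StarConvex ℝ ((0, s) : (Fin m → ℝ) × ℝ)
        {p | p.1 ≠ 0 ∨ 0 < s * p.2} := by
      intro s hs p hp a b ha hb hab
      by_cases hb0 : b = 0
      · right
        have : a = 1 := by linarith
        subst hb0 this
        simpa using hs
      have hbp : 0 < b := lt_of_le_of_ne hb (Ne.symm hb0)
      rcases hp with hp | hp
      · left; simpa [hb0] using hp
      · right
        have : 0 < s * s := mul_self_pos.2 hs
        have := mul_pos hbp hp
        simp; nlinarith
    have op : ∀ s : ℝ, IsOpen {p : (Fin m → ℝ) × ℝ | p.1 ≠ 0 ∨ 0 < s * p.2} := fun s =>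
      ((isOpen_ne.preimage continuous_fst).union
        (isOpen_lt continuous_const (continuous_const.mul continuous_snd)))
    have ct : ∀ s : ℝ, s ≠ 0 → HasEulerChar {p : (Fin m → ℝ) × ℝ | p.1 ≠ 0 ∨ 0 < s * p.2} 1 := by
      intro s hs
      have := (star s hs).contractibleSpace ⟨(0, s), by right; simpa using hs⟩
      exact hasEulerChar_of_contractible
    have h_int := ((ih.prod_of_contractible (C := ℝ))).homeo
      ((Homeomorph.prodComm _ _).trans (prodSubtypeHomeo (Z := ℝ) {x : Fin m → ℝ | x ≠ 0}))
    have h_int' := h_int.homeo ((Homeomorph.prodComm _ _).subtype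
      (q := fun p : (Fin m → ℝ) × ℝ => p ∈ {p : (Fin m → ℝ) × ℝ | p.1 ≠ 0}) fun p => Iff.rfl)
    refine (HasEulerChar.union (op 1) (op (-1)) (ct 1 (by simp)) (ct (-1) (by simp))
      (h_int'.of_eq ?_ rfl)).of_eq ?_ (by ring)
    · ext p
      by_cases h : p.1 = 0
      · simp [h]; intro h; linarith
      · simp [h]
    · ext ⟨p, q⟩
      by_cases h : p = 0
      · simp [h]
        rcases lt_trichotomy q 0 with h | h | h <;> grind
      · simp [h]

section
open Set Filter Topology NNReal
variable {E : Type*} [NormedAddCommGroup E] [NormedSpace ℝ E] [CompleteSpace E]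

lemma exists_integralCurve_of_lipschitzWith {v : E → E} {K L : ℝ≥0} (hv : LipschitzWith K v)
    (hL : ∀ x, ‖v x‖ ≤ L) (x : E) :
    ∃ γ : ℝ → E, γ 0 = x ∧ ∀ t, HasDerivAt γ (v (γ t)) t := by
  have key : ∀ N : ℕ, ∃ γ : ℝ → E, γ 0 = x ∧
      ∀ t ∈ Ioo (-(N + 1 : ℝ)) (N + 1), HasDerivAt γ (v (γ t)) t := by
    intro N
    have h0 : (0 : ℝ) ∈ Icc (-(N + 1 : ℝ)) (N + 1) := by constructor <;> linarith
    have hpl : IsPicardLindelof (fun _ => v) (⟨0, h0⟩ : Icc (-(N + 1 : ℝ)) (N + 1)) x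
        (L * (N + 1)) 0 L K :=
      IsPicardLindelof.of_time_independent (fun y _ => hL y) hv.lipschitzOnWith (by simp)
    obtain ⟨γ, h1, h2⟩ := hpl.exists_eq_forall_mem_Icc_hasDerivWithinAt₀
    exact ⟨γ, h1, fun t ht => (h2 t (Ioo_subset_Icc_self ht)).hasDerivAt (Icc_mem_nhds ht.1 ht.2)⟩
  choose γ h0 hγ using key
  have agree : ∀ N M : ℕ, ∀ t : ℝ, |t| < N + 1 → N ≤ M → γ N t = γ M t := by
    intro N M t ht hNM
    have hNM' : (N : ℝ) ≤ M := by exact_mod_cast hNM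
    refine ODE_solution_unique_of_mem_Ioo (v := fun _ => v) (s := fun _ => univ)
      (a := -(N + 1 : ℝ)) (b := N + 1) (t₀ := 0)
      (fun _ _ => hv.lipschitzOnWith) (by constructor <;> linarith)
      (fun s hs => ⟨hγ N s hs, trivial⟩)
      (fun s hs => ⟨hγ M s ⟨by linarith [hs.1], by linarith [hs.2]⟩, trivial⟩) (by rw [h0, h0])
      (abs_lt.1 ht)
  refine ⟨fun t => γ ⌈|t|⌉₊ t, h0 _, fun t₀ => ?_⟩
  have hev : (fun t => γ ⌈|t|⌉₊ t) =ᶠ[𝓝 t₀] γ (⌈|t₀|⌉₊ + 1) := by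
    have : ∀ᶠ t in 𝓝 t₀, |t| < |t₀| + 1 :=
      continuous_abs.continuousAt.eventually_lt continuousAt_const (by linarith)
    filter_upwards [this] with t ht
    refine agree _ _ t (by linarith [Nat.le_ceil |t|]) ?_
    refine Nat.ceil_le.2 (ht.le.trans ?_)
    push_cast
    linarith [Nat.le_ceil |t₀|]
  refine HasDerivAt.congr_of_eventuallyEq ?_ hev
  rw [show (fun t => γ ⌈|t|⌉₊ t) t₀ = _ from hev.eq_of_nhds]
  refine hγ _ t₀ (abs_lt.1 ?_)
  push_cast
  linarith [Nat.le_ceil |t₀|]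

omit [CompleteSpace E] in
lemma dist_le_of_integralCurve {v : E → E} {K : ℝ≥0} (hv : LipschitzWith K v) {f g : ℝ → E}
    (hf : ∀ t, HasDerivAt f (v (f t)) t) (hg : ∀ t, HasDerivAt g (v (g t)) t) (t : ℝ) :
    dist (f t) (g t) ≤ dist (f 0) (g 0) * Real.exp (K * |t|) := by
  have aux : ∀ {v : E → E} (_ : LipschitzWith K v) {f g : ℝ → E}
    (_ : ∀ t, HasDerivAt f (v (f t)) t) (_ : ∀ t, HasDerivAt g (v (g t)) t) (t : ℝ), 0 ≤ t →
    dist (f t) (g t) ≤ dist (f 0) (g 0) * Real.exp (K * t) := by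
    intro v hv f g hf hg t ht
    have := dist_le_of_trajectories_ODE (v := fun _ => v) (fun _ => hv) (a := 0) (b := t)
      (HasDerivAt.continuousOn fun s _ => hf s) (fun s _ => (hf s).hasDerivWithinAt)
      (HasDerivAt.continuousOn fun s _ => hg s) (fun s _ => (hg s).hasDerivWithinAt) le_rfl
      t ⟨ht, le_rfl⟩
    simpa using this
  rcases le_total 0 t with ht | ht
  · rw [abs_of_nonneg ht]; exact aux hv hf hg t ht
  · have h1 : LipschitzWith K (fun x => -v x) := hv.neg
    have h2 : ∀ {f : ℝ → E}, (∀ t, HasDerivAt f (v (f t)) t) →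
        ∀ t, HasDerivAt (fun s => f (-s)) (-v (f (-t))) t := by
      intro f hf t
      simpa [Function.comp_def] using (hf (-t)).scomp t (hasDerivAt_neg t)
    have := aux h1 (h2 hf) (h2 hg) (-t) (by linarith)
    rw [abs_of_nonpos ht]
    simpa using this

omit [CompleteSpace E] in
lemma continuous_uncurry_of_integralCurve {v : E → E} {K : ℝ≥0} (hv : LipschitzWith K v)
    {φ : ℝ → E → E} (h0 : ∀ x, φ 0 x = x) (hφ : ∀ x t, HasDerivAt (φ · x) (v (φ t x)) t) :
    Continuous (Function.uncurry φ) := by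
  rw [continuous_iff_continuousAt]
  rintro ⟨t₀, x₀⟩
  rw [ContinuousAt, tendsto_iff_dist_tendsto_zero]
  have hb : ∀ p : ℝ × E, dist (Function.uncurry φ p) (φ t₀ x₀) ≤
      dist p.2 x₀ * Real.exp (K * |p.1|) + dist (φ p.1 x₀) (φ t₀ x₀) := by
    rintro ⟨t, x⟩
    refine (dist_triangle _ (φ t x₀) _).trans (add_le_add_left ?_ _)
    simpa [h0] using dist_le_of_integralCurve hv (hφ x) (hφ x₀) t
  refine squeeze_zero (fun _ => dist_nonneg) hb ?_
  have hc : Continuous (φ · x₀) := continuous_iff_continuousAt.2 fun t => (hφ x₀ t).continuousAt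
  have : Continuous fun p : ℝ × E =>
      dist p.2 x₀ * Real.exp (K * |p.1|) + dist (φ p.1 x₀) (φ t₀ x₀) := by
    have := hc.comp (continuous_fst : Continuous (Prod.fst : ℝ × E → ℝ))
    fun_prop
  simpa using this.tendsto (t₀, x₀)

omit [CompleteSpace E] in
lemma integralCurve_unique {Ω : Set E} (hΩ : IsOpen Ω) {v : E → E} (hv : ContDiffOn ℝ 1 v Ω)
    {f g : ℝ → E} (hfΩ : ∀ t, f t ∈ Ω)
    (hf : ∀ t, HasDerivAt f (v (f t)) t) (hg : ∀ t, HasDerivAt g (v (g t)) t) {t₀ : ℝ}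
    (h : f t₀ = g t₀) : f = g := by
  have hcf : Continuous f := continuous_iff_continuousAt.2 fun t => (hf t).continuousAt
  have hcg : Continuous g := continuous_iff_continuousAt.2 fun t => (hg t).continuousAt
  have hcl : IsClopen {t | f t = g t} := by
    refine ⟨isClosed_eq hcf hcg, isOpen_iff_mem_nhds.2 fun t ht => ?_⟩
    obtain ⟨K, s, hs, hK⟩ := ((hv.contDiffAt (hΩ.mem_nhds (hfΩ t)))).exists_lipschitzOnWith
    refine ODE_solution_unique_of_eventually (v := fun _ => v) (s := fun _ => s) (K := K)
      (Eventually.of_forall fun _ => hK) ?_ ?_ ht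
    · filter_upwards [hcf.continuousAt.preimage_mem_nhds hs] with r hr using ⟨hf r, hr⟩
    · have : s ∈ 𝓝 (g t) := by rw [← (ht : f t = g t)]; exact hs
      filter_upwards [hcg.continuousAt.preimage_mem_nhds this] with r hr using ⟨hg r, hr⟩
  have := hcl.eq_univ ⟨t₀, h⟩
  ext t
  exact (this ▸ mem_univ t : t ∈ {t | f t = g t})

end

section
open Set Filter Topology NNReal
variable {E : Type*} [NormedAddCommGroup E] [NormedSpace ℝ E]

/-- The vector field `v`, cut off to the region where `B` is at most `R + 1`. -/
def cutoffField (Ω : Set E) (v : E → E) (B : E → ℝ) (R : ℝ) (x : E) : E :=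
  open Classical in if x ∈ Ω then Real.smoothTransition (R + 1 - B x) • v x else 0

lemma cutoffField_of_le {Ω : Set E} {v : E → E} {B : E → ℝ} {R : ℝ} {x : E} (hx : x ∈ Ω)
    (h : B x ≤ R) : cutoffField Ω v B R x = v x := by
  rw [cutoffField, if_pos hx, Real.smoothTransition.one_of_one_le (by linarith), one_smul]

lemma cutoffField_eq_zero {Ω : Set E} {v : E → E} {B : E → ℝ} {R : ℝ} {x : E}
    (h : x ∉ {x | x ∈ Ω ∧ B x ≤ R + 1}) : cutoffField Ω v B R x = 0 := by
  rw [cutoffField]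
  split_ifs with hx
  · have : R + 1 < B x := by
      by_contra hB
      exact h ⟨hx, by linarith⟩
    rw [Real.smoothTransition.zero_of_nonpos (by linarith), zero_smul]
  · rfl

lemma contDiff_cutoffField {Ω : Set E} (hΩ : IsOpen Ω) {v : E → E} (hv : ContDiffOn ℝ 1 v Ω)
    {B : E → ℝ} (hB : ContDiffOn ℝ 1 B Ω) {R : ℝ} (hc : IsCompact {x | x ∈ Ω ∧ B x ≤ R + 1}) :
    ContDiff ℝ 1 (cutoffField Ω v B R) := by
  rw [contDiff_iff_contDiffAt]
  intro x
  by_cases hx : x ∈ Ω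
  · have h1 : ContDiffAt ℝ 1 (fun y => Real.smoothTransition (R + 1 - B y) • v y) x :=
      (Real.smoothTransition.contDiffAt.comp x (contDiffAt_const.sub
        (hB.contDiffAt (hΩ.mem_nhds hx)))).smul (hv.contDiffAt (hΩ.mem_nhds hx))
    refine h1.congr_of_eventuallyEq ?_
    filter_upwards [hΩ.mem_nhds hx] with y hy
    rw [cutoffField, if_pos hy]
  · refine (contDiffAt_const (c := (0 : E))).congr_of_eventuallyEq ?_
    filter_upwards [hc.isClosed.isOpen_compl.mem_nhds (fun h => hx h.1)] with y hy
    exact cutoffField_eq_zero hy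

/-- A `C¹` vector field along which a proper function grows at most exponentially is complete. -/
theorem exists_flow [FiniteDimensional ℝ E] {Ω : Set E} (hΩ : IsOpen Ω) {v : E → E} (hv : ContDiffOn ℝ 1 v Ω)
    {B : E → ℝ} (hB : ContDiffOn ℝ 1 B Ω) (hB0 : ∀ x ∈ Ω, 0 ≤ B x)
    (hc : ∀ R, IsCompact {x | x ∈ Ω ∧ B x ≤ R}) {C : ℝ}
    (hC : ∀ x ∈ Ω, |fderiv ℝ B x (v x)| ≤ C * B x) :
    ∃ Φ : ℝ → E → E, (∀ x ∈ Ω, Φ 0 x = x) ∧ (∀ t, ∀ x ∈ Ω, Φ t x ∈ Ω) ∧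
      (∀ x ∈ Ω, ∀ t, HasDerivAt (Φ · x) (v (Φ t x)) t) ∧
      ContinuousOn (Function.uncurry Φ) (univ ×ˢ Ω) := by
  wlog hC0 : 0 ≤ C generalizing C
  · refine this (C := 0) (fun x hx => (hC x hx).trans ?_) le_rfl
    exact mul_le_mul_of_nonneg_right (by linarith) (hB0 x hx)
  have hsm := fun R => contDiff_cutoffField hΩ hv hB (hc (R + 1))
  have hcs : ∀ R, HasCompactSupport (cutoffField Ω v B R) := fun R =>
    HasCompactSupport.intro (hc (R + 1)) fun x hx => cutoffField_eq_zero hx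
  have hK := fun R => (hsm R).lipschitzWith_of_hasCompactSupport (hcs R) one_ne_zero
  choose K hK using hK
  have hL : ∀ R, ∃ L : ℝ≥0, ∀ x, ‖cutoffField Ω v B R x‖ ≤ L := fun R => by
    obtain ⟨L, hL⟩ := (hcs R).exists_bound_of_continuous (hsm R).continuous
    exact ⟨L.toNNReal, fun x => (hL x).trans (Real.le_coe_toNNReal L)⟩
  choose L hL using hL
  have hφ := fun R x => exists_integralCurve_of_lipschitzWith (hK R) (hL R) x
  choose φ h0 hφ using hφ
  have hcont : ∀ R, Continuous fun p : ℝ × E => φ R p.2 p.1 := fun R =>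
    continuous_uncurry_of_integralCurve (φ := fun t x => φ R x t) (hK R) (h0 R) (hφ R)
  -- the curves stay in the domain
  have hstay : ∀ R, ∀ x ∈ Ω, ∀ t, φ R x t ∈ Ω := by
    intro R x hx t
    by_contra hn
    have hz : cutoffField Ω v B R (φ R x t) = 0 := cutoffField_eq_zero fun h => hn h.1
    have : φ R x = fun _ => φ R x t :=
      integralCurve_unique isOpen_univ (hsm R).contDiffOn (fun _ => mem_univ _) (hφ R x)
        (fun s => by rw [hz]; exact hasDerivAt_const _ _) (t₀ := t) rfl
    have h2 := congrFun this 0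
    rw [h0] at h2
    exact hn (h2 ▸ hx)
  have hgrow : ∀ R, ∀ x ∈ Ω, ∀ t, B (φ R x t) ≤ B x * Real.exp (C * |t|) := by
    intro R x hx t
    have hd : ∀ s, ∃ θ : ℝ, 0 ≤ θ ∧ θ ≤ 1 ∧ HasDerivAt (fun s => B (φ R x s))
        (θ * fderiv ℝ B (φ R x s) (v (φ R x s))) s := by
      intro s
      have hs := hstay R x hx s
      refine ⟨_, Real.smoothTransition.nonneg (R + 1 - B (φ R x s)),
        Real.smoothTransition.le_one _, ?_⟩
      have hBd := ((hB.contDiffAt (hΩ.mem_nhds hs)).differentiableAt one_ne_zero).hasFDerivAt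
      have := hBd.comp_hasDerivAt s (hφ R x s)
      rw [cutoffField, if_pos hs, map_smul] at this
      exact this
    choose θ hθ0 hθ1 hd using hd
    have hbd : ∀ s, |θ s * fderiv ℝ B (φ R x s) (v (φ R x s))| ≤ C * B (φ R x s) := by
      intro s
      rw [abs_mul, abs_of_nonneg (hθ0 s)]
      exact (mul_le_of_le_one_left (abs_nonneg _) (hθ1 s)).trans (hC _ (hstay R x hx s))
    rcases le_total 0 t with ht | ht
    · have hg : ∀ s, HasDerivAt (fun s => Real.exp (-C * s) * B (φ R x s))
          (Real.exp (-C * s) * (-C) * B (φ R x s) + Real.exp (-C * s) *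
            (θ s * fderiv ℝ B (φ R x s) (v (φ R x s)))) s := fun s => by
        have := ((hasDerivAt_id s).const_mul (-C)).exp.mul (hd s)
        simpa [Pi.mul_def] using this
      have ha : Antitone fun s => Real.exp (-C * s) * B (φ R x s) := by
        refine antitone_of_deriv_nonpos (fun s => (hg s).differentiableAt) fun s => ?_
        rw [(hg s).deriv]
        have := (abs_le.1 (hbd s)).2
        have he := (Real.exp_pos (-C * s)).le
        nlinarith
      have := ha ht
      simp only [mul_zero, Real.exp_zero, one_mul, h0] at this
      rw [abs_of_nonneg ht]
      have h2 := mul_le_mul_of_nonneg_right this (Real.exp_pos (C * t)).le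
      rw [mul_right_comm, ← Real.exp_add] at h2
      simpa using h2
    · have hg : ∀ s, HasDerivAt (fun s => Real.exp (C * s) * B (φ R x s))
          (Real.exp (C * s) * C * B (φ R x s) + Real.exp (C * s) *
            (θ s * fderiv ℝ B (φ R x s) (v (φ R x s)))) s := fun s => by
        have := ((hasDerivAt_id s).const_mul C).exp.mul (hd s)
        simpa [Pi.mul_def] using this
      have ha : Monotone fun s => Real.exp (C * s) * B (φ R x s) := by
        refine monotone_of_deriv_nonneg (fun s => (hg s).differentiableAt) fun s => ?_
        rw [(hg s).deriv]
        have := (abs_le.1 (hbd s)).1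
        have he := (Real.exp_pos (C * s)).le
        nlinarith
      have := ha ht
      simp only [mul_zero, Real.exp_zero, one_mul, h0] at this
      rw [abs_of_nonpos ht]
      have h2 := mul_le_mul_of_nonneg_right this (Real.exp_pos (C * -t)).le
      rw [mul_right_comm, ← Real.exp_add] at h2
      simpa using h2
  have agree : ∀ R R' : ℝ, ∀ x ∈ Ω, ∀ t, B x * Real.exp (C * |t|) < R → R ≤ R' →
      φ R x t = φ R' x t := by
    intro R R' x hx t ht hRR
    have hev : ∀ᶠ T in 𝓝 |t|, B x * Real.exp (C * T) < R :=
      (by fun_prop : Continuous fun T => B x * Real.exp (C * T)).continuousAt.eventually_lt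
        continuousAt_const ht
    obtain ⟨ε, hε, hT⟩ := Metric.eventually_nhds_iff.1 hev
    have hT' := @hT (|t| + ε / 2) (by simp [abs_of_pos, hε])
    have hle : ∀ s ∈ Ioo (-(|t| + ε / 2)) (|t| + ε / 2), B (φ R x s) ≤ R := by
      intro s hs
      refine (hgrow R x hx s).trans (le_trans ?_ hT'.le)
      have := hB0 x hx
      have := (abs_lt.2 hs).le
      gcongr
    refine ODE_solution_unique_of_mem_Ioo (v := fun _ => cutoffField Ω v B R') (s := fun _ => univ)
      (a := -(|t| + ε / 2)) (b := |t| + ε / 2) (t₀ := 0)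
      (fun _ _ => (hK R').lipschitzOnWith)
      (by constructor <;> linarith [abs_nonneg t])
      (fun s hs => ⟨?_, trivial⟩) (fun s hs => ⟨hφ R' x s, trivial⟩) (by rw [h0, h0])
      (abs_lt.1 (by linarith))
    have := hφ R x s
    have hm := hstay R x hx s
    rw [cutoffField_of_le hm (hle s hs)] at this
    rw [cutoffField_of_le hm ((hle s hs).trans hRR)]
    exact this
  let R₀ : ℝ → E → ℝ := fun t x => B x * Real.exp (C * |t|) + 1
  have hev : ∀ t₀, ∀ x₀ ∈ Ω, ∀ᶠ p : ℝ × E in 𝓝 (t₀, x₀), p.2 ∈ Ω →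
      φ (R₀ p.1 p.2) p.2 p.1 = φ (R₀ t₀ x₀ + 1) p.2 p.1 := by
    intro t₀ x₀ hx₀
    have hcB : ContinuousAt B x₀ := hB.continuousOn.continuousAt (hΩ.mem_nhds hx₀)
    have hcR : ContinuousAt (fun p : ℝ × E => R₀ p.1 p.2) (t₀, x₀) := by
      have : ContinuousAt (fun p : ℝ × E => B p.2) (t₀, x₀) :=
        ContinuousAt.comp (f := Prod.snd) (x := (t₀, x₀)) hcB continuousAt_snd
      refine ContinuousAt.add (this.mul ?_) continuousAt_const
      fun_prop
    filter_upwards [hcR.eventually_lt (continuousAt_const (y := R₀ t₀ x₀ + 1)) (by simp)]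
      with p hp hpΩ
    exact agree _ _ p.2 hpΩ p.1 (by simp [R₀]) hp.le
  refine ⟨fun t x => φ (R₀ t x) x t, fun x _ => h0 _ _, fun t x hx => hstay _ x hx t,
    fun x hx t => ?_, ?_⟩
  · have h1 : (fun s => φ (R₀ s x) x s) =ᶠ[𝓝 t] φ (R₀ t x + 1) x := by
      have := (continuous_id.prodMk (continuous_const (y := x))).continuousAt.eventually
        (hev t x hx)
      filter_upwards [this] with s hs using hs hx
    refine HasDerivAt.congr_of_eventuallyEq ?_ h1
    have h2 : φ (R₀ t x) x t = φ (R₀ t x + 1) x t := h1.eq_of_nhds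
    have := hφ (R₀ t x + 1) x t
    rw [cutoffField_of_le (hstay _ x hx t) ((hgrow _ x hx t).trans (by simp [R₀]; linarith))] at this
    change HasDerivAt _ (v (φ (R₀ t x) x t)) t
    rw [h2]
    exact this
  · rintro ⟨t, x⟩ ⟨-, hx⟩
    refine ContinuousAt.continuousWithinAt ?_
    refine (hcont (R₀ t x + 1)).continuousAt.congr ?_
    have hn : ∀ᶠ p : ℝ × E in 𝓝 (t, x), p.2 ∈ Ω :=
      continuous_snd.continuousAt.eventually (hΩ.mem_nhds hx)
    filter_upwards [hev t x hx, hn] with p hp hpn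
    exact (hp hpn).symm

end

section
open Set Filter Topology

/-- The linear hyperbolic flow on a product. -/
def hypFlow {E : Type*} [AddCommGroup E] [Module ℝ E] (t : ℝ) (p : E × E) : E × E :=
  (Real.exp t • p.1, Real.exp (-t) • p.2)

section hyp
variable {E : Type*} [NormedAddCommGroup E] [NormedSpace ℝ E]

lemma hypFlow_add (s t : ℝ) (p : E × E) : hypFlow (s + t) p = hypFlow s (hypFlow t p) := by
  simp [hypFlow, smul_smul, ← Real.exp_add, add_comm]

@[simp] lemma hypFlow_zero (p : E × E) : hypFlow 0 p = p := by simp [hypFlow]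

lemma hypFlow_neg_cancel (t : ℝ) (p : E × E) : hypFlow (-t) (hypFlow t p) = p := by
  rw [← hypFlow_add]; simp

lemma hypFlow_cancel (t : ℝ) (p : E × E) : hypFlow t (hypFlow (-t) p) = p := by
  rw [← hypFlow_add]; simp

lemma continuous_hypFlow (t : ℝ) : Continuous (hypFlow t : E × E → E × E) := by
  unfold hypFlow; fun_prop

/-- The unit box. -/
def unitBox (E : Type*) [NormedAddCommGroup E] : Set (E × E) := {p | ‖p.1‖ < 1 ∧ ‖p.2‖ < 1}

/-- The union of all translates of the unit box under the hyperbolic flow. -/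
def hypDomain (E : Type*) [NormedAddCommGroup E] : Set (E × E) := {p | ‖p.1‖ * ‖p.2‖ < 1}

omit [NormedSpace ℝ E] in
lemma isOpen_unitBox : IsOpen (unitBox E) :=
  (isOpen_lt (f := fun p : E × E => ‖p.1‖) (g := fun _ => 1) (by fun_prop) (by fun_prop)).inter
    (isOpen_lt (f := fun p : E × E => ‖p.2‖) (g := fun _ => 1) (by fun_prop) (by fun_prop))

omit [NormedSpace ℝ E] in
lemma isOpen_hypDomain : IsOpen (hypDomain E) := isOpen_lt (by fun_prop) (by fun_prop)

lemma hypFlow_mem_hypDomain {t : ℝ} {p : E × E} (hp : p ∈ hypDomain E) :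
    hypFlow t p ∈ hypDomain E := by
  simp only [hypDomain, hypFlow, mem_ofPred_eq, norm_smul, Real.norm_eq_abs, Real.abs_exp] at *
  calc _ = (Real.exp t * Real.exp (-t)) * (‖p.1‖ * ‖p.2‖) := by ring
    _ < 1 := by rw [← Real.exp_add]; simpa using hp

omit [NormedSpace ℝ E] in
lemma unitBox_subset_hypDomain : unitBox E ⊆ hypDomain E := fun p hp => by
  simp only [hypDomain, unitBox, mem_ofPred_eq] at *
  nlinarith [norm_nonneg p.1, norm_nonneg p.2]

lemma exists_hypFlow_mem_unitBox {p : E × E} (hp : p ∈ hypDomain E) :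
    ∃ t, hypFlow (-t) p ∈ unitBox E := by
  simp only [hypDomain, mem_ofPred_eq] at hp
  set w := ‖p.1‖ + (1 - ‖p.1‖ * ‖p.2‖) / (1 + ‖p.2‖) with hw
  have h1 := norm_nonneg p.1
  have h2 := norm_nonneg p.2
  have h3 : 0 < (1 - ‖p.1‖ * ‖p.2‖) / (1 + ‖p.2‖) := div_pos (by linarith) (by linarith)
  have hw0 : 0 < w := by linarith
  have h4 : w * ‖p.2‖ < 1 := by
    have : w * (1 + ‖p.2‖) = ‖p.1‖ * (1 + ‖p.2‖) + (1 - ‖p.1‖ * ‖p.2‖) := by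
      rw [hw]; field_simp
    nlinarith
  refine ⟨Real.log w, ?_⟩
  simp only [unitBox, hypFlow, mem_ofPred_eq, norm_smul, Real.norm_eq_abs, neg_neg,
    Real.exp_neg, Real.exp_log hw0, abs_inv, abs_of_pos hw0]
  refine ⟨?_, h4⟩
  rw [inv_mul_lt_iff₀ hw0]
  linarith

end hyp

/-- A flow with finitely many hyperbolic rest points in linearised boxes, all other orbits being
attracted by a set of rest points. -/
structure BoxFlow (X : Type*) [TopologicalSpace X] (E : Type*) [NormedAddCommGroup E]
    [NormedSpace ℝ E] (ι : Type*) where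
  /-- the flow -/
  flow : ℝ → X → X
  continuous_flow : Continuous (Function.uncurry flow)
  flow_zero : ∀ x, flow 0 x = x
  flow_add : ∀ s t x, flow (s + t) x = flow s (flow t x)
  /-- the boxes -/
  box : ι → OpenPartialHomeomorph (E × E) X
  box_source : ∀ i, (box i).source = unitBox E
  flow_box : ∀ i t, ∀ p ∈ unitBox E, hypFlow t p ∈ unitBox E →
    flow t (box i p) = box i (hypFlow t p)
  box_sep : ∀ i j s, ∀ p ∈ unitBox E, 0 ≤ s → flow s (box i p) ∈ (box j).target →
    i = j ∧ Real.exp s * ‖p.1‖ < 1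
  /-- the attracting set -/
  attr : Set X
  /-- a neighbourhood of the attracting set -/
  nbhd : Set X
  isClosed_attr : IsClosed attr
  isOpen_nbhd : IsOpen nbhd
  attr_subset : attr ⊆ nbhd
  flow_attr : ∀ t, ∀ x ∈ attr, flow t x = x
  flow_nbhd : ∀ t, 0 ≤ t → ∀ x ∈ nbhd, flow t x ∈ nbhd
  box_nbhd : ∀ i, Disjoint (box i).target nbhd
  enter : ∀ x, (∃ t, 0 ≤ t ∧ ∃ i, flow t x ∈ (box i).target) ∨ ∃ t, 0 ≤ t ∧ flow t x ∈ nbhd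
  /-- the limit map -/
  lim : X → X
  lim_mem : ∀ x ∈ nbhd, lim x ∈ attr
  tendsto_lim : ∀ x ∈ nbhd,
    Tendsto (fun p : ℝ × X => flow p.1 p.2) (atTop ×ˢ 𝓝 x) (𝓝 (lim x))

namespace BoxFlow
variable {X : Type*} [TopologicalSpace X] {E : Type*} [NormedAddCommGroup E] [NormedSpace ℝ E]
  {ι : Type*} (F : BoxFlow X E ι)

lemma flow_neg_cancel (t : ℝ) (x : X) : F.flow (-t) (F.flow t x) = x := by
  rw [← F.flow_add, neg_add_cancel, F.flow_zero]

lemma flow_cancel (t : ℝ) (x : X) : F.flow t (F.flow (-t) x) = x := by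
  rw [← F.flow_add, add_neg_cancel, F.flow_zero]

lemma continuous_flow_const (t : ℝ) : Continuous (F.flow t) :=
  F.continuous_flow.comp (Continuous.prodMk_right t)

/-- The time `t` homeomorphism. -/
def flowHomeo (t : ℝ) : X ≃ₜ X where
  toFun := F.flow t
  invFun := F.flow (-t)
  left_inv := F.flow_neg_cancel t
  right_inv := F.flow_cancel t
  continuous_toFun := F.continuous_flow_const t
  continuous_invFun := F.continuous_flow_const (-t)

open Classical in
/-- The extension of a box to the saturation of the unit box. -/
def ext (i : ι) (p : E × E) : X :=
  if h : p ∈ hypDomain E then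
    F.flow (exists_hypFlow_mem_unitBox h).choose
      (F.box i (hypFlow (-(exists_hypFlow_mem_unitBox h).choose) p))
  else F.box i p

lemma flow_box_eq_of_le {i : ι} {p : E × E} {s t : ℝ}
    (hs : hypFlow (-s) p ∈ unitBox E) (ht : hypFlow (-t) p ∈ unitBox E) :
    F.flow s (F.box i (hypFlow (-s) p)) = F.flow t (F.box i (hypFlow (-t) p)) := by
  have h : hypFlow (t - s) (hypFlow (-t) p) = hypFlow (-s) p := by
    rw [← hypFlow_add]; congr 1; ring
  rw [← h, ← F.flow_box i (t - s) _ ht (by rwa [h]), ← F.flow_add]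
  congr 1; ring

lemma ext_eq {i : ι} {p : E × E} {t : ℝ} (ht : hypFlow (-t) p ∈ unitBox E) :
    F.ext i p = F.flow t (F.box i (hypFlow (-t) p)) := by
  have hp : p ∈ hypDomain E := by
    have := hypFlow_mem_hypDomain (t := t) (unitBox_subset_hypDomain ht)
    rwa [hypFlow_cancel] at this
  rw [ext, dif_pos hp]
  exact F.flow_box_eq_of_le (exists_hypFlow_mem_unitBox hp).choose_spec ht

lemma ext_box {i : ι} {p : E × E} (hp : p ∈ unitBox E) : F.ext i p = F.box i p := by
  rw [F.ext_eq (t := 0) (by simpa using hp)]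
  simp [F.flow_zero]

lemma flow_ext {i : ι} {p : E × E} (hp : p ∈ hypDomain E) (s : ℝ) :
    F.flow s (F.ext i p) = F.ext i (hypFlow s p) := by
  obtain ⟨t, ht⟩ := exists_hypFlow_mem_unitBox hp
  have h : hypFlow (-(s + t)) (hypFlow s p) = hypFlow (-t) p := by
    rw [← hypFlow_add]; congr 1; ring
  rw [F.ext_eq ht, F.ext_eq (t := s + t) (by rwa [h]), h, F.flow_add]

lemma box_mem_target {i : ι} {p : E × E} (hp : p ∈ unitBox E) : F.box i p ∈ (F.box i).target :=
  (F.box i).map_source (by rwa [F.box_source])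

lemma ext_inj {i j : ι} {p q : E × E} (hp : p ∈ hypDomain E) (hq : q ∈ hypDomain E)
    (h : F.ext i p = F.ext j q) : i = j ∧ p = q := by
  obtain ⟨s, hs⟩ := exists_hypFlow_mem_unitBox hp
  obtain ⟨t, ht⟩ := exists_hypFlow_mem_unitBox hq
  wlog hst : s ≤ t generalizing i j p q s t
  · obtain ⟨h1, h2⟩ := this hq hp h.symm t ht s hs (by linarith)
    exact ⟨h1.symm, h2.symm⟩
  rw [F.ext_eq hs, F.ext_eq ht] at h
  have h1 : F.box i (hypFlow (-s) p) = F.flow (t - s) (F.box j (hypFlow (-t) q)) := by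
    rw [sub_eq_neg_add, F.flow_add, ← h, F.flow_neg_cancel]
  obtain ⟨hji, hlt⟩ := F.box_sep j i (t - s) _ ht (by linarith) (h1 ▸ F.box_mem_target hs)
  subst hji
  refine ⟨rfl, ?_⟩
  have hm : hypFlow (t - s) (hypFlow (-t) q) ∈ unitBox E := by
    refine ⟨?_, ?_⟩
    · rw [hypFlow, norm_smul, Real.norm_eq_abs, Real.abs_exp]; exact hlt
    · have := ht.2
      rw [hypFlow, norm_smul, Real.norm_eq_abs, Real.abs_exp]
      refine lt_of_le_of_lt (mul_le_of_le_one_left (norm_nonneg _) ?_) this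
      rw [Real.exp_le_one_iff]; linarith
  rw [F.flow_box j _ _ ht hm] at h1
  have h2 := (F.box j).injOn (by rwa [F.box_source]) (by rwa [F.box_source]) h1
  rw [← hypFlow_add, show t - s + -t = -s by ring] at h2
  have := congrArg (hypFlow s) h2
  rwa [hypFlow_cancel, hypFlow_cancel] at this

lemma ext_eventuallyEq {i : ι} {p : E × E} {t : ℝ} (ht : hypFlow (-t) p ∈ unitBox E) :
    F.ext i =ᶠ[𝓝 p] fun q => F.flow t (F.box i (hypFlow (-t) q)) := by
  filter_upwards [(continuous_hypFlow (-t)).continuousAt.preimage_mem_nhds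
    (isOpen_unitBox.mem_nhds ht)] with q hq
  exact F.ext_eq hq

lemma continuousOn_ext (i : ι) : ContinuousOn (F.ext i) (hypDomain E) := by
  intro p hp
  obtain ⟨t, ht⟩ := exists_hypFlow_mem_unitBox hp
  refine ContinuousAt.continuousWithinAt (ContinuousAt.congr ?_ (F.ext_eventuallyEq ht).symm)
  exact (F.continuous_flow_const t).continuousAt.comp
    (((F.box i).continuousAt (by rwa [F.box_source])).comp (continuous_hypFlow (-t)).continuousAt)

lemma map_nhds_ext (i : ι) {p : E × E} (hp : p ∈ hypDomain E) :
    map (F.ext i) (𝓝 p) = 𝓝 (F.ext i p) := by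
  obtain ⟨t, ht⟩ := exists_hypFlow_mem_unitBox hp
  rw [map_congr (F.ext_eventuallyEq ht), F.ext_eq ht]
  let e : E × E ≃ₜ E × E := ⟨⟨hypFlow (-t), hypFlow t, hypFlow_cancel t, hypFlow_neg_cancel t⟩,
    continuous_hypFlow _, continuous_hypFlow _⟩
  have h1 : map (hypFlow (-t)) (𝓝 p) = 𝓝 (hypFlow (-t) p) := e.map_nhds_eq p
  have h2 := (F.box i).map_nhds_eq (x := hypFlow (-t) p) (by rwa [F.box_source])
  have h3 : map (F.flow t) (𝓝 (F.box i (hypFlow (-t) p))) = _ := (F.flowHomeo t).map_nhds_eq _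
  change _ = 𝓝 (F.flowHomeo t _)
  rw [← h3, ← h2, ← h1, map_map, map_map]
  rfl

/-- The extended box as an open partial homeomorphism. -/
def extChart [Nonempty E] (i : ι) : OpenPartialHomeomorph (E × E) X :=
  OpenPartialHomeomorph.ofContinuousOpenRestrict
    ((show InjOn (F.ext i) (hypDomain E) from
      fun _ hp _ hq h => (F.ext_inj hp hq h).2).toPartialEquiv _ _) (F.continuousOn_ext i)
    (by
      refine IsOpenMap.of_nhds_le fun p => ?_
      change 𝓝 (F.ext i p.1) ≤ map (F.ext i ∘ Subtype.val) (𝓝 p)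
      rw [← map_map, map_nhds_subtype_coe_eq_nhds p.2 (isOpen_hypDomain.mem_nhds p.2)]
      exact (F.map_nhds_ext i p.2).ge) isOpen_hypDomain

end BoxFlow
end

section
open Set Filter Topology

/-- A homotopy from the identity preserving a subset and ending in it is a homotopy equivalence. -/
lemma homotopyEquiv_of_deformation {X : Type*} [TopologicalSpace X] {S : Set X} {H : ℝ → X → X}
    (hH : ContinuousOn (Function.uncurry H) (Icc 0 1 ×ˢ univ)) (h0 : ∀ x, H 0 x = x)
    (h1 : ∀ x, H 1 x ∈ S) (hS : ∀ s ∈ Icc (0 : ℝ) 1, ∀ x ∈ S, H s x ∈ S) :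
    Nonempty (ContinuousMap.HomotopyEquiv X S) := by
  have hc : Continuous fun p : I × X => H p.1 p.2 :=
    hH.comp_continuous (f := fun p : I × X => ((p.1 : ℝ), p.2)) (by fun_prop)
      fun p => ⟨p.1.2, mem_univ _⟩
  let r : C(X, S) := ⟨fun x => ⟨H 1 x, h1 x⟩, by
    have := hc.comp (Continuous.prodMk_right (1 : I))
    exact Continuous.subtype_mk (by simpa [Function.comp_def] using this) _⟩
  let i : C(S, X) := ⟨Subtype.val, continuous_subtype_val⟩
  refine ⟨⟨r, i, ⟨ContinuousMap.Homotopy.symm ⟨⟨fun p => H p.1 p.2, hc⟩, ?_, ?_⟩⟩,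
    ⟨ContinuousMap.Homotopy.symm
      ⟨⟨fun p => ⟨H p.1 p.2, hS _ p.1.2 _ p.2.2⟩, ?_⟩, ?_, ?_⟩⟩⟩⟩
  · intro x; simp [h0]
  · intro x; simp [r, i]
  · exact Continuous.subtype_mk
      (hc.comp (continuous_fst.prodMk (continuous_subtype_val.comp continuous_snd))) _
  · intro x; ext; simp [h0]
  · intro x; ext; simp [r, i]

namespace BoxFlow
variable {X : Type} [TopologicalSpace X] {E : Type*} [NormedAddCommGroup E] [NormedSpace ℝ E]
  {ι : Type*} (F : BoxFlow X E ι)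

/-- The basin of the attracting set. -/
def basin : Set X := {x | ∃ t, 0 ≤ t ∧ F.flow t x ∈ F.nbhd}

lemma isOpen_basin : IsOpen F.basin := by
  have : F.basin = ⋃ t : ℝ, ⋃ (_ : 0 ≤ t), F.flow t ⁻¹' F.nbhd := by
    ext x; simp [basin]
  rw [this]
  exact isOpen_iUnion fun t => isOpen_iUnion fun _ =>
    F.isOpen_nbhd.preimage (F.continuous_flow_const t)

lemma flow_mem_nbhd_of_le {x : X} {s t : ℝ} (h : F.flow s x ∈ F.nbhd) (hst : s ≤ t) :
    F.flow t x ∈ F.nbhd := by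
  have := F.flow_nbhd (t - s) (by linarith) _ h
  rwa [← F.flow_add, sub_add_cancel] at this

lemma flow_mem_basin {x : X} (t : ℝ) : F.flow t x ∈ F.basin ↔ x ∈ F.basin := by
  constructor
  · rintro ⟨s, hs, h⟩
    rw [← F.flow_add] at h
    exact ⟨max 0 (s + t), le_max_left _ _, F.flow_mem_nbhd_of_le h (le_max_right _ _)⟩
  · rintro ⟨s, hs, h⟩
    refine ⟨max 0 (s - t), le_max_left _ _, ?_⟩
    rw [← F.flow_add]
    exact F.flow_mem_nbhd_of_le h (by linarith [le_max_right 0 (s - t)])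

lemma nbhd_subset_basin : F.nbhd ⊆ F.basin := fun x hx => ⟨0, le_rfl, by rwa [F.flow_zero]⟩

lemma attr_subset_basin : F.attr ⊆ F.basin := F.attr_subset.trans F.nbhd_subset_basin

lemma ext_not_mem_nbhd {i : ι} {p : E × E} (hp : p ∈ hypDomain E) (h1 : ‖p.1‖ < 1) :
    F.ext i p ∉ F.nbhd := by
  intro h
  obtain ⟨t, ht⟩ := exists_hypFlow_mem_unitBox hp
  have key : ∀ s, 0 ≤ s → hypFlow s p ∈ unitBox E → False := fun s hs hb => by
    have h2 := F.flow_nbhd s hs _ h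
    rw [F.flow_ext hp, F.ext_box hb] at h2
    exact Set.disjoint_left.1 (F.box_nbhd i) (F.box_mem_target hb) h2
  rcases le_total t 0 with h0 | h0
  · exact key (-t) (by linarith) ht
  · refine key 0 le_rfl ?_
    rw [hypFlow_zero]
    refine ⟨h1, lt_of_le_of_lt ?_ ht.2⟩
    simp only [hypFlow, norm_smul, Real.norm_eq_abs, Real.abs_exp, neg_neg]
    exact le_mul_of_one_le_left (norm_nonneg _) (Real.one_le_exp h0)

lemma one_le_of_flow_ext_mem_nbhd {i : ι} {p : E × E} (hp : p ∈ hypDomain E) {t : ℝ}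
    (h : F.flow t (F.ext i p) ∈ F.nbhd) : 1 ≤ Real.exp t * ‖p.1‖ := by
  by_contra! hc
  rw [F.flow_ext hp] at h
  refine F.ext_not_mem_nbhd (hypFlow_mem_hypDomain hp) ?_ h
  simpa [hypFlow, norm_smul] using hc

lemma ext_mem_basin {i : ι} {p : E × E} (hp : p ∈ hypDomain E) :
    F.ext i p ∈ F.basin ↔ p.1 ≠ 0 := by
  constructor
  · rintro ⟨t, -, h⟩ h0
    have := F.one_le_of_flow_ext_mem_nbhd hp h
    simp [h0] at this
    linarith
  · intro h0
    obtain ⟨s, hs⟩ := exists_hypFlow_mem_unitBox hp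
    have hn : 0 < ‖p.1‖ := norm_pos_iff.2 h0
    set t := max (-s) (-Real.log ‖p.1‖) with ht
    rcases F.enter (F.flow t (F.ext i p)) with ⟨r, hr, j, hj⟩ | ⟨r, hr, h⟩
    · exfalso
      rw [← F.flow_add, F.ext_eq hs, ← F.flow_add] at hj
      have h1 : 0 ≤ r + t + s := by linarith [le_max_left (-s) (-Real.log ‖p.1‖)]
      obtain ⟨-, h2⟩ := F.box_sep _ _ _ _ hs h1 hj
      simp only [hypFlow, norm_smul, Real.norm_eq_abs, Real.abs_exp] at h2
      rw [← mul_assoc, ← Real.exp_add] at h2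
      have h3 : Real.exp (-Real.log ‖p.1‖) ≤ Real.exp (r + t + s + -s) := by
        rw [Real.exp_le_exp]
        linarith [le_max_right (-s) (-Real.log ‖p.1‖)]
      rw [Real.exp_neg, Real.exp_log hn] at h3
      have : ‖p.1‖⁻¹ * ‖p.1‖ < 1 := lt_of_le_of_lt (by gcongr) h2
      rw [inv_mul_cancel₀ hn.ne'] at this
      exact lt_irrefl _ this
    · exact (F.flow_mem_basin _).1 ((F.flow_mem_basin r).1 (F.nbhd_subset_basin h))

lemma exists_ext_of_not_mem_basin {x : X} (hx : x ∉ F.basin) :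
    ∃ i, ∃ p ∈ hypDomain E, F.ext i p = x ∧ p.1 = 0 := by
  rcases F.enter x with ⟨t, ht, i, hi⟩ | h
  · have h1 := (F.box i).map_target hi
    rw [F.box_source] at h1
    refine ⟨i, hypFlow (-t) ((F.box i).symm (F.flow t x)),
      hypFlow_mem_hypDomain (unitBox_subset_hypDomain h1), ?_⟩
    have h2 : F.ext i (hypFlow (-t) ((F.box i).symm (F.flow t x))) = x := by
      rw [← F.flow_ext (unitBox_subset_hypDomain h1), F.ext_box h1, (F.box i).right_inv hi,
        F.flow_neg_cancel]
    refine ⟨h2, ?_⟩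
    by_contra h3
    rw [← h2] at hx
    exact hx ((F.ext_mem_basin (hypFlow_mem_hypDomain (unitBox_subset_hypDomain h1))).2 h3)
  · exact absurd h hx

lemma exists_limit {x : X} (hx : x ∈ F.basin) : ∃ y ∈ F.attr,
    Tendsto (fun p : ℝ × X => F.flow p.1 p.2) (atTop ×ˢ 𝓝 x) (𝓝 y) := by
  obtain ⟨t, ht, h⟩ := hx
  refine ⟨F.lim (F.flow t x), F.lim_mem _ h, ?_⟩
  have h1 : Tendsto (fun p : ℝ × X => (p.1 - t, F.flow t p.2)) (atTop ×ˢ 𝓝 x)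
      (atTop ×ˢ 𝓝 (F.flow t x)) :=
    (tendsto_atTop_add_const_right _ (-t) tendsto_id).prodMap
      ((F.continuous_flow_const t).tendsto x)
  refine ((F.tendsto_lim _ h).comp h1).congr fun p => ?_
  simp only [Function.comp]
  rw [← F.flow_add, sub_add_cancel]

open Classical in
/-- The limit map on the basin. -/
def limit (x : X) : X := if h : x ∈ F.basin then (F.exists_limit h).choose else x

lemma limit_mem {x : X} (hx : x ∈ F.basin) : F.limit x ∈ F.attr := by
  rw [limit, dif_pos hx]; exact (F.exists_limit hx).choose_spec.1

lemma tendsto_limit {x : X} (hx : x ∈ F.basin) :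
    Tendsto (fun p : ℝ × X => F.flow p.1 p.2) (atTop ×ˢ 𝓝 x) (𝓝 (F.limit x)) := by
  rw [limit, dif_pos hx]; exact (F.exists_limit hx).choose_spec.2

lemma tendsto_flow_limit {x : X} (hx : x ∈ F.basin) :
    Tendsto (fun t => F.flow t x) atTop (𝓝 (F.limit x)) :=
  (F.tendsto_limit hx).comp (tendsto_id.prodMk tendsto_const_nhds)

lemma limit_of_attr [T2Space X] {x : X} (hx : x ∈ F.attr) : F.limit x = x :=
  tendsto_nhds_unique (F.tendsto_flow_limit (F.attr_subset_basin hx))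
    (by simp [F.flow_attr _ x hx])

/-- The flow with reparametrised time, reaching the limit at time one. -/
def flowTo (s : ℝ) (x : X) : X := if s < 1 then F.flow (s / (1 - s)) x else F.limit x

@[simp] lemma flowTo_zero (x : X) : F.flowTo 0 x = x := by simp [flowTo, F.flow_zero]

@[simp] lemma flowTo_one (x : X) : F.flowTo 1 x = F.limit x := by simp [flowTo]

lemma flowTo_attr [T2Space X] (s : ℝ) {x : X} (hx : x ∈ F.attr) : F.flowTo s x = x := by
  unfold flowTo
  split_ifs
  · exact F.flow_attr _ _ hx
  · exact F.limit_of_attr hx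

lemma flowTo_mem_basin {s : ℝ} {x : X} (hx : x ∈ F.basin) : F.flowTo s x ∈ F.basin := by
  unfold flowTo
  split_ifs
  · exact (F.flow_mem_basin _).2 hx
  · exact F.attr_subset_basin (F.limit_mem hx)

lemma continuousOn_flowTo [T3Space X] :
    ContinuousOn (Function.uncurry F.flowTo) {p : ℝ × X | p.1 < 1 ∨ p.1 = 1 ∧ p.2 ∈ F.basin} := by
  rintro ⟨s, x⟩ hp
  rcases hp with hp | ⟨hp, hx⟩
  · simp only at hp
    refine ContinuousAt.continuousWithinAt (ContinuousAt.congr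
      (f := fun p : ℝ × X => F.flow (p.1 / (1 - p.1)) p.2) ?_ ?_)
    · refine F.continuous_flow.continuousAt.comp (f := fun p : ℝ × X => (p.1 / (1 - p.1), p.2)) ?_
      have : 1 - s ≠ 0 := by linarith
      fun_prop (disch := assumption)
    · have : {p : ℝ × X | p.1 < 1} ∈ 𝓝 (s, x) :=
        (isOpen_lt continuous_fst continuous_const).mem_nhds hp
      filter_upwards [this] with p hp
      simp only [Function.uncurry, flowTo]
      rw [if_pos hp]
  · simp only at hp hx
    subst hp
    rw [ContinuousWithinAt, show Function.uncurry F.flowTo (1, x) = F.limit x by simp]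
    refine (closed_nhds_basis (F.limit x)).tendsto_right_iff.2 fun W hW => ?_
    have h1 := F.tendsto_limit hx hW.1
    obtain ⟨S, hS, V, hV, hSV⟩ := mem_prod_iff.1 h1
    obtain ⟨T, hT⟩ := mem_atTop_sets.1 hS
    obtain ⟨V', hV'V, hV'o, hxV'⟩ := mem_nhds_iff.1 hV
    have h2 : ∀ᶠ s : ℝ in 𝓝 1, s < 1 → T ≤ s / (1 - s) := by
      have : ∀ᶠ s : ℝ in 𝓝 1, (T : ℝ) * (1 - s) < s := by
        refine (ContinuousAt.eventually_lt (by fun_prop) (by fun_prop) (by simp))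
      filter_upwards [this] with s hs hs1
      rw [le_div_iff₀ (by linarith)]; exact hs.le
    have h3 : ∀ᶠ p : ℝ × X in 𝓝 (1, x), p.1 < 1 → T ≤ p.1 / (1 - p.1) :=
      (continuousAt_fst (p := ((1 : ℝ), x))).eventually h2
    have h4 : ∀ᶠ p : ℝ × X in 𝓝 (1, x), p.2 ∈ V' :=
      (continuousAt_snd (p := ((1 : ℝ), x))).eventually (hV'o.mem_nhds hxV')
    filter_upwards [self_mem_nhdsWithin, nhdsWithin_le_nhds h3, nhdsWithin_le_nhds h4]
      with p hp hp3 hp4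
    simp only [Function.uncurry, flowTo]
    split_ifs with hlt
    · exact hSV (show (_, _) ∈ S ×ˢ V from ⟨hT _ (hp3 hlt), hV'V hp4⟩)
    · have hb : p.2 ∈ F.basin := by
        rcases hp with hp | hp
        · exact absurd hp hlt
        · exact hp.2
      refine hW.2.mem_of_tendsto (F.tendsto_flow_limit hb) ?_
      filter_upwards [eventually_ge_atTop T] with t ht
      exact hSV (show (_, _) ∈ S ×ˢ V from ⟨hT _ ht, hV'V hp4⟩)

lemma basin_homotopyEquiv [T3Space X] : Nonempty (ContinuousMap.HomotopyEquiv F.basin F.attr) := by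
  obtain ⟨e⟩ := homotopyEquiv_of_deformation (X := F.basin) (S := Subtype.val ⁻¹' F.attr)
    (H := fun s x => ⟨F.flowTo s x, F.flowTo_mem_basin x.2⟩) (by
      rw [continuousOn_iff_continuous_domRestrict]
      refine Continuous.subtype_mk ?_ _
      refine F.continuousOn_flowTo.comp_continuous
        (f := fun p : ↥(Icc (0 : ℝ) 1 ×ˢ (univ : Set F.basin)) => (p.1.1, (p.1.2 : X)))
        (by fun_prop) fun p => ?_
      rcases lt_or_eq_of_le p.2.1.2 with h | h
      · exact Or.inl h
      · exact Or.inr ⟨h, p.1.2.2⟩)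
    (fun x => by simp) (fun x => by simpa using F.limit_mem x.2)
    (fun s _ x hx => by simpa [F.flowTo_attr s hx] using hx)
  exact ⟨e.trans (preimageValHomeo F.attr_subset_basin).toHomotopyEquiv⟩

end BoxFlow
end

section
open Set Filter Topology

/-- The gauge of the union of the translates of the unit box under the forward flow. -/
def hypGauge {E : Type*} [NormedAddCommGroup E] (p : E × E) : ℝ := ‖p.1‖ * max 1 ‖p.2‖

section
variable {E : Type*} [NormedAddCommGroup E]

@[fun_prop]
lemma continuous_hypGauge : Continuous (hypGauge : E × E → ℝ) := by
  unfold hypGauge; fun_prop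

lemma norm_fst_le_hypGauge (p : E × E) : ‖p.1‖ ≤ hypGauge p :=
  le_mul_of_one_le_right (norm_nonneg _) (le_max_left _ _)

lemma hypGauge_nonneg (p : E × E) : 0 ≤ hypGauge p :=
  (norm_nonneg _).trans (norm_fst_le_hypGauge p)

lemma mem_hypDomain_of_hypGauge {p : E × E} (h : hypGauge p < 1) : p ∈ hypDomain E :=
  lt_of_le_of_lt (mul_le_mul_of_nonneg_left (le_max_right _ _) (norm_nonneg _)) h

lemma hypGauge_eq_zero {p : E × E} (h : p.1 = 0) : hypGauge p = 0 := by simp [hypGauge, h]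

lemma mk_zero_mem_hypDomain (y : E) : (y, (0 : E)) ∈ hypDomain E := by simp [hypDomain]

end

namespace BoxFlow
variable {X : Type} [TopologicalSpace X] {E : Type*} [NormedAddCommGroup E] [NormedSpace ℝ E]
  {ι : Type*} (F : BoxFlow X E ι)

lemma isClosed_ext_image [T2Space X] [ProperSpace E] (i : ι) {r : ℝ} (hr : r < 1) (hr0 : 0 ≤ r) :
    IsClosed (F.ext i '' {p | hypGauge p ≤ r}) := by
  refine isClosed_of_closure_subset fun y hy => ?_
  by_cases hb : y ∈ F.basin
  · obtain ⟨t, ht, hty⟩ := hb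
    set Q : Set (E × E) := {p | hypGauge p ≤ r ∧ 1 ≤ Real.exp t * ‖p.1‖} with hQ
    have hQc : IsCompact Q := by
      refine (isCompact_closedBall (0 : E × E) (max r (r * Real.exp t))).of_isClosed_subset ?_ ?_
      · exact (isClosed_le (f := fun p : E × E => hypGauge p) (g := fun _ => r)
          (by fun_prop) (by fun_prop)).inter (isClosed_le (f := fun _ : E × E => (1 : ℝ)) (g := fun p => Real.exp t * ‖p.1‖)
            (by fun_prop) (by fun_prop))
      · rintro p ⟨h1, h2⟩
        rw [mem_closedBall_zero_iff, Prod.norm_def]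
        refine max_le_max ((norm_fst_le_hypGauge p).trans h1) ?_
        have h3 : ‖p.1‖ * ‖p.2‖ ≤ r :=
          (mul_le_mul_of_nonneg_left (le_max_right _ _) (norm_nonneg _)).trans h1
        calc ‖p.2‖ ≤ (Real.exp t * ‖p.1‖) * ‖p.2‖ := le_mul_of_one_le_left (norm_nonneg _) h2
          _ = (‖p.1‖ * ‖p.2‖) * Real.exp t := by ring
          _ ≤ _ := by gcongr
    have hsub : Q ⊆ hypDomain E := fun p hp => mem_hypDomain_of_hypGauge (lt_of_le_of_lt hp.1 hr)
    have hcl : IsClosed (F.ext i '' Q) :=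
      (hQc.image_of_continuousOn ((F.continuousOn_ext i).mono hsub)).isClosed
    have hU : IsOpen (F.flow t ⁻¹' F.nbhd) := F.isOpen_nbhd.preimage (F.continuous_flow_const t)
    have h1 : y ∈ closure (F.flow t ⁻¹' F.nbhd ∩ F.ext i '' {p | hypGauge p ≤ r}) :=
      hU.inter_closure ⟨hty, hy⟩
    have h2 : F.flow t ⁻¹' F.nbhd ∩ F.ext i '' {p | hypGauge p ≤ r} ⊆ F.ext i '' Q := by
      rintro _ ⟨h, p, hp, rfl⟩
      exact ⟨p, ⟨hp, F.one_le_of_flow_ext_mem_nbhd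
        (mem_hypDomain_of_hypGauge (lt_of_le_of_lt hp hr)) h⟩, rfl⟩
    exact image_mono (fun p hp => hp.1) (hcl.closure_subset_iff.2 h2 h1)
  · obtain ⟨j, p, hp, rfl, hp0⟩ := F.exists_ext_of_not_mem_basin hb
    by_cases hij : j = i
    · subst hij
      exact ⟨p, by simpa [hypGauge_eq_zero hp0] using hr0, rfl⟩
    · exfalso
      obtain ⟨z, ⟨q, hq, rfl⟩, q', hq', h⟩ := mem_closure_iff.1 hy _ (F.extChart j).open_target
        ⟨p, hp, rfl⟩
      exact hij (F.ext_inj hq (mem_hypDomain_of_hypGauge (lt_of_le_of_lt hq' hr)) h.symm).1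

/-- The cutoff for the stable directions. -/
def stableCut (r : ℝ) : ℝ := max 0 (min 1 (3 - 4 * r))

lemma stableCut_mem (r : ℝ) : stableCut r ∈ Icc (0 : ℝ) 1 :=
  ⟨le_max_left _ _, max_le zero_le_one (min_le_left _ _)⟩

/-- The deformation in the coordinates of an extended box. -/
def boxDeform (s : ℝ) (i : ι) (p : E × E) : X :=
  F.flowTo (min s (2 * hypGauge p)) (F.ext i (p.1, (1 - s * stableCut (hypGauge p)) • p.2))

open Classical in
/-- The deformation to the union of the attracting set and the unstable manifolds. -/
def deform (s : ℝ) (x : X) : X :=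
  if h : ∃ q : ι × (E × E), hypGauge q.2 < 1 ∧ F.ext q.1 q.2 = x then
    F.boxDeform s h.choose.1 h.choose.2 else F.flowTo s x

lemma deform_ext (s : ℝ) {i : ι} {p : E × E} (hp : hypGauge p < 1) :
    F.deform s (F.ext i p) = F.boxDeform s i p := by
  have h : ∃ q : ι × (E × E), hypGauge q.2 < 1 ∧ F.ext q.1 q.2 = F.ext i p := ⟨(i, p), hp, rfl⟩
  rw [deform, dif_pos h]
  obtain ⟨h1, h2⟩ := F.ext_inj (mem_hypDomain_of_hypGauge h.choose_spec.1)
    (mem_hypDomain_of_hypGauge hp) h.choose_spec.2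
  rw [h1, h2]

lemma deform_of_not {s : ℝ} (hs : s ≤ 1) {x : X}
    (hx : ∀ i, x ∉ F.ext i '' {p | hypGauge p ≤ 3 / 4}) : F.deform s x = F.flowTo s x := by
  by_cases h : ∃ q : ι × (E × E), hypGauge q.2 < 1 ∧ F.ext q.1 q.2 = x
  · obtain ⟨⟨i, p⟩, h1, h2⟩ := h
    simp only at h1 h2
    subst h2
    have h3 : 3 / 4 < hypGauge p := by
      by_contra! h3
      exact hx i ⟨p, h3, rfl⟩
    have h4 : stableCut (hypGauge p) = 0 :=
      max_eq_left ((min_le_right _ _).trans (by linarith))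
    rw [F.deform_ext s h1, boxDeform, h4, min_eq_left (by linarith)]
    simp
  · rw [deform, dif_neg h]

lemma boxDeform_dom {s : ℝ} (hs : s ∈ Icc (0 : ℝ) 1) {p : E × E} (hp : hypGauge p < 1) :
    (p.1, (1 - s * stableCut (hypGauge p)) • p.2) ∈ hypDomain E := by
  refine lt_of_le_of_lt ?_ (show ‖p.1‖ * ‖p.2‖ < 1 from mem_hypDomain_of_hypGauge hp)
  have h1 := stableCut_mem (hypGauge p)
  have h2 : 0 ≤ s * stableCut (hypGauge p) := mul_nonneg hs.1 h1.1
  have h3 : s * stableCut (hypGauge p) ≤ 1 := mul_le_one₀ hs.2 h1.1 h1.2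
  simp only [norm_smul, Real.norm_eq_abs]
  rw [abs_of_nonneg (by linarith)]
  gcongr
  exact mul_le_of_le_one_left (norm_nonneg _) (by linarith)

variable [T3Space X]

omit [T3Space X] in
lemma flowTo_dom {s : ℝ} {i : ι} {p : E × E} (hp : p ∈ hypDomain E) (hs : s ≤ 1)
    (h : s = 1 → p.1 ≠ 0) :
    (s, F.ext i p) ∈ {p : ℝ × X | p.1 < 1 ∨ p.1 = 1 ∧ p.2 ∈ F.basin} := by
  rcases lt_or_eq_of_le hs with h1 | h1
  · exact Or.inl h1
  · exact Or.inr ⟨h1, (F.ext_mem_basin hp).2 (h h1)⟩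

lemma continuousOn_boxDeform (i : ι) : ContinuousOn (fun q : ℝ × (E × E) => F.boxDeform q.1 i q.2)
    (Icc 0 1 ×ˢ {p | hypGauge p < 1}) := by
  refine F.continuousOn_flowTo.comp (t := {p : ℝ × X | p.1 < 1 ∨ p.1 = 1 ∧ p.2 ∈ F.basin})
    (f := fun q : ℝ × (E × E) => (min q.1 (2 * hypGauge q.2),
      F.ext i (q.2.1, (1 - q.1 * stableCut (hypGauge q.2)) • q.2.2))) ?_ ?_
  · refine ContinuousOn.prodMk (by fun_prop) ((F.continuousOn_ext i).comp ?_ ?_)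
    · unfold stableCut; fun_prop
    · rintro q ⟨h1, h2⟩
      exact boxDeform_dom h1 h2
  · rintro q ⟨h1, h2⟩
    refine F.flowTo_dom (boxDeform_dom h1 h2) ((min_le_left _ _).trans h1.2) fun h3 h4 => ?_
    simp only at h4
    rw [hypGauge_eq_zero h4] at h3
    have := min_le_right q.1 (2 * 0)
    linarith

lemma continuousOn_deform [ProperSpace E] [Finite ι] :
    ContinuousOn (Function.uncurry F.deform) (Icc 0 1 ×ˢ univ) := by
  rintro ⟨s, x⟩ ⟨hs, -⟩
  by_cases hx : x ∈ ⋃ i, F.ext i '' {p | hypGauge p ≤ 3 / 4}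
  · obtain ⟨i, p, hp, rfl⟩ := mem_iUnion.1 hx
    simp only [mem_ofPred_eq] at hp
    have hp1 : hypGauge p < 1 := by linarith
    have hpd := mem_hypDomain_of_hypGauge hp1
    have hT : IsOpen ((F.extChart i).target ∩ (F.extChart i).symm ⁻¹' {p | hypGauge p < 1}) :=
      (F.extChart i).symm.isOpen_inter_preimage (isOpen_lt (by fun_prop) (by fun_prop))
    have hsymm : (F.extChart i).symm (F.ext i p) = p := (F.extChart i).left_inv hpd
    have hmem : F.ext i p ∈ (F.extChart i).target ∩ (F.extChart i).symm ⁻¹' {p | hypGauge p < 1} :=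
      ⟨⟨p, hpd, rfl⟩, by rw [mem_preimage, hsymm]; exact hp1⟩
    have key : ContinuousOn (fun q : ℝ × X => F.boxDeform q.1 i ((F.extChart i).symm q.2))
        (Icc 0 1 ×ˢ ((F.extChart i).target ∩ (F.extChart i).symm ⁻¹' {p | hypGauge p < 1})) := by
      refine (F.continuousOn_boxDeform i).comp
        (f := fun q : ℝ × X => (q.1, (F.extChart i).symm q.2)) ?_ ?_
      · exact continuousOn_fst.prodMk ((F.extChart i).continuousOn_symm.comp continuousOn_snd
          fun q hq => hq.2.1)
      · exact fun q hq => ⟨hq.1, hq.2.2⟩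
    have h1 : ContinuousWithinAt (Function.uncurry F.deform)
        (Icc 0 1 ×ˢ ((F.extChart i).target ∩ (F.extChart i).symm ⁻¹' {p | hypGauge p < 1}))
        (s, F.ext i p) := by
      refine (key (s, F.ext i p) ⟨hs, hmem⟩).congr (fun q hq => ?_) ?_
      · conv_lhs => rw [Function.uncurry, ← (F.extChart i).right_inv hq.2.1]
        exact F.deform_ext _ hq.2.2
      · simp only [Function.uncurry, hsymm]
        exact F.deform_ext _ hp1
    refine h1.mono_of_mem_nhdsWithin ?_
    rw [nhdsWithin_prod_eq, nhdsWithin_univ]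
    exact prod_mem_prod self_mem_nhdsWithin (hT.mem_nhds hmem)
  · have hcl : IsClosed (⋃ i, F.ext i '' {p | hypGauge p ≤ 3 / 4}) :=
      isClosed_iUnion_of_finite fun i => F.isClosed_ext_image i (by norm_num) (by norm_num)
    have hb : ∀ y, y ∉ (⋃ i, F.ext i '' {p : E × E | hypGauge p ≤ 3 / 4}) → y ∈ F.basin := by
      intro y hy
      by_contra hyb
      obtain ⟨j, q, hq, rfl, hq0⟩ := F.exists_ext_of_not_mem_basin hyb
      refine hy (mem_iUnion.2 ⟨j, q, ?_, rfl⟩)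
      simp only [mem_ofPred_eq, hypGauge_eq_zero hq0]; norm_num
    have h1 : ContinuousWithinAt (Function.uncurry F.deform)
        (Icc 0 1 ×ˢ (⋃ i, F.ext i '' {p | hypGauge p ≤ 3 / 4})ᶜ) (s, x) := by
      refine ContinuousWithinAt.congr (f := Function.uncurry F.flowTo) ?_ ?_ ?_
      · refine (F.continuousOn_flowTo.mono ?_) (s, x) ⟨hs, hx⟩
        rintro ⟨s, y⟩ ⟨h1, h2⟩
        rcases lt_or_eq_of_le h1.2 with h | h
        · exact Or.inl h
        · exact Or.inr ⟨h, hb _ h2⟩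
      · rintro ⟨s, y⟩ ⟨h1, h2⟩
        exact F.deform_of_not h1.2 fun i hi => h2 (mem_iUnion.2 ⟨i, hi⟩)
      · exact F.deform_of_not hs.2 fun i hi => hx (mem_iUnion.2 ⟨i, hi⟩)
    refine h1.mono_of_mem_nhdsWithin ?_
    rw [nhdsWithin_prod_eq, nhdsWithin_univ]
    exact prod_mem_prod self_mem_nhdsWithin (hcl.isOpen_compl.mem_nhds hx)

/-- The union of the attracting set and the unstable manifolds. -/
def skeleton : Set X := F.attr ∪ ⋃ i, range fun y : E => F.ext i (y, 0)

omit [T3Space X] in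
lemma flowTo_mem_skeleton {s : ℝ} {i : ι} {y : E} (hs : 1 ≤ s → y ≠ 0) :
    F.flowTo s (F.ext i (y, 0)) ∈ F.skeleton := by
  unfold flowTo
  split_ifs with h
  · rw [F.flow_ext (mk_zero_mem_hypDomain y)]
    refine Or.inr (mem_iUnion.2 ⟨i, Real.exp (s / (1 - s)) • y, ?_⟩)
    simp [hypFlow]
  · exact Or.inl (F.limit_mem ((F.ext_mem_basin (mk_zero_mem_hypDomain y)).2 (hs (by linarith))))

omit [T3Space X] in
lemma deform_one_mem (x : X) : F.deform 1 x ∈ F.skeleton := by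
  by_cases hx : ∃ i, x ∈ F.ext i '' {p | hypGauge p ≤ 3 / 4}
  · obtain ⟨i, p, hp, rfl⟩ := hx
    simp only [mem_ofPred_eq] at hp
    have hp1 : hypGauge p < 1 := by linarith
    rw [F.deform_ext _ hp1, boxDeform]
    rcases le_total (hypGauge p) (1 / 2) with h | h
    · have : stableCut (hypGauge p) = 1 := by
        unfold stableCut
        rw [min_eq_left (by linarith), max_eq_right zero_le_one]
      rw [this]
      simp only [mul_one, sub_self, zero_smul]
      refine F.flowTo_mem_skeleton fun h1 h0 => ?_
      rw [hypGauge_eq_zero h0] at h1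
      have := min_le_right (1 : ℝ) (2 * 0)
      linarith
    · rw [min_eq_left (by linarith), flowTo_one]
      refine Or.inl (F.limit_mem ((F.ext_mem_basin (boxDeform_dom (by simp) hp1)).2 fun h0 => ?_))
      simp only at h0
      rw [hypGauge_eq_zero h0] at h
      norm_num at h
  · push Not at hx
    rw [F.deform_of_not le_rfl hx, flowTo_one]
    refine Or.inl (F.limit_mem ?_)
    by_contra hyb
    obtain ⟨j, q, hq, rfl, hq0⟩ := F.exists_ext_of_not_mem_basin hyb
    refine hx j ⟨q, ?_, rfl⟩
    simp only [mem_ofPred_eq, hypGauge_eq_zero hq0]; norm_num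

lemma deform_mem {s : ℝ} (hs : s ∈ Icc (0 : ℝ) 1) {x : X} (hx : x ∈ F.skeleton) :
    F.deform s x ∈ F.skeleton := by
  rcases hx with hx | hx
  · rw [F.deform_of_not hs.2, F.flowTo_attr _ hx]
    · exact Or.inl hx
    · rintro i ⟨p, hp, rfl⟩
      simp only [mem_ofPred_eq] at hp
      exact F.ext_not_mem_nbhd (i := i) (mem_hypDomain_of_hypGauge (by linarith))
        (by linarith [norm_fst_le_hypGauge p]) (F.attr_subset hx)
  · obtain ⟨i, y, rfl⟩ := mem_iUnion.1 hx
    simp only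
    by_cases hy : hypGauge (y, (0 : E)) < 1
    · rw [F.deform_ext _ hy, boxDeform]
      simp only [smul_zero]
      refine F.flowTo_mem_skeleton fun h1 h0 => ?_
      rw [hypGauge_eq_zero h0] at h1
      have := min_le_right s (2 * 0)
      linarith
    · rw [F.deform_of_not hs.2]
      · refine F.flowTo_mem_skeleton fun h1 h0 => ?_
        rw [hypGauge_eq_zero h0] at hy
        norm_num at hy
      · rintro j ⟨p, hp, h⟩
        simp only [mem_ofPred_eq] at hp
        obtain ⟨-, h2⟩ := F.ext_inj (mem_hypDomain_of_hypGauge (by linarith))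
          (mk_zero_mem_hypDomain y) h
        rw [h2] at hp
        linarith

lemma skeleton_homotopyEquiv [ProperSpace E] [Finite ι] :
    Nonempty (ContinuousMap.HomotopyEquiv X F.skeleton) := by
  refine homotopyEquiv_of_deformation F.continuousOn_deform (fun x => ?_) F.deform_one_mem
    fun s hs x hx => F.deform_mem hs hx
  by_cases hx : ∃ i, x ∈ F.ext i '' {p | hypGauge p ≤ 3 / 4}
  · obtain ⟨i, p, hp, rfl⟩ := hx
    simp only [mem_ofPred_eq] at hp
    rw [F.deform_ext _ (by linarith), boxDeform, min_eq_left (by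
      linarith [hypGauge_nonneg p])]
    simp
  · push Not at hx
    rw [F.deform_of_not zero_le_one hx, flowTo_zero]

end BoxFlow
end

section
open Set Filter Topology

/-- The radial stretching factor. -/
def stretch (r : ℝ) : ℝ := Real.exp (r / (1 - r))

lemma stretch_strictMonoOn : StrictMonoOn (fun r => stretch r * r) (Ico 0 1) := by
  intro r hr s hs hrs
  have h1 : r / (1 - r) ≤ s / (1 - s) := by
    rw [div_le_div_iff₀ (by linarith [hr.2]) (by linarith [hs.2])]
    nlinarith
  have h2 : stretch r ≤ stretch s := Real.exp_le_exp.2 h1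
  have h3 : 0 < stretch s := Real.exp_pos _
  calc stretch r * r ≤ stretch s * r := mul_le_mul_of_nonneg_right h2 hr.1
    _ < stretch s * s := mul_lt_mul_of_pos_left hrs h3

lemma exists_stretch {ρ : ℝ} (hρ : 0 ≤ ρ) : ∃ r ∈ Ico (0 : ℝ) 1, stretch r * r = ρ := by
  set b : ℝ := (1 + ρ) / (2 + ρ) with hb
  have hb1 : b < 1 := by rw [hb, div_lt_one (by linarith)]; linarith
  have hb0 : 0 ≤ b := by positivity
  have hbb : b / (1 - b) = 1 + ρ := by
    rw [hb]; field_simp; ring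
  have h1 : ρ ≤ stretch b * b := by
    rw [stretch, hbb]
    have h2 := Real.add_one_le_exp (1 + ρ)
    have h3 : (2 + ρ) * b = 1 + ρ := by rw [hb]; field_simp
    nlinarith
  have hc : ContinuousOn (fun r => stretch r * r) (Icc 0 b) := by
    unfold stretch
    have : ∀ r ∈ Icc (0 : ℝ) b, 1 - r ≠ 0 := fun r hr => by linarith [hr.2]
    fun_prop (disch := assumption)
  obtain ⟨r, hr, h⟩ := intermediate_value_Icc hb0 hc ⟨by simpa using hρ, h1⟩
  exact ⟨r, ⟨hr.1, by linarith [hr.2]⟩, h⟩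

namespace BoxFlow
variable {X : Type} [TopologicalSpace X] [T3Space X] {n k : ℕ}
  (F : BoxFlow X (EuclideanSpace ℝ (Fin n)) (Fin k))

/-- The attaching maps. -/
def attach (i : Fin k) : C(Metric.sphere (0 : EuclideanSpace ℝ (Fin n)) 1, F.attr) where
  toFun v := ⟨F.limit (F.ext i (v, 0)),
    F.limit_mem ((F.ext_mem_basin (mk_zero_mem_hypDomain _)).2 (ne_zero_of_mem_unit_sphere v))⟩
  continuous_toFun := by
    refine Continuous.subtype_mk ?_ _
    have : Continuous fun v : Metric.sphere (0 : EuclideanSpace ℝ (Fin n)) 1 =>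
        Function.uncurry F.flowTo (1, F.ext i (v, 0)) := by
      refine F.continuousOn_flowTo.comp_continuous ?_ fun v => ?_
      · exact continuous_const.prodMk ((F.continuousOn_ext i).comp_continuous (by fun_prop)
          fun v => mk_zero_mem_hypDomain _)
      · exact F.flowTo_dom (mk_zero_mem_hypDomain _) le_rfl fun _ => ne_zero_of_mem_unit_sphere v
    simpa [Function.uncurry] using this

/-- The characteristic map of the skeleton. -/
def charMap : F.attr ⊕ (Fin k × Metric.closedBall (0 : EuclideanSpace ℝ (Fin n)) 1) → X :=
  Sum.elim Subtype.val fun p => F.flowTo ‖(p.2 : EuclideanSpace ℝ (Fin n))‖ (F.ext p.1 (p.2, 0))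

lemma norm_le_one_of_closedBall (w : Metric.closedBall (0 : EuclideanSpace ℝ (Fin n)) 1) :
    ‖(w : EuclideanSpace ℝ (Fin n))‖ ≤ 1 := mem_closedBall_zero_iff.1 w.2

lemma continuous_charMap : Continuous F.charMap := by
  refine continuous_subtype_val.sumElim ?_
  rw [continuous_prod_of_discrete_left]
  intro i
  refine F.continuousOn_flowTo.comp_continuous
    (f := fun w : Metric.closedBall (0 : EuclideanSpace ℝ (Fin n)) 1 =>
      (‖(w : EuclideanSpace ℝ (Fin n))‖, F.ext i (w, 0))) ?_ fun w => ?_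
  · exact (by fun_prop : Continuous fun w : Metric.closedBall (0 : EuclideanSpace ℝ (Fin n)) 1 =>
      ‖(w : EuclideanSpace ℝ (Fin n))‖).prodMk
      ((F.continuousOn_ext i).comp_continuous (by fun_prop) fun v => mk_zero_mem_hypDomain _)
  · refine F.flowTo_dom (mk_zero_mem_hypDomain _) (norm_le_one_of_closedBall w) fun h h0 => ?_
    simp only at h0
    rw [h0] at h
    norm_num at h

lemma isClosedMap_charMap : IsClosedMap F.charMap := by
  refine IsClosedMap.sumElim F.isClosed_attr.isClosedEmbedding_subtypeVal.isClosedMap ?_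
  exact Continuous.isClosedMap (F.continuous_charMap.comp continuous_inr)

omit [T3Space X] in
lemma charMap_inr_of_lt {i : Fin k} {w : Metric.closedBall (0 : EuclideanSpace ℝ (Fin n)) 1}
    (h : ‖(w : EuclideanSpace ℝ (Fin n))‖ < 1) :
    F.charMap (Sum.inr (i, w)) =
      F.ext i (stretch ‖(w : EuclideanSpace ℝ (Fin n))‖ • (w : EuclideanSpace ℝ (Fin n)), 0) := by
  simp only [charMap, Sum.elim_inr, flowTo, if_pos h]
  rw [F.flow_ext (mk_zero_mem_hypDomain _)]
  simp [hypFlow, stretch]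

lemma charMap_glue (i : Fin k) (v : Metric.sphere (0 : EuclideanSpace ℝ (Fin n)) 1) :
    F.charMap (Sum.inr (i, ⟨v.1, Metric.sphere_subset_closedBall v.2⟩)) =
      F.charMap (Sum.inl (F.attach i v)) := by
  simp [charMap, attach]

omit [T3Space X] in
lemma ext_mk_zero_not_mem_attr (i : Fin k) (y : EuclideanSpace ℝ (Fin n)) :
    F.ext i (y, 0) ∉ F.attr := by
  intro h
  have h1 : ∀ t, F.ext i (hypFlow t (y, 0)) ∈ F.nbhd := fun t => by
    rw [← F.flow_ext (mk_zero_mem_hypDomain y), F.flow_attr t _ h]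
    exact F.attr_subset h
  obtain ⟨t, ht⟩ := exists_hypFlow_mem_unitBox (mk_zero_mem_hypDomain y)
  exact F.ext_not_mem_nbhd (hypFlow_mem_hypDomain (mk_zero_mem_hypDomain y)) ht.1 (h1 (-t))

/-- The map from the space with cells attached. -/
def attachDesc : AttachCells F.attr n k F.attach → X :=
  Quot.lift F.charMap (by rintro _ _ ⟨i, v, rfl, rfl⟩; exact F.charMap_glue i v)

lemma continuous_attachDesc : Continuous F.attachDesc := continuous_quot_lift _ F.continuous_charMap

lemma isClosedMap_attachDesc : IsClosedMap F.attachDesc := by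
  intro C hC
  have h1 : IsClosed (Quot.mk _ ⁻¹' C : Set (F.attr ⊕ _)) := hC.preimage continuous_quot_mk
  have h2 : F.attachDesc '' C = F.charMap '' (Quot.mk _ ⁻¹' C) := by
    ext x
    constructor
    · rintro ⟨z, hz, rfl⟩
      obtain ⟨a, rfl⟩ := Quot.exists_rep z
      exact ⟨a, hz, rfl⟩
    · rintro ⟨a, ha, rfl⟩
      exact ⟨_, ha, rfl⟩
  rw [h2]
  exact F.isClosedMap_charMap _ h1

lemma attach_normal_form (z : AttachCells F.attr n k F.attach) :
    (∃ a : F.attr, z = Quot.mk _ (Sum.inl a)) ∨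
    ∃ (i : Fin k) (w : Metric.closedBall (0 : EuclideanSpace ℝ (Fin n)) 1),
      ‖(w : EuclideanSpace ℝ (Fin n))‖ < 1 ∧ z = Quot.mk _ (Sum.inr (i, w)) := by
  obtain ⟨a | ⟨i, w⟩, rfl⟩ := Quot.exists_rep z
  · exact Or.inl ⟨a, rfl⟩
  · rcases lt_or_eq_of_le (norm_le_one_of_closedBall w) with h | h
    · exact Or.inr ⟨i, w, h, rfl⟩
    · exact Or.inl ⟨F.attach i ⟨w, mem_sphere_zero_iff_norm.2 h⟩, Quot.sound ⟨i, _, rfl, rfl⟩⟩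

lemma attachDesc_injective : Function.Injective F.attachDesc := by
  intro z z' h
  rcases F.attach_normal_form z with ⟨a, rfl⟩ | ⟨i, w, hw, rfl⟩ <;>
  rcases F.attach_normal_form z' with ⟨a', rfl⟩ | ⟨i', w', hw', rfl⟩ <;>
  simp only [attachDesc] at h
  · have : a = a' := Subtype.ext h
    rw [this]
  · rw [F.charMap_inr_of_lt hw'] at h
    exact absurd (by rw [← h]; exact a.2) (F.ext_mk_zero_not_mem_attr _ _)
  · rw [F.charMap_inr_of_lt hw] at h
    exact absurd (by rw [h]; exact a'.2) (F.ext_mk_zero_not_mem_attr _ _)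
  · rw [F.charMap_inr_of_lt hw, F.charMap_inr_of_lt hw'] at h
    obtain ⟨rfl, h2⟩ := F.ext_inj (mk_zero_mem_hypDomain _) (mk_zero_mem_hypDomain _) h
    have h3 := congrArg Prod.fst h2
    simp only at h3
    have h4 := congrArg norm h3
    simp only [norm_smul, Real.norm_eq_abs, stretch, Real.abs_exp] at h4
    have h5 := stretch_strictMonoOn.injOn ⟨norm_nonneg _, hw⟩ ⟨norm_nonneg _, hw'⟩ h4
    rw [h5] at h3
    have h6 : (w : EuclideanSpace ℝ (Fin n)) = w' :=
      smul_right_injective _ (Real.exp_pos _).ne' h3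
    rw [Subtype.ext h6]

lemma range_attachDesc : range F.attachDesc = F.skeleton := by
  ext x
  constructor
  · rintro ⟨z, rfl⟩
    rcases F.attach_normal_form z with ⟨a, rfl⟩ | ⟨i, w, hw, rfl⟩ <;> simp only [attachDesc]
    · exact Or.inl a.2
    · rw [F.charMap_inr_of_lt hw]
      exact Or.inr (mem_iUnion.2 ⟨i, _, rfl⟩)
  · rintro (hx | hx)
    · exact ⟨Quot.mk _ (Sum.inl ⟨x, hx⟩), rfl⟩
    · obtain ⟨i, y, rfl⟩ := mem_iUnion.1 hx
      obtain ⟨r, hr, hry⟩ := exists_stretch (norm_nonneg y)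
      have hs : 0 < stretch r := Real.exp_pos _
      have hn : ‖(stretch r)⁻¹ • y‖ = r := by
        rw [norm_smul, norm_inv, Real.norm_eq_abs, abs_of_pos hs, ← hry]
        field_simp
      refine ⟨Quot.mk _ (Sum.inr (i, ⟨(stretch r)⁻¹ • y,
        mem_closedBall_zero_iff.2 (hn.le.trans hr.2.le)⟩)), ?_⟩
      simp only [attachDesc]
      rw [F.charMap_inr_of_lt (by simpa only [hn] using hr.2)]
      simp only [hn]
      rw [smul_inv_smul₀ hs.ne']

/-- The space carrying the flow is the attracting set with cells attached, up to homotopy. -/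
theorem exists_attachCells : ∃ φ : Fin k → C(Metric.sphere (0 : EuclideanSpace ℝ (Fin n)) 1, F.attr),
    Nonempty (ContinuousMap.HomotopyEquiv X (AttachCells F.attr n k φ)) := by
  refine ⟨F.attach, ?_⟩
  obtain ⟨e⟩ := F.skeleton_homotopyEquiv
  let g : AttachCells F.attr n k F.attach ≃ F.skeleton :=
    (Equiv.ofInjective _ F.attachDesc_injective).trans (Equiv.setCongr F.range_attachDesc)
  have hg : ∀ z, (g z : X) = F.attachDesc z := fun z => rfl
  have hc : Continuous g := continuous_induced_rng.2 F.continuous_attachDesc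
  have hcl : IsClosedMap g := by
    intro C hC
    have : g '' C = Subtype.val ⁻¹' (F.attachDesc '' C) := by
      ext x
      constructor
      · rintro ⟨z, hz, rfl⟩
        exact ⟨z, hz, rfl⟩
      · rintro ⟨z, hz, h⟩
        exact ⟨z, hz, Subtype.ext h⟩
    rw [this]
    exact (F.isClosedMap_attachDesc C hC).preimage continuous_subtype_val
  exact ⟨e.trans (g.toHomeomorphOfContinuousClosed hc hcl).symm.toHomotopyEquiv⟩

omit [T3Space X] in
lemma isOpen_ext_image (i : Fin k) : IsOpen (F.ext i '' hypDomain _) := (F.extChart i).open_target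

omit [T3Space X] in
lemma hasEulerChar_tube (i : Fin k) : HasEulerChar ↥(F.ext i '' hypDomain _) 1 := by
  have h1 : HasEulerChar ↥(hypDomain (EuclideanSpace ℝ (Fin n))) 1 := by
    have : ContractibleSpace ↥(hypDomain (EuclideanSpace ℝ (Fin n))) := by
      have hst : StarConvex ℝ 0 (hypDomain (EuclideanSpace ℝ (Fin n))) := by
        rw [starConvex_zero_iff]
        intro p hp a ha0 ha1
        simp only [hypDomain, mem_ofPred_eq, Prod.smul_fst, Prod.smul_snd, norm_smul,
          Real.norm_eq_abs, abs_of_nonneg ha0] at *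
        calc _ = (a * a) * (‖p.1‖ * ‖p.2‖) := by ring
          _ ≤ 1 * (‖p.1‖ * ‖p.2‖) := by gcongr; nlinarith
          _ < 1 := by linarith
      exact hst.contractibleSpace ⟨0, by simp [hypDomain]⟩
    exact hasEulerChar_of_contractible
  exact h1.homeo (F.extChart i).toHomeomorphSourceTarget

omit [T3Space X] in
lemma hasEulerChar_tube_inter (i : Fin k) :
    HasEulerChar ↥(F.ext i '' hypDomain _ ∩ F.basin) (1 - (-1) ^ n) := by
  set E := EuclideanSpace ℝ (Fin n)
  have h1 : HasEulerChar {y : E | y ≠ 0} (1 - (-1) ^ n) := by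
    refine (hasEulerChar_punctured n).homeo ?_
    refine (Homeomorph.subtype (EuclideanSpace.equiv (Fin n) ℝ).toHomeomorph fun y => ?_).symm
    simp
  set S : Set (E × E) := hypDomain E ∩ {p | p.1 ≠ 0} with hS
  have h2 : HasEulerChar S (1 - (-1) ^ n) := by
    obtain ⟨e⟩ := homotopyEquiv_of_deformation (X := S) (S := {p | p.1.2 = 0})
      (H := fun s p => if h : s ∈ Icc (0 : ℝ) 1 then ⟨(p.1.1, (1 - s) • p.1.2), by
        refine ⟨lt_of_le_of_lt ?_ (show ‖p.1.1‖ * ‖p.1.2‖ < 1 from p.2.1), p.2.2⟩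
        simp only [norm_smul, Real.norm_eq_abs]
        gcongr
        refine mul_le_of_le_one_left (norm_nonneg _) ?_
        rw [abs_of_nonneg (by linarith [h.2])]; linarith [h.1]⟩ else p) (by
        rw [continuousOn_iff_continuous_domRestrict]
        have : Continuous fun q : ↥(Icc (0 : ℝ) 1 ×ˢ (univ : Set S)) =>
            ((q.1.2.1.1, (1 - q.1.1) • q.1.2.1.2) : E × E) := by fun_prop
        refine continuous_induced_rng.2 (this.congr fun q => ?_)
        have hq := q.2.1
        simp only [domRestrict_apply, Function.uncurry, Function.comp, dif_pos hq])
      (fun x => by simp) (fun x => by simp) (by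
        intro s hs p hp
        simp only [mem_ofPred_eq] at hp
        simp [hs, hp])
    let g : {p : S | p.1.2 = 0} ≃ₜ {y : E | y ≠ 0} :=
      { toFun := fun p => ⟨p.1.1.1, p.1.2.2⟩
        invFun := fun y => ⟨⟨(y.1, 0), mk_zero_mem_hypDomain _, y.2⟩, rfl⟩
        left_inv := fun p => by
          obtain ⟨⟨⟨a, b⟩, h⟩, hb⟩ := p
          simp only [mem_ofPred_eq] at hb
          subst hb; rfl
        right_inv := fun y => rfl
        continuous_toFun := by fun_prop
        continuous_invFun := by fun_prop }
    exact (h1.homeo g.symm).congr e.symm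
  have hsub : S ⊆ (F.extChart i).source := inter_subset_left
  have h3 : F.extChart i '' S = F.ext i '' hypDomain _ ∩ F.basin := by
    ext x
    constructor
    · rintro ⟨p, hp, rfl⟩
      exact ⟨⟨p, hp.1, rfl⟩, (F.ext_mem_basin hp.1).2 hp.2⟩
    · rintro ⟨⟨p, hp, rfl⟩, hx⟩
      exact ⟨p, ⟨hp, (F.ext_mem_basin hp).1 hx⟩, rfl⟩
  rw [← h3]
  let g : S ≃ₜ F.extChart i '' S :=
    { (Equiv.Set.imageOfInjOn (F.extChart i) S ((F.extChart i).injOn.mono hsub)) with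
      continuous_toFun := by
        refine continuous_induced_rng.2 ?_
        exact ((F.extChart i).continuousOn.mono hsub).domRestrict
      continuous_invFun := by
        have : Continuous fun y : F.extChart i '' S => (F.extChart i).symm y := by
          refine ((F.extChart i).continuousOn_symm.mono ?_).domRestrict
          rintro _ ⟨p, hp, rfl⟩
          exact (F.extChart i).map_source (hsub hp)
        refine continuous_induced_rng.2 (this.congr fun y => ?_)
        obtain ⟨_, p, hp, rfl⟩ := y
        have h4 := (Equiv.Set.imageOfInjOn (F.extChart i) S
          ((F.extChart i).injOn.mono hsub)).symm_apply_apply ⟨p, hp⟩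
        have h5 : (F.extChart i).symm (F.extChart i p) = p := (F.extChart i).left_inv (hsub hp)
        change (F.extChart i).symm (F.extChart i p) = _
        rw [h5]
        exact (congrArg Subtype.val h4).symm }
  exact h2.homeo g

/-- The Euler characteristic of the space carrying the flow. -/
theorem hasEulerChar {a : ℤ} (ha : HasEulerChar F.attr a) : HasEulerChar X (a + (-1) ^ n * k) := by
  have hb : HasEulerChar F.basin a := ha.congr F.basin_homotopyEquiv.some.symm
  have hd : ∀ i j : Fin k, i ≠ j → Disjoint (F.ext i '' hypDomain _) (F.ext j '' hypDomain _) := by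
    intro i j hij
    rw [Set.disjoint_left]
    rintro _ ⟨p, hp, rfl⟩ ⟨q, hq, h⟩
    exact hij (F.ext_inj hq hp h).1.symm
  have h1 := hasEulerChar_biUnion_disjoint (fun i : Fin k => F.ext i '' hypDomain _)
    F.isOpen_ext_image hd (fun _ => 1) F.hasEulerChar_tube Finset.univ
  have h2 := hasEulerChar_biUnion_disjoint (fun i : Fin k => F.ext i '' hypDomain _ ∩ F.basin)
    (fun i => (F.isOpen_ext_image i).inter F.isOpen_basin)
    (fun i j hij => (hd i j hij).mono inter_subset_left inter_subset_left)
    (fun _ => 1 - (-1) ^ n) F.hasEulerChar_tube_inter Finset.univ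
  have hun : F.basin ∪ (⋃ i ∈ Finset.univ, F.ext i '' hypDomain _) = univ := by
    refine eq_univ_of_forall fun x => ?_
    by_cases hx : x ∈ F.basin
    · exact Or.inl hx
    · obtain ⟨i, p, hp, rfl, -⟩ := F.exists_ext_of_not_mem_basin hx
      exact Or.inr (mem_iUnion₂.2 ⟨i, Finset.mem_univ i, p, hp, rfl⟩)
  have h3 := HasEulerChar.union F.isOpen_basin (isOpen_biUnion fun i _ => F.isOpen_ext_image i) hb
    h1 (h2.of_eq (by rw [← iUnion₂_inter, inter_comm]; simp) rfl)
  refine (h3.of_eq hun ?_).homeo (Homeomorph.Set.univ X)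
  simp; ring

end BoxFlow
end

section
open Set Filter Topology

variable {m : ℕ}

/-- The linear form with coefficient vector `c`. -/
def dotForm (c : Fin m → ℂ) : (Fin m → ℂ) →L[ℂ] ℂ :=
  ∑ i, c i • ContinuousLinearMap.proj (R := ℂ) (φ := fun _ : Fin m => ℂ) i

lemma dotForm_apply (c x : Fin m → ℂ) : dotForm c x = ∑ i, c i * x i := by
  simp [dotForm]

/-- The gradient of `f` at `x`. -/
def gradAt (f : MvPolynomial (Fin m) ℂ) (x : Fin m → ℂ) : Fin m → ℂ :=
  fun i => eval x (pderiv i f)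

lemma hasStrictFDerivAt_eval (f : MvPolynomial (Fin m) ℂ) (x : Fin m → ℂ) :
    HasStrictFDerivAt (fun y => eval y f) (dotForm (gradAt f x)) x := by
  induction f using MvPolynomial.induction_on with
  | C a =>
    have : dotForm (gradAt (C a) x) = 0 := by ext; simp [dotForm_apply, gradAt]
    rw [this]
    simpa using hasStrictFDerivAt_const a x
  | add p q hp hq =>
    have : dotForm (gradAt (p + q) x) = dotForm (gradAt p x) + dotForm (gradAt q x) := by
      ext; simp [dotForm_apply, gradAt, add_mul, Finset.sum_add_distrib]
    rw [this]
    simp only [map_add]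
    exact hp.add hq
  | mul_X p i hp =>
    have h : dotForm (gradAt (p * X i) x) =
        eval x p • ContinuousLinearMap.proj (R := ℂ) (φ := fun _ : Fin m => ℂ) i +
          x i • dotForm (gradAt p x) := by
      ext y
      simp only [dotForm_apply, gradAt, Derivation.leibniz, pderiv_X, map_add, smul_eq_mul, map_mul,
        eval_X, add_mul, Finset.sum_add_distrib, _root_.add_apply,
        _root_.smul_apply, ContinuousLinearMap.proj_apply, Finset.mul_sum, mul_assoc]
      congr 1
      rw [Finset.sum_eq_single i]
      · simp
      · intro j _ hj
        simp [hj.symm]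
      · simp
    rw [h]
    simp only [map_mul, eval_X]
    exact hp.mul (hasStrictFDerivAt_apply (𝕜 := ℂ) i x)

lemma contDiff_eval (f : MvPolynomial (Fin m) ℂ) {k : WithTop ℕ∞} :
    ContDiff ℂ k (fun y => eval y f) := by
  have h := AnalyticOnNhd.eval_mvPolynomial (𝕜 := ℂ) f
  exact contDiff_iff_contDiffAt.2 fun x => (h x (mem_univ x)).contDiffAt

lemma continuous_eval_poly (f : MvPolynomial (Fin m) ℂ) : Continuous (fun y => eval y f) :=
  (contDiff_eval f (k := 0)).continuous

lemma contDiff_gradAt (f : MvPolynomial (Fin m) ℂ) {k : WithTop ℕ∞} : ContDiff ℂ k (gradAt f) :=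
  contDiff_pi.2 fun _ => contDiff_eval _

lemma continuous_gradAt (f : MvPolynomial (Fin m) ℂ) : Continuous (gradAt f) :=
  (contDiff_gradAt f (k := 0)).continuous

lemma eval_smul_of_isHomogeneous {f : MvPolynomial (Fin m) ℂ} {d : ℕ} (hf : f.IsHomogeneous d)
    (t : ℂ) (x : Fin m → ℂ) : eval (t • x) f = t ^ d * eval x f := by
  rw [eval_eq, eval_eq, Finset.mul_sum]
  refine Finset.sum_congr rfl fun s hs => ?_
  have h : s.degree = d := by
    have := hf (mem_support_iff.1 hs)
    rw [← this, Finsupp.degree_eq_weight_one]; rfl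
  have h2 : ∏ i ∈ s.support, (t • x) i ^ s i = t ^ d * ∏ i ∈ s.support, x i ^ s i := by
    simp only [Pi.smul_apply, smul_eq_mul, mul_pow, Finset.prod_mul_distrib]
    rw [Finset.prod_pow_eq_pow_sum, ← h]
    rfl
  rw [h2]; ring

lemma gradAt_smul {f : MvPolynomial (Fin m) ℂ} {d : ℕ} (hf : f.IsHomogeneous d)
    (t : ℂ) (x : Fin m → ℂ) : gradAt f (t • x) = t ^ (d - 1) • gradAt f x := by
  ext i
  simp [gradAt, eval_smul_of_isHomogeneous (hf.pderiv (i := i))]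

lemma dotForm_gradAt_self {f : MvPolynomial (Fin m) ℂ} {d : ℕ} (hf : f.IsHomogeneous d)
    (x : Fin m → ℂ) : dotForm (gradAt f x) x = d * eval x f := by
  have := congrArg (eval x) hf.sum_X_mul_pderiv
  simp only [map_sum, map_mul, eval_X, nsmul_eq_mul, map_natCast] at this
  rw [dotForm_apply, ← this]
  exact Finset.sum_congr rfl fun i _ => mul_comm _ _

lemma eval_zero_of_isHomogeneous {f : MvPolynomial (Fin m) ℂ} {d : ℕ} (hf : f.IsHomogeneous d)
    (hd : 0 < d) : eval (0 : Fin m → ℂ) f = 0 := by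
  have := eval_smul_of_isHomogeneous hf 0 0
  simpa [hd.ne'] using this

/-- Chain rule along a real curve. -/
lemma HasDerivAt.eval_poly (f : MvPolynomial (Fin m) ℂ) {x : ℝ → Fin m → ℂ} {x' : Fin m → ℂ}
    {t : ℝ} (h : HasDerivAt x x' t) :
    HasDerivAt (fun s => eval (x s) f) (dotForm (gradAt f (x t)) x') t := by
  have h1 := (hasStrictFDerivAt_eval f (x t)).hasFDerivAt.restrictScalars ℝ
  exact h1.comp_hasDerivAt t h

lemma HasDerivAt.dotForm (c : Fin m → ℂ) {x : ℝ → Fin m → ℂ} {x' : Fin m → ℂ}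
    {t : ℝ} (h : HasDerivAt x x' t) :
    HasDerivAt (fun s => dotForm c (x s)) (dotForm c x') t :=
  ((_root_.dotForm c).hasFDerivAt.restrictScalars ℝ).comp_hasDerivAt t h

end

section
open Set Filter Topology

variable {n : ℕ}

/-- The quotient map from nonzero vectors to projective space. -/
def toProj (x : {x : Fin (n + 1) → ℂ // x ≠ 0}) : Proj n := Projectivization.mk ℂ x.1 x.2

lemma toProj_eq_iff (x y : {x : Fin (n + 1) → ℂ // x ≠ 0}) :
    toProj x = toProj y ↔ ∃ a : ℂ, a • y.1 = x.1 :=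
  Projectivization.mk_eq_mk_iff' ..

lemma continuous_toProj : Continuous (toProj (n := n)) := continuous_quotient_mk'

lemma isOpenQuotientMap_toProj : IsOpenQuotientMap (toProj (n := n)) := by
  refine ⟨fun x => ⟨⟨x.rep, x.rep_nonzero⟩, x.mk_rep⟩, continuous_toProj, fun U hU => ?_⟩
  have hq : IsQuotientMap (toProj (n := n)) := isQuotientMap_quotient_mk'
  rw [← hq.isOpen_preimage]
  have : toProj ⁻¹' (toProj '' U) =
      ⋃ a : ℂˣ, {x : {x : Fin (n + 1) → ℂ // x ≠ 0} |
        (⟨a • x.1, (smul_ne_zero_iff_ne a).2 x.2⟩ : {x : Fin (n + 1) → ℂ // x ≠ 0}) ∈ U} := by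
    ext x
    simp only [mem_preimage, mem_image, mem_iUnion, mem_ofPred_eq]
    constructor
    · rintro ⟨y, hy, hxy⟩
      obtain ⟨a, ha⟩ := (toProj_eq_iff _ _).1 hxy
      have ha0 : a ≠ 0 := by
        rintro rfl
        exact y.2 (by simpa using ha.symm)
      refine ⟨Units.mk0 a ha0, ?_⟩
      convert hy using 1
      exact Subtype.ext ha
    · rintro ⟨a, ha⟩
      exact ⟨_, ha, (toProj_eq_iff _ _).2 ⟨a, rfl⟩⟩
  rw [this]
  refine isOpen_iUnion fun a => hU.preimage ?_
  exact Continuous.subtype_mk (continuous_subtype_val.const_smul (a : ℂ)) _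

instance : T2Space (Proj n) := by
  have hN : ∀ x : {x : Fin (n + 1) → ℂ // x ≠ 0}, ∑ i, x.1 i * star (x.1 i) ≠ 0 := by
    intro x h
    apply x.2
    simp only [Complex.star_def, Complex.mul_conj, Complex.normSq_eq_norm_sq] at h
    have h2 : ∑ i, ‖x.1 i‖ ^ 2 = 0 := by exact_mod_cast h
    rw [Finset.sum_eq_zero_iff_of_nonneg (fun _ _ => by positivity)] at h2
    ext i
    simpa using h2 i (Finset.mem_univ i)
  let g : {x : Fin (n + 1) → ℂ // x ≠ 0} → (Fin (n + 1) → Fin (n + 1) → ℂ) := fun x i j =>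
    x.1 i * star (x.1 j) / ∑ i, x.1 i * star (x.1 i)
  have hg : Continuous g := by
    have hc : ∀ i, Continuous fun x : {x : Fin (n + 1) → ℂ // x ≠ 0} => x.1 i := fun i =>
      (continuous_apply i).comp continuous_subtype_val
    refine continuous_pi fun i => continuous_pi fun j => ?_
    exact ((hc i).mul (hc j).star).div (continuous_finsetSum _ fun i _ => (hc i).mul (hc i).star) hN
  have hgl : ∀ x y : {x : Fin (n + 1) → ℂ // x ≠ 0}, toProj x = toProj y ↔ g x = g y := by
    intro x y
    rw [toProj_eq_iff]
    constructor
    · rintro ⟨a, ha⟩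
      have ha0 : a ≠ 0 := by
        rintro rfl
        exact x.2 (by simpa using ha.symm)
      have hy := hN y
      ext i j
      simp only [g, ← ha, Pi.smul_apply, smul_eq_mul, star_mul']
      have : ∀ i j, a * y.1 i * (star a * star (y.1 j)) = (a * star a) * (y.1 i * star (y.1 j)) :=
        fun i j => by ring
      simp only [this, ← Finset.mul_sum]
      rw [mul_div_mul_left]
      simpa using ha0
    · intro h
      obtain ⟨j, hj⟩ : ∃ j, x.1 j ≠ 0 := by
        by_contra! hc
        exact x.2 (funext hc)
      have hx := hN x
      have hy := hN y
      have hj' : star (x.1 j) ≠ 0 := by simpa using hj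
      refine ⟨(star (y.1 j) / ∑ i, y.1 i * star (y.1 i)) * ((∑ i, x.1 i * star (x.1 i)) /
        star (x.1 j)), ?_⟩
      ext i
      have h1 := congrFun (congrFun h i) j
      simp only [g] at h1
      rw [div_eq_div_iff hx hy] at h1
      simp only [Pi.smul_apply, smul_eq_mul]
      field_simp
      linear_combination -h1
  have h1 : Function.Injective (fun p : Proj n => g ⟨p.rep, p.rep_nonzero⟩) := by
    intro p q hpq
    have := (hgl _ _).2 hpq
    simpa [toProj, Projectivization.mk_rep] using this
  refine T2Space.of_injective_continuous h1 ?_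
  rw [← isOpenQuotientMap_toProj.continuous_comp_iff]
  convert hg using 1
  ext1 x
  refine ((hgl _ _).1 ?_)
  exact Projectivization.mk_rep _

instance : CompactSpace (Proj n) := by
  have : CompactSpace (Metric.sphere (0 : Fin (n + 1) → ℂ) 1) :=
    isCompact_iff_compactSpace.1 (isCompact_sphere _ _)
  have hne : ∀ x : Metric.sphere (0 : Fin (n + 1) → ℂ) 1, x.1 ≠ 0 := fun x h => by
    have := x.2; simp [h] at this
  let g : Metric.sphere (0 : Fin (n + 1) → ℂ) 1 → Proj n := fun x => toProj ⟨x.1, hne x⟩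
  have hg : Continuous g := continuous_toProj.comp (continuous_subtype_val.subtype_mk _)
  refine Function.Surjective.compactSpace (f := g) hg (fun p => ?_)
  have hp : ‖p.rep‖ ≠ 0 := norm_ne_zero_iff.2 p.rep_nonzero
  refine ⟨⟨(‖p.rep‖⁻¹ : ℂ) • p.rep, by simp [norm_smul, hp]⟩, ?_⟩
  conv_rhs => rw [← p.mk_rep]
  exact (Projectivization.mk_eq_mk_iff' ..).2 ⟨_, rfl⟩

/-- The affine cone over the complement of a projective hypersurface. -/
abbrev OpenCone (f : MvPolynomial (Fin (n + 1)) ℂ) : Type :=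
  {x : Fin (n + 1) → ℂ // eval x f ≠ 0}

lemma isOpen_openCone (f : MvPolynomial (Fin (n + 1)) ℂ) :
    IsOpen {x : Fin (n + 1) → ℂ | eval x f ≠ 0} :=
  isOpen_ne_fun (continuous_eval_poly f) continuous_const

variable {f : MvPolynomial (Fin (n + 1)) ℂ} {d : ℕ} (hf : f.IsHomogeneous d) (hd : 0 < d)

include hf hd in
lemma ne_zero_of_eval_ne_zero {x : Fin (n + 1) → ℂ} (hx : eval x f ≠ 0) : x ≠ 0 := by
  rintro rfl
  exact hx (eval_zero_of_isHomogeneous hf hd)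

lemma exists_rep_eq_smul (x : Fin (n + 1) → ℂ) (hx : x ≠ 0) :
    ∃ a : ℂ, a ≠ 0 ∧ (Projectivization.mk ℂ x hx).rep = a • x := by
  obtain ⟨a, ha⟩ := Projectivization.exists_smul_eq_mk_rep ℂ x hx
  exact ⟨a, a.ne_zero, ha.symm⟩

include hf in
lemma mk_mem_principalOpen {x : Fin (n + 1) → ℂ} (hx : x ≠ 0) :
    Projectivization.mk ℂ x hx ∈ principalOpen f ↔ eval x f ≠ 0 := by
  obtain ⟨a, ha, h⟩ := exists_rep_eq_smul x hx
  simp [principalOpen, h, eval_smul_of_isHomogeneous hf, ha]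

/-- The projection of the open cone onto the complement of the hypersurface. -/
def coneProj (x : OpenCone f) : ↥(principalOpen f) :=
  ⟨Projectivization.mk ℂ x.1 (ne_zero_of_eval_ne_zero hf hd x.2),
    (mk_mem_principalOpen hf _).2 x.2⟩

/-- A lift of a point of the complement to the open cone. -/
def coneRep (x : ↥(principalOpen f)) : OpenCone f := ⟨x.1.rep, x.2⟩

@[simp] lemma coneProj_coneRep (x : ↥(principalOpen f)) : coneProj hf hd (coneRep x) = x :=
  Subtype.ext (Projectivization.mk_rep _)

lemma coneProj_eq_iff (x y : OpenCone f) :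
    coneProj hf hd x = coneProj hf hd y ↔ ∃ a : ℂ, a ≠ 0 ∧ y.1 = a • x.1 := by
  rw [coneProj, coneProj, Subtype.mk.injEq, Projectivization.mk_eq_mk_iff']
  constructor
  · rintro ⟨a, ha⟩
    have ha0 : a ≠ 0 := by
      rintro rfl
      exact ne_zero_of_eval_ne_zero hf hd x.2 (by simpa using ha.symm)
    exact ⟨a⁻¹, inv_ne_zero ha0, by rw [← ha, smul_smul, inv_mul_cancel₀ ha0, one_smul]⟩
  · rintro ⟨a, ha, h⟩
    exact ⟨a⁻¹, by rw [h, smul_smul, inv_mul_cancel₀ ha, one_smul]⟩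

lemma exists_coneRep_coneProj (x : OpenCone f) :
    ∃ a : ℂ, a ≠ 0 ∧ (coneRep (coneProj hf hd x)).1 = a • x.1 :=
  (coneProj_eq_iff hf hd _ _).1 (coneProj_coneRep hf hd _).symm

lemma isOpenQuotientMap_coneProj : IsOpenQuotientMap (coneProj hf hd) := by
  refine ⟨fun x => ⟨coneRep x, coneProj_coneRep hf hd x⟩, ?_, fun U hU => ?_⟩
  · refine Continuous.subtype_mk ?_ _
    exact continuous_toProj.comp (continuous_subtype_val.subtype_mk
      fun x : OpenCone f => ne_zero_of_eval_ne_zero hf hd x.2)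
  · have h1 : IsOpen (Subtype.val '' U) := (isOpen_openCone f).isOpenMap_subtype_val U hU
    have h2 : IsOpen (toProj '' (Subtype.val ⁻¹' (Subtype.val '' U))) :=
      isOpenQuotientMap_toProj.isOpenMap _ (h1.preimage continuous_subtype_val)
    convert h2.preimage (continuous_subtype_val (p := (· ∈ principalOpen f)))
    ext y
    simp only [mem_image, mem_preimage]
    constructor
    · rintro ⟨x, hx, rfl⟩
      exact ⟨⟨x.1, ne_zero_of_eval_ne_zero hf hd x.2⟩, ⟨x, hx, rfl⟩, rfl⟩
    · rintro ⟨x, ⟨z, hz, hzx⟩, hxy⟩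
      refine ⟨z, hz, Subtype.ext ?_⟩
      rw [← hxy]
      simp only [coneProj, toProj, hzx]

lemma continuous_coneProj : Continuous (coneProj hf hd) :=
  (isOpenQuotientMap_coneProj hf hd).continuous

instance : T3Space ↥(principalOpen f) := inferInstance

end

section
open Set Filter Topology

variable {n : ℕ}

/-- Coordinatewise complex conjugation. -/
def conjE : EuclideanSpace ℂ (Fin n) →L[ℝ] EuclideanSpace ℂ (Fin n) :=
  (((EuclideanSpace.equiv (Fin n) ℂ).symm.toContinuousLinearMap.restrictScalars ℝ).comp
    (ContinuousLinearMap.pi fun i => (Complex.conjCLE.toContinuousLinearMap).comp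
      (ContinuousLinearMap.proj (R := ℝ) (φ := fun _ : Fin n => ℂ) i))).comp
    ((EuclideanSpace.equiv (Fin n) ℂ).toContinuousLinearMap.restrictScalars ℝ)

@[simp] lemma conjE_apply (z : EuclideanSpace ℂ (Fin n)) (i : Fin n) :
    conjE z i = (starRingEnd ℂ) (z i) := rfl

@[simp] lemma norm_conjE (z : EuclideanSpace ℂ (Fin n)) : ‖conjE z‖ = ‖z‖ := by
  simp [EuclideanSpace.norm_eq]

/-- The standard hermitian product. -/
def hermDot {m : ℕ} (x y : Fin m → ℂ) : ℂ := ∑ i, x i * (starRingEnd ℂ) (y i)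

lemma hermDot_self_eq {m : ℕ} (x : Fin m → ℂ) : hermDot x x = ((∑ i, ‖x i‖ ^ 2 : ℝ) : ℂ) := by
  simp [hermDot, Complex.mul_conj, Complex.normSq_eq_norm_sq]

lemma norm_sq_le_norm_hermDot_self {m : ℕ} (x : Fin m → ℂ) : ‖x‖ ^ 2 ≤ ‖hermDot x x‖ := by
  have h0 : 0 ≤ ∑ i, ‖x i‖ ^ 2 := Finset.sum_nonneg fun _ _ => by positivity
  rw [hermDot_self_eq, Complex.norm_real, Real.norm_of_nonneg h0]
  have h : ‖x‖ ≤ Real.sqrt (∑ i, ‖x i‖ ^ 2) := by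
    refine (pi_norm_le_iff_of_nonneg (Real.sqrt_nonneg _)).2 fun i => ?_
    refine Real.le_sqrt_of_sq_le ?_
    exact Finset.single_le_sum (f := fun i => ‖x i‖ ^ 2) (fun _ _ => by positivity)
      (Finset.mem_univ i)
  calc ‖x‖ ^ 2 ≤ Real.sqrt (∑ i, ‖x i‖ ^ 2) ^ 2 := by gcongr
    _ = _ := Real.sq_sqrt h0

lemma hermDot_self_eq_zero {m : ℕ} {x : Fin m → ℂ} : hermDot x x = 0 ↔ x = 0 := by
  constructor
  · intro h
    have := norm_sq_le_norm_hermDot_self x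
    rw [h, norm_zero] at this
    have h2 : ‖x‖ = 0 := by nlinarith [norm_nonneg x]
    exact norm_eq_zero.1 h2
  · rintro rfl; simp [hermDot]

lemma hermDot_smul_smul {m : ℕ} (a b : ℂ) (x y : Fin m → ℂ) :
    hermDot (a • x) (b • y) = a * (starRingEnd ℂ) b * hermDot x y := by
  simp only [hermDot, Pi.smul_apply, smul_eq_mul, map_mul, Finset.mul_sum]
  exact Finset.sum_congr rfl fun i _ => by ring

/-- The component of `c` orthogonal to `g`. -/
def orthPart {m : ℕ} (c g : Fin m → ℂ) : Fin m → ℂ := c - (hermDot c g / hermDot g g) • g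

lemma hermDot_orthPart {m : ℕ} (c g : Fin m → ℂ) : hermDot g (orthPart c g) = 0 := by
  by_cases hg : g = 0
  · simp [hg, hermDot]
  have hg' : hermDot g g ≠ 0 := fun h => hg (hermDot_self_eq_zero.1 h)
  have h1 : hermDot g (orthPart c g) =
      hermDot g c - (starRingEnd ℂ) (hermDot c g / hermDot g g) * hermDot g g := by
    simp only [hermDot, orthPart, Pi.sub_apply, Pi.smul_apply, smul_eq_mul, map_sub, map_mul,
      mul_sub, Finset.sum_sub_distrib, Finset.mul_sum]
    congr 1
    exact Finset.sum_congr rfl fun i _ => by ring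
  have h2 : ∀ x y : Fin m → ℂ, (starRingEnd ℂ) (hermDot x y) = hermDot y x := fun x y => by
    simp [hermDot, mul_comm]
  rw [h1, map_div₀, h2, h2, div_mul_cancel₀ _ hg', sub_self]

lemma hermDot_orthPart_left {m : ℕ} (c g : Fin m → ℂ) :
    hermDot c (orthPart c g) = hermDot (orthPart c g) (orthPart c g) := by
  have h := hermDot_orthPart c g
  have : hermDot (orthPart c g) (orthPart c g) = hermDot c (orthPart c g) -
      (hermDot c g / hermDot g g) * hermDot g (orthPart c g) := by
    conv_lhs => rw [hermDot]
    simp only [hermDot, orthPart, Pi.sub_apply, Pi.smul_apply, smul_eq_mul, sub_mul,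
      Finset.sum_sub_distrib, Finset.mul_sum, mul_assoc]
  rw [this, h, mul_zero, sub_zero]

lemma orthPart_smul {m : ℕ} (c g : Fin m → ℂ) {a : ℂ} (ha : a ≠ 0) :
    orthPart c (a • g) = orthPart c g := by
  have h1 : hermDot c (a • g) = (starRingEnd ℂ) a * hermDot c g := by
    simpa using hermDot_smul_smul 1 a c g
  have ha' : (starRingEnd ℂ) a ≠ 0 := by simpa using ha
  rw [orthPart, orthPart, h1, hermDot_smul_smul, smul_smul]
  congr 2
  by_cases hg : hermDot g g = 0
  · simp [hg]
  field_simp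

/-- A vector `w` with `∑ gᵢ wᵢ = 0` and `∑ cᵢ wᵢ = 1`, when `c` is not a multiple of `g`. -/
def transVec {m : ℕ} (c g : Fin m → ℂ) : Fin m → ℂ :=
  (hermDot (orthPart c g) (orthPart c g))⁻¹ • fun i => (starRingEnd ℂ) (orthPart c g i)

lemma dotForm_transVec {m : ℕ} (c g : Fin m → ℂ) : dotForm g (transVec c g) = 0 := by
  have := hermDot_orthPart c g
  rw [transVec, map_smul, dotForm_apply]
  simp only [hermDot] at this
  rw [this, smul_zero]

lemma dotForm_transVec' {m : ℕ} (c g : Fin m → ℂ) (h : orthPart c g ≠ 0) :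
    dotForm c (transVec c g) = 1 := by
  have := hermDot_orthPart_left c g
  rw [transVec, map_smul, dotForm_apply]
  have h0 : hermDot (orthPart c g) (orthPart c g) ≠ 0 := fun hh => h (hermDot_self_eq_zero.1 hh)
  conv at this => lhs; rw [hermDot]
  rw [this, smul_eq_mul, inv_mul_cancel₀ h0]

lemma norm_transVec_le {m : ℕ} (c g : Fin m → ℂ) {ε : ℝ} (hε : 0 < ε) (h : ε ≤ ‖orthPart c g‖) :
    ‖transVec c g‖ ≤ ε⁻¹ := by
  have h1 : ‖(fun i => (starRingEnd ℂ) (orthPart c g i))‖ = ‖orthPart c g‖ := by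
    simp [Pi.norm_def]
  have h2 := norm_sq_le_norm_hermDot_self (orthPart c g)
  have h3 : 0 < ‖orthPart c g‖ := hε.trans_le h
  rw [transVec, norm_smul, h1, norm_inv, inv_mul_le_iff₀ (lt_of_lt_of_le (by positivity) h2)]
  calc ‖orthPart c g‖ ≤ ‖orthPart c g‖ * (‖orthPart c g‖ * ε⁻¹) := by
        refine le_mul_of_one_le_right h3.le ?_
        rw [← div_eq_mul_inv, one_le_div hε]; exact h
    _ = ‖orthPart c g‖ ^ 2 * ε⁻¹ := by ring
    _ ≤ _ := by gcongr

lemma contDiff_hermDot {m : ℕ} {E : Type*} [NormedAddCommGroup E] [NormedSpace ℝ E]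
    {x y : E → Fin m → ℂ} {p : E} (hx : ContDiffAt ℝ 1 x p) (hy : ContDiffAt ℝ 1 y p) :
    ContDiffAt ℝ 1 (fun q => hermDot (x q) (y q)) p := by
  unfold hermDot
  refine ContDiffAt.sum fun i _ => ?_
  refine ContDiffAt.mul ((contDiffAt_pi (𝕜 := ℝ)).1 hx i) ?_
  exact Complex.conjCLE.contDiff.contDiffAt.comp p ((contDiffAt_pi (𝕜 := ℝ)).1 hy i)

lemma contDiffAt_orthPart {m : ℕ} {E : Type*} [NormedAddCommGroup E] [NormedSpace ℝ E]
    (c : Fin m → ℂ) {g : E → Fin m → ℂ} {p : E} (hg : ContDiffAt ℝ 1 g p) (h : g p ≠ 0) :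
    ContDiffAt ℝ 1 (fun q => orthPart c (g q)) p := by
  simp only [orthPart, div_eq_mul_inv]
  have h1 := (contDiff_hermDot (contDiffAt_const (c := c)) hg).mul ((contDiff_hermDot hg hg).inv
    fun hh => h (hermDot_self_eq_zero.1 hh))
  exact contDiffAt_const.sub (h1.smul hg)

lemma contDiffAt_transVec {m : ℕ} {E : Type*} [NormedAddCommGroup E] [NormedSpace ℝ E]
    (c : Fin m → ℂ) {g : E → Fin m → ℂ} {p : E} (hg : ContDiffAt ℝ 1 g p) (h : g p ≠ 0)
    (h' : orthPart c (g p) ≠ 0) :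
    ContDiffAt ℝ 1 (fun q => transVec c (g q)) p := by
  have ho := contDiffAt_orthPart c hg h
  unfold transVec
  refine ContDiffAt.smul ((contDiff_hermDot ho ho).inv fun hh => h' (hermDot_self_eq_zero.1 hh)) ?_
  refine contDiffAt_pi.2 fun i => ?_
  exact Complex.conjCLE.contDiff.contDiffAt.comp p ((contDiffAt_pi (𝕜 := ℝ)).1 ho i)

end

section
open Set Filter Topology

variable {n : ℕ}

lemma dotForm_smul_left {m : ℕ} (a : ℂ) (c x : Fin m → ℂ) :
    dotForm (a • c) x = a * dotForm c x := by
  simp [dotForm_apply, Finset.mul_sum, mul_assoc]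

/-- Local data of a tame Morse pair `(f, c)`: coordinates around the critical points of `f` on the
affine hyperplane `c · x = 1`, adapted to the quadratic part of `f`. -/
structure MorseData (f : MvPolynomial (Fin (n + 1)) ℂ) (c : Fin (n + 1) → ℂ) (k : ℕ) where
  κ : ℂ
  κ_re : κ.re = 1
  ch : Fin k → ((Fin (n + 1) → ℂ) ≃L[ℂ] ℂ × EuclideanSpace ℂ (Fin n))
  ch_fst : ∀ i x, (ch i x).1 = dotForm c x
  δ : ℝ
  δ_pos : 0 < δ
  δ_le : δ ≤ 1
  eval_ne : ∀ i z, ‖z‖ ≤ δ → eval ((ch i).symm (1, z)) f ≠ 0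
  rho : ∀ i z, ‖z‖ ≤ δ →
    ‖dotForm (gradAt f ((ch i).symm (1, z))) ((ch i).symm (0, conjE z)) -
      2 * κ * ‖z‖ ^ 2 * eval ((ch i).symm (1, z)) f‖ ≤ ‖z‖ ^ 2 * ‖eval ((ch i).symm (1, z)) f‖
  disj : ∀ i j x, dotForm c x ≠ 0 → ‖(ch i x).2‖ ≤ δ * ‖dotForm c x‖ →
    ‖(ch j x).2‖ ≤ δ * ‖dotForm c x‖ → i = j
  ε : ℝ
  ε_pos : 0 < ε
  orth_bound : ∀ x, eval x f ≠ 0 → (∀ i, δ / 2 * ‖dotForm c x‖ ≤ ‖(ch i x).2‖) →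
    ε ≤ ‖orthPart c (gradAt f x)‖
  a : ℝ
  a_pos : 0 < a
  a_lt : 2 * a ^ 2 < (δ / 2) ^ 2
  gain : ∀ i j, eval ((ch i).symm (1, 0)) f = eval ((ch j).symm (1, 0)) f →
    ∀ z w, ‖z‖ ^ 2 ≤ 2 * a ^ 2 → ‖w‖ ^ 2 ≤ 2 * a ^ 2 →
      Real.log ‖eval ((ch j).symm (1, w)) f‖ - Real.log ‖eval ((ch i).symm (1, z)) f‖ <
        δ ^ 2 / 8 - a ^ 2
  sep : ∀ i j, eval ((ch i).symm (1, 0)) f ≠ eval ((ch j).symm (1, 0)) f →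
    ∀ z w, ‖z‖ ≤ δ → ‖w‖ ≤ δ → ∀ τ : ℝ, 0 ≤ τ →
      eval ((ch j).symm (1, w)) f ≠ eval ((ch i).symm (1, z)) f * Complex.exp (κ * τ)

namespace MorseData

variable {f : MvPolynomial (Fin (n + 1)) ℂ} {c : Fin (n + 1) → ℂ} {k : ℕ} (D : MorseData f c k)

/-- The cutoff function around the `i`-th critical line. -/
def chi (i : Fin k) (x : Fin (n + 1) → ℂ) : ℝ :=
  Real.smoothTransition (((3 / 4 * D.δ) ^ 2 * ‖dotForm c x‖ ^ 2 - ‖(D.ch i x).2‖ ^ 2) /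
    ((D.δ / 2) ^ 2 * (‖dotForm c x‖ ^ 2 + ‖(D.ch i x).2‖ ^ 2)))

lemma norm_pos_of_ne (i : Fin k) {x : Fin (n + 1) → ℂ} (hx : x ≠ 0) :
    0 < ‖dotForm c x‖ ^ 2 + ‖(D.ch i x).2‖ ^ 2 := by
  by_contra! h
  have h1 : ‖dotForm c x‖ = 0 := by nlinarith [sq_nonneg ‖dotForm c x‖, sq_nonneg ‖(D.ch i x).2‖]
  have h2 : ‖(D.ch i x).2‖ = 0 := by
    nlinarith [sq_nonneg ‖dotForm c x‖, sq_nonneg ‖(D.ch i x).2‖]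
  apply hx
  apply (D.ch i).injective
  rw [map_zero]
  ext1
  · rw [D.ch_fst]; simpa using h1
  · simpa using h2

lemma chi_nonneg (i : Fin k) (x) : 0 ≤ D.chi i x := Real.smoothTransition.nonneg _

lemma chi_le_one (i : Fin k) (x) : D.chi i x ≤ 1 := Real.smoothTransition.le_one _

lemma chi_eq_zero (i : Fin k) {x} (h : 3 / 4 * D.δ * ‖dotForm c x‖ ≤ ‖(D.ch i x).2‖) :
    D.chi i x = 0 := by
  have := D.δ_pos
  refine Real.smoothTransition.zero_of_nonpos (div_nonpos_of_nonpos_of_nonneg ?_ (by positivity))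
  rw [← mul_pow, sub_nonpos]
  gcongr

lemma chi_eq_one (i : Fin k) {x} (h0 : x ≠ 0) (h : ‖(D.ch i x).2‖ ≤ D.δ / 2 * ‖dotForm c x‖) :
    D.chi i x = 1 := by
  have hδ := D.δ_pos
  have hδ1 := D.δ_le
  refine Real.smoothTransition.one_of_one_le ?_
  have := D.norm_pos_of_ne i h0
  rw [one_le_div (by positivity)]
  have h2 : ‖(D.ch i x).2‖ ^ 2 ≤ (D.δ / 2 * ‖dotForm c x‖) ^ 2 := by gcongr
  have h3 : D.δ ^ 2 * ‖dotForm c x‖ ^ 2 * D.δ ^ 2 ≤ D.δ ^ 2 * ‖dotForm c x‖ ^ 2 :=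
    mul_le_of_le_one_right (by positivity) (by nlinarith)
  have h4 : D.δ ^ 2 * ‖(D.ch i x).2‖ ^ 2 ≤ D.δ ^ 2 * (D.δ / 2 * ‖dotForm c x‖) ^ 2 := by gcongr
  nlinarith

lemma chi_smul (i : Fin k) {a : ℂ} (ha : a ≠ 0) (x) : D.chi i (a • x) = D.chi i x := by
  have h : ‖a‖ ^ 2 ≠ 0 := by simpa using ha
  unfold chi
  simp only [map_smul, Prod.smul_snd, norm_smul, mul_pow]
  rw [show ∀ A B C E : ℝ, A * (‖a‖ ^ 2 * B) - ‖a‖ ^ 2 * C = ‖a‖ ^ 2 * (A * B - C) by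
    intros; ring, show ∀ A B C E : ℝ, A * (‖a‖ ^ 2 * B + ‖a‖ ^ 2 * C) = ‖a‖ ^ 2 * (A * (B + C)) by
    intros; ring, mul_div_mul_left _ _ h] <;> exact 0

lemma norm_le_of_chi_ne_zero {i : Fin k} {x} (h : D.chi i x ≠ 0) :
    ‖(D.ch i x).2‖ < 3 / 4 * D.δ * ‖dotForm c x‖ := by
  by_contra! hh
  exact h (D.chi_eq_zero i hh)

lemma dotForm_ne_of_chi_ne_zero {i : Fin k} {x} (h : D.chi i x ≠ 0) : dotForm c x ≠ 0 := by
  intro h0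
  have := D.norm_le_of_chi_ne_zero h
  rw [h0] at this
  simp at this
  linarith [norm_nonneg (D.ch i x).2]

lemma chi_unique {i j : Fin k} {x} (hi : D.chi i x ≠ 0) (hj : D.chi j x ≠ 0) : i = j := by
  have hδ := D.δ_pos
  have := D.dotForm_ne_of_chi_ne_zero hi
  refine D.disj i j x this ((D.norm_le_of_chi_ne_zero hi).le.trans ?_)
    ((D.norm_le_of_chi_ne_zero hj).le.trans ?_) <;> gcongr <;> linarith

lemma contDiffAt_norm_sq (i : Fin k) (x : Fin (n + 1) → ℂ) :
    ContDiffAt ℝ 1 (fun y => ‖(D.ch i y).2‖ ^ 2) x := by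
  have h2 : ContDiff ℝ 1 (fun y => (D.ch i y).2) :=
    contDiff_snd.comp ((D.ch i).contDiff.restrict_scalars ℝ)
  exact (h2.norm_sq ℂ).contDiffAt

lemma contDiffAt_chi (i : Fin k) {x : Fin (n + 1) → ℂ} (hx : x ≠ 0) :
    ContDiffAt ℝ 1 (D.chi i) x := by
  have hδ := D.δ_pos
  have h1 : ContDiff ℝ 1 (fun y => dotForm c y) := (dotForm c).contDiff.restrict_scalars ℝ
  have h3 := (h1.norm_sq ℂ).contDiffAt (x := x)
  have h4 := D.contDiffAt_norm_sq i x
  refine Real.smoothTransition.contDiffAt.comp x (ContDiffAt.div ?_ ?_ ?_)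
  · exact (contDiffAt_const.mul h3).sub h4
  · exact contDiffAt_const.mul (h3.add h4)
  · exact (mul_pos (by positivity) (D.norm_pos_of_ne i hx)).ne'

/-- The sum of the cutoff functions. -/
def chiSum (x : Fin (n + 1) → ℂ) : ℝ := ∑ i, D.chi i x

lemma chiSum_eq {i : Fin k} {x} (hi : D.chi i x ≠ 0) : D.chiSum x = D.chi i x := by
  refine Finset.sum_eq_single i (fun j _ hj => ?_) (by simp)
  by_contra h
  exact hj (D.chi_unique h hi)

lemma chiSum_nonneg (x) : 0 ≤ D.chiSum x := Finset.sum_nonneg fun i _ => D.chi_nonneg i x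

lemma chiSum_le_one (x) : D.chiSum x ≤ 1 := by
  by_cases h : ∃ i, D.chi i x ≠ 0
  · obtain ⟨i, hi⟩ := h
    rw [D.chiSum_eq hi]; exact D.chi_le_one i x
  · push Not at h
    simp [chiSum, h]

lemma chiSum_smul {a : ℂ} (ha : a ≠ 0) (x) : D.chiSum (a • x) = D.chiSum x := by
  simp [chiSum, D.chi_smul _ ha]

lemma orthPart_bound {x} (hx : eval x f ≠ 0) (h0 : x ≠ 0) (h : D.chiSum x ≠ 1) :
    D.ε ≤ ‖orthPart c (gradAt f x)‖ := by
  refine D.orth_bound x hx fun i => ?_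
  by_contra! hi
  apply h
  have h1 := D.chi_eq_one i h0 hi.le
  rw [D.chiSum_eq (i := i) (by rw [h1]; exact one_ne_zero), h1]

/-- The transversal part of the vector field. -/
def U (x : Fin (n + 1) → ℂ) : Fin (n + 1) → ℂ :=
  (1 - D.chiSum x) • transVec c (gradAt f x)

lemma gradAt_dotForm_U (x) : dotForm (gradAt f x) (D.U x) = 0 := by
  have := dotForm_transVec c (gradAt f x)
  rw [U, ← Complex.coe_smul, map_smul, this, smul_zero]

lemma dotForm_U {x} (hx : eval x f ≠ 0) (h0 : x ≠ 0) :
    dotForm c (D.U x) = 1 - D.chiSum x := by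
  rw [U, ← Complex.coe_smul, map_smul]
  by_cases h : D.chiSum x = 1
  · simp [h]
  · rw [dotForm_transVec']
    · simp
    · intro h2
      have := D.orthPart_bound hx h0 h
      rw [h2, norm_zero] at this
      linarith [D.ε_pos]

lemma norm_U_le {x} (hx : eval x f ≠ 0) (h0 : x ≠ 0) : ‖D.U x‖ ≤ D.ε⁻¹ := by
  have hε := D.ε_pos
  rw [U, norm_smul]
  by_cases h : D.chiSum x = 1
  · simp [h, hε.le]
  · have h1 := norm_transVec_le c (gradAt f x) hε (D.orthPart_bound hx h0 h)
    have h2 : ‖1 - D.chiSum x‖ ≤ 1 := by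
      rw [Real.norm_eq_abs, abs_le]
      constructor <;> linarith [D.chiSum_le_one x, D.chiSum_nonneg x]
    calc _ ≤ 1 * D.ε⁻¹ := by gcongr
      _ = _ := one_mul _

lemma U_smul {d : ℕ} (hf : f.IsHomogeneous d) {a : ℂ} (ha : a ≠ 0) (x) : D.U (a • x) = D.U x := by
  simp only [U, D.chiSum_smul ha, gradAt_smul hf]
  have : orthPart c (a ^ (d - 1) • gradAt f x) = orthPart c (gradAt f x) :=
    orthPart_smul _ _ (pow_ne_zero _ ha)
  simp only [transVec, this]

lemma gradAt_ne_zero {d : ℕ} (hf : f.IsHomogeneous d) (hd : 0 < d) {x} (hx : eval x f ≠ 0) :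
    gradAt f x ≠ 0 := by
  intro h
  have := dotForm_gradAt_self hf x
  rw [h] at this
  have h2 : dotForm (0 : Fin (n + 1) → ℂ) x = 0 := by simp [dotForm_apply]
  rw [h2] at this
  have hd' : (d : ℂ) ≠ 0 := by exact_mod_cast hd.ne'
  exact mul_ne_zero hd' hx this.symm

lemma contDiffAt_chiSum {x : Fin (n + 1) → ℂ} (hx : x ≠ 0) : ContDiffAt ℝ 1 D.chiSum x :=
  ContDiffAt.sum fun i _ => D.contDiffAt_chi i hx

lemma continuous_ch_snd (i : Fin k) : Continuous fun x => (D.ch i x).2 :=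
  continuous_snd.comp (D.ch i).continuous

lemma contDiffAt_U {d : ℕ} (hf : f.IsHomogeneous d) (hd : 0 < d) {x} (hx : eval x f ≠ 0) :
    ContDiffAt ℝ 1 D.U x := by
  have h0 := ne_zero_of_eval_ne_zero hf hd hx
  by_cases h : orthPart c (gradAt f x) = 0
  · obtain ⟨i, hi⟩ : ∃ i, ‖(D.ch i x).2‖ < D.δ / 2 * ‖dotForm c x‖ := by
      by_contra! hh
      have := D.orth_bound x hx hh
      rw [h, norm_zero] at this
      linarith [D.ε_pos]
    have : ∀ᶠ y in 𝓝 x, D.U y = 0 := by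
      have h1 : ∀ᶠ y in 𝓝 x, ‖(D.ch i y).2‖ < D.δ / 2 * ‖dotForm c y‖ := by
        have h2 := D.continuous_ch_snd i
        exact (isOpen_lt (f := fun y => ‖(D.ch i y).2‖) (g := fun y => D.δ / 2 * ‖dotForm c y‖)
          (by fun_prop) (by fun_prop)).mem_nhds hi
      filter_upwards [h1, isOpen_ne.mem_nhds h0] with y hy hy0
      have h3 := D.chi_eq_one i hy0 hy.le
      rw [U, D.chiSum_eq (i := i) (by rw [h3]; exact one_ne_zero), h3]
      simp
    exact contDiffAt_const.congr_of_eventuallyEq this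
  · exact (contDiffAt_const.sub (D.contDiffAt_chiSum h0)).smul
      (contDiffAt_transVec c ((contDiff_gradAt f).restrict_scalars ℝ).contDiffAt
        (gradAt_ne_zero hf hd hx) h)

/-- The local gradient-like part of the vector field. -/
def Npart (i : Fin k) (x : Fin (n + 1) → ℂ) : Fin (n + 1) → ℂ :=
  D.chi i x • (D.ch i).symm (0, dotForm c x • conjE ((dotForm c x)⁻¹ • (D.ch i x).2))

lemma contDiffAt_Npart (i : Fin k) {x : Fin (n + 1) → ℂ} (hx : x ≠ 0) :
    ContDiffAt ℝ 1 (D.Npart i) x := by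
  by_cases h : dotForm c x = 0
  · have : ∀ᶠ y in 𝓝 x, D.Npart i y = 0 := by
      have h1 : ∀ᶠ y in 𝓝 x, 3 / 4 * D.δ * ‖dotForm c y‖ < ‖(D.ch i y).2‖ := by
        have h2 := D.continuous_ch_snd i
        refine (isOpen_lt (f := fun y => 3 / 4 * D.δ * ‖dotForm c y‖)
          (g := fun y => ‖(D.ch i y).2‖) (by fun_prop) (by fun_prop)).mem_nhds ?_
        have h3 := D.norm_pos_of_ne i hx
        rw [h] at h3
        simp only [mem_ofPred_eq, h, norm_zero, mul_zero]
        by_contra! h4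
        have h5 : ‖(D.ch i x).2‖ = 0 := le_antisymm h4 (norm_nonneg _)
        simp [h5] at h3
      filter_upwards [h1] with y hy
      rw [Npart, D.chi_eq_zero i hy.le, zero_smul]
    exact contDiffAt_const.congr_of_eventuallyEq this
  · have h1 : ContDiffAt ℝ 1 (fun y => dotForm c y) x :=
      ((dotForm c).contDiff.restrict_scalars ℝ).contDiffAt
    have h2 : ContDiffAt ℝ 1 (fun y => (D.ch i y).2) x :=
      (contDiff_snd.comp ((D.ch i).contDiff.restrict_scalars ℝ)).contDiffAt
    have h3 := h1.smul ((conjE (n := n)).contDiff.contDiffAt.comp x ((h1.inv h).smul h2))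
    have h4 := ((D.ch i).symm.contDiff.restrict_scalars ℝ).contDiffAt.comp x
      ((contDiffAt_const (c := (0 : ℂ))).prodMk h3)
    exact (D.contDiffAt_chi i hx).smul h4

/-- The vector field. -/
def field (x : Fin (n + 1) → ℂ) : Fin (n + 1) → ℂ :=
  -(D.κ * dotForm c x) • D.U x + ∑ i, D.Npart i x

lemma contDiffAt_field {d : ℕ} (hf : f.IsHomogeneous d) (hd : 0 < d) {x} (hx : eval x f ≠ 0) :
    ContDiffAt ℝ 1 D.field x := by
  have h0 := ne_zero_of_eval_ne_zero hf hd hx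
  have h1 : ContDiffAt ℝ 1 (fun y => dotForm c y) x :=
    ((dotForm c).contDiff.restrict_scalars ℝ).contDiffAt
  exact ((contDiffAt_const.mul h1).neg.smul (D.contDiffAt_U hf hd hx)).add
    (ContDiffAt.sum fun i _ => D.contDiffAt_Npart i h0)

lemma Npart_smul (i : Fin k) {a : ℂ} (ha : a ≠ 0) (x) : D.Npart i (a • x) = a • D.Npart i x := by
  unfold Npart
  have h1 : (dotForm c (a • x))⁻¹ • (D.ch i (a • x)).2 = (dotForm c x)⁻¹ • (D.ch i x).2 := by
    simp only [map_smul, smul_eq_mul, Prod.smul_snd, smul_smul, mul_inv]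
    congr 1
    field_simp
  have h2 : ∀ z : EuclideanSpace ℂ (Fin n), ((0 : ℂ), a • z) = a • ((0 : ℂ), z) := fun z => by
    ext <;> simp
  rw [h1, D.chi_smul i ha, map_smul, smul_eq_mul, mul_smul, h2, map_smul, smul_comm]

lemma field_smul {d : ℕ} (hf : f.IsHomogeneous d) {a : ℂ} (ha : a ≠ 0) (x) :
    D.field (a • x) = a • D.field x := by
  simp only [field, D.U_smul hf ha, D.Npart_smul _ ha, map_smul, smul_eq_mul, smul_add,
    Finset.smul_sum, smul_smul]
  congr 2
  ring

lemma dotForm_Npart (i : Fin k) (x) : dotForm c (D.Npart i x) = 0 := by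
  rw [Npart, ← Complex.coe_smul, map_smul, ← D.ch_fst i]
  simp

lemma dotForm_field {x} (hx : eval x f ≠ 0) (h0 : x ≠ 0) :
    dotForm c (D.field x) = -(D.κ * (1 - D.chiSum x)) * dotForm c x := by
  rw [field, map_add, map_smul, D.dotForm_U hx h0, map_sum]
  simp only [D.dotForm_Npart, Finset.sum_const_zero, smul_eq_mul]
  ring

lemma field_eq_zero {x} (hx : dotForm c x = 0) : D.field x = 0 := by
  have h : ∀ i, D.Npart i x = 0 := fun i => by
    have : D.chi i x = 0 := D.chi_eq_zero i (by simp [hx])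
    rw [Npart, this, zero_smul]
  simp [field, hx, h]

/-- The affine coordinate of a point near the `i`-th critical line. -/
def zeta (i : Fin k) (x : Fin (n + 1) → ℂ) : EuclideanSpace ℂ (Fin n) :=
  (dotForm c x)⁻¹ • (D.ch i x).2

lemma zeta_smul (i : Fin k) {a : ℂ} (ha : a ≠ 0) (x) : D.zeta i (a • x) = D.zeta i x := by
  simp only [zeta, map_smul, smul_eq_mul, Prod.smul_snd, smul_smul, mul_inv]
  congr 1
  field_simp

lemma norm_zeta {i : Fin k} {x} (hx : dotForm c x ≠ 0) (r : ℝ) :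
    ‖D.zeta i x‖ ≤ r ↔ ‖(D.ch i x).2‖ ≤ r * ‖dotForm c x‖ := by
  rw [zeta, norm_smul, norm_inv, inv_mul_le_iff₀ (norm_pos_iff.2 hx), mul_comm]

lemma smul_symm_zeta {i : Fin k} {x} (hx : dotForm c x ≠ 0) :
    dotForm c x • (D.ch i).symm (1, D.zeta i x) = x := by
  apply (D.ch i).injective
  rw [map_smul, ContinuousLinearEquiv.apply_symm_apply]
  ext1
  · simp [D.ch_fst]
  · simp [zeta, smul_smul, hx]

lemma dotForm_symm (i : Fin k) (s : ℂ) (z) : dotForm c ((D.ch i).symm (s, z)) = s := by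
  rw [← D.ch_fst i]; simp

lemma zeta_symm (i : Fin k) (z) : D.zeta i ((D.ch i).symm (1, z)) = z := by
  simp [zeta, D.dotForm_symm]

/-- The logarithmic derivative of `f` in the `i`-th ball along the local part of the field. -/
def rhoLoc (f : MvPolynomial (Fin (n + 1)) ℂ) {c} {k} (D : MorseData f c k) (i : Fin k)
    (z : EuclideanSpace ℂ (Fin n)) : ℂ :=
  dotForm (gradAt f ((D.ch i).symm (1, z))) ((D.ch i).symm (0, conjE z)) /
    eval ((D.ch i).symm (1, z)) f

lemma norm_rhoLoc_sub_le (i : Fin k) {z} (hz : ‖z‖ ≤ D.δ) :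
    ‖D.rhoLoc f i z - 2 * D.κ * ‖z‖ ^ 2‖ ≤ ‖z‖ ^ 2 := by
  have h1 := D.eval_ne i z hz
  have h2 := D.rho i z hz
  rw [rhoLoc, div_sub' h1, norm_div, div_le_iff₀ (norm_pos_iff.2 h1), mul_comm (eval _ f)]
  exact h2

lemma sq_le_re_rhoLoc (i : Fin k) {z} (hz : ‖z‖ ≤ D.δ) : ‖z‖ ^ 2 ≤ (D.rhoLoc f i z).re := by
  have h1 := D.norm_rhoLoc_sub_le i hz
  have h2 := (abs_le.1 ((Complex.abs_re_le_norm _).trans h1)).1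
  have h3 : (2 * D.κ * (‖z‖ : ℂ) ^ 2).re = 2 * ‖z‖ ^ 2 := by
    rw [← Complex.ofReal_pow, Complex.re_mul_ofReal]
    simp [D.κ_re]
  rw [Complex.sub_re, h3] at h2
  linarith

lemma norm_rhoLoc_le (i : Fin k) {z} (hz : ‖z‖ ≤ D.δ) :
    ‖D.rhoLoc f i z‖ ≤ 2 * ‖D.κ‖ + 1 := by
  have h1 := D.norm_rhoLoc_sub_le i hz
  have h4 : ‖z‖ ^ 2 ≤ 1 := pow_le_one₀ (norm_nonneg _) (hz.trans D.δ_le)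
  have h3 : ‖2 * D.κ * (‖z‖ : ℂ) ^ 2‖ ≤ 2 * ‖D.κ‖ := by
    simp only [norm_mul, norm_pow, Complex.norm_real, norm_norm, Complex.norm_ofNat]
    exact mul_le_of_le_one_right (by positivity) h4
  calc ‖D.rhoLoc f i z‖ = ‖(D.rhoLoc f i z - 2 * D.κ * ‖z‖ ^ 2) + 2 * D.κ * ‖z‖ ^ 2‖ := by
        rw [sub_add_cancel]
    _ ≤ _ := (norm_add_le _ _).trans (by linarith)

lemma dotForm_gradAt_Npart {d : ℕ} (hf : f.IsHomogeneous d) (hd : 0 < d) (i : Fin k)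
    {x} (h : D.chi i x ≠ 0) :
    dotForm (gradAt f x) (D.Npart i x) = D.chi i x * D.rhoLoc f i (D.zeta i x) * eval x f := by
  have hl := D.dotForm_ne_of_chi_ne_zero h
  have hz : ‖D.zeta i x‖ ≤ D.δ := by
    rw [D.norm_zeta hl]
    refine (D.norm_le_of_chi_ne_zero h).le.trans ?_
    have := D.δ_pos
    gcongr; linarith
  have h1 := D.eval_ne i _ hz
  rw [Npart, ← Complex.coe_smul, map_smul, smul_eq_mul, mul_assoc]
  congr 1
  rw [rhoLoc, div_mul_eq_mul_div, eq_div_iff h1]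
  have h2 : ((0 : ℂ), dotForm c x • conjE ((dotForm c x)⁻¹ • (D.ch i x).2)) =
    dotForm c x • ((0 : ℂ), conjE (D.zeta i x)) := by ext <;> simp [zeta]
  rw [h2, map_smul, map_smul]
  set y := (D.ch i).symm (1, D.zeta i x) with hy
  have h3 : x = dotForm c x • y := (D.smul_symm_zeta hl).symm
  have h4 : eval x f = dotForm c x ^ d * eval y f := by
    conv_lhs => rw [h3]
    exact eval_smul_of_isHomogeneous hf _ _
  have h5 : gradAt f x = dotForm c x ^ (d - 1) • gradAt f y := by
    conv_lhs => rw [h3]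
    exact gradAt_smul hf _ _
  have h6 : ∀ v, dotForm (gradAt f x) v = dotForm c x ^ (d - 1) * dotForm (gradAt f y) v := by
    intro v
    rw [h5, dotForm_smul_left]
  rw [h4, h6, smul_eq_mul]
  obtain ⟨e, rfl⟩ : ∃ e, d = e + 1 := ⟨d - 1, by omega⟩
  simp only [Nat.add_sub_cancel, pow_succ]
  ring

/-- The logarithmic derivative of `f` along the field. -/
def rhoF (x : Fin (n + 1) → ℂ) : ℂ := ∑ i, D.chi i x * D.rhoLoc f i (D.zeta i x)

lemma dotForm_gradAt_field {d : ℕ} (hf : f.IsHomogeneous d) (hd : 0 < d) (x) :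
    dotForm (gradAt f x) (D.field x) = D.rhoF x * eval x f := by
  rw [field, map_add, map_smul, D.gradAt_dotForm_U, smul_zero, zero_add, map_sum, rhoF,
    Finset.sum_mul]
  refine Finset.sum_congr rfl fun i _ => ?_
  by_cases h : D.chi i x = 0
  · simp [h, Npart]
  · exact D.dotForm_gradAt_Npart hf hd i h

lemma rhoF_eq {i : Fin k} {x} (hi : D.chi i x ≠ 0) :
    D.rhoF x = D.chi i x * D.rhoLoc f i (D.zeta i x) := by
  refine Finset.sum_eq_single i (fun j _ hj => ?_) (by simp)
  have : D.chi j x = 0 := by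
    by_contra h
    exact hj (D.chi_unique h hi)
  simp [this]

lemma norm_zeta_le_of_chi_ne_zero {i : Fin k} {x} (h : D.chi i x ≠ 0) : ‖D.zeta i x‖ ≤ D.δ := by
  rw [D.norm_zeta (D.dotForm_ne_of_chi_ne_zero h)]
  refine (D.norm_le_of_chi_ne_zero h).le.trans ?_
  have := D.δ_pos
  gcongr; linarith

lemma norm_rhoF_le (x) : ‖D.rhoF x‖ ≤ 2 * ‖D.κ‖ + 1 := by
  by_cases h : ∃ i, D.chi i x ≠ 0
  · obtain ⟨i, hi⟩ := h
    rw [D.rhoF_eq hi, norm_mul, Complex.norm_real, Real.norm_of_nonneg (D.chi_nonneg i x)]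
    calc _ ≤ 1 * (2 * ‖D.κ‖ + 1) := by
          gcongr
          · exact D.chi_le_one i x
          · exact D.norm_rhoLoc_le i (D.norm_zeta_le_of_chi_ne_zero hi)
      _ = _ := one_mul _
  · push Not at h
    simp only [rhoF, h]
    simp; positivity

end MorseData

end

section
open Set Filter Topology

variable {n : ℕ}

/-- The exhaustion function of the open cone. -/
def exhaust (f : MvPolynomial (Fin (n + 1)) ℂ) (x : Fin (n + 1) → ℂ) : ℝ :=
  ∑ i, ‖x i‖ ^ 2 + (‖eval x f‖ ^ 2)⁻¹

lemma norm_sq_le_sum {m : ℕ} (x : Fin m → ℂ) : ‖x‖ ^ 2 ≤ ∑ i, ‖x i‖ ^ 2 := by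
  have h0 : 0 ≤ ∑ i, ‖x i‖ ^ 2 := Finset.sum_nonneg fun _ _ => by positivity
  have := norm_sq_le_norm_hermDot_self x
  rwa [hermDot_self_eq, Complex.norm_real, Real.norm_of_nonneg h0] at this

lemma contDiffAt_exhaust (f : MvPolynomial (Fin (n + 1)) ℂ) {x : Fin (n + 1) → ℂ}
    (hx : eval x f ≠ 0) : ContDiffAt ℝ 1 (exhaust f) x := by
  have h1 : ContDiff ℝ 1 (fun y : Fin (n + 1) → ℂ => eval y f) :=
    (contDiff_eval f).restrict_scalars ℝ
  refine ContDiffAt.add (ContDiffAt.sum fun i _ => ?_) (ContDiffAt.inv ?_ ?_)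
  · exact ((contDiff_apply ℝ ℂ i).norm_sq ℂ).contDiffAt
  · exact (h1.norm_sq ℂ).contDiffAt
  · simpa using hx

lemma isCompact_exhaust_le (f : MvPolynomial (Fin (n + 1)) ℂ) (R : ℝ) :
    IsCompact {x | x ∈ {x | eval x f ≠ 0} ∧ exhaust f x ≤ R} := by
  have hc := continuous_eval_poly f
  have h : {x | x ∈ {x | eval x f ≠ 0} ∧ exhaust f x ≤ R} =
      {x | (∑ i, ‖x i‖ ^ 2) * ‖eval x f‖ ^ 2 + 1 ≤ R * ‖eval x f‖ ^ 2} := by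
    ext x
    simp only [mem_ofPred_eq, exhaust]
    constructor
    · rintro ⟨h1, h2⟩
      have h3 : 0 < ‖eval x f‖ ^ 2 := by have := norm_pos_iff.2 h1; positivity
      calc _ = (∑ i, ‖x i‖ ^ 2 + (‖eval x f‖ ^ 2)⁻¹) * ‖eval x f‖ ^ 2 := by
            rw [add_mul, inv_mul_cancel₀ h3.ne']
        _ ≤ _ := by gcongr
    · intro h2
      have h1 : eval x f ≠ 0 := by
        intro h; rw [h] at h2; norm_num at h2
      have h3 : 0 < ‖eval x f‖ ^ 2 := by have := norm_pos_iff.2 h1; positivity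
      refine ⟨h1, le_of_mul_le_mul_right ?_ h3⟩
      rwa [add_mul, inv_mul_cancel₀ h3.ne']
  have h2 : {x | x ∈ {x | eval x f ≠ 0} ∧ exhaust f x ≤ R} ⊆ Metric.closedBall 0 (Real.sqrt R) := by
    rintro x ⟨-, hx⟩
    rw [mem_closedBall_zero_iff]
    refine Real.le_sqrt_of_sq_le ((norm_sq_le_sum x).trans (le_trans ?_ hx))
    exact le_add_of_nonneg_right (by positivity)
  refine Metric.isCompact_of_isClosed_isBounded ?_ (Metric.isBounded_closedBall.subset h2)
  rw [h]
  exact isClosed_le (f := fun x : Fin (n + 1) → ℂ => (∑ i, ‖x i‖ ^ 2) * ‖eval x f‖ ^ 2 + 1)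
    (g := fun x => R * ‖eval x f‖ ^ 2) (by fun_prop) (by fun_prop)

lemma abs_fderiv_exhaust_le_add (f : MvPolynomial (Fin (n + 1)) ℂ) {x v : Fin (n + 1) → ℂ}
    (hx : eval x f ≠ 0) {C ρ : ℝ} (hC : 0 ≤ C) (hv : ‖v‖ ≤ C * ‖x‖)
    (hfv : ‖dotForm (gradAt f x) v‖ ≤ ρ * ‖eval x f‖) :
    |fderiv ℝ (exhaust f) x v| ≤
      2 * (n + 1) * C * ∑ i, ‖x i‖ ^ 2 + 2 * ρ * (‖eval x f‖ ^ 2)⁻¹ := by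
  have hcurve : HasDerivAt (fun t : ℝ => x + t • v) v 0 := by
    simpa using ((hasDerivAt_id (0 : ℝ)).smul_const v).const_add x
  have h1 : HasDerivAt (fun t : ℝ => exhaust f (x + t • v)) (fderiv ℝ (exhaust f) x v) 0 := by
    have h2 : HasFDerivAt (exhaust f) (fderiv ℝ (exhaust f) x) (x + (0 : ℝ) • v) := by
      rw [zero_smul, add_zero]
      exact ((contDiffAt_exhaust f hx).differentiableAt one_ne_zero).hasFDerivAt
    exact h2.comp_hasDerivAt 0 hcurve
  have h2 : ∀ i, HasDerivAt (fun t : ℝ => ‖(x + t • v) i‖ ^ 2) (2 * inner ℝ (x i) (v i)) 0 := by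
    intro i
    have := ((hasDerivAt_pi.1 hcurve) i).norm_sq
    simpa using this
  have hf1 : HasDerivAt (fun t : ℝ => eval (x + t • v) f) (dotForm (gradAt f x) v) 0 := by
    have := HasDerivAt.eval_poly f hcurve
    simpa using this
  have h3 := hf1.norm_sq
  have hne : ‖eval (x + (0 : ℝ) • v) f‖ ^ 2 ≠ 0 := by simpa using hx
  have h4 := h3.inv hne
  have h5 := (HasDerivAt.fun_sum fun i (_ : i ∈ Finset.univ) => h2 i).add h4
  have h6 := h1.unique h5
  rw [h6]
  simp only [zero_smul, add_zero]
  have h7 : |∑ i, 2 * inner ℝ (x i) (v i)| ≤ 2 * (n + 1) * C * ∑ i, ‖x i‖ ^ 2 := by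
    calc _ ≤ ∑ i : Fin (n + 1), |2 * inner ℝ (x i) (v i)| := Finset.abs_sum_le_sum_abs _ _
      _ ≤ ∑ i : Fin (n + 1), 2 * (C * ‖x‖ ^ 2) := by
        refine Finset.sum_le_sum fun i _ => ?_
        rw [abs_mul, abs_two]
        gcongr
        calc _ ≤ ‖x i‖ * ‖v i‖ := abs_real_inner_le_norm _ _
          _ ≤ ‖x‖ * (C * ‖x‖) := by
            gcongr
            · exact norm_le_pi_norm _ _
            · exact (norm_le_pi_norm _ _).trans hv
          _ = _ := by ring
      _ = 2 * (n + 1) * C * ‖x‖ ^ 2 := by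
        rw [Finset.sum_const, Finset.card_univ, Fintype.card_fin, nsmul_eq_mul]; push_cast; ring
      _ ≤ _ := by gcongr; exact norm_sq_le_sum x
  have hp : 0 < ‖eval x f‖ := norm_pos_iff.2 hx
  have h8 : |-(2 * inner ℝ (eval x f) (dotForm (gradAt f x) v)) / (‖eval x f‖ ^ 2) ^ 2| ≤
      2 * ρ * (‖eval x f‖ ^ 2)⁻¹ := by
    rw [abs_div, abs_neg, abs_mul, abs_two, abs_of_pos (by positivity : 0 < (‖eval x f‖ ^ 2) ^ 2),
      div_le_iff₀ (by positivity)]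
    have : |inner ℝ (eval x f) (dotForm (gradAt f x) v)| ≤ ‖eval x f‖ * (ρ * ‖eval x f‖) :=
      (abs_real_inner_le_norm _ _).trans (by gcongr)
    calc _ ≤ 2 * (‖eval x f‖ * (ρ * ‖eval x f‖)) := by gcongr
      _ = _ := by field_simp
  exact (abs_add_le _ _).trans (add_le_add h7 h8)

lemma abs_fderiv_exhaust_le (f : MvPolynomial (Fin (n + 1)) ℂ) {x v : Fin (n + 1) → ℂ}
    (hx : eval x f ≠ 0) {C ρ : ℝ} (hC : 0 ≤ C) (hρ : 0 ≤ ρ) (hv : ‖v‖ ≤ C * ‖x‖)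
    (hfv : ‖dotForm (gradAt f x) v‖ ≤ ρ * ‖eval x f‖) :
    |fderiv ℝ (exhaust f) x v| ≤ (2 * (n + 1) * C + 2 * ρ) * exhaust f x := by
  have h9 : 0 ≤ ∑ i, ‖x i‖ ^ 2 := Finset.sum_nonneg fun _ _ => by positivity
  have h10 : 0 ≤ (‖eval x f‖ ^ 2)⁻¹ := by positivity
  calc _ ≤ _ := abs_fderiv_exhaust_le_add f hx hC hv hfv
    _ ≤ _ := by
      rw [exhaust]
      nlinarith [mul_nonneg (mul_nonneg (by positivity : (0:ℝ) ≤ 2 * (n + 1)) hC) h10,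
        mul_nonneg hρ h9]

namespace MorseData

variable {f : MvPolynomial (Fin (n + 1)) ℂ} {c : Fin (n + 1) → ℂ} {k : ℕ} (D : MorseData f c k)
variable {d : ℕ} (hf : f.IsHomogeneous d) (hd : 0 < d)

lemma norm_Npart_le (i : Fin k) (x) :
    ‖D.Npart i x‖ ≤ ‖((D.ch i).symm : (ℂ × EuclideanSpace ℂ (Fin n)) →L[ℂ] (Fin (n + 1) → ℂ))‖ *
      (‖((D.ch i) : (Fin (n + 1) → ℂ) →L[ℂ] (ℂ × EuclideanSpace ℂ (Fin n)))‖ * ‖x‖) := by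
  have h1 : ‖dotForm c x • conjE ((dotForm c x)⁻¹ • (D.ch i x).2)‖ ≤ ‖(D.ch i x).2‖ := by
    rw [norm_smul, norm_conjE, norm_smul, norm_inv, ← mul_assoc]
    refine mul_le_of_le_one_left (norm_nonneg _) ?_
    exact mul_inv_le_one
  have h2 : ‖(D.ch i x).2‖ ≤
      ‖((D.ch i) : (Fin (n + 1) → ℂ) →L[ℂ] (ℂ × EuclideanSpace ℂ (Fin n)))‖ * ‖x‖ :=
    (norm_snd_le _).trans
      (((D.ch i) : (Fin (n + 1) → ℂ) →L[ℂ] (ℂ × EuclideanSpace ℂ (Fin n))).le_opNorm x)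
  rw [Npart, norm_smul, Real.norm_of_nonneg (D.chi_nonneg i x)]
  refine (mul_le_of_le_one_left (norm_nonneg _) (D.chi_le_one i x)).trans ?_
  refine (((D.ch i).symm : (ℂ × EuclideanSpace ℂ (Fin n)) →L[ℂ]
    (Fin (n + 1) → ℂ)).le_opNorm _).trans ?_
  gcongr
  rw [Prod.norm_def]
  simpa using h1.trans h2

include hf hd in
lemma exists_norm_field_le : ∃ C : ℝ, 0 ≤ C ∧ ∀ x, eval x f ≠ 0 → ‖D.field x‖ ≤ C * ‖x‖ := by
  refine ⟨‖D.κ‖ * ‖dotForm c‖ * D.ε⁻¹ +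
    ∑ i, ‖((D.ch i).symm : (ℂ × EuclideanSpace ℂ (Fin n)) →L[ℂ] (Fin (n + 1) → ℂ))‖ *
      ‖((D.ch i) : (Fin (n + 1) → ℂ) →L[ℂ] (ℂ × EuclideanSpace ℂ (Fin n)))‖, ?_, fun x hx => ?_⟩
  · have := D.ε_pos
    positivity
  have h0 := ne_zero_of_eval_ne_zero hf hd hx
  have := D.ε_pos
  rw [field, add_mul, Finset.sum_mul]
  refine (norm_add_le _ _).trans (add_le_add ?_ ((norm_sum_le _ _).trans
    (Finset.sum_le_sum fun i _ => ?_)))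
  · rw [norm_smul, norm_neg, norm_mul]
    calc _ ≤ ‖D.κ‖ * (‖dotForm c‖ * ‖x‖) * D.ε⁻¹ := by
          gcongr
          · exact (dotForm c).le_opNorm x
          · exact D.norm_U_le hx h0
      _ = _ := by ring
  · rw [mul_assoc]; exact D.norm_Npart_le i x

include hf hd in
lemma exists_flowMap : ∃ Φ : ℝ → (Fin (n + 1) → ℂ) → (Fin (n + 1) → ℂ),
    (∀ x ∈ {x | eval x f ≠ 0}, Φ 0 x = x) ∧
    (∀ t, ∀ x ∈ {x | eval x f ≠ 0}, Φ t x ∈ {x | eval x f ≠ 0}) ∧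
    (∀ x ∈ {x | eval x f ≠ 0}, ∀ t, HasDerivAt (Φ · x) (D.field (Φ t x)) t) ∧
    ContinuousOn (Function.uncurry Φ) (univ ×ˢ {x | eval x f ≠ 0}) := by
  obtain ⟨C, hC0, hC⟩ := D.exists_norm_field_le hf hd
  refine exists_flow (isOpen_openCone f) (v := D.field) (B := exhaust f)
    (fun x hx => (D.contDiffAt_field hf hd hx).contDiffWithinAt)
    (fun x hx => (contDiffAt_exhaust f hx).contDiffWithinAt) (fun x _ => ?_)
    (isCompact_exhaust_le f) (C := 2 * (n + 1) * C + 2 * (2 * ‖D.κ‖ + 1)) fun x hx => ?_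
  · unfold exhaust; positivity
  · refine abs_fderiv_exhaust_le f hx hC0 (by positivity) (hC x hx) ?_
    rw [D.dotForm_gradAt_field hf hd, norm_mul]
    gcongr
    exact D.norm_rhoF_le x

/-- The flow of the vector field. -/
def flowMap : ℝ → (Fin (n + 1) → ℂ) → (Fin (n + 1) → ℂ) := (D.exists_flowMap hf hd).choose

lemma flowMap_zero {x} (hx : eval x f ≠ 0) : D.flowMap hf hd 0 x = x :=
  (D.exists_flowMap hf hd).choose_spec.1 x hx

lemma eval_flowMap_ne (t : ℝ) {x} (hx : eval x f ≠ 0) : eval (D.flowMap hf hd t x) f ≠ 0 :=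
  (D.exists_flowMap hf hd).choose_spec.2.1 t x hx

lemma hasDerivAt_flowMap (t : ℝ) {x} (hx : eval x f ≠ 0) :
    HasDerivAt (fun s => D.flowMap hf hd s x) (D.field (D.flowMap hf hd t x)) t :=
  (D.exists_flowMap hf hd).choose_spec.2.2.1 x hx t

lemma continuousOn_flowMap :
    ContinuousOn (Function.uncurry (D.flowMap hf hd)) (univ ×ˢ {x | eval x f ≠ 0}) :=
  (D.exists_flowMap hf hd).choose_spec.2.2.2

lemma flowMap_unique {g : ℝ → Fin (n + 1) → ℂ} (hg : ∀ t, eval (g t) f ≠ 0)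
    (hg' : ∀ t, HasDerivAt g (D.field (g t)) t) (t : ℝ) : D.flowMap hf hd t (g 0) = g t := by
  have := integralCurve_unique (t₀ := 0) (isOpen_openCone f) (v := D.field)
    (fun x hx => (D.contDiffAt_field hf hd hx).contDiffWithinAt)
    (f := fun s => D.flowMap hf hd s (g 0)) (g := g)
    (fun s => D.eval_flowMap_ne hf hd s (hg 0))
    (fun s => D.hasDerivAt_flowMap hf hd s (hg 0)) hg' (D.flowMap_zero hf hd (hg 0))
  exact congrFun this t

lemma flowMap_add (s t : ℝ) {x} (hx : eval x f ≠ 0) :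
    D.flowMap hf hd (s + t) x = D.flowMap hf hd s (D.flowMap hf hd t x) := by
  have := D.flowMap_unique hf hd (g := fun s => D.flowMap hf hd (s + t) x)
    (fun s => D.eval_flowMap_ne hf hd _ hx)
    (fun s => (D.hasDerivAt_flowMap hf hd (s + t) hx).comp_add_const s t) s
  simpa using this.symm

lemma flowMap_smul (t : ℝ) {a : ℂ} (ha : a ≠ 0) {x} (hx : eval x f ≠ 0) :
    D.flowMap hf hd t (a • x) = a • D.flowMap hf hd t x := by
  have := D.flowMap_unique hf hd (g := fun s => a • D.flowMap hf hd s x)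
    (fun s => by
      rw [eval_smul_of_isHomogeneous hf]
      exact mul_ne_zero (pow_ne_zero _ ha) (D.eval_flowMap_ne hf hd _ hx))
    (fun s => by
      rw [D.field_smul hf ha]
      exact (D.hasDerivAt_flowMap hf hd s hx).const_smul a) t
  simpa [D.flowMap_zero hf hd hx] using this

lemma flowMap_of_dotForm_eq_zero (t : ℝ) {x} (hx : eval x f ≠ 0) (h : dotForm c x = 0) :
    D.flowMap hf hd t x = x :=
  D.flowMap_unique hf hd (g := fun _ => x) (fun _ => hx)
    (fun s => by rw [D.field_eq_zero h]; exact hasDerivAt_const s x) t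

lemma dotForm_flowMap_ne (t : ℝ) {x} (hx : eval x f ≠ 0) (h : dotForm c x ≠ 0) :
    dotForm c (D.flowMap hf hd t x) ≠ 0 := by
  intro h0
  have h1 := D.flowMap_of_dotForm_eq_zero hf hd (-t) (D.eval_flowMap_ne hf hd t hx) h0
  rw [← D.flowMap_add hf hd _ _ hx, neg_add_cancel, D.flowMap_zero hf hd hx] at h1
  rw [← h1] at h0
  exact h h0

lemma hasDerivAt_dotForm_flowMap (t : ℝ) {x} (hx : eval x f ≠ 0) :
    HasDerivAt (fun s => dotForm c (D.flowMap hf hd s x))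
      (-(D.κ * (1 - D.chiSum (D.flowMap hf hd t x))) * dotForm c (D.flowMap hf hd t x)) t := by
  have h1 := D.eval_flowMap_ne hf hd t hx
  rw [← D.dotForm_field h1 (ne_zero_of_eval_ne_zero hf hd h1)]
  exact HasDerivAt.dotForm c (D.hasDerivAt_flowMap hf hd t hx)

lemma hasDerivAt_eval_flowMap (t : ℝ) {x} (hx : eval x f ≠ 0) :
    HasDerivAt (fun s => eval (D.flowMap hf hd s x) f)
      (D.rhoF (D.flowMap hf hd t x) * eval (D.flowMap hf hd t x) f) t := by
  rw [← D.dotForm_gradAt_field hf hd]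
  exact HasDerivAt.eval_poly f (D.hasDerivAt_flowMap hf hd t hx)

lemma continuous_flowMap_cone :
    Continuous fun p : ℝ × OpenCone f => D.flowMap hf hd p.1 p.2.1 := by
  have h := D.continuousOn_flowMap hf hd
  exact h.comp_continuous (f := fun p : ℝ × OpenCone f => (p.1, p.2.1)) (by fun_prop)
    fun p => ⟨mem_univ _, p.2.2⟩

end MorseData

end

section
open Set Filter Topology

lemma integralCurve_unique_on {E : Type*} [NormedAddCommGroup E] [NormedSpace ℝ E]
    {Ω : Set E} (hΩ : IsOpen Ω) {v : E → E} (hv : ContDiffOn ℝ 1 v Ω)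
    {f g : ℝ → E} (hfΩ : ∀ t, f t ∈ Ω) (hf : ∀ t, HasDerivAt f (v (f t)) t) {J : Set ℝ}
    (hJ : IsOpen J) (hJ' : _root_.IsPreconnected J) (hg : ∀ t ∈ J, HasDerivAt g (v (g t)) t) {t₀ : ℝ}
    (ht₀ : t₀ ∈ J) (h : f t₀ = g t₀) {t : ℝ} (ht : t ∈ J) : f t = g t := by
  have hsub : J ⊆ {t | t ∈ J ∧ f t = g t} := by
    refine hJ'.subset_of_closure_inter_subset ?_ ⟨t₀, ht₀, ht₀, h⟩ ?_
    · refine isOpen_iff_mem_nhds.2 fun t ⟨ht, hfg⟩ => ?_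
      obtain ⟨K, s, hs, hK⟩ := ((hv.contDiffAt (hΩ.mem_nhds (hfΩ t)))).exists_lipschitzOnWith
      have h1 : ∀ᶠ r in 𝓝 t, f r ∈ s := (hf t).continuousAt.eventually_mem hs
      have h2 : ∀ᶠ r in 𝓝 t, g r ∈ s := (hg t ht).continuousAt.eventually_mem (hfg ▸ hs)
      have h3 : f =ᶠ[𝓝 t] g := by
        refine ODE_solution_unique_of_eventually (v := fun _ => v) (s := fun _ => s) (K := K)
          (Eventually.of_forall fun _ => hK) ?_ ?_ hfg
        · filter_upwards [h1] with r hr using ⟨hf r, hr⟩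
        · filter_upwards [h2, hJ.mem_nhds ht] with r hr hrJ using ⟨hg r hrJ, hr⟩
      filter_upwards [h3, hJ.mem_nhds ht] with r hr hrJ using ⟨hrJ, hr⟩
    · rintro t ⟨ht, htJ⟩
      refine ⟨htJ, ?_⟩
      obtain ⟨u, hu, hut⟩ := mem_closure_iff_seq_limit.1 ht
      have h1 := ((hf t).continuousAt.tendsto.comp hut)
      have h2 := ((hg t htJ).continuousAt.tendsto.comp hut)
      refine tendsto_nhds_unique h1 (h2.congr fun m => ?_)
      exact (hu m).2.symm
  exact (hsub ht).2

lemma hasDerivAt_log_norm {p : ℝ → ℂ} {s : ℂ} {t : ℝ} (h : HasDerivAt p (s * p t) t)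
    (h0 : p t ≠ 0) : HasDerivAt (fun r => Real.log ‖p r‖) s.re t := by
  have h1 := h.norm_sq
  have h2 : ‖p t‖ ^ 2 ≠ 0 := by simpa using h0
  have h3 := (h1.log h2).div_const 2
  have h4 : (fun r => Real.log (‖p r‖ ^ 2) / 2) = fun r => Real.log ‖p r‖ := by
    ext r; rw [Real.log_pow]; push_cast; ring
  rw [h4] at h3
  have h5 : inner ℝ (p t) (s * p t) = s.re * ‖p t‖ ^ 2 := by
    rw [Complex.inner, mul_assoc, Complex.mul_conj, Complex.normSq_eq_norm_sq,
      Complex.re_mul_ofReal]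
  refine h3.congr_deriv ?_
  rw [h5]
  field_simp

variable {n : ℕ}

/-- The identification `ℝⁿ × ℝⁿ ≃ ℂⁿ`. -/
def cplx (p : EuclideanSpace ℝ (Fin n) × EuclideanSpace ℝ (Fin n)) : EuclideanSpace ℂ (Fin n) :=
  WithLp.toLp 2 fun i => (p.1 i : ℂ) + p.2 i * Complex.I

/-- The coordinatewise real and imaginary parts. -/
def uncplx (z : EuclideanSpace ℂ (Fin n)) : EuclideanSpace ℝ (Fin n) × EuclideanSpace ℝ (Fin n) :=
  (WithLp.toLp 2 fun i => (z i).re, WithLp.toLp 2 fun i => (z i).im)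

@[simp] lemma cplx_uncplx (z : EuclideanSpace ℂ (Fin n)) : cplx (uncplx z) = z := by
  ext i; simp [cplx, uncplx, Complex.re_add_im]

@[simp] lemma uncplx_cplx (p : EuclideanSpace ℝ (Fin n) × EuclideanSpace ℝ (Fin n)) :
    uncplx (cplx p) = p := by
  ext i <;> simp [cplx, uncplx]

lemma continuous_cplx : Continuous (cplx (n := n)) := by
  refine (PiLp.continuous_toLp 2 _).comp (continuous_pi fun i => ?_)
  fun_prop

lemma continuous_uncplx : Continuous (uncplx (n := n)) := by
  refine Continuous.prodMk ((PiLp.continuous_toLp 2 _).comp (continuous_pi fun i => ?_))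
    ((PiLp.continuous_toLp 2 _).comp (continuous_pi fun i => ?_))
  · fun_prop
  · fun_prop

lemma norm_cplx_sq (p : EuclideanSpace ℝ (Fin n) × EuclideanSpace ℝ (Fin n)) :
    ‖cplx p‖ ^ 2 = ‖p.1‖ ^ 2 + ‖p.2‖ ^ 2 := by
  simp only [EuclideanSpace.norm_sq_eq, cplx, ← Finset.sum_add_distrib]
  refine Finset.sum_congr rfl fun i _ => ?_
  rw [← Complex.normSq_eq_norm_sq, Complex.normSq_add_mul_I]
  simp

lemma hasDerivAt_cplx_hypFlow (p : EuclideanSpace ℝ (Fin n) × EuclideanSpace ℝ (Fin n)) (t : ℝ) :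
    HasDerivAt (fun s => cplx (hypFlow s p)) (conjE (cplx (hypFlow t p))) t := by
  have h : HasDerivAt (fun s : ℝ => fun i => ((Real.exp s * p.1 i : ℝ) : ℂ) +
      ((Real.exp (-s) * p.2 i : ℝ) : ℂ) * Complex.I)
      (fun i => ((Real.exp t * p.1 i : ℝ) : ℂ) - ((Real.exp (-t) * p.2 i : ℝ) : ℂ) * Complex.I) t := by
    refine hasDerivAt_pi.2 fun i => ?_
    have h1 := ((Real.hasDerivAt_exp t).mul_const (p.1 i)).ofReal_comp
    have h2 := (((Real.hasDerivAt_exp (-t)).comp t (hasDerivAt_neg t)).mul_const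
      (p.2 i)).ofReal_comp.mul_const Complex.I
    refine (h1.add h2).congr_deriv ?_
    push_cast; ring
  have h2 := (((EuclideanSpace.equiv (Fin n) ℂ).symm.toContinuousLinearMap.restrictScalars
    ℝ).hasFDerivAt).comp_hasDerivAt t h
  have h3 : conjE (cplx (hypFlow t p)) = WithLp.toLp 2 fun i => ((Real.exp t * p.1 i : ℝ) : ℂ) -
      ((Real.exp (-t) * p.2 i : ℝ) : ℂ) * Complex.I := by
    ext i
    simp [cplx, hypFlow, sub_eq_add_neg, ← Complex.exp_conj]
  rw [h3]
  exact h2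

end

section
open Set Filter Topology

namespace MorseData
variable {n : ℕ}
variable {f : MvPolynomial (Fin (n + 1)) ℂ} {c : Fin (n + 1) → ℂ} {k : ℕ} (D : MorseData f c k)
variable {d : ℕ} (hf : f.IsHomogeneous d) (hd : 0 < d)

/-- The function `f / ℓ ^ d` of degree zero. -/
def height (f : MvPolynomial (Fin (n + 1)) ℂ) (c : Fin (n + 1) → ℂ) (d : ℕ)
    (x : Fin (n + 1) → ℂ) : ℂ := eval x f * ((dotForm c x) ^ d)⁻¹

lemma height_ne {x} (hx : eval x f ≠ 0) (hl : dotForm c x ≠ 0) : height f c d x ≠ 0 :=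
  mul_ne_zero hx (inv_ne_zero (pow_ne_zero _ hl))

include hf in
lemma height_eq {i : Fin k} {x} (hl : dotForm c x ≠ 0) :
    height f c d x = eval ((D.ch i).symm (1, D.zeta i x)) f := by
  rw [height]
  conv_lhs => rw [← D.smul_symm_zeta (i := i) hl]
  rw [eval_smul_of_isHomogeneous hf, map_smul, D.dotForm_symm, smul_eq_mul, mul_one]
  field_simp

/-- The logarithmic derivative of the height along the flow. -/
def sig (d : ℕ) (x : Fin (n + 1) → ℂ) : ℂ := D.rhoF x + d * D.κ * (1 - D.chiSum x)

lemma hasDerivAt_height (t : ℝ) {x} (hx : eval x f ≠ 0) (hl : dotForm c x ≠ 0) :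
    HasDerivAt (fun s => height f c d (D.flowMap hf hd s x))
      (D.sig d (D.flowMap hf hd t x) * height f c d (D.flowMap hf hd t x)) t := by
  have hl' := D.dotForm_flowMap_ne hf hd t hx hl
  have h1 := D.hasDerivAt_eval_flowMap hf hd t hx
  have h2 := ((D.hasDerivAt_dotForm_flowMap hf hd t hx).pow d).inv (pow_ne_zero d hl')
  refine (h1.mul h2).congr_deriv ?_
  simp only [sig, height, Pi.pow_apply, Pi.inv_apply]
  obtain ⟨e, rfl⟩ : ∃ e, d = e + 1 := ⟨d - 1, by omega⟩
  simp only [Nat.add_sub_cancel]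
  field_simp
  ring

/-- The logarithm of the modulus of the height along the flow. -/
def logH (x : Fin (n + 1) → ℂ) (t : ℝ) : ℝ := Real.log ‖height f c d (D.flowMap hf hd t x)‖

lemma hasDerivAt_logH (t : ℝ) {x} (hx : eval x f ≠ 0) (hl : dotForm c x ≠ 0) :
    HasDerivAt (D.logH hf hd x) (D.sig d (D.flowMap hf hd t x)).re t :=
  hasDerivAt_log_norm (D.hasDerivAt_height hf hd t hx hl)
    (height_ne (D.eval_flowMap_ne hf hd t hx) (D.dotForm_flowMap_ne hf hd t hx hl))

lemma sig_re_eq {i : Fin k} {x} (hi : D.chi i x ≠ 0) :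
    (D.sig d x).re = D.chi i x * (D.rhoLoc f i (D.zeta i x)).re + d * (1 - D.chi i x) := by
  rw [sig, D.rhoF_eq hi, D.chiSum_eq hi, Complex.add_re, Complex.re_ofReal_mul]
  congr 1
  rw [mul_assoc, ← Complex.ofReal_natCast, Complex.re_ofReal_mul, ← Complex.ofReal_one,
    ← Complex.ofReal_sub, Complex.re_mul_ofReal, D.κ_re, one_mul]

lemma sig_of_chi {x} (h : ∀ i, D.chi i x = 0) : D.sig d x = d * D.κ := by
  simp [sig, rhoF, chiSum, h]

include hd in
lemma sig_re_ge {x} {b : ℝ} (hb1 : b ≤ 1)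
    (h : ∀ i, D.chi i x ≠ 0 → b ≤ ‖D.zeta i x‖ ^ 2) : b ≤ (D.sig d x).re := by
  have hd' : (1 : ℝ) ≤ d := by exact_mod_cast hd
  by_cases h0 : ∃ i, D.chi i x ≠ 0
  · obtain ⟨i, hi⟩ := h0
    rw [D.sig_re_eq hi]
    have h1 := D.sq_le_re_rhoLoc i (D.norm_zeta_le_of_chi_ne_zero hi)
    have h2 := h i hi
    have h3 := D.chi_nonneg i x
    have h4 := D.chi_le_one i x
    nlinarith [mul_nonneg h3 (sub_nonneg.2 (h2.trans h1)),
      mul_nonneg (sub_nonneg.2 hd') (sub_nonneg.2 h4), mul_nonneg (sub_nonneg.2 hb1) (sub_nonneg.2 h4)]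
  · push Not at h0
    rw [D.sig_of_chi h0, ← Complex.ofReal_natCast, Complex.re_ofReal_mul, D.κ_re]
    linarith

include hd in
lemma sig_re_nonneg (x) : 0 ≤ (D.sig d x).re :=
  D.sig_re_ge hd zero_le_one fun _ _ => sq_nonneg _

lemma monotone_logH {x} (hx : eval x f ≠ 0) (hl : dotForm c x ≠ 0) :
    Monotone (D.logH hf hd x) :=
  monotone_of_deriv_nonneg (fun t => (D.hasDerivAt_logH hf hd t hx hl).differentiableAt)
    fun t => by
      rw [(D.hasDerivAt_logH hf hd t hx hl).deriv]
      exact D.sig_re_nonneg hd _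

/-- The modulus of a hyperbolic orbit. -/
lemma norm_smul_cplx_hypFlow_sq (p : EuclideanSpace ℝ (Fin n) × EuclideanSpace ℝ (Fin n))
    (t : ℝ) : ‖D.a • cplx (hypFlow t p)‖ ^ 2 =
      D.a ^ 2 * ‖p.1‖ ^ 2 * Real.exp (2 * t) + D.a ^ 2 * ‖p.2‖ ^ 2 * Real.exp (-2 * t) := by
  rw [norm_smul, mul_pow, norm_cplx_sq, hypFlow, norm_smul, norm_smul, Real.norm_eq_abs, sq_abs,
    Real.norm_eq_abs, Real.norm_eq_abs, Real.abs_exp, Real.abs_exp, mul_pow, mul_pow,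
    ← Real.exp_nat_mul, ← Real.exp_nat_mul]
  have h1 : ((2 : ℕ) : ℝ) * -t = -2 * t := by push_cast; ring
  rw [h1]
  push_cast
  ring

lemma convex_exp {A B r : ℝ} (hA : 0 ≤ A) (hB : 0 ≤ B) :
    Convex ℝ {t : ℝ | A * Real.exp (2 * t) + B * Real.exp (-2 * t) < r} := by
  have h : ∀ s : ℝ, ConvexOn ℝ univ fun t : ℝ => Real.exp (s * t) := fun s => by
    exact convexOn_exp.comp_linearMap (LinearMap.mulLeft ℝ s)
  have := (((h 2).smul hA).add ((h (-2)).smul hB)).convex_lt r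
  simpa using this

lemma field_symm {i : Fin k} {l : ℂ} (hl : l ≠ 0) {z : EuclideanSpace ℂ (Fin n)} (hz : ‖z‖ ≤ D.δ / 2) :
    D.field ((D.ch i).symm (l, l • z)) = (D.ch i).symm (0, l • conjE z) := by
  have hs : (D.ch i).symm (l, l • z) = l • (D.ch i).symm (1, z) := by
    rw [← map_smul]; simp
  have h0 : (D.ch i).symm (l, l • z) ≠ 0 := by
    intro h
    have := D.dotForm_symm i l (l • z)
    rw [h, map_zero] at this
    exact hl this.symm
  have h1 : D.chi i ((D.ch i).symm (l, l • z)) = 1 := by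
    refine D.chi_eq_one i h0 ?_
    rw [D.dotForm_symm]
    simp only [ContinuousLinearEquiv.apply_symm_apply, norm_smul]
    rw [mul_comm]
    gcongr
  have h2 : D.chiSum ((D.ch i).symm (l, l • z)) = 1 := by
    rw [D.chiSum_eq (i := i) (by rw [h1]; exact one_ne_zero), h1]
  rw [field, U, h2]
  simp only [sub_self, zero_smul, smul_zero, zero_add]
  rw [Finset.sum_eq_single i, Npart, h1, D.dotForm_symm]
  · simp [smul_smul, hl]
  · intro j _ hj
    have : D.chi j ((D.ch i).symm (l, l • z)) = 0 := by
      by_contra h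
      exact hj (D.chi_unique h (by rw [h1]; exact one_ne_zero))
    rw [Npart, this, zero_smul]
  · simp

lemma chi_symm {i : Fin k} {z : EuclideanSpace ℂ (Fin n)} (hz : ‖z‖ ≤ D.δ / 2) :
    D.chi i ((D.ch i).symm (1, z)) = 1 := by
  refine D.chi_eq_one i ?_ ?_
  · intro h
    have := D.dotForm_symm i 1 z
    rw [h, map_zero] at this
    exact one_ne_zero this.symm
  · rw [D.dotForm_symm]; simpa using hz

lemma flowMap_symm {i : Fin k} {p : EuclideanSpace ℝ (Fin n) × EuclideanSpace ℝ (Fin n)}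
    (h0 : ‖D.a • cplx p‖ ^ 2 < (D.δ / 2) ^ 2) {t : ℝ}
    (ht : ‖D.a • cplx (hypFlow t p)‖ ^ 2 < (D.δ / 2) ^ 2) :
    D.flowMap hf hd t ((D.ch i).symm (1, D.a • cplx p)) =
      (D.ch i).symm (1, D.a • cplx (hypFlow t p)) := by
  have hδ := D.δ_pos
  have hz : hypFlow 0 p = p := by simp [hypFlow]
  have hx : eval ((D.ch i).symm (1, D.a • cplx p)) f ≠ 0 :=
    D.eval_ne i _ ((lt_of_pow_lt_pow_left₀ 2 (by positivity) h0).le.trans (by linarith))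
  have hconv : Convex ℝ {s : ℝ | ‖D.a • cplx (hypFlow s p)‖ ^ 2 < (D.δ / 2) ^ 2} := by
    simp only [D.norm_smul_cplx_hypFlow_sq]
    exact convex_exp (by positivity) (by positivity)
  have hg : ∀ s, HasDerivAt (fun s => (D.ch i).symm (1, D.a • cplx (hypFlow s p)))
      ((D.ch i).symm (0, D.a • conjE (cplx (hypFlow s p)))) s := fun s => by
    have h1 := (hasDerivAt_const s (1 : ℂ)).prodMk ((hasDerivAt_cplx_hypFlow p s).const_smul D.a)
    exact (((D.ch i).symm.toContinuousLinearMap.restrictScalars ℝ).hasFDerivAt).comp_hasDerivAt s h1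
  refine integralCurve_unique_on (isOpen_openCone f) (v := D.field)
    (fun x hx => (D.contDiffAt_field hf hd hx).contDiffWithinAt)
    (f := fun s => D.flowMap hf hd s ((D.ch i).symm (1, D.a • cplx p)))
    (g := fun s => (D.ch i).symm (1, D.a • cplx (hypFlow s p)))
    (fun s => D.eval_flowMap_ne hf hd s hx) (fun s => D.hasDerivAt_flowMap hf hd s hx)
    (J := {s : ℝ | ‖D.a • cplx (hypFlow s p)‖ ^ 2 < (D.δ / 2) ^ 2}) ?_ hconv.isPreconnected
    ?_ (t₀ := 0) ?_ ?_ ht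
  · refine isOpen_lt ?_ continuous_const
    have : Continuous fun s => cplx (hypFlow s p) :=
      continuous_iff_continuousAt.2 fun s => (hasDerivAt_cplx_hypFlow p s).continuousAt
    fun_prop
  · intro s hs
    refine (hg s).congr_deriv ?_
    have := D.field_symm (i := i) (l := 1) one_ne_zero (z := D.a • cplx (hypFlow s p))
      (lt_of_pow_lt_pow_left₀ 2 (by positivity) hs).le
    rw [one_smul, one_smul, map_smul] at this
    exact this.symm
  · simpa [hz] using h0
  · simp [hz, D.flowMap_zero hf hd hx]

end MorseData

end

section
open Set Filter Topology

namespace MorseData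
variable {n : ℕ}
variable {f : MvPolynomial (Fin (n + 1)) ℂ} {c : Fin (n + 1) → ℂ} {k : ℕ} (D : MorseData f c k)
variable {d : ℕ} (hf : f.IsHomogeneous d) (hd : 0 < d)

/-- The value of `f` at the `i`-th critical point. -/
def crit (i : Fin k) : ℂ := eval ((D.ch i).symm (1, 0)) f

lemma chi_eq_zero_of_zeta (i : Fin k) {x} (h : D.δ < ‖D.zeta i x‖) :
    D.chi i x = 0 := by
  have hδ := D.δ_pos
  by_contra h0
  exact absurd (D.norm_zeta_le_of_chi_ne_zero h0) (not_le.2 h)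

lemma continuous_flowMap_right {x} (hx : eval x f ≠ 0) :
    Continuous fun t => D.flowMap hf hd t x :=
  continuous_iff_continuousAt.2 fun t => (D.hasDerivAt_flowMap hf hd t hx).continuousAt

lemma continuous_zeta_flowMap (i : Fin k) {x} (hx : eval x f ≠ 0) (hl : dotForm c x ≠ 0) :
    Continuous fun t => D.zeta i (D.flowMap hf hd t x) := by
  have h := D.continuous_flowMap_right hf hd hx
  exact (((dotForm c).continuous.comp h).inv₀ fun t => D.dotForm_flowMap_ne hf hd t hx hl).smul
    ((D.continuous_ch_snd i).comp h)

include hf hd in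
lemma height_const {x} (hx : eval x f ≠ 0) (hl : dotForm c x ≠ 0) {t₁ t₂ : ℝ} (h12 : t₁ ≤ t₂)
    (h : ∀ t ∈ Ioo t₁ t₂, ∀ i, D.chi i (D.flowMap hf hd t x) = 0) :
    height f c d (D.flowMap hf hd t₂ x) =
      height f c d (D.flowMap hf hd t₁ x) * Complex.exp (D.κ * (d * (t₂ - t₁) : ℝ)) := by
  set g : ℝ → ℂ := fun t => height f c d (D.flowMap hf hd t x) * Complex.exp (-(D.κ * d) * t)
  have hg : ∀ t, HasDerivAt g
      ((D.sig d (D.flowMap hf hd t x) - D.κ * d) * g t) t := fun t => by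
    have h1 : HasDerivAt (fun t : ℝ => Complex.exp (-(D.κ * d) * t))
        (Complex.exp (-(D.κ * d) * t) * (-(D.κ * d) * 1)) t :=
      (Complex.hasDerivAt_exp _).comp t (((hasDerivAt_id (t : ℂ)).const_mul _).comp_ofReal)
    refine ((D.hasDerivAt_height hf hd t hx hl).mul h1).congr_deriv ?_
    simp only [g]; ring
  have hc : g t₂ = g t₁ := by
    refine constant_of_has_deriv_right_zero (f := g)
      (fun t _ => (hg t).continuousAt.continuousWithinAt) (fun t ht => ?_) t₂ ⟨h12, le_rfl⟩
    have h0 : ∀ i, D.chi i (D.flowMap hf hd t x) = 0 := fun i => by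
      have hcl : IsClosed {t | D.chi i (D.flowMap hf hd t x) = 0} := by
        refine isClosed_eq (continuous_iff_continuousAt.2 fun t => ?_) continuous_const
        exact ContinuousAt.comp (g := D.chi i) (D.contDiffAt_chi i (ne_zero_of_eval_ne_zero hf hd
          (D.eval_flowMap_ne hf hd t hx))).continuousAt
          (D.continuous_flowMap_right hf hd hx).continuousAt
      have h1 := hcl.closure_subset_iff.2 fun t ht => h t ht i
      rw [closure_Ioo (ht.1.trans_lt ht.2).ne] at h1
      exact h1 ⟨ht.1, ht.2.le⟩
    refine (hg t).hasDerivWithinAt.congr_deriv ?_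
    rw [D.sig_of_chi h0]
    ring
  have := congrArg (· * Complex.exp (D.κ * d * t₂)) hc
  simp only [g, mul_assoc, ← Complex.exp_add] at this
  rw [show -(D.κ * d) * (t₂ : ℂ) + D.κ * (d * t₂) = 0 by ring, Complex.exp_zero, mul_one] at this
  rw [this]
  congr 2
  push_cast
  ring

include hf hd in
lemma crit_eq_of_flow {i j : Fin k} {x} (hx : eval x f ≠ 0) (hl : dotForm c x ≠ 0) {s : ℝ}
    (hs : 0 ≤ s) (hi : ‖D.zeta i x‖ ≤ D.δ) (hj : ‖D.zeta j (D.flowMap hf hd s x)‖ ≤ D.δ) :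
    D.crit i = D.crit j := by
  by_contra hne
  have hcl : ∀ j, IsClosed {t | ‖D.zeta j (D.flowMap hf hd t x)‖ ≤ D.δ} := fun j =>
    isClosed_le (D.continuous_zeta_flowMap hf hd j hx hl).norm continuous_const
  have hcl' : ∀ S : Set (Fin k), IsClosed {t | ∃ j ∈ S, ‖D.zeta j (D.flowMap hf hd t x)‖ ≤ D.δ} :=
    fun S => by
      have : {t | ∃ j ∈ S, ‖D.zeta j (D.flowMap hf hd t x)‖ ≤ D.δ} =
          ⋃ j ∈ S, {t | ‖D.zeta j (D.flowMap hf hd t x)‖ ≤ D.δ} := by ext; simp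
      rw [this]
      exact S.toFinite.isClosed_biUnion fun j _ => hcl j
  obtain ⟨t₂, ⟨⟨h20, h2s⟩, j', hj', hj''⟩, hmin⟩ :=
    (isCompact_Icc.inter_right (hcl' {j | D.crit j ≠ D.crit i})).exists_isLeast
      (s := Icc 0 s ∩ _) ⟨s, ⟨hs, le_rfl⟩, j, Ne.symm hne, hj⟩
  obtain ⟨t₁, ⟨⟨h10, h1s⟩, i', hi', hi''⟩, hmax⟩ :=
    (isCompact_Icc.inter_right (hcl' {j | D.crit j = D.crit i})).exists_isGreatest
      (s := Icc 0 t₂ ∩ _) ⟨0, ⟨le_rfl, h20⟩, i, rfl, by rwa [D.flowMap_zero hf hd hx]⟩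
  have hz : ∀ t ∈ Ioo t₁ t₂, ∀ i, D.chi i (D.flowMap hf hd t x) = 0 := by
    intro t ht m
    refine D.chi_eq_zero_of_zeta m ?_
    by_contra! hm
    by_cases hq : D.crit m = D.crit i
    · exact absurd (hmax ⟨⟨h10.trans ht.1.le, ht.2.le⟩, m, hq, hm⟩) (not_le.2 ht.1)
    · exact absurd (hmin ⟨⟨h10.trans ht.1.le, ht.2.le.trans h2s⟩, m, hq, hm⟩) (not_le.2 ht.2)
  have := D.height_const hf hd hx hl h1s hz
  rw [D.height_eq hf (i := j') (D.dotForm_flowMap_ne hf hd _ hx hl),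
    D.height_eq hf (i := i') (D.dotForm_flowMap_ne hf hd _ hx hl)] at this
  refine D.sep i' j' (fun h => hj' ?_) _ _ hi'' hj'' _ ?_ this
  · exact h.symm.trans hi'
  · exact mul_nonneg (Nat.cast_nonneg d) (sub_nonneg.2 h1s)

include hf hd in
lemma logH_zero_lt {i j : Fin k} (hij : D.crit i = D.crit j) {x} (hx : eval x f ≠ 0)
    (hl : dotForm c x ≠ 0) {s : ℝ}
    (hi : ‖D.zeta i x‖ ^ 2 ≤ 2 * D.a ^ 2)
    (hj : ‖D.zeta j (D.flowMap hf hd s x)‖ ^ 2 ≤ 2 * D.a ^ 2) :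
    D.logH hf hd x s - D.logH hf hd x 0 < D.δ ^ 2 / 8 - D.a ^ 2 := by
  rw [logH, logH, D.flowMap_zero hf hd hx, D.height_eq hf (i := i) hl,
    D.height_eq hf (i := j) (D.dotForm_flowMap_ne hf hd _ hx hl)]
  exact D.gain i j hij _ _ hi hj

lemma norm_smul_cplx_sq_lt {p : EuclideanSpace ℝ (Fin n) × EuclideanSpace ℝ (Fin n)}
    (hp : p ∈ unitBox (EuclideanSpace ℝ (Fin n))) : ‖D.a • cplx p‖ ^ 2 < 2 * D.a ^ 2 := by
  have ha := D.a_pos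
  rw [norm_smul, mul_pow, norm_cplx_sq, Real.norm_eq_abs, sq_abs]
  have h1 : ‖p.1‖ ^ 2 < 1 := pow_lt_one₀ (norm_nonneg _) hp.1 two_ne_zero
  have h2 : ‖p.2‖ ^ 2 < 1 := pow_lt_one₀ (norm_nonneg _) hp.2 two_ne_zero
  have : 0 < D.a ^ 2 := by positivity
  nlinarith

lemma eval_symm_box {i : Fin k} {p : EuclideanSpace ℝ (Fin n) × EuclideanSpace ℝ (Fin n)}
    (hp : p ∈ unitBox (EuclideanSpace ℝ (Fin n))) :
    eval ((D.ch i).symm (1, D.a • cplx p)) f ≠ 0 := by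
  have hδ := D.δ_pos
  refine D.eval_ne i _ ?_
  have := lt_of_pow_lt_pow_left₀ 2 (by positivity) ((D.norm_smul_cplx_sq_lt hp).trans D.a_lt)
  linarith

/-- The gain of the logarithmic height along an orbit leaving a box. -/
lemma le_logH_of_exit {i : Fin k} {p : EuclideanSpace ℝ (Fin n) × EuclideanSpace ℝ (Fin n)}
    (hp : p ∈ unitBox (EuclideanSpace ℝ (Fin n))) {s : ℝ} (hs : 0 ≤ s)
    (hexit : (D.δ / 2) ^ 2 ≤ ‖D.a • cplx (hypFlow s p)‖ ^ 2) :
    D.δ ^ 2 / 8 - D.a ^ 2 ≤ D.logH hf hd ((D.ch i).symm (1, D.a • cplx p)) s -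
      D.logH hf hd ((D.ch i).symm (1, D.a • cplx p)) 0 := by
  have hδ := D.δ_pos
  have hx := D.eval_symm_box (i := i) hp
  have hl : dotForm c ((D.ch i).symm (1, D.a • cplx p)) ≠ 0 := by
    rw [D.dotForm_symm]; exact one_ne_zero
  have hN : Continuous fun t => ‖D.a • cplx (hypFlow t p)‖ ^ 2 := by
    simp only [D.norm_smul_cplx_hypFlow_sq]
    fun_prop
  obtain ⟨s₁, ⟨⟨h10, h1s⟩, hs1⟩, hmin⟩ :=
    (isCompact_Icc.inter_right (isClosed_le continuous_const hN)).exists_isLeast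
      (s := Icc 0 s ∩ {t | (D.δ / 2) ^ 2 ≤ ‖D.a • cplx (hypFlow t p)‖ ^ 2})
      ⟨s, ⟨hs, le_rfl⟩, hexit⟩
  have hlt : ∀ t ∈ Ioo 0 s₁, ‖D.a • cplx (hypFlow t p)‖ ^ 2 < (D.δ / 2) ^ 2 := by
    intro t ht
    by_contra! h
    exact absurd (hmin ⟨⟨ht.1.le, ht.2.le.trans h1s⟩, h⟩) (not_le.2 ht.2)
  set A := D.a ^ 2 * ‖p.1‖ ^ 2 with hA
  set B := D.a ^ 2 * ‖p.2‖ ^ 2 with hB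
  set x₀ := (D.ch i).symm (1, D.a • cplx p)
  set G : ℝ → ℝ := fun t => D.logH hf hd x₀ t -
    (A * Real.exp (2 * t) - B * Real.exp (-2 * t)) / 2
  have hE : ∀ r t : ℝ, HasDerivAt (fun t => Real.exp (r * t)) (Real.exp (r * t) * (r * 1)) t :=
    fun r t => ((hasDerivAt_id t).const_mul r).exp
  have hG : ∀ t, HasDerivAt G ((D.sig d (D.flowMap hf hd t x₀)).re -
      ‖D.a • cplx (hypFlow t p)‖ ^ 2) t := fun t => by
    refine ((D.hasDerivAt_logH hf hd t hx hl).sub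
      ((((hE 2 t).const_mul A).sub ((hE (-2) t).const_mul B)).div_const 2)).congr_deriv ?_
    rw [D.norm_smul_cplx_hypFlow_sq]
    ring
  have hmono : MonotoneOn G (Icc 0 s₁) := by
    refine monotoneOn_of_deriv_nonneg (convex_Icc _ _)
      (fun t _ => (hG t).continuousAt.continuousWithinAt)
      (fun t _ => (hG t).differentiableAt.differentiableWithinAt) fun t ht => ?_
    rw [interior_Icc] at ht
    rw [(hG t).deriv, sub_nonneg]
    have hsq := hlt t ht
    have hfl := D.flowMap_symm (i := i) hf hd ((D.norm_smul_cplx_sq_lt hp).trans D.a_lt) hsq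
    rw [hfl]
    have hz : ‖D.a • cplx (hypFlow t p)‖ ≤ D.δ / 2 :=
      (lt_of_pow_lt_pow_left₀ 2 (by positivity) hsq).le
    have hc1 := D.chi_symm (i := i) hz
    rw [D.sig_re_eq (i := i) (by rw [hc1]; exact one_ne_zero), hc1, D.zeta_symm]
    simpa using D.sq_le_re_rhoLoc i (hz.trans (by linarith))
  have h1 := hmono (left_mem_Icc.2 h10) (right_mem_Icc.2 h10) h10
  have h2 := D.monotone_logH hf hd hx hl h1s
  have h3 := D.norm_smul_cplx_hypFlow_sq p s₁
  have ha : 0 < D.a ^ 2 := by have := D.a_pos; positivity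
  have hA1 : A ≤ D.a ^ 2 := mul_le_of_le_one_right ha.le (pow_le_one₀ (norm_nonneg _) hp.1.le)
  have hB1 : B ≤ D.a ^ 2 := mul_le_of_le_one_right ha.le (pow_le_one₀ (norm_nonneg _) hp.2.le)
  have hB0 : 0 ≤ B := by positivity
  have hexp : Real.exp (-2 * s₁) ≤ 1 := Real.exp_le_one_iff.2 (by linarith)
  have hB2 : B * Real.exp (-2 * s₁) ≤ B := mul_le_of_le_one_right hB0 hexp
  simp only [G, mul_zero, Real.exp_zero, mul_one] at h1
  rw [mem_ofPred_eq] at hs1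
  nlinarith

include hf hd in
/-- An orbit which starts in a box meets the boxes only inside its own box. -/
lemma box_sep_cone {i j : Fin k} {p : EuclideanSpace ℝ (Fin n) × EuclideanSpace ℝ (Fin n)}
    (hp : p ∈ unitBox (EuclideanSpace ℝ (Fin n))) {s : ℝ} (hs : 0 ≤ s)
    {q : EuclideanSpace ℝ (Fin n) × EuclideanSpace ℝ (Fin n)}
    (hq : q ∈ unitBox (EuclideanSpace ℝ (Fin n)))
    (h : D.zeta j (D.flowMap hf hd s ((D.ch i).symm (1, D.a • cplx p))) = D.a • cplx q) :
    i = j ∧ Real.exp s * ‖p.1‖ < 1 := by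
  have hδ := D.δ_pos
  have ha := D.a_pos
  have hx := D.eval_symm_box (i := i) hp
  have hl : dotForm c ((D.ch i).symm (1, D.a • cplx p)) ≠ 0 := by
    rw [D.dotForm_symm]; exact one_ne_zero
  have hlt : ∀ q ∈ unitBox (EuclideanSpace ℝ (Fin n)), ‖D.a • cplx q‖ ≤ D.δ := fun q hq => by
    have := lt_of_pow_lt_pow_left₀ 2 (by positivity) ((D.norm_smul_cplx_sq_lt hq).trans D.a_lt)
    linarith
  have hij : D.crit i = D.crit j := by
    refine D.crit_eq_of_flow hf hd hx hl hs ?_ ?_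
    · rw [D.zeta_symm]; exact hlt p hp
    · rw [h]; exact hlt q hq
  by_cases hexit : (D.δ / 2) ^ 2 ≤ ‖D.a • cplx (hypFlow s p)‖ ^ 2
  · have h1 := D.le_logH_of_exit (i := i) hf hd hp hs hexit
    have h2 := D.logH_zero_lt hf hd hij hx hl (s := s)
      (by rw [D.zeta_symm]; exact (D.norm_smul_cplx_sq_lt hp).le)
      (by rw [h]; exact (D.norm_smul_cplx_sq_lt hq).le)
    linarith
  · push Not at hexit
    have hfl := D.flowMap_symm (i := i) hf hd ((D.norm_smul_cplx_sq_lt hp).trans D.a_lt) hexit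
    rw [hfl] at h
    have hz := lt_of_pow_lt_pow_left₀ 2 (by positivity) hexit
    have hl2 : dotForm c ((D.ch i).symm (1, D.a • cplx (hypFlow s p))) ≠ 0 := by
      rw [D.dotForm_symm]; exact one_ne_zero
    have hii : i = j := by
      refine D.disj i j _ hl2 ?_ ?_
      · rw [← D.norm_zeta hl2, D.zeta_symm]; linarith
      · rw [← D.norm_zeta hl2, h]; exact hlt q hq
    subst hii
    refine ⟨rfl, ?_⟩
    rw [D.zeta_symm] at h
    have h3 := congrArg uncplx (smul_right_injective _ ha.ne' h)
    rw [uncplx_cplx, uncplx_cplx] at h3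
    have h4 := hq.1
    rw [← h3] at h4
    simpa [hypFlow, norm_smul] using h4

end MorseData

end

section
open Set Filter Topology

namespace MorseData
variable {n : ℕ}
variable {f : MvPolynomial (Fin (n + 1)) ℂ} {c : Fin (n + 1) → ℂ} {k : ℕ} (D : MorseData f c k)
variable {d : ℕ} (hf : f.IsHomogeneous d) (hd : 0 < d)

lemma exists_cap : ∃ C : ℝ, 0 < C ∧ ∀ i z, ‖z‖ ≤ D.δ → ‖eval ((D.ch i).symm (1, z)) f‖ ≤ C := by
  have h : ∀ i, ∃ C : ℝ, ∀ z, ‖z‖ ≤ D.δ → ‖eval ((D.ch i).symm (1, z)) f‖ ≤ C := fun i => by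
    obtain ⟨C, hC⟩ := (isCompact_closedBall (0 : EuclideanSpace ℂ (Fin n)) D.δ).exists_bound_of_continuousOn
      (f := fun z => eval ((D.ch i).symm (1, z)) f)
      ((continuous_eval_poly f).comp ((D.ch i).symm.continuous.comp
        (Continuous.prodMk_right 1))).continuousOn
    exact ⟨C, fun z hz => hC z (by simpa using hz)⟩
  choose C hC using h
  refine ⟨∑ i, |C i| + 1, by positivity, fun i z hz => (hC i z hz).trans ?_⟩
  have := Finset.single_le_sum (f := fun i => |C i|) (fun i _ => abs_nonneg _) (Finset.mem_univ i)
  linarith [le_abs_self (C i)]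

/-- A bound for `f` on the affine coordinate balls. -/
def cap : ℝ := D.exists_cap.choose

lemma cap_pos : 0 < D.cap := D.exists_cap.choose_spec.1

lemma norm_eval_le_cap (i z) (hz : ‖z‖ ≤ D.δ) : ‖eval ((D.ch i).symm (1, z)) f‖ ≤ D.cap :=
  D.exists_cap.choose_spec.2 i z hz

/-- The cone over a neighbourhood of the hyperplane section. -/
def far (d : ℕ) (x : Fin (n + 1) → ℂ) : Prop := D.cap * ‖dotForm c x‖ ^ d < ‖eval x f‖

include hd in
lemma far_of_dotForm_eq_zero {x} (hx : eval x f ≠ 0) (h : dotForm c x = 0) : D.far d x := by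
  simpa [far, h, hd.ne'] using hx

lemma far_iff {x} (hl : dotForm c x ≠ 0) : D.far d x ↔ D.cap < ‖height f c d x‖ := by
  have : 0 < ‖dotForm c x‖ ^ d := pow_pos (norm_pos_iff.2 hl) d
  rw [far, height, norm_mul, norm_inv, norm_pow, ← div_eq_mul_inv, lt_div_iff₀ this]

include hf in
lemma far_smul {a : ℂ} (ha : a ≠ 0) (x) : D.far d (a • x) ↔ D.far d x := by
  have : 0 < ‖a‖ ^ d := pow_pos (norm_pos_iff.2 ha) d
  rw [far, far, eval_smul_of_isHomogeneous hf, map_smul, smul_eq_mul, norm_mul, norm_mul, norm_pow,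
    mul_pow, mul_left_comm, mul_lt_mul_iff_right₀ this]

include hf in
lemma not_far_of_zeta {i : Fin k} {x} (hl : dotForm c x ≠ 0) (h : ‖D.zeta i x‖ ≤ D.δ) :
    ¬ D.far d x := by
  rw [D.far_iff hl, not_lt, D.height_eq hf (i := i) hl]
  exact D.norm_eval_le_cap i _ h

include hf in
lemma chi_eq_zero_of_far {x} (h : D.far d x) (i) : D.chi i x = 0 := by
  by_contra h0
  exact D.not_far_of_zeta hf (D.dotForm_ne_of_chi_ne_zero h0) (D.norm_zeta_le_of_chi_ne_zero h0) h

lemma far_flowMap {x} (hx : eval x f ≠ 0) (h : D.far d x) {t : ℝ} (ht : 0 ≤ t) :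
    D.far d (D.flowMap hf hd t x) := by
  by_cases hl : dotForm c x = 0
  · rwa [D.flowMap_of_dotForm_eq_zero hf hd t hx hl]
  · have hl' := D.dotForm_flowMap_ne hf hd t hx hl
    rw [D.far_iff hl'] at *
    rw [D.far_iff hl] at h
    refine h.trans_le ?_
    have h1 := D.monotone_logH hf hd hx hl ht
    rw [logH, logH, D.flowMap_zero hf hd hx] at h1
    exact (Real.log_le_log_iff (norm_pos_iff.2 (height_ne hx hl))
      (norm_pos_iff.2 (height_ne (D.eval_flowMap_ne hf hd t hx) hl'))).1 h1

lemma enter_cone {x} (hx : eval x f ≠ 0) :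
    (∃ t, 0 ≤ t ∧ ∃ i, dotForm c (D.flowMap hf hd t x) ≠ 0 ∧
      ‖D.zeta i (D.flowMap hf hd t x)‖ < D.a) ∨ ∃ t, 0 ≤ t ∧ D.far d (D.flowMap hf hd t x) := by
  by_cases hl : dotForm c x = 0
  · refine Or.inr ⟨0, le_rfl, ?_⟩
    rw [D.flowMap_zero hf hd hx]
    exact D.far_of_dotForm_eq_zero hd hx hl
  have ha := D.a_pos
  have ha1 : D.a ^ 2 ≤ 1 := by
    have := D.a_lt; have := D.δ_le; have := D.δ_pos
    nlinarith
  by_contra! h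
  obtain ⟨h1, h2⟩ := h
  have hl' := fun t => D.dotForm_flowMap_ne hf hd t hx hl
  have hmono : MonotoneOn (fun t => D.logH hf hd x t - D.a ^ 2 * t) (Ici 0) := by
    have hder : ∀ t, HasDerivAt (fun t => D.logH hf hd x t - D.a ^ 2 * t)
        ((D.sig d (D.flowMap hf hd t x)).re - D.a ^ 2 * 1) t := fun t =>
      (D.hasDerivAt_logH hf hd t hx hl).sub ((hasDerivAt_id t).const_mul _)
    refine monotoneOn_of_deriv_nonneg (convex_Ici 0)
      (fun t _ => (hder t).continuousAt.continuousWithinAt)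
      (fun t _ => (hder t).differentiableAt.differentiableWithinAt) fun t ht => ?_
    rw [interior_Ici] at ht
    rw [(hder t).deriv, mul_one, sub_nonneg]
    refine D.sig_re_ge hd ha1 fun i _ => ?_
    have := h1 t ht.le i (hl' t)
    gcongr
  obtain ⟨T, hT0, hT⟩ : ∃ T : ℝ, 0 ≤ T ∧ Real.log D.cap - D.logH hf hd x 0 < D.a ^ 2 * T := by
    refine ⟨(|Real.log D.cap - D.logH hf hd x 0| + 1) / D.a ^ 2, by positivity, ?_⟩
    rw [mul_div_cancel₀ _ (by positivity)]
    linarith [le_abs_self (Real.log D.cap - D.logH hf hd x 0)]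
  have h3 := hmono (mem_Ici.2 le_rfl) (mem_Ici.2 hT0) hT0
  simp only [mul_zero, sub_zero] at h3
  refine h2 T hT0 ((D.far_iff (hl' T)).2 ?_)
  refine (Real.log_lt_log_iff D.cap_pos (norm_pos_iff.2
    (height_ne (D.eval_flowMap_ne hf hd T hx) (hl' T)))).1 ?_
  change _ < D.logH hf hd x T
  linarith

section far
variable {x : Fin (n + 1) → ℂ} (hx : eval x f ≠ 0) (h : D.far d x)
include hx h

lemma eval_flowMap_of_far {t : ℝ} (ht : 0 ≤ t) : eval (D.flowMap hf hd t x) f = eval x f := by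
  have := constant_of_has_deriv_right_zero (a := 0) (b := t)
    (f := fun s => eval (D.flowMap hf hd s x) f)
    (fun s _ => (D.hasDerivAt_eval_flowMap hf hd s hx).continuousAt.continuousWithinAt)
    (fun s hs => by
      refine (D.hasDerivAt_eval_flowMap hf hd s hx).hasDerivWithinAt.congr_deriv ?_
      simp [rhoF, D.chi_eq_zero_of_far hf (D.far_flowMap hf hd hx h hs.1)]) t ⟨ht, le_rfl⟩
  simpa [D.flowMap_zero hf hd hx] using this

lemma dotForm_flowMap_of_far {t : ℝ} (ht : 0 ≤ t) :
    dotForm c (D.flowMap hf hd t x) = dotForm c x * Complex.exp (-D.κ * t) := by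
  have hE : ∀ s : ℝ, HasDerivAt (fun s : ℝ => Complex.exp (D.κ * s))
      (Complex.exp (D.κ * s) * (D.κ * 1)) s := fun s =>
    (Complex.hasDerivAt_exp _).comp s (((hasDerivAt_id (s : ℂ)).const_mul _).comp_ofReal)
  have := constant_of_has_deriv_right_zero (a := 0) (b := t)
    (f := fun s : ℝ => dotForm c (D.flowMap hf hd s x) * Complex.exp (D.κ * s))
    (fun s _ => ((D.hasDerivAt_dotForm_flowMap hf hd s hx).mul
      (hE s)).continuousAt.continuousWithinAt)
    (fun s hs => by
      refine ((D.hasDerivAt_dotForm_flowMap hf hd s hx).mul (hE s)).hasDerivWithinAt.congr_deriv ?_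
      simp only [chiSum, D.chi_eq_zero_of_far hf (D.far_flowMap hf hd hx h hs.1),
        Finset.sum_const_zero]
      push_cast
      ring) t ⟨ht, le_rfl⟩
  simp only [D.flowMap_zero hf hd hx, Complex.ofReal_zero, mul_zero, Complex.exp_zero, mul_one]
    at this
  rw [← this, mul_assoc, ← Complex.exp_add]
  simp

lemma norm_field_of_far {t : ℝ} (ht : 0 ≤ t) :
    ‖D.field (D.flowMap hf hd t x)‖ ≤ ‖D.κ‖ * D.ε⁻¹ * ‖dotForm c x‖ * Real.exp (-t) := by
  have hx' := D.eval_flowMap_ne hf hd t hx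
  have h1 := D.norm_U_le hx' (ne_zero_of_eval_ne_zero hf hd hx')
  have h2 : ∑ i, D.Npart i (D.flowMap hf hd t x) = 0 := by
    simp [Npart, D.chi_eq_zero_of_far hf (D.far_flowMap hf hd hx h ht)]
  rw [field, h2, add_zero, norm_smul, norm_neg, norm_mul, D.dotForm_flowMap_of_far hf hd hx h ht,
    norm_mul, Complex.norm_exp]
  have h3 : (-D.κ * t).re = -t := by rw [Complex.re_mul_ofReal, Complex.neg_re, D.κ_re]; ring
  rw [h3]
  calc _ ≤ ‖D.κ‖ * (‖dotForm c x‖ * Real.exp (-t)) * D.ε⁻¹ := by gcongr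
    _ = _ := by ring

lemma norm_flowMap_sub_le {s t : ℝ} (hs : 0 ≤ s) (hst : s ≤ t) :
    ‖D.flowMap hf hd t x - D.flowMap hf hd s x‖ ≤
      ‖D.κ‖ * D.ε⁻¹ * ‖dotForm c x‖ * (Real.exp (-s) - Real.exp (-t)) := by
  have hE : ∀ r : ℝ, HasDerivAt (fun r => ‖D.κ‖ * D.ε⁻¹ * ‖dotForm c x‖ *
      (Real.exp (-s) - Real.exp (-r))) (‖D.κ‖ * D.ε⁻¹ * ‖dotForm c x‖ * Real.exp (-r)) r :=
    fun r => by
      refine (((hasDerivAt_neg r).exp.const_sub (Real.exp (-s))).const_mul _).congr_deriv ?_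
      ring
  refine image_norm_le_of_norm_deriv_right_le_deriv_boundary (a := s) (b := t)
    (f := fun r => D.flowMap hf hd r x - D.flowMap hf hd s x)
    (f' := fun r => D.field (D.flowMap hf hd r x))
    (fun r _ => ((D.hasDerivAt_flowMap hf hd r hx).sub_const _).continuousAt.continuousWithinAt)
    (fun r _ => ((D.hasDerivAt_flowMap hf hd r hx).sub_const _).hasDerivWithinAt) (by simp)
    hE (fun r hr => D.norm_field_of_far hf hd hx h (hs.trans hr.1)) ⟨hst, le_rfl⟩

lemma exists_limit_of_far : ∃ y, eval y f ≠ 0 ∧ dotForm c y = 0 ∧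
    ∀ t, 0 ≤ t → ‖y - D.flowMap hf hd t x‖ ≤ ‖D.κ‖ * D.ε⁻¹ * ‖dotForm c x‖ * Real.exp (-t) := by
  have hM : 0 ≤ ‖D.κ‖ * D.ε⁻¹ * ‖dotForm c x‖ := by have := D.ε_pos; positivity
  have hexp : Tendsto (fun t : ℝ => ‖D.κ‖ * D.ε⁻¹ * ‖dotForm c x‖ * Real.exp (-t)) atTop (𝓝 0) := by
    simpa using (Real.tendsto_exp_neg_atTop_nhds_zero).const_mul (‖D.κ‖ * D.ε⁻¹ * ‖dotForm c x‖)
  have hle : ∀ s t : ℝ, 0 ≤ s → s ≤ t → ‖D.flowMap hf hd t x - D.flowMap hf hd s x‖ ≤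
      ‖D.κ‖ * D.ε⁻¹ * ‖dotForm c x‖ * Real.exp (-s) := fun s t hs hst => by
    refine (D.norm_flowMap_sub_le hf hd hx h hs hst).trans ?_
    gcongr
    linarith [Real.exp_pos (-t)]
  have hcau : CauchySeq fun m : ℕ => D.flowMap hf hd m x := by
    refine cauchySeq_of_le_tendsto_0' (fun m : ℕ => ‖D.κ‖ * D.ε⁻¹ * ‖dotForm c x‖ *
      Real.exp (-(m : ℝ))) (fun m l hml => ?_) (hexp.comp tendsto_natCast_atTop_atTop)
    rw [dist_comm, dist_eq_norm]
    exact hle m l (Nat.cast_nonneg m) (Nat.cast_le.2 hml)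
  obtain ⟨y, hy⟩ := cauchySeq_tendsto_of_complete hcau
  refine ⟨y, ?_, ?_, fun t ht => ?_⟩
  · have h1 := ((continuous_eval_poly f).tendsto y).comp hy
    have h2 : Tendsto ((fun y => eval y f) ∘ fun m : ℕ => D.flowMap hf hd m x) atTop
        (𝓝 (eval x f)) := by
      refine tendsto_const_nhds.congr fun m => ?_
      exact (D.eval_flowMap_of_far hf hd hx h (Nat.cast_nonneg m)).symm
    rw [tendsto_nhds_unique h1 h2]; exact hx
  · have h1 := ((dotForm c).continuous.tendsto y).comp hy
    refine tendsto_nhds_unique h1 (squeeze_zero_norm (a := fun m : ℕ => ‖dotForm c x‖ *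
      Real.exp (-(m : ℝ))) (fun m => ?_) ?_)
    · rw [Function.comp, D.dotForm_flowMap_of_far hf hd hx h (Nat.cast_nonneg m), norm_mul,
        Complex.norm_exp, Complex.re_mul_ofReal, Complex.neg_re, D.κ_re, neg_one_mul]
    · simpa using ((Real.tendsto_exp_neg_atTop_nhds_zero).comp
        tendsto_natCast_atTop_atTop).const_mul ‖dotForm c x‖
  · refine le_of_tendsto (hy.sub_const (D.flowMap hf hd t x)).norm ?_
    filter_upwards [tendsto_natCast_atTop_atTop.eventually_ge_atTop t] with m hm
    exact hle t m ht hm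

end far

lemma isOpen_far : IsOpen {x : Fin (n + 1) → ℂ | D.far d x} :=
  isOpen_lt (continuous_const.mul ((dotForm c).continuous.norm.pow d))
    (continuous_eval_poly f).norm

lemma tendsto_flowMap_of_far {x : Fin (n + 1) → ℂ} (hx : eval x f ≠ 0) (h : D.far d x) {y}
    (hy : ∀ t, 0 ≤ t → ‖y - D.flowMap hf hd t x‖ ≤
      ‖D.κ‖ * D.ε⁻¹ * ‖dotForm c x‖ * Real.exp (-t)) :
    Tendsto (fun p : ℝ × (Fin (n + 1) → ℂ) => D.flowMap hf hd p.1 p.2) (atTop ×ˢ 𝓝 x) (𝓝 y) := by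
  have hε := D.ε_pos
  set M := ‖D.κ‖ * D.ε⁻¹ with hM
  have hM0 : 0 ≤ M := by positivity
  have hexp : Tendsto (fun t : ℝ => M * (‖dotForm c x‖ + 1) * Real.exp (-t)) atTop (𝓝 0) := by
    simpa using (Real.tendsto_exp_neg_atTop_nhds_zero).const_mul (M * (‖dotForm c x‖ + 1))
  rw [Metric.tendsto_nhds]
  intro e he
  obtain ⟨T, hT, hT0⟩ := ((hexp.eventually_lt_const (by positivity : 0 < e / 3)).and
    (eventually_ge_atTop 0)).exists
  have hc : ContinuousAt (fun x' => D.flowMap hf hd T x') x := by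
    have := (D.continuousOn_flowMap hf hd).continuousAt (x := (T, x))
      ((isOpen_univ.prod (isOpen_openCone f)).mem_nhds ⟨mem_univ _, hx⟩)
    exact this.comp (f := fun x' => (T, x')) (by fun_prop)
  have h1 : ∀ᶠ x' in 𝓝 x, ‖D.flowMap hf hd T x' - D.flowMap hf hd T x‖ < e / 3 := by
    have := Metric.tendsto_nhds.1 hc (e / 3) (by positivity)
    simpa only [dist_eq_norm] using this
  have h2 : ∀ᶠ x' in 𝓝 x, ‖dotForm c x'‖ < ‖dotForm c x‖ + 1 :=
    (dotForm c).continuous.norm.tendsto x |>.eventually_lt_const (by linarith)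
  have h3 := D.isOpen_far (d := d).mem_nhds h
  have h4 := (isOpen_openCone f).mem_nhds hx
  filter_upwards [prod_mem_prod (Ici_mem_atTop T) (inter_mem (inter_mem h1 h2) (inter_mem h3 h4))]
    with ⟨t, x'⟩ ⟨ht, ⟨h1, h2⟩, h3, h4⟩
  rw [mem_ofPred_eq] at h1 h2
  have h5 := D.norm_flowMap_sub_le hf hd h4 h3 hT0 ht
  have h6 := hy T hT0
  rw [dist_eq_norm]
  have h7 : ‖D.flowMap hf hd t x' - D.flowMap hf hd T x'‖ ≤
      M * (‖dotForm c x‖ + 1) * Real.exp (-T) := by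
    have h9 : 0 ≤ Real.exp (-T) - Real.exp (-t) :=
      sub_nonneg.2 (Real.exp_le_exp.2 (neg_le_neg ht))
    refine h5.trans ?_
    gcongr
    linarith [Real.exp_pos (-t)]
  have h8 : ‖y - D.flowMap hf hd T x‖ ≤ M * (‖dotForm c x‖ + 1) * Real.exp (-T) := by
    refine h6.trans ?_
    gcongr
    linarith
  calc ‖D.flowMap hf hd t x' - y‖ = ‖(D.flowMap hf hd t x' - D.flowMap hf hd T x') +
        (D.flowMap hf hd T x' - D.flowMap hf hd T x) - (y - D.flowMap hf hd T x)‖ := by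
        congr 1; abel
    _ ≤ _ := (norm_sub_le _ _).trans (add_le_add_left (norm_add_le _ _) _)
    _ < e := by linarith

end MorseData

end

section
open Set Filter Topology

namespace MorseData
variable {n : ℕ}
variable {f : MvPolynomial (Fin (n + 1)) ℂ} {c : Fin (n + 1) → ℂ} {k : ℕ} (D : MorseData f c k)
variable {d : ℕ} (hf : f.IsHomogeneous d) (hd : 0 < d)

/-- The flow on the open cone. -/
def coneFlow (t : ℝ) (x : OpenCone f) : OpenCone f :=
  ⟨D.flowMap hf hd t x.1, D.eval_flowMap_ne hf hd t x.2⟩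

lemma continuous_coneFlow : Continuous fun p : ℝ × OpenCone f => D.coneFlow hf hd p.1 p.2 :=
  (D.continuous_flowMap_cone hf hd).subtype_mk _

/-- The flow on the complement of the hypersurface. -/
def projFlow (t : ℝ) (x : ↥(principalOpen f)) : ↥(principalOpen f) :=
  coneProj hf hd (D.coneFlow hf hd t (coneRep x))

lemma projFlow_coneProj (t : ℝ) (x : OpenCone f) :
    D.projFlow hf hd t (coneProj hf hd x) = coneProj hf hd (D.coneFlow hf hd t x) := by
  obtain ⟨a, ha, h⟩ := exists_coneRep_coneProj hf hd x
  refine ((coneProj_eq_iff hf hd _ _).2 ⟨a, ha, ?_⟩).symm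
  simp only [coneFlow, h, D.flowMap_smul hf hd t ha x.2]

lemma continuous_projFlow : Continuous (Function.uncurry (D.projFlow hf hd)) := by
  have h := (IsOpenQuotientMap.id (X := ℝ)).prodMap (isOpenQuotientMap_coneProj hf hd)
  rw [← h.continuous_comp_iff]
  have : Function.uncurry (D.projFlow hf hd) ∘ Prod.map id (coneProj hf hd) =
      fun p => coneProj hf hd (D.coneFlow hf hd p.1 p.2) := by
    ext1 ⟨t, x⟩
    exact D.projFlow_coneProj hf hd t x
  rw [this]
  exact (continuous_coneProj hf hd).comp (D.continuous_coneFlow hf hd)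

/-- The affine ball around the `i`-th critical point, extended by a constant. -/
def coneBox (i : Fin k) (z : EuclideanSpace ℂ (Fin n)) : OpenCone f :=
  ⟨(D.ch i).symm (1, if ‖z‖ ≤ D.δ then z else 0), by
    refine D.eval_ne i _ ?_
    split_ifs with h
    · exact h
    · simpa using D.δ_pos.le⟩

lemma norm_smul_cplx_le {p : EuclideanSpace ℝ (Fin n) × EuclideanSpace ℝ (Fin n)}
    (hp : p ∈ unitBox (EuclideanSpace ℝ (Fin n))) : ‖D.a • cplx p‖ ≤ D.δ := by
  have hδ := D.δ_pos
  have := lt_of_pow_lt_pow_left₀ 2 (by positivity) ((D.norm_smul_cplx_sq_lt hp).trans D.a_lt)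
  linarith

lemma coneBox_val {i : Fin k} {z : EuclideanSpace ℂ (Fin n)} (hz : ‖z‖ ≤ D.δ) :
    (D.coneBox i z).1 = (D.ch i).symm (1, z) := by
  simp [coneBox, hz]

/-- The coordinates of a box. -/
def boxInv (i : Fin k) (x : ↥(principalOpen f)) :
    EuclideanSpace ℝ (Fin n) × EuclideanSpace ℝ (Fin n) :=
  uncplx (D.a⁻¹ • D.zeta i (coneRep x).1)

lemma boxInv_coneProj (i : Fin k) (y : OpenCone f) :
    D.boxInv i (coneProj hf hd y) = uncplx (D.a⁻¹ • D.zeta i y.1) := by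
  obtain ⟨b, hb, h⟩ := exists_coneRep_coneProj hf hd y
  rw [boxInv, h, D.zeta_smul i hb]

lemma dotForm_coneRep_coneProj (y : OpenCone f) :
    dotForm c (coneRep (coneProj hf hd y)).1 = 0 ↔ dotForm c y.1 = 0 := by
  obtain ⟨b, hb, h⟩ := exists_coneRep_coneProj hf hd y
  rw [h, map_smul, smul_eq_mul, mul_eq_zero, or_iff_right hb]

lemma far_coneRep_coneProj (y : OpenCone f) :
    D.far d (coneRep (coneProj hf hd y)).1 ↔ D.far d y.1 := by
  obtain ⟨b, hb, h⟩ := exists_coneRep_coneProj hf hd y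
  rw [h, D.far_smul hf hb]

include hf hd in
lemma isClosed_dotForm_coneRep :
    IsClosed {x : ↥(principalOpen f) | dotForm c (coneRep x).1 = 0} := by
  rw [← (isOpenQuotientMap_coneProj hf hd).isQuotientMap.isClosed_preimage]
  simp only [preimage_ofPred_eq, dotForm_coneRep_coneProj]
  exact isClosed_eq ((dotForm c).continuous.comp continuous_subtype_val) continuous_const

include hf hd in
lemma continuousOn_boxInv (i : Fin k) :
    ContinuousOn (D.boxInv i) {x | dotForm c (coneRep x).1 ≠ 0} := by
  intro x hx
  refine ContinuousAt.continuousWithinAt ?_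
  have h := isOpenQuotientMap_coneProj hf hd
  rw [← coneProj_coneRep hf hd x, ← h.continuousAt_comp_iff]
  have : D.boxInv i ∘ coneProj hf hd = fun y => uncplx (D.a⁻¹ • D.zeta i y.1) := by
    ext1 y; exact D.boxInv_coneProj hf hd i y
  rw [this]
  refine (continuous_uncplx.comp (continuous_const_smul D.a⁻¹)).continuousAt.comp
    (f := fun y : OpenCone f => D.zeta i y.1) ?_
  refine ContinuousAt.smul (f := fun y : OpenCone f => (dotForm c y.1)⁻¹) (ContinuousAt.inv₀ ?_ hx) ?_
  · exact ((dotForm c).continuous.comp continuous_subtype_val).continuousAt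
  · exact ((D.continuous_ch_snd i).comp continuous_subtype_val).continuousAt

/-- The box around the `i`-th rest point. -/
def projBox (i : Fin k) : OpenPartialHomeomorph
    (EuclideanSpace ℝ (Fin n) × EuclideanSpace ℝ (Fin n)) ↥(principalOpen f) where
  toFun p := coneProj hf hd (D.coneBox i (D.a • cplx p))
  invFun := D.boxInv i
  source := unitBox _
  target := {x | dotForm c (coneRep x).1 ≠ 0} ∩ D.boxInv i ⁻¹' unitBox _
  map_source' p hp := by
    refine ⟨?_, ?_⟩
    · rw [mem_ofPred_eq, ne_eq, dotForm_coneRep_coneProj, D.coneBox_val (D.norm_smul_cplx_le hp),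
        D.dotForm_symm]
      exact one_ne_zero
    · rw [mem_preimage, D.boxInv_coneProj, D.coneBox_val (D.norm_smul_cplx_le hp), D.zeta_symm,
        inv_smul_smul₀ D.a_pos.ne', uncplx_cplx]
      exact hp
  map_target' x hx := hx.2
  left_inv' p hp := by
    rw [D.boxInv_coneProj, D.coneBox_val (D.norm_smul_cplx_le hp), D.zeta_symm,
        inv_smul_smul₀ D.a_pos.ne', uncplx_cplx]
  right_inv' x hx := by
    obtain ⟨h1, h2⟩ := hx
    have h3 := D.norm_smul_cplx_le h2
    rw [boxInv, cplx_uncplx, smul_inv_smul₀ D.a_pos.ne'] at h3 ⊢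
    conv_rhs => rw [← coneProj_coneRep hf hd x]
    refine (coneProj_eq_iff hf hd _ _).2 ⟨_, h1, ?_⟩
    rw [D.coneBox_val h3, D.smul_symm_zeta h1]
  open_source := isOpen_unitBox
  open_target := (D.continuousOn_boxInv hf hd i).isOpen_inter_preimage
    (isClosed_dotForm_coneRep hf hd).isOpen_compl isOpen_unitBox
  continuousOn_toFun := by
    rw [continuousOn_iff_continuous_domRestrict]
    refine (continuous_coneProj hf hd).comp (Continuous.subtype_mk ?_ _)
    have : Continuous fun p : ↥(unitBox (EuclideanSpace ℝ (Fin n))) =>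
        (D.ch i).symm (1, D.a • cplx p.1) :=
      (D.ch i).symm.continuous.comp (continuous_const.prodMk
        ((continuous_const_smul D.a).comp (continuous_cplx.comp continuous_subtype_val)))
    refine this.congr fun p => ?_
    rw [if_pos (D.norm_smul_cplx_le p.2)]
  continuousOn_invFun := (D.continuousOn_boxInv hf hd i).mono inter_subset_left

open Classical in
/-- The limit of an orbit close to the hyperplane section. -/
def projLim (x : ↥(principalOpen f)) : ↥(principalOpen f) :=
  if h : D.far d (coneRep x).1 then
    coneProj hf hd ⟨_, (D.exists_limit_of_far hf hd (coneRep x).2 h).choose_spec.1⟩ else x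

/-- The flow on the complement of the hypersurface, with its boxes. -/
def boxFlow : BoxFlow ↥(principalOpen f) (EuclideanSpace ℝ (Fin n)) (Fin k) where
  flow := D.projFlow hf hd
  continuous_flow := D.continuous_projFlow hf hd
  flow_zero x := by
    rw [← coneProj_coneRep hf hd x, D.projFlow_coneProj]
    congr 1
    exact Subtype.ext (D.flowMap_zero hf hd (coneRep x).2)
  flow_add s t x := by
    rw [← coneProj_coneRep hf hd x, D.projFlow_coneProj, D.projFlow_coneProj, D.projFlow_coneProj]
    congr 1
    exact Subtype.ext (D.flowMap_add hf hd s t (coneRep x).2)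
  box := D.projBox hf hd
  box_source _ := rfl
  flow_box i t p hp hp' := by
    change D.projFlow hf hd t (coneProj hf hd _) = coneProj hf hd _
    rw [D.projFlow_coneProj]
    congr 1
    refine Subtype.ext ?_
    change D.flowMap hf hd t (D.coneBox i _).1 = _
    rw [D.coneBox_val (D.norm_smul_cplx_le hp), D.coneBox_val (D.norm_smul_cplx_le hp')]
    exact D.flowMap_symm hf hd ((D.norm_smul_cplx_sq_lt hp).trans D.a_lt)
      ((D.norm_smul_cplx_sq_lt hp').trans D.a_lt)
  box_sep i j s p hp hs h := by
    have h2 : D.boxInv j (D.projFlow hf hd s (coneProj hf hd (D.coneBox i (D.a • cplx p)))) ∈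
      unitBox _ := h.2
    rw [D.projFlow_coneProj, D.boxInv_coneProj] at h2
    refine D.box_sep_cone hf hd hp hs h2 ?_
    rw [cplx_uncplx, smul_inv_smul₀ D.a_pos.ne']
    change _ = D.zeta j (D.flowMap hf hd s (D.coneBox i _).1)
    rw [D.coneBox_val (D.norm_smul_cplx_le hp)]
  attr := {x | dotForm c (coneRep x).1 = 0}
  nbhd := {x | D.far d (coneRep x).1}
  isClosed_attr := isClosed_dotForm_coneRep hf hd
  isOpen_nbhd := by
    rw [← (isOpenQuotientMap_coneProj hf hd).isQuotientMap.isOpen_preimage]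
    simp only [preimage_ofPred_eq, far_coneRep_coneProj]
    exact D.isOpen_far.preimage continuous_subtype_val
  attr_subset x hx := D.far_of_dotForm_eq_zero hd (coneRep x).2 hx
  flow_attr t x hx := by
    conv_rhs => rw [← coneProj_coneRep hf hd x]
    rw [projFlow]
    congr 1
    exact Subtype.ext (D.flowMap_of_dotForm_eq_zero hf hd t (coneRep x).2 hx)
  flow_nbhd t ht x hx := by
    rw [mem_ofPred_eq, projFlow, far_coneRep_coneProj]
    exact D.far_flowMap hf hd (coneRep x).2 hx ht
  box_nbhd i := by
    rw [Set.disjoint_left]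
    rintro x ⟨h1, h2⟩ h3
    have h4 := D.norm_smul_cplx_le h2
    rw [boxInv, cplx_uncplx, smul_inv_smul₀ D.a_pos.ne'] at h4
    exact D.not_far_of_zeta hf h1 h4 h3
  enter x := by
    rcases D.enter_cone hf hd (coneRep x).2 with ⟨t, ht, i, h1, h2⟩ | ⟨t, ht, h⟩
    · refine Or.inl ⟨t, ht, i, ?_, ?_⟩
      · rw [mem_ofPred_eq, ne_eq, projFlow, dotForm_coneRep_coneProj]
        exact h1
      · rw [mem_preimage, projFlow, boxInv_coneProj]
        have ha := D.a_pos
        have h3 : ‖D.a⁻¹ • D.zeta i (D.flowMap hf hd t (coneRep x).1)‖ ^ 2 < 1 := by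
          rw [norm_smul, norm_inv, Real.norm_of_nonneg ha.le]
          refine pow_lt_one₀ (by positivity) ?_ two_ne_zero
          rwa [inv_mul_lt_one₀ ha]
        rw [← cplx_uncplx (D.a⁻¹ • D.zeta i (D.flowMap hf hd t (coneRep x).1)), norm_cplx_sq] at h3
        constructor
        · exact lt_of_pow_lt_pow_left₀ 2 zero_le_one (by
            rw [one_pow]; exact (le_add_of_nonneg_right (sq_nonneg _)).trans_lt h3)
        · exact lt_of_pow_lt_pow_left₀ 2 zero_le_one (by
            rw [one_pow]; exact (le_add_of_nonneg_left (sq_nonneg _)).trans_lt h3)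
    · refine Or.inr ⟨t, ht, ?_⟩
      rw [mem_ofPred_eq, projFlow, far_coneRep_coneProj]
      exact h
  lim := D.projLim hf hd
  lim_mem x hx := by
    rw [mem_ofPred_eq] at hx
    rw [mem_ofPred_eq, projLim, dif_pos hx, dotForm_coneRep_coneProj]
    exact (D.exists_limit_of_far hf hd (coneRep x).2 hx).choose_spec.2.1
  tendsto_lim x hx := by
    rw [mem_ofPred_eq] at hx
    obtain ⟨h1, -, h3⟩ := (D.exists_limit_of_far hf hd (coneRep x).2 hx).choose_spec
    have h4 := D.tendsto_flowMap_of_far hf hd (coneRep x).2 hx h3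
    have h5 : Tendsto (fun p : ℝ × OpenCone f => D.coneFlow hf hd p.1 p.2)
        (atTop ×ˢ 𝓝 (coneRep x)) (𝓝 ⟨_, h1⟩) := by
      rw [tendsto_subtype_rng]
      exact h4.comp (tendsto_id.prodMap continuous_subtype_val.continuousAt)
    have h6 := ((continuous_coneProj hf hd).tendsto _).comp h5
    rw [projLim, dif_pos hx]
    conv => enter [2, 2]; rw [← coneProj_coneRep hf hd x]
    rw [← (isOpenQuotientMap_coneProj hf hd).map_nhds_eq, ← map_id (f := atTop), prod_map_map_eq,
      tendsto_map'_iff]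
    refine h6.congr fun p => ?_
    exact (D.projFlow_coneProj hf hd _ _).symm

end MorseData

end

section
open Set Filter Topology

variable {n m : ℕ}

lemma pderiv_pderiv_comm (f : MvPolynomial (Fin m) ℂ) (i j : Fin m) :
    pderiv i (pderiv j f) = pderiv j (pderiv i f) := by
  have h : ⁅(pderiv i : Derivation ℂ (MvPolynomial (Fin m) ℂ) (MvPolynomial (Fin m) ℂ)),
      (pderiv j : Derivation ℂ (MvPolynomial (Fin m) ℂ) (MvPolynomial (Fin m) ℂ))⁆ = 0 := by
    refine MvPolynomial.derivation_ext fun k => ?_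
    have hX : ∀ a b : Fin m, pderiv a (pderiv b (X k : MvPolynomial (Fin m) ℂ)) = 0 := by
      intro a b
      rw [pderiv_X]
      by_cases hb : b = k
      · subst hb; simp
      · rw [Pi.single_eq_of_ne (Ne.symm hb)]; simp
    rw [Derivation.commutator_apply, hX, hX]
    simp
  have := congrArg (fun D => D f) h
  simpa [Derivation.commutator_apply, sub_eq_zero] using this

/-- The derivative of the gradient of `f`, i.e. the Hessian of `f` at `p`. -/
def hessL (f : MvPolynomial (Fin m) ℂ) (p : Fin m → ℂ) : (Fin m → ℂ) →L[ℂ] (Fin m → ℂ) :=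
  ContinuousLinearMap.pi fun i => dotForm (gradAt (pderiv i f) p)

lemma hasFDerivAt_gradAt (f : MvPolynomial (Fin m) ℂ) (p : Fin m → ℂ) :
    HasFDerivAt (gradAt f) (hessL f p) p :=
  hasFDerivAt_pi.2 fun i => (hasStrictFDerivAt_eval (pderiv i f) p).hasFDerivAt

lemma dotForm_hessL_comm (f : MvPolynomial (Fin m) ℂ) (p v w : Fin m → ℂ) :
    dotForm (hessL f p v) w = dotForm (hessL f p w) v := by
  simp only [dotForm_apply, hessL, ContinuousLinearMap.pi_apply, Finset.sum_mul]
  rw [Finset.sum_comm]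
  refine Finset.sum_congr rfl fun i _ => Finset.sum_congr rfl fun j _ => ?_
  simp only [gradAt]
  rw [pderiv_pderiv_comm]
  ring

/-- The Hessian of `f` as a bilinear form. -/
def hessB (f : MvPolynomial (Fin m) ℂ) (p : Fin m → ℂ) : LinearMap.BilinForm ℂ (Fin m → ℂ) :=
  LinearMap.mk₂ ℂ (fun v w => dotForm (hessL f p v) w)
    (fun v v' w => by simp [dotForm_apply, add_mul, Finset.sum_add_distrib])
    (fun a v w => by simp [dotForm_smul_left])
    (fun v w w' => by simp) (fun a v w => by simp)

lemma hessB_apply (f : MvPolynomial (Fin m) ℂ) (p v w : Fin m → ℂ) :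
    hessB f p v w = dotForm (hessL f p v) w := rfl

/-- The critical points of `f` on the affine hyperplane `c · x = 1`. -/
def critSet (f : MvPolynomial (Fin m) ℂ) (c : Fin m → ℂ) : Set (Fin m → ℂ) :=
  {x | dotForm c x = 1 ∧ eval x f ≠ 0 ∧ ∃ l : ℂ, gradAt f x = l • c}

/-- `f` has no critical points near infinity, uniformly for linear forms close to `c`. -/
def TameAt (f : MvPolynomial (Fin m) ℂ) (c : Fin m → ℂ) (d : ℕ) : Prop :=
  ∃ ε > 0, ∃ C : ℝ, ∀ (x c' : Fin m → ℂ) (l : ℂ), ‖c' - c‖ ≤ ε → gradAt f x = l • c' →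
    eval x f ≠ 0 → ‖x‖ ^ d ≤ C * ‖eval x f‖

/-- The critical points of `f` on `c · x = 1` are nondegenerate. -/
def NondegAt (f : MvPolynomial (Fin m) ℂ) (c : Fin m → ℂ) : Prop :=
  ∀ p ∈ critSet f c, ∀ w, dotForm c w = 0 → (∀ w', dotForm c w' = 0 → hessB f p w w' = 0) → w = 0

lemma exists_orthonormal_ker {c : Fin (n + 1) → ℂ} (hc : c ≠ 0)
    (B : LinearMap.BilinForm ℂ (Fin (n + 1) → ℂ)) (hs : ∀ v w, B v w = B w v)
    (hB : ∀ w, dotForm c w = 0 → (∀ w', dotForm c w' = 0 → B w w' = 0) → w = 0)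
    {s : ℂ} (hs0 : s ≠ 0) :
    ∃ L : EuclideanSpace ℂ (Fin n) ≃ₗ[ℂ] LinearMap.ker (dotForm c).toLinearMap,
      ∀ z w, B (L z) (L w) = s * ∑ i, z i * w i := by
  set K := LinearMap.ker (dotForm c).toLinearMap with hK
  have hc' : ((dotForm c).toLinearMap : Module.Dual ℂ (Fin (n + 1) → ℂ)) ≠ 0 := by
    intro h
    apply hc
    ext i
    have := congrArg (fun g => g (Pi.single i 1)) h
    simpa [dotForm_apply, Pi.single_apply] using this
  have hr : Module.finrank ℂ K = n := by
    have := Module.Dual.finrank_ker_add_one_of_ne_zero hc'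
    simpa using this
  let BK : LinearMap.BilinForm ℂ K := s⁻¹ • B.restrict K
  have hB's : ∀ v w, BK v w = BK w v := fun v w => by
    simp [BK, hs v.1 w.1]
  let Q : QuadraticForm ℂ K := LinearMap.BilinMap.toQuadraticMap BK
  have hass : QuadraticMap.associated Q = BK := QuadraticMap.associated_left_inverse ℂ hB's
  have hsep : (QuadraticMap.associated (R := ℂ) Q).SeparatingLeft := by
    rw [hass]
    intro w hw
    have := hB w.1 w.2 fun w' hw' => by
      have := hw ⟨w', hw'⟩
      simpa [BK, hs0] using this
    exact Subtype.ext this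
  obtain ⟨e⟩ := QuadraticForm.equivalent_weightedSumSquares_of_isAlgClosed Q hsep
  let r : EuclideanSpace ℂ (Fin n) ≃ₗ[ℂ] (Fin (Module.finrank ℂ K) → ℂ) :=
    (WithLp.linearEquiv 2 ℂ (Fin n → ℂ)).trans
      (LinearEquiv.funCongrLeft ℂ ℂ (finCongr hr))
  let L := r.trans e.symm.toLinearEquiv
  have hq : ∀ z, BK (L z) (L z) = ∑ i, z i * z i := by
    intro z
    have h1 : Q (L z) = QuadraticMap.weightedSumSquares ℂ (1 : Fin (Module.finrank ℂ K) → ℂ) (r z) :=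
      e.symm.map_app (r z)
    have h2 : Q (L z) = BK (L z) (L z) := rfl
    rw [← h2, h1, QuadraticMap.weightedSumSquares_apply]
    simp only [Pi.one_apply, one_smul]
    exact Fintype.sum_equiv (finCongr hr) _ _ fun i => rfl
  have hbil : ∀ z w, BK (L z) (L w) = ∑ i, z i * w i := by
    intro z w
    have h1 := hq (z + w)
    simp only [map_add, LinearMap.add_apply, hq, hB's (L w) (L z)] at h1
    have h2 : ∑ i, (z + w) i * (z + w) i =
        ∑ i, z i * z i + ∑ i, w i * w i + 2 * ∑ i, z i * w i := by
      rw [Finset.mul_sum, ← Finset.sum_add_distrib, ← Finset.sum_add_distrib]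
      exact Finset.sum_congr rfl fun i _ => by simp; ring
    rw [h2] at h1
    have h3 : (2 : ℂ) ≠ 0 := two_ne_zero
    apply mul_left_cancel₀ h3
    linear_combination h1
  refine ⟨L, fun z w => ?_⟩
  rw [← hbil z w]
  simp [BK, hs0]

/-- The coordinates `(c · x, z)` with `x = (c · x) p + L z`. -/
lemma exists_chart {c p : Fin (n + 1) → ℂ} (hp : dotForm c p = 1)
    (L : EuclideanSpace ℂ (Fin n) ≃ₗ[ℂ] LinearMap.ker (dotForm c).toLinearMap) :
    ∃ ch : (Fin (n + 1) → ℂ) ≃L[ℂ] ℂ × EuclideanSpace ℂ (Fin n),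
      (∀ x, (ch x).1 = dotForm c x) ∧ ∀ s z, ch.symm (s, z) = s • p + (L z).1 := by
  have hL : ∀ z, dotForm c (L z).1 = 0 := fun z => (L z).2
  let e : (ℂ × EuclideanSpace ℂ (Fin n)) ≃ₗ[ℂ] (Fin (n + 1) → ℂ) :=
    { toFun := fun q => q.1 • p + (L q.2).1
      map_add' := fun q q' => by simp [add_smul]; abel
      map_smul' := fun a q => by simp [smul_smul]
      invFun := fun x => (dotForm c x, L.symm ⟨x - dotForm c x • p, by simp [hp]⟩)
      left_inv := fun q => by
        ext1
        · simp [hp, hL]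
        · simp only [LinearEquiv.symm_apply_eq]
          ext1
          simp [hp, hL]
      right_inv := fun x => by simp }
  exact ⟨e.symm.toContinuousLinearEquiv, fun x => rfl, fun s z => rfl⟩

lemma sum_mul_conjE (z : EuclideanSpace ℂ (Fin n)) : ∑ i, z i * conjE z i = (‖z‖ : ℂ) ^ 2 := by
  rw [← Complex.ofReal_pow, EuclideanSpace.norm_sq_eq]
  simp [Complex.mul_conj, Complex.normSq_eq_norm_sq]

/-- Near a nondegenerate critical point there are linear coordinates adapted to the quadratic part
of `f`. -/
lemma exists_morse_chart {f : MvPolynomial (Fin (n + 1)) ℂ} {c : Fin (n + 1) → ℂ}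
    (hN : NondegAt f c) {κ : ℂ} (hκ : κ ≠ 0) {p : Fin (n + 1) → ℂ} (hp : p ∈ critSet f c) :
    ∃ ch : (Fin (n + 1) → ℂ) ≃L[ℂ] ℂ × EuclideanSpace ℂ (Fin n),
      (∀ x, (ch x).1 = dotForm c x) ∧ ch.symm (1, 0) = p ∧
      ∀ᶠ z in 𝓝 (0 : EuclideanSpace ℂ (Fin n)),
        ‖dotForm (gradAt f (ch.symm (1, z))) (ch.symm (0, conjE z)) -
          2 * κ * ‖z‖ ^ 2 * eval (ch.symm (1, z)) f‖ ≤ ‖z‖ ^ 2 * ‖eval (ch.symm (1, z)) f‖ := by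
  obtain ⟨hp1, hp0, l, hl⟩ := id hp
  have hc : c ≠ 0 := by
    rintro rfl
    simp [dotForm_apply] at hp1
  obtain ⟨L, hL⟩ := exists_orthonormal_ker hc (hessB f p) (dotForm_hessL_comm f p) (hN p hp)
    (s := 2 * κ * eval p f) (by simp [hκ, hp0])
  obtain ⟨ch, hch, hs⟩ := exists_chart hp1 L
  refine ⟨ch, hch, by simp [hs], ?_⟩
  have hsc : Continuous fun z : EuclideanSpace ℂ (Fin n) => ch.symm (1, z) := by fun_prop
  -- a bound for the linear map `L`
  set T : EuclideanSpace ℂ (Fin n) →L[ℂ] (Fin (n + 1) → ℂ) :=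
    ch.symm.toContinuousLinearMap.comp (ContinuousLinearMap.inr ℂ ℂ (EuclideanSpace ℂ (Fin n)))
    with hT
  have hTL : ∀ z, T z = (L z).1 := fun z => by simp [hT, hs]
  have hpT : ∀ z, ch.symm (1, z) = p + T z := fun z => by rw [hs, hTL, one_smul]
  have hT0 : ∀ z, ch.symm (0, z) = T z := fun z => rfl
  obtain ⟨N, hN0, hNb⟩ : ∃ N : ℝ, 0 < N ∧ ∀ x y : Fin (n + 1) → ℂ,
      ‖dotForm x y‖ ≤ N * ‖x‖ * ‖y‖ := by
    refine ⟨n + 1, by positivity, fun x y => ?_⟩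
    rw [dotForm_apply]
    refine (norm_sum_le _ _).trans ((Finset.sum_le_sum fun i _ => ?_).trans (b := ∑ i : Fin (n + 1), ‖x‖ * ‖y‖) ?_)
    · rw [norm_mul]
      exact mul_le_mul (norm_le_pi_norm x i) (norm_le_pi_norm y i) (norm_nonneg _) (norm_nonneg _)
    · simp [mul_assoc]
  set f0 := ‖eval p f‖ with hf0
  have hf0' : 0 < f0 := norm_pos_iff.2 hp0
  -- Taylor expansion of the gradient
  have ho := (hasFDerivAt_gradAt f p).isLittleO
  have hη : 0 < f0 / (4 * N * (‖T‖ + 1) ^ 2) := by positivity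
  have hmap : Tendsto (fun z => ch.symm (1, z)) (𝓝 0) (𝓝 p) := by
    have := hsc.tendsto 0
    rwa [hpT, map_zero, add_zero] at this
  have h1 := hmap.eventually (ho.def hη)
  have hev : Tendsto (fun z => eval (ch.symm (1, z)) f) (𝓝 0) (𝓝 (eval p f)) :=
    ((continuous_eval_poly f).tendsto p).comp hmap
  have h2 : ∀ᶠ z in 𝓝 0, f0 / 2 < ‖eval (ch.symm (1, z)) f‖ :=
    (hev.norm).eventually (lt_mem_nhds (half_lt_self hf0'))
  have h3 : ∀ᶠ z in 𝓝 0, ‖2 * κ‖ * ‖eval (ch.symm (1, z)) f - eval p f‖ < f0 / 4 := by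
    have : Tendsto (fun z => ‖2 * κ‖ * ‖eval (ch.symm (1, z)) f - eval p f‖) (𝓝 0) (𝓝 0) := by
      have := ((hev.sub_const (eval p f)).norm).const_mul ‖2 * κ‖
      simpa using this
    exact this.eventually (gt_mem_nhds (by positivity))
  filter_upwards [h1, h2, h3] with z h1 h2 h3
  rw [hpT] at h1 h2 h3 ⊢
  rw [hT0]
  have hc0 : dotForm c (T (conjE z)) = 0 := by rw [hTL]; exact (L _).2
  have hquad : dotForm (hessL f p (T z)) (T (conjE z)) = 2 * κ * eval p f * ‖z‖ ^ 2 := by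
    rw [hTL, hTL, ← hessB_apply, hL, sum_mul_conjE]
  rw [add_sub_cancel_left] at h1
  have hkey : dotForm (gradAt f (p + T z)) (T (conjE z)) - 2 * κ * ‖z‖ ^ 2 * eval (p + T z) f =
      dotForm (gradAt f (p + T z) - gradAt f p - hessL f p (T z)) (T (conjE z)) -
        ‖z‖ ^ 2 * (2 * κ * (eval (p + T z) f - eval p f)) := by
    have e1 : dotForm (gradAt f (p + T z) - gradAt f p - hessL f p (T z)) (T (conjE z)) =
        dotForm (gradAt f (p + T z)) (T (conjE z)) - dotForm (gradAt f p) (T (conjE z)) -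
          dotForm (hessL f p (T z)) (T (conjE z)) := by
      simp [dotForm_apply, sub_mul, Finset.sum_sub_distrib]
    rw [e1, hquad, hl, dotForm_smul_left, hc0]
    ring
  have hTn : ∀ w, ‖T w‖ ≤ (‖T‖ + 1) * ‖w‖ := fun w =>
    (T.le_opNorm w).trans (by gcongr; linarith)
  have hb1 : ‖dotForm (gradAt f (p + T z) - gradAt f p - hessL f p (T z)) (T (conjE z))‖ ≤
      ‖z‖ ^ 2 * (f0 / 4) := by
    refine (hNb _ _).trans ?_
    calc _ ≤ N * (f0 / (4 * N * (‖T‖ + 1) ^ 2) * ((‖T‖ + 1) * ‖z‖)) * ((‖T‖ + 1) * ‖z‖) := by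
          gcongr
          · exact h1.trans (by gcongr; exact hTn z)
          · exact (hTn _).trans (by rw [norm_conjE])
      _ = _ := by field_simp
  rw [hkey]
  refine (norm_sub_le _ _).trans ?_
  have hb2 : ‖(‖z‖ : ℂ) ^ 2 * (2 * κ * (eval (p + T z) f - eval p f))‖ ≤ ‖z‖ ^ 2 * (f0 / 4) := by
    rw [norm_mul, norm_pow, Complex.norm_real, norm_norm, norm_mul (2 * κ)]
    gcongr
  calc _ ≤ ‖z‖ ^ 2 * (f0 / 4) + ‖z‖ ^ 2 * (f0 / 4) := add_le_add hb1 hb2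
    _ = ‖z‖ ^ 2 * (f0 / 2) := by ring
    _ ≤ _ := by gcongr

end

section
open Set Filter Topology

variable {n d m : ℕ}

lemma exists_eq_smul_iff {c g : Fin m → ℂ} (hc : c ≠ 0) :
    (∃ l : ℂ, g = l • c) ↔ ∀ i j, c i * g j = c j * g i := by
  constructor
  · rintro ⟨l, rfl⟩ i j
    simp; ring
  · intro h
    obtain ⟨i, hi⟩ : ∃ i, c i ≠ 0 := by
      by_contra! h'
      exact hc (funext h')
    refine ⟨g i / c i, funext fun j => ?_⟩
    have := h i j
    rw [Pi.smul_apply, smul_eq_mul, div_mul_eq_mul_div, eq_div_iff hi]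
    linear_combination this

/-- Rescaling to the affine hyperplane `c · x = 1`. -/
lemma inv_smul_mem_critSet {f : MvPolynomial (Fin m) ℂ} (hf : f.IsHomogeneous d) (hd : 0 < d)
    {c x : Fin m → ℂ} (hx : eval x f ≠ 0) {l : ℂ} (hl : gradAt f x = l • c) :
    dotForm c x ≠ 0 ∧ (dotForm c x)⁻¹ • x ∈ critSet f c := by
  have h0 : dotForm c x ≠ 0 := by
    intro h
    have h1 := dotForm_gradAt_self hf x
    rw [hl, dotForm_smul_left, h, mul_zero] at h1
    have : (d : ℂ) ≠ 0 := by exact_mod_cast hd.ne'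
    exact mul_ne_zero this hx h1.symm
  refine ⟨h0, by simp [h0], ?_, (dotForm c x)⁻¹ ^ (d - 1) * l, ?_⟩
  · rw [eval_smul_of_isHomogeneous hf]
    exact mul_ne_zero (pow_ne_zero _ (inv_ne_zero h0)) hx
  · rw [gradAt_smul hf, hl, smul_smul]

lemma isCompact_critSet {f : MvPolynomial (Fin m) ℂ} (hf : f.IsHomogeneous d) (hd : 0 < d)
    {c : Fin m → ℂ} (hc : c ≠ 0) (hT : TameAt f c d) : IsCompact (critSet f c) := by
  obtain ⟨ε, hε, C, hC⟩ := hT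
  let S : Set (Fin m → ℂ) := {x | ‖x‖ = 1 ∧ 1 ≤ C * ‖eval x f‖ ∧
    ∀ i j, c i * gradAt f x j = c j * gradAt f x i}
  have hg : ∀ i, Continuous fun x => gradAt f x i := fun i =>
    (continuous_apply i).comp (continuous_gradAt f)
  have hS : IsCompact S := by
    refine (isCompact_sphere (0 : Fin m → ℂ) 1).of_isClosed_subset ?_ fun x hx => by
      simpa using hx.1
    have e : S = {x | ‖x‖ = 1} ∩ ({x | 1 ≤ C * ‖eval x f‖} ∩
        ⋂ i, ⋂ j, {x | c i * gradAt f x j = c j * gradAt f x i}) := by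
      ext x; simp [S]
    rw [e]
    refine (isClosed_eq continuous_norm continuous_const).inter
      ((isClosed_le continuous_const ?_).inter (isClosed_iInter fun i => isClosed_iInter fun j =>
        isClosed_eq (continuous_const.mul (hg j)) (continuous_const.mul (hg i))))
    exact continuous_const.mul (continuous_eval_poly f).norm
  have key : ∀ x ∈ S, eval x f ≠ 0 ∧ ∃ l : ℂ, gradAt f x = l • c := by
    intro x hx
    refine ⟨fun h => ?_, (exists_eq_smul_iff hc).2 hx.2.2⟩
    have := hx.2.1
    rw [h] at this
    norm_num at this
  have himg : critSet f c = (fun x => (dotForm c x)⁻¹ • x) '' S := by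
    ext y
    constructor
    · rintro ⟨h1, h2, l, hl⟩
      have hy : y ≠ 0 := by rintro rfl; simp at h1
      have hy' : (‖y‖ : ℂ) ≠ 0 := by simpa using hy
      have hb := hC y c l (by simpa using hε.le) hl h2
      refine ⟨(‖y‖ : ℂ)⁻¹ • y, ⟨?_, ?_, ?_⟩, ?_⟩
      · simp [norm_smul, hy]
      · rw [eval_smul_of_isHomogeneous hf, norm_mul, norm_pow, norm_inv, Complex.norm_real,
          norm_norm, inv_pow]
        have : 0 < ‖y‖ ^ d := by positivity
        rw [mul_left_comm, inv_mul_eq_div, le_div_iff₀ this, one_mul]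
        exact hb
      · rw [← exists_eq_smul_iff hc]
        exact ⟨_, by rw [gradAt_smul hf, hl, smul_smul]⟩
      · simp [h1, smul_smul, hy']
    · rintro ⟨x, hx, rfl⟩
      obtain ⟨h2, l, hl⟩ := key x hx
      exact (inv_smul_mem_critSet hf hd h2 hl).2
  rw [himg]
  refine hS.image_of_continuousOn ?_
  refine ContinuousOn.smul (ContinuousOn.inv₀ (dotForm c).continuous.continuousOn fun x hx => ?_)
    continuousOn_id
  obtain ⟨h2, l, hl⟩ := key x hx
  exact (inv_smul_mem_critSet hf hd h2 hl).1

lemma finite_critSet {f : MvPolynomial (Fin (n + 1)) ℂ} (hf : f.IsHomogeneous d) (hd : 0 < d)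
    {c : Fin (n + 1) → ℂ} (hc : c ≠ 0) (hT : TameAt f c d) (hN : NondegAt f c) :
    (critSet f c).Finite := by
  by_contra hinf
  obtain ⟨p, hp, hacc⟩ := Set.Infinite.exists_accPt_of_subset_isCompact hinf
    (isCompact_critSet hf hd hc hT) subset_rfl
  obtain ⟨ch, hch, hchp, hrho⟩ := exists_morse_chart hN one_ne_zero hp
  have hcp : ch p = (1, 0) := by rw [← hchp]; simp
  have ht : Tendsto (fun y => (ch y).2) (𝓝 p) (𝓝 0) := by
    have : Continuous fun y => (ch y).2 := by fun_prop
    simpa [hcp] using this.tendsto p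
  have hfr := accPt_iff_frequently.1 hacc
  obtain ⟨y, ⟨hyp, hy⟩, hb⟩ := (hfr.and_eventually (ht.eventually hrho)).exists
  apply hyp
  obtain ⟨h1, h2, l, hl⟩ := hy
  set z := (ch y).2 with hz
  have hyz : ch y = (1, z) := by
    ext1
    · rw [hch, h1]
    · rfl
  have hs : ch.symm (1, z) = y := by rw [← hyz]; simp
  rw [hs, hl, dotForm_smul_left, ← hch] at hb
  simp only [ContinuousLinearEquiv.apply_symm_apply, mul_zero, zero_sub, norm_neg, norm_mul,
    norm_pow, Complex.norm_real, norm_norm] at hb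
  have hf' : 0 < ‖eval y f‖ := norm_pos_iff.2 h2
  have : ‖z‖ ^ 2 * ‖eval y f‖ ≤ 0 := by
    norm_num at hb
    linarith
  have hz0 : z = 0 := by
    by_contra hne
    have : 0 < ‖z‖ := norm_pos_iff.2 hne
    nlinarith [mul_pos (pow_pos this 2) hf']
  rw [← hs, hz0, hchp]

lemma exists_generic_slope {ι : Type*} [Finite ι] (r : ι → ℂ) (hr : ∀ i, r i ≠ 1) :
    ∃ κ : ℂ, κ.re = 1 ∧ ∀ i, ∀ τ : ℝ, 0 ≤ τ → r i ≠ Complex.exp (κ * τ) := by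
  have key : ∀ i, ∀ᶠ a : ℝ in 𝓝[≠] 0, ∀ τ : ℝ, 0 ≤ τ →
      r i ≠ Complex.exp ((1 + a * Complex.I) * τ) := by
    intro i
    set t := Real.log ‖r i‖ with ht
    have hτ : ∀ a τ : ℝ, r i = Complex.exp ((1 + a * Complex.I) * τ) → τ = t := by
      intro a τ h
      rw [ht, h, Complex.norm_exp]
      simp
    by_cases h0 : t = 0
    · refine Eventually.of_forall fun a τ _ h => hr i ?_
      rw [h, hτ a τ h, h0]
      simp
    have hder : HasDerivAt (fun a : ℝ => Complex.exp ((1 + a * Complex.I) * t))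
        (Complex.exp ((1 + (0 : ℝ) * Complex.I) * t) * ((1 * Complex.I) * t)) 0 := by
      have h1 : HasDerivAt (fun a : ℝ => (a : ℂ)) 1 0 := Complex.ofRealCLM.hasDerivAt
      exact (((h1.mul_const Complex.I).const_add 1).mul_const (t : ℂ)).cexp
    have := hder.eventually_ne (c := r i) (by simp [h0])
    filter_upwards [this] with a ha τ _ h
    exact ha (by rw [← hτ a τ h, ← h])
  obtain ⟨a, ha⟩ := (eventually_all.2 key).exists
  exact ⟨1 + a * Complex.I, by simp, ha⟩

lemma eventually_ne_exp {κ : ℂ} (hκ : κ.re = 1) {r : ℂ} (hr0 : r ≠ 0)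
    (hr : ∀ τ : ℝ, 0 ≤ τ → r ≠ Complex.exp (κ * τ)) :
    ∀ᶠ w in 𝓝 r, ∀ τ : ℝ, 0 ≤ τ → w ≠ Complex.exp (κ * τ) := by
  have hτ : ∀ (w : ℂ) (τ : ℝ), w = Complex.exp (κ * τ) → τ = Real.log ‖w‖ := by
    intro w τ h
    rw [h, Complex.norm_exp]
    simp [hκ]
  have hcont : ContinuousAt (fun w : ℂ => w - Complex.exp (κ * (Real.log ‖w‖ : ℝ))) r := by
    refine continuousAt_id.sub (Complex.continuous_exp.continuousAt.comp
      (continuousAt_const.mul (Complex.continuous_ofReal.continuousAt.comp ?_)))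
    exact (Real.continuousAt_log (norm_ne_zero_iff.2 hr0)).comp continuous_norm.continuousAt
  by_cases h : r - Complex.exp (κ * (Real.log ‖r‖ : ℝ)) = 0
  · have h1 : ‖r‖ < 1 := by
      by_contra! h1
      exact hr _ (Real.log_nonneg h1) (sub_eq_zero.1 h)
    filter_upwards [continuous_norm.continuousAt.eventually (gt_mem_nhds h1)] with w hw τ h0 hwτ
    rw [hwτ, Complex.norm_exp] at hw
    simp [hκ] at hw
    linarith
  · filter_upwards [hcont.eventually_ne h] with w hw τ h0 hwτ
    rw [← hτ w τ hwτ] at hw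
    exact hw (sub_eq_zero.2 hwτ)

end

section
open Set Filter Topology

variable {n d k : ℕ}

lemma exists_delta {E : Type*} [NormedAddCommGroup E] {P : E → E → Prop}
    (h : ∀ᶠ q in 𝓝 (0 : E × E), P q.1 q.2) :
    ∃ δ > 0, ∀ z w, ‖z‖ ≤ δ → ‖w‖ ≤ δ → P z w := by
  obtain ⟨δ, hδ, hP⟩ := Metric.eventually_nhds_iff.1 h
  refine ⟨δ / 2, by positivity, fun z w hz hw => hP (y := (z, w)) ?_⟩
  rw [dist_zero_right, Prod.norm_def]
  exact (max_le hz hw).trans_lt (half_lt_self hδ)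

/-- Away from the critical lines, the gradient of `f` is uniformly far from being parallel to `c`. -/
lemma exists_orth_bound {f : MvPolynomial (Fin (n + 1)) ℂ} (hf : f.IsHomogeneous d) (hd : 0 < d)
    {c : Fin (n + 1) → ℂ} (hc : c ≠ 0) (hT : TameAt f c d) {p : Fin k → Fin (n + 1) → ℂ}
    (hp : range p = critSet f c)
    {ch : Fin k → ((Fin (n + 1) → ℂ) ≃L[ℂ] ℂ × EuclideanSpace ℂ (Fin n))}
    (hchp : ∀ i, (ch i).symm (1, 0) = p i)
    {δ : ℝ} (hδ : 0 < δ) :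
    ∃ ε > 0, ∀ x, eval x f ≠ 0 → (∀ i, δ / 2 * ‖dotForm c x‖ ≤ ‖(ch i x).2‖) →
      ε ≤ ‖orthPart c (gradAt f x)‖ := by
  obtain ⟨εT, hεT, C, hC⟩ := hT
  let S : Set (Fin (n + 1) → ℂ) := {x | ‖x‖ = 1 ∧ 1 ≤ C * ‖eval x f‖ ∧
    ∀ i, δ / 2 * ‖dotForm c x‖ ≤ ‖(ch i x).2‖}
  have hS : IsCompact S := by
    refine (isCompact_sphere (0 : Fin (n + 1) → ℂ) 1).of_isClosed_subset ?_ fun x hx => by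
      simpa using hx.1
    have e : S = {x | ‖x‖ = 1} ∩ ({x | 1 ≤ C * ‖eval x f‖} ∩
        ⋂ i, {x | δ / 2 * ‖dotForm c x‖ ≤ ‖(ch i x).2‖}) := by
      ext x; simp [S]
    rw [e]
    refine (isClosed_eq continuous_norm continuous_const).inter
      ((isClosed_le continuous_const ?_).inter (isClosed_iInter fun i =>
        isClosed_le (by fun_prop) (by fun_prop)))
    exact continuous_const.mul (continuous_eval_poly f).norm
  have hS0 : ∀ x ∈ S, eval x f ≠ 0 := by
    intro x hx h
    have := hx.2.1
    rw [h] at this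
    norm_num at this
  have hpos : ∀ x ∈ S, 0 < ‖orthPart c (gradAt f x)‖ := by
    intro x hx
    refine norm_pos_iff.2 fun h => ?_
    rw [orthPart, sub_eq_zero] at h
    set μ := hermDot c (gradAt f x) / hermDot (gradAt f x) (gradAt f x)
    have hμ : μ ≠ 0 := by
      intro h0
      rw [h0, zero_smul] at h
      exact hc h
    have hg : gradAt f x = μ⁻¹ • c := by
      rw [eq_inv_smul_iff₀ hμ]
      exact h.symm
    obtain ⟨h0, hcr⟩ := inv_smul_mem_critSet hf hd (hS0 x hx) hg
    rw [← hp] at hcr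
    obtain ⟨i, hi⟩ := hcr
    have h1 : ch i x = dotForm c x • (1, 0) := by
      have : x = dotForm c x • p i := by rw [hi, smul_inv_smul₀ h0]
      conv_lhs => rw [this]
      rw [map_smul, ← hchp]
      simp
    have h2 := hx.2.2 i
    rw [h1] at h2
    simp only [Prod.smul_mk, smul_zero, norm_zero] at h2
    have : 0 < δ / 2 * ‖dotForm c x‖ := by
      have := norm_pos_iff.2 h0
      positivity
    linarith
  have hcont : ContinuousOn (fun x => ‖orthPart c (gradAt f x)‖) S := by
    intro x hx
    have h1 : ContDiffAt ℝ 1 (gradAt f) x := ((contDiff_gradAt f).restrict_scalars ℝ).contDiffAt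
    exact (contDiffAt_orthPart c h1
      (MorseData.gradAt_ne_zero hf hd (hS0 x hx))).continuousAt.norm.continuousWithinAt
  obtain ⟨ε0, hε0, hb⟩ : ∃ ε > 0, ∀ x ∈ S, ε ≤ ‖orthPart c (gradAt f x)‖ := by
    rcases S.eq_empty_or_nonempty with h | h
    · exact ⟨1, one_pos, by simp [h]⟩
    · obtain ⟨x, hx, hm⟩ := hS.exists_isMinOn h hcont
      exact ⟨_, hpos x hx, fun y hy => hm hy⟩
  have hcn : 0 < ‖c‖ := norm_pos_iff.2 hc
  refine ⟨min ε0 (min εT (‖c‖ / 2)), by positivity, fun x hx hi => ?_⟩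
  by_contra! hlt
  have hl0 := hlt.trans_le (min_le_left _ _)
  have hlT := hlt.trans_le ((min_le_right _ _).trans (min_le_left _ _))
  have hlc := hlt.trans_le ((min_le_right _ _).trans (min_le_right _ _))
  set μ := hermDot c (gradAt f x) / hermDot (gradAt f x) (gradAt f x) with hμd
  have ho : c - orthPart c (gradAt f x) = μ • gradAt f x := by simp [orthPart, hμd]
  have hμ : μ ≠ 0 := by
    intro h0
    rw [h0, zero_smul, sub_eq_zero] at ho
    rw [← ho] at hlc
    linarith
  have hg : gradAt f x = μ⁻¹ • (c - orthPart c (gradAt f x)) := by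
    rw [eq_inv_smul_iff₀ hμ, ho]
  have ht := hC x _ _ (by simpa using hlT.le) hg hx
  have hx0 : x ≠ 0 := by
    rintro rfl
    exact hx (eval_zero_of_isHomogeneous hf hd)
  have hxn : 0 < ‖x‖ := norm_pos_iff.2 hx0
  have ha : ((‖x‖ : ℂ)⁻¹) ≠ 0 := by simpa using hx0
  have hxS : (‖x‖ : ℂ)⁻¹ • x ∈ S := by
    refine ⟨by simp [norm_smul, hx0], ?_, fun i => ?_⟩
    · rw [eval_smul_of_isHomogeneous hf, norm_mul, norm_pow, norm_inv, Complex.norm_real,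
        norm_norm, inv_pow]
      have : 0 < ‖x‖ ^ d := by positivity
      rw [mul_left_comm, inv_mul_eq_div, le_div_iff₀ this, one_mul]
      exact ht
    · have := hi i
      simp only [map_smul, Prod.smul_snd, norm_smul, norm_inv, Complex.norm_real, norm_norm,
        smul_eq_mul, norm_mul]
      rw [mul_left_comm]
      gcongr
  have := hb _ hxS
  rw [gradAt_smul hf, orthPart_smul _ _ (pow_ne_zero _ ha)] at this
  linarith

lemma exists_morseData {f : MvPolynomial (Fin (n + 1)) ℂ} (hf : f.IsHomogeneous d) (hd : 0 < d)
    {c : Fin (n + 1) → ℂ} (hc : c ≠ 0) (hT : TameAt f c d) (hN : NondegAt f c)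
    {p : Fin k → Fin (n + 1) → ℂ} (hinj : Function.Injective p) (hp : range p = critSet f c) :
    Nonempty (MorseData f c k) := by
  have hpc : ∀ i, p i ∈ critSet f c := fun i => hp ▸ mem_range_self i
  have hp0 : ∀ i, eval (p i) f ≠ 0 := fun i => (hpc i).2.1
  obtain ⟨κ, hκ1, hκ⟩ := exists_generic_slope
    (ι := {q : Fin k × Fin k // eval (p q.1) f ≠ eval (p q.2) f})
    (fun q => eval (p q.1.2) f / eval (p q.1.1) f) fun q h => by
      rw [div_eq_one_iff_eq (hp0 _)] at h
      exact q.2 h.symm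
  have hκ0 : κ ≠ 0 := by rintro rfl; simp at hκ1
  choose ch hch hchp hrho using fun i => exists_morse_chart hN hκ0 (hpc i)
  have hsc : ∀ i, Tendsto (fun z : EuclideanSpace ℂ (Fin n) => (ch i).symm (1, z)) (𝓝 0)
      (𝓝 (p i)) := by
    intro i
    have : Continuous fun z : EuclideanSpace ℂ (Fin n) => (ch i).symm (1, z) := by fun_prop
    simpa [hchp] using this.tendsto 0
  have hev : ∀ i, Tendsto (fun z : EuclideanSpace ℂ (Fin n) => eval ((ch i).symm (1, z)) f) (𝓝 0)
      (𝓝 (eval (p i) f)) := fun i => ((continuous_eval_poly f).tendsto _).comp (hsc i)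
  have hfst : Tendsto Prod.fst (𝓝 (0 : EuclideanSpace ℂ (Fin n) × EuclideanSpace ℂ (Fin n)))
      (𝓝 0) := continuous_fst.tendsto _
  have hsnd : Tendsto Prod.snd (𝓝 (0 : EuclideanSpace ℂ (Fin n) × EuclideanSpace ℂ (Fin n)))
      (𝓝 0) := continuous_snd.tendsto _
  have hev0 : ∀ i, ∀ᶠ z in 𝓝 (0 : EuclideanSpace ℂ (Fin n)), eval ((ch i).symm (1, z)) f ≠ 0 :=
    fun i => (hev i).eventually_ne (hp0 i)
  have hsep : ∀ i j, eval (p i) f ≠ eval (p j) f →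
      ∀ᶠ q in 𝓝 (0 : EuclideanSpace ℂ (Fin n) × EuclideanSpace ℂ (Fin n)),
      ∀ τ : ℝ, 0 ≤ τ → eval ((ch j).symm (1, q.2)) f ≠
        eval ((ch i).symm (1, q.1)) f * Complex.exp (κ * τ) := by
    intro i j hij
    have h1 := ((hev j).comp hsnd).div ((hev i).comp hfst) (hp0 i)
    have h2 := h1.eventually (eventually_ne_exp hκ1 (div_ne_zero (hp0 j) (hp0 i))
      (hκ ⟨(i, j), hij⟩))
    filter_upwards [h2, hfst.eventually (hev0 i)] with q hq h0 τ hτ h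
    exact hq τ hτ (by
      show eval _ f / eval _ f = _
      rw [h, mul_div_cancel_left₀ _ h0])
  have hdisj : ∀ i j, i ≠ j →
      ∀ᶠ q in 𝓝 (0 : EuclideanSpace ℂ (Fin n) × EuclideanSpace ℂ (Fin n)),
      (ch i).symm (1, q.1) ≠ (ch j).symm (1, q.2) := by
    intro i j hij
    filter_upwards [(((hsc i).comp hfst).sub ((hsc j).comp hsnd)).eventually_ne
      (sub_ne_zero.2 fun h => hij (hinj h))] with q hq using sub_ne_zero.1 hq
  obtain ⟨δ0, hδ0, hδ⟩ := exists_delta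
    (P := fun z w => (∀ i, eval ((ch i).symm (1, z)) f ≠ 0 ∧
      ‖dotForm (gradAt f ((ch i).symm (1, z))) ((ch i).symm (0, conjE z)) -
          2 * κ * ‖z‖ ^ 2 * eval ((ch i).symm (1, z)) f‖ ≤
        ‖z‖ ^ 2 * ‖eval ((ch i).symm (1, z)) f‖) ∧
      ∀ i j, (eval (p i) f ≠ eval (p j) f → ∀ τ : ℝ, 0 ≤ τ → eval ((ch j).symm (1, w)) f ≠
        eval ((ch i).symm (1, z)) f * Complex.exp (κ * τ)) ∧
        (i ≠ j → (ch i).symm (1, z) ≠ (ch j).symm (1, w)))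
    (by
      refine (eventually_all.2 fun i => ?_).and
        (eventually_all.2 fun i => eventually_all.2 fun j => ?_)
      · exact hfst.eventually ((hev0 i).and (hrho i))
      · refine Eventually.and ?_ ?_
        · by_cases h : eval (p i) f = eval (p j) f
          · exact Eventually.of_forall fun q h' => absurd h h'
          · filter_upwards [hsep i j h] with q hq _ using hq
        · by_cases h : i = j
          · exact Eventually.of_forall fun q h' => absurd h h'
          · filter_upwards [hdisj i j h] with q hq _ using hq)
  set δ := min δ0 1 with hδd
  have hδpos : 0 < δ := lt_min hδ0 one_pos
  have hδle : δ ≤ δ0 := min_le_left _ _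
  obtain ⟨a0, ha0, hgain⟩ := exists_delta (E := EuclideanSpace ℂ (Fin n))
    (P := fun z w => ∀ i j, eval (p i) f = eval (p j) f →
      Real.log ‖eval ((ch j).symm (1, w)) f‖ - Real.log ‖eval ((ch i).symm (1, z)) f‖ < δ ^ 2 / 16)
    (by
      refine eventually_all.2 fun i => eventually_all.2 fun j => ?_
      by_cases h : eval (p i) f = eval (p j) f
      · have hlog : ∀ i, Tendsto (fun z : EuclideanSpace ℂ (Fin n) =>
            Real.log ‖eval ((ch i).symm (1, z)) f‖) (𝓝 0) (𝓝 (Real.log ‖eval (p i) f‖)) :=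
          fun i => (hev i).norm.log (norm_ne_zero_iff.2 (hp0 i))
        have h1 := ((hlog j).comp hsnd).sub ((hlog i).comp hfst)
        rw [h, sub_self] at h1
        filter_upwards [h1.eventually (gt_mem_nhds (show (0 : ℝ) < δ ^ 2 / 16 by positivity))]
          with q hq _ using hq
      · exact Eventually.of_forall fun q h' => absurd h' h)
  obtain ⟨ε, hε, horth⟩ := exists_orth_bound hf hd hc hT hp hchp hδpos
  set a := min (a0 / 2) (δ / 8) with had
  have hapos : 0 < a := lt_min (by positivity) (by positivity)
  have ha1 : a ≤ a0 / 2 := min_le_left _ _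
  have ha2 : a ≤ δ / 8 := min_le_right _ _
  have hsmall : ∀ z : EuclideanSpace ℂ (Fin n), ‖z‖ ^ 2 ≤ 2 * a ^ 2 → ‖z‖ ≤ a0 := by
    intro z hz
    nlinarith [norm_nonneg z]
  refine ⟨{ κ := κ, κ_re := hκ1, ch := ch, ch_fst := hch, δ := δ, δ_pos := hδpos,
            δ_le := min_le_right _ _, ε := ε, ε_pos := hε, orth_bound := horth,
            a := a, a_pos := hapos, a_lt := ?_,
            eval_ne := ?_, rho := ?_, disj := ?_, gain := ?_, sep := ?_ }⟩
  · exact fun i z hz => ((hδ z z (hz.trans hδle) (hz.trans hδle)).1 i).1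
  · exact fun i z hz => ((hδ z z (hz.trans hδle) (hz.trans hδle)).1 i).2
  · intro i j x h0 hi hj
    by_contra hij
    have hn : 0 < ‖dotForm c x‖ := norm_pos_iff.2 h0
    have hb : ∀ i, ‖(ch i x).2‖ ≤ δ * ‖dotForm c x‖ →
        ‖(dotForm c x)⁻¹ • (ch i x).2‖ ≤ δ0 ∧
        (ch i).symm (1, (dotForm c x)⁻¹ • (ch i x).2) = (dotForm c x)⁻¹ • x := by
      intro i hi
      constructor
      · rw [norm_smul, norm_inv, inv_mul_le_iff₀ hn]
        exact hi.trans (by rw [mul_comm]; gcongr)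
      · rw [ContinuousLinearEquiv.symm_apply_eq]
        ext1
        · simp [hch, h0]
        · simp
    refine ((hδ _ _ (hb i hi).1 (hb j hj).1).2 i j).2 hij ?_
    rw [(hb i hi).2, (hb j hj).2]
  · nlinarith
  · intro i j hij z w hz hw
    rw [hchp, hchp] at hij
    have := hgain z w (hsmall z hz) (hsmall w hw) i j hij
    nlinarith
  · intro i j hij z w hz hw
    rw [hchp, hchp] at hij
    exact ((hδ z w (hz.trans hδle) (hw.trans hδle)).2 i j).1 hij

end

section
open Set Filter Topology

variable {n d m : ℕ}

/-- Any polynomial is algebraically dependent on `m` given polynomials in `m` variables, or these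
are themselves dependent. -/
lemma exists_algebraic_relation (g : Fin m → MvPolynomial (Fin m) ℂ) (h : MvPolynomial (Fin m) ℂ) :
    ∃ P : Polynomial (MvPolynomial (Fin m) ℂ), P ≠ 0 ∧
      ∀ x, (P.map (eval fun i => eval x (g i))).eval (eval x h) = 0 := by
  have hdep : ¬ AlgebraicIndependent ℂ (fun o : Option (Fin m) => o.elim h g) := by
    intro hi
    have h1 := hi.cardinalMk_le_trdeg
    rw [MvPolynomial.trdeg_of_isDomain] at h1
    simp only [Cardinal.mk_option, Cardinal.mk_fin, Cardinal.lift_natCast] at h1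
    have h2 : ((m + 1 : ℕ) : Cardinal.{0}) ≤ m := by exact_mod_cast h1
    rw [Nat.cast_le] at h2
    omega
  rw [algebraicIndependent_iff] at hdep
  push Not at hdep
  obtain ⟨Q, hQ, hQ0⟩ := hdep
  refine ⟨optionEquivLeft ℂ (Fin m) Q, by simpa using hQ0, fun x => ?_⟩
  rw [← optionEquivLeft_elim_eval]
  have h1 := congrArg (eval x) hQ
  rw [map_zero, aeval_def, eval_eval₂] at h1
  rw [← h1, eval_eq', eval₂_eq']
  refine Finset.sum_congr rfl fun s _ => ?_
  congr 1
  · simp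
  · refine Finset.prod_congr rfl fun o _ => ?_
    cases o <;> simp

lemma eval_map_eq_sum (P : Polynomial (MvPolynomial (Fin m) ℂ)) (y : Fin m → ℂ) (t : ℂ) :
    (P.map (eval y)).eval t = ∑ j ∈ Finset.range (P.natDegree + 1), eval y (P.coeff j) * t ^ j := by
  rw [Polynomial.eval_map, Polynomial.eval₂_eq_sum_range]

/-- Fibrewise upper bounds: away from a hypersurface, `h` is bounded on the fibres of `g`. -/
lemma exists_fibre_bound (g : Fin m → MvPolynomial (Fin m) ℂ) (h : MvPolynomial (Fin m) ℂ) :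
    ∃ A : MvPolynomial (Fin m) ℂ, A ≠ 0 ∧ ∀ c, eval c A ≠ 0 →
      ∃ ε > 0, ∃ C : ℝ, ∀ x, ‖(fun i => eval x (g i)) - c‖ ≤ ε → ‖eval x h‖ ≤ C := by
  obtain ⟨P, hP, hPx⟩ := exists_algebraic_relation g h
  set s := P.natDegree with hs
  refine ⟨P.leadingCoeff, by simpa using hP, fun c hc => ?_⟩
  have hcont : Continuous fun q : (Fin m → ℂ) × ℂ =>
      ∑ j ∈ Finset.range (s + 1), eval q.1 (P.coeff j) * q.2 ^ (s - j) := by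
    refine continuous_finsetSum _ fun j _ => Continuous.mul ?_ (by fun_prop)
    exact (continuous_eval_poly (P.coeff j)).comp continuous_fst
  have h0 : ∑ j ∈ Finset.range (s + 1), eval c (P.coeff j) * (0 : ℂ) ^ (s - j) ≠ 0 := by
    rw [Finset.sum_range_succ, Finset.sum_eq_zero]
    · simpa [hs] using hc
    · intro j hj
      have : s - j ≠ 0 := by simp at hj; omega
      simp [this]
  have hev := (hcont.tendsto (c, 0)).eventually_ne h0
  obtain ⟨δ, hδ, hb⟩ := Metric.eventually_nhds_iff.1 hev
  refine ⟨δ / 2, by positivity, (δ / 2)⁻¹, fun x hx => ?_⟩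
  by_contra! hlt
  have ht : eval x h ≠ 0 := by
    intro h0
    rw [h0, norm_zero] at hlt
    have : 0 < (δ / 2)⁻¹ := by positivity
    linarith
  refine hb (y := (fun i => eval x (g i), (eval x h)⁻¹)) ?_ ?_
  · rw [Prod.dist_eq, dist_eq_norm, dist_zero_right, norm_inv]
    refine max_lt (hx.trans_lt (half_lt_self hδ)) ?_
    exact (inv_lt_of_inv_lt₀ (by positivity) hlt).trans (half_lt_self hδ)
  · have h1 := hPx x
    rw [eval_map_eq_sum] at h1
    have h2 : (∑ j ∈ Finset.range (s + 1), eval (fun i => eval x (g i)) (P.coeff j) *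
        (eval x h)⁻¹ ^ (s - j)) * eval x h ^ s = 0 := by
      rw [← h1, Finset.sum_mul]
      refine Finset.sum_congr rfl fun j hj => ?_
      have hj' : j ≤ s := by simp at hj; omega
      rw [mul_assoc, inv_pow, ← pow_sub_mul_pow (eval x h) hj', inv_mul_cancel_left₀
        (pow_ne_zero _ ht)]
    exact (mul_eq_zero.1 h2).resolve_right (pow_ne_zero _ ht)

/-- Fibrewise lower bounds: away from a hypersurface, `h` is bounded away from zero on the fibres
of `g`. -/
lemma exists_fibre_lower_bound (g : Fin m → MvPolynomial (Fin m) ℂ) {h : MvPolynomial (Fin m) ℂ}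
    (hh : h ≠ 0) :
    ∃ A : MvPolynomial (Fin m) ℂ, A ≠ 0 ∧ ∀ c, eval c A ≠ 0 →
      ∃ ε > 0, ∃ η > 0, ∀ x, ‖(fun i => eval x (g i)) - c‖ ≤ ε → η ≤ ‖eval x h‖ := by
  obtain ⟨P, hP, hPx, hP0⟩ : ∃ P : Polynomial (MvPolynomial (Fin m) ℂ), P ≠ 0 ∧
      (∀ x, (P.map (eval fun i => eval x (g i))).eval (eval x h) = 0) ∧ P.coeff 0 ≠ 0 := by
    obtain ⟨P, hP, hPx⟩ := exists_algebraic_relation g h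
    obtain ⟨Q, hQ, hdvd⟩ := Polynomial.exists_eq_pow_rootMultiplicity_mul_and_not_dvd P hP 0
    simp only [map_zero, sub_zero] at hQ hdvd
    set r := P.rootMultiplicity 0
    have hQ0 : Q ≠ 0 := by rintro rfl; simp at hdvd
    refine ⟨Q, hQ0, ?_, by rwa [Polynomial.X_dvd_iff] at hdvd⟩
    -- evaluate as polynomials in `x`
    let ψ : Polynomial (MvPolynomial (Fin m) ℂ) →+* MvPolynomial (Fin m) ℂ :=
      Polynomial.eval₂RingHom (aeval g).toRingHom h
    have hψ : ∀ (R : Polynomial (MvPolynomial (Fin m) ℂ)) x,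
        eval x (ψ R) = (R.map (eval fun i => eval x (g i))).eval (eval x h) := by
      intro R x
      rw [Polynomial.eval_map]
      simp only [ψ, Polynomial.coe_eval₂RingHom]
      rw [Polynomial.hom_eval₂]
      congr 1
      refine MvPolynomial.ringHom_ext (fun a => ?_) fun i => ?_ <;> simp
    have h1 : ψ P = 0 := by
      refine MvPolynomial.funext fun x => ?_
      rw [hψ, hPx, map_zero]
    rw [hQ, map_mul, map_pow] at h1
    have hX : ψ Polynomial.X = h := by simp [ψ]
    rw [hX] at h1
    have h2 := (mul_eq_zero.1 h1).resolve_left (pow_ne_zero _ hh)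
    intro x
    rw [← hψ, h2, map_zero]
  refine ⟨P.coeff 0, hP0, fun c hc => ?_⟩
  have hcont : Continuous fun q : (Fin m → ℂ) × ℂ =>
      ∑ j ∈ Finset.range (P.natDegree + 1), eval q.1 (P.coeff j) * q.2 ^ j := by
    refine continuous_finsetSum _ fun j _ => Continuous.mul ?_ (by fun_prop)
    exact (continuous_eval_poly (P.coeff j)).comp continuous_fst
  have h0 : ∑ j ∈ Finset.range (P.natDegree + 1), eval c (P.coeff j) * (0 : ℂ) ^ j ≠ 0 := by
    rw [Finset.sum_range_succ', Finset.sum_eq_zero]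
    · simpa using hc
    · simp
  have hev := (hcont.tendsto (c, 0)).eventually_ne h0
  obtain ⟨δ, hδ, hb⟩ := Metric.eventually_nhds_iff.1 hev
  refine ⟨δ / 2, by positivity, δ / 2, by positivity, fun x hx => ?_⟩
  by_contra! hlt
  refine hb (y := (fun i => eval x (g i), eval x h)) ?_ ?_
  · rw [Prod.dist_eq, dist_eq_norm, dist_zero_right]
    exact max_lt (hx.trans_lt (half_lt_self hδ)) (hlt.trans (half_lt_self hδ))
  · rw [← eval_map_eq_sum]
    exact hPx x

end

section
open Set Filter Topology

variable {n d m : ℕ}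

/-- The Hessian matrix of `f`, as a matrix of polynomials. -/
def hessM (f : MvPolynomial (Fin m) ℂ) : Matrix (Fin m) (Fin m) (MvPolynomial (Fin m) ℂ) :=
  Matrix.of fun i j => pderiv j (pderiv i f)

lemma hessL_eq_mulVec (f : MvPolynomial (Fin m) ℂ) (x v : Fin m → ℂ) :
    hessL f x v = ((hessM f).map (eval x)).mulVec v := by
  ext i
  simp [hessL, dotForm_apply, gradAt, Matrix.mulVec, dotProduct, hessM]

lemma injective_hessL_iff (f : MvPolynomial (Fin m) ℂ) (x : Fin m → ℂ) :
    (∀ w, hessL f x w = 0 → w = 0) ↔ eval x (hessM f).det ≠ 0 := by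
  have h1 : eval x (hessM f).det = ((hessM f).map (eval x)).det := RingHom.map_det (eval x) _
  rw [h1, ← not_iff_not, not_not, ← Matrix.exists_mulVec_eq_zero_iff]
  push Not
  simp only [hessL_eq_mulVec]
  exact ⟨fun ⟨v, h1, h2⟩ => ⟨v, h2, h1⟩, fun ⟨v, h1, h2⟩ => ⟨v, h2, h1⟩⟩

/-- If the gradient map is dominant, the Hessian determinant does not vanish identically. -/
lemma hessM_det_ne_zero {f : MvPolynomial (Fin m) ℂ}
    (hind : ∀ R : MvPolynomial (Fin m) ℂ, (∀ x, eval (gradAt f x) R = 0) → R = 0) :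
    (hessM f).det ≠ 0 := by
  classical
  -- minimal relations
  have hmin : ∀ i : Fin m, ∃ P : Polynomial (MvPolynomial (Fin m) ℂ),
      (∀ x, (P.map (eval (gradAt f x))).eval (x i) = 0) ∧
      ∃ x, (P.derivative.map (eval (gradAt f x))).eval (x i) ≠ 0 := by
    intro i
    have hex : ∃ N, ∃ P : Polynomial (MvPolynomial (Fin m) ℂ), P ≠ 0 ∧ P.natDegree = N ∧
        ∀ x, (P.map (eval (gradAt f x))).eval (x i) = 0 := by
      obtain ⟨P, hP, hPx⟩ := exists_algebraic_relation (fun i => pderiv i f) (X i)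
      exact ⟨_, P, hP, rfl, fun x => by
        have h := hPx x
        rw [eval_X] at h
        exact h⟩
    obtain ⟨P, hP, hPN, hPx⟩ := Nat.find_spec hex
    refine ⟨P, hPx, ?_⟩
    by_contra! hcon
    have hdeg : P.natDegree ≠ 0 := by
      intro h0
      rw [Polynomial.eq_C_of_natDegree_eq_zero h0] at hP hPx
      apply hP
      rw [hind (P.coeff 0) fun x => by simpa using hPx x, map_zero]
    have hder : P.derivative ≠ 0 := by
      intro h
      exact hdeg (Polynomial.derivative_eq_zero.1 h)
    exact Nat.find_min hex (hPN ▸ Polynomial.natDegree_derivative_lt hdeg)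
      ⟨_, hder, rfl, hcon⟩
  choose P hP hPd using hmin
  -- a common point where all derivatives are nonzero
  have hψ : ∀ i, ∃ q : MvPolynomial (Fin m) ℂ, ∀ x,
      eval x q = ((P i).derivative.map (eval (gradAt f x))).eval (x i) := by
    intro i
    refine ⟨(P i).derivative.eval₂ (aeval fun j => pderiv j f).toRingHom (X i), fun x => ?_⟩
    rw [Polynomial.eval_map, Polynomial.hom_eval₂, eval_X]
    congr 1
    refine MvPolynomial.ringHom_ext (fun a => ?_) fun j => ?_ <;> simp [gradAt]
  choose q hq using hψ
  have hprod : ∏ i, q i ≠ 0 := by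
    refine Finset.prod_ne_zero_iff.2 fun i _ h => ?_
    obtain ⟨x, hx⟩ := hPd i
    rw [← hq, h, map_zero] at hx
    exact hx rfl
  obtain ⟨x, hx⟩ : ∃ x, eval x (∏ i, q i) ≠ 0 := by
    by_contra! h
    exact hprod (MvPolynomial.funext fun x => by rw [h, map_zero])
  rw [map_prod, Finset.prod_ne_zero_iff] at hx
  suffices h : ∀ w, hessL f x w = 0 → w = 0 by
    intro h0
    rw [injective_hessL_iff, h0, map_zero] at h
    exact h rfl
  intro w hw
  funext i
  have hcurve : HasDerivAt (fun s : ℝ => x + (s : ℂ) • w) w 0 := by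
    have h1 : HasDerivAt (fun s : ℝ => (s : ℂ)) 1 0 := Complex.ofRealCLM.hasDerivAt
    simpa using (h1.smul_const w).const_add x
  have hgrad : HasDerivAt (fun s : ℝ => gradAt f (x + (s : ℂ) • w)) 0 0 := by
    have h1 := ((hasFDerivAt_gradAt f (x + ((0 : ℝ) : ℂ) • w)).restrictScalars ℝ).comp_hasDerivAt
      (0 : ℝ) hcurve
    refine h1.congr_deriv ?_
    simpa using hw
  have hsum : HasDerivAt (fun s : ℝ => ∑ j ∈ Finset.range ((P i).natDegree + 1),
      eval (gradAt f (x + (s : ℂ) • w)) ((P i).coeff j) * (x i + s * w i) ^ j)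
      (∑ j ∈ Finset.range ((P i).natDegree + 1),
        eval (gradAt f x) ((P i).coeff j) * (j * x i ^ (j - 1) * w i)) 0 := by
    refine HasDerivAt.fun_sum fun j _ => ?_
    have h1 := HasDerivAt.eval_poly ((P i).coeff j) hgrad
    have h2 : HasDerivAt (fun s : ℝ => x i + s * w i) (w i) 0 := by
      have h1 : HasDerivAt (fun s : ℝ => (s : ℂ)) 1 0 := Complex.ofRealCLM.hasDerivAt
      simpa using (h1.mul_const (w i)).const_add (x i)
    refine (h1.mul (h2.pow j)).congr_deriv ?_
    simp
  have hzero : (fun s : ℝ => ∑ j ∈ Finset.range ((P i).natDegree + 1),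
      eval (gradAt f (x + (s : ℂ) • w)) ((P i).coeff j) * (x i + s * w i) ^ j) = fun _ => 0 := by
    funext s
    have := hP i (x + (s : ℂ) • w)
    rw [eval_map_eq_sum] at this
    simpa using this
  rw [hzero] at hsum
  have h0 := hsum.unique (hasDerivAt_const _ _)
  have h3 : ((P i).derivative.map (eval (gradAt f x))).eval (x i) * w i = 0 := by
    rw [← h0, ← Polynomial.derivative_map, Polynomial.derivative_eval,
      Polynomial.sum_over_range' _ _ ((P i).natDegree + 1)
        (Nat.lt_succ_of_le Polynomial.natDegree_map_le), Finset.sum_mul]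
    · refine Finset.sum_congr rfl fun j _ => ?_
      rw [Polynomial.coeff_map]
      ring
    · simp
  have h4 := hx i (Finset.mem_univ i)
  rw [hq] at h4
  exact (mul_eq_zero.1 h3).resolve_left h4

lemma exists_nondeg_poly (f : MvPolynomial (Fin m) ℂ) :
    ∃ A : MvPolynomial (Fin m) ℂ, A ≠ 0 ∧ ∀ x, eval (gradAt f x) A ≠ 0 →
      ∀ w, hessL f x w = 0 → w = 0 := by
  by_cases hind : ∀ R : MvPolynomial (Fin m) ℂ, (∀ x, eval (gradAt f x) R = 0) → R = 0
  · obtain ⟨A, hA, h⟩ := exists_fibre_lower_bound (fun i => pderiv i f) (hessM_det_ne_zero hind)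
    refine ⟨A, hA, fun x hx => (injective_hessL_iff f x).2 ?_⟩
    obtain ⟨ε, hε, η, hη, hb⟩ := h _ hx
    have := hb x (by
      have : (fun i => eval x (pderiv i f)) - gradAt f x = 0 := sub_self _
      rw [this, norm_zero]; exact hε.le)
    exact norm_pos_iff.1 (hη.trans_le this)
  · push Not at hind
    obtain ⟨R, hR, hR0⟩ := hind
    exact ⟨R, hR0, fun x hx => absurd (hR x) hx⟩

/-- A polynomial whose homogeneous component does not vanish at `c` is nonzero somewhere on the
punctured line through `c`. -/
lemma exists_smul_eval_ne_zero {A : MvPolynomial (Fin m) ℂ} {E : ℕ} {c : Fin m → ℂ}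
    (h : eval c (homogeneousComponent E A) ≠ 0) : ∃ t : ℂ, t ≠ 0 ∧ eval (t • c) A ≠ 0 := by
  let q : Polynomial ℂ := ∑ e ∈ Finset.range (A.totalDegree + 1),
    Polynomial.C (eval c (homogeneousComponent e A)) * Polynomial.X ^ e
  have hE : E ∈ Finset.range (A.totalDegree + 1) := by
    by_contra hE
    rw [homogeneousComponent_eq_zero _ _ (by simpa using hE)] at h
    simp at h
  have hq : q ≠ 0 := by
    intro h0
    have := congrArg (fun p => Polynomial.coeff p E) h0
    simp only [q, Polynomial.finsetSum_coeff, Polynomial.coeff_C_mul, Polynomial.coeff_X_pow,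
      Polynomial.coeff_zero, mul_ite, mul_one, mul_zero, Finset.sum_ite_eq, hE, if_true] at this
    exact h this
  have heval : ∀ t, q.eval t = eval (t • c) A := by
    intro t
    conv_rhs => rw [← sum_homogeneousComponent A]
    simp only [q, Polynomial.eval_finsetSum, map_sum]
    refine Finset.sum_congr rfl fun e _ => ?_
    rw [eval_smul_of_isHomogeneous (homogeneousComponent_isHomogeneous e A), Polynomial.eval_mul,
      Polynomial.eval_C, Polynomial.eval_pow, Polynomial.eval_X, mul_comm]
  obtain ⟨t, ht⟩ : ∃ t, (q * Polynomial.X).eval t ≠ 0 := by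
    by_contra! hall
    exact mul_ne_zero hq Polynomial.X_ne_zero (Polynomial.funext fun t => by simp [hall t])
  rw [Polynomial.eval_mul, Polynomial.eval_X, heval] at ht
  exact ⟨t, right_ne_zero_of_mul ht, left_ne_zero_of_mul ht⟩

/-- Tameness and nondegeneracy hold outside a hypersurface. -/
lemma exists_generic_poly {f : MvPolynomial (Fin m) ℂ} (hf0 : f ≠ 0) (hd : 2 ≤ d)
    (hf : f.IsHomogeneous d) :
    ∃ (E : ℕ) (A : MvPolynomial (Fin m) ℂ), A ≠ 0 ∧ A.IsHomogeneous E ∧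
      ∀ c, eval c A ≠ 0 → TameAt f c d ∧ NondegAt f c := by
  choose AU hAU hU using fun i : Fin m => exists_fibre_bound (fun i => pderiv i f) (X i)
  obtain ⟨AL, hAL, hL⟩ := exists_fibre_lower_bound (fun i => pderiv i f) hf0
  obtain ⟨AN, hAN, hN⟩ := exists_nondeg_poly f
  set A := (∏ i, AU i) * (AL * AN) with hA
  have hA0 : A ≠ 0 := mul_ne_zero (Finset.prod_ne_zero_iff.2 fun i _ => hAU i) (mul_ne_zero hAL hAN)
  obtain ⟨E, hE⟩ : ∃ E, homogeneousComponent E A ≠ 0 := by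
    by_contra! h
    apply hA0
    rw [← sum_homogeneousComponent A, Finset.sum_eq_zero fun e _ => h e]
  refine ⟨E, _, hE, homogeneousComponent_isHomogeneous E A, fun c hc => ?_⟩
  obtain ⟨t, ht, htA⟩ := exists_smul_eval_ne_zero hc
  rw [hA, map_mul, map_mul, map_prod] at htA
  have htU : ∀ i, eval (t • c) (AU i) ≠ 0 := fun i =>
    Finset.prod_ne_zero_iff.1 (left_ne_zero_of_mul htA) i (Finset.mem_univ i)
  have htL := left_ne_zero_of_mul (right_ne_zero_of_mul htA)
  have htN := right_ne_zero_of_mul (right_ne_zero_of_mul htA)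
  have hd0 : 0 < d := by omega
  -- rescaling a point with gradient `l • c'`
  have hscale : ∀ (x c' : Fin m → ℂ) (l : ℂ), gradAt f x = l • c' → eval x f ≠ 0 →
      ∃ μ : ℂ, μ ≠ 0 ∧ gradAt f (μ • x) = t • c' := by
    intro x c' l hl hx
    have hl0 : l ≠ 0 := by
      rintro rfl
      rw [zero_smul] at hl
      have h1 := dotForm_gradAt_self hf x
      rw [hl] at h1
      have : (d : ℂ) ≠ 0 := by exact_mod_cast hd0.ne'
      exact mul_ne_zero this hx (by rw [← h1]; simp [dotForm_apply])
    obtain ⟨μ, hμ⟩ := IsAlgClosed.exists_pow_nat_eq (t / l) (show 0 < d - 1 by omega)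
    refine ⟨μ, ?_, ?_⟩
    · rintro rfl
      rw [zero_pow (by omega)] at hμ
      exact div_ne_zero ht hl0 hμ.symm
    · rw [gradAt_smul hf, hμ, hl, smul_smul, div_mul_cancel₀ _ hl0]
  constructor
  · choose εU hεU C hC using fun i => hU i _ (htU i)
    obtain ⟨εL, hεL, η, hη, hη'⟩ := hL _ htL
    obtain ⟨ε, hε, hεle⟩ : ∃ ε > 0, ε ≤ εL ∧ ∀ i, ε ≤ εU i := by
      rcases isEmpty_or_nonempty (Fin m) with h | h
      · exact ⟨εL, hεL, le_rfl, fun i => isEmptyElim i⟩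
      · refine ⟨min εL (Finset.univ.inf' Finset.univ_nonempty εU), lt_min hεL ?_, min_le_left _ _,
          fun i => (min_le_right _ _).trans (Finset.inf'_le _ (Finset.mem_univ i))⟩
        exact (Finset.lt_inf'_iff _).2 fun i _ => hεU i
    obtain ⟨K, hK, hCK⟩ : ∃ K : ℝ, 0 ≤ K ∧ ∀ i, C i ≤ K :=
      ⟨∑ i, |C i|, Finset.sum_nonneg fun _ _ => abs_nonneg _, fun i => (le_abs_self _).trans
        (Finset.single_le_sum (f := fun i => |C i|) (fun _ _ => abs_nonneg _) (Finset.mem_univ i))⟩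
    have htn : 0 < ‖t‖ := norm_pos_iff.2 ht
    refine ⟨ε / ‖t‖, by positivity, K ^ d / η, fun x c' l hc' hl hx => ?_⟩
    obtain ⟨μ, hμ, hg⟩ := hscale x c' l hl hx
    have hclose : ‖gradAt f (μ • x) - t • c‖ ≤ ε := by
      rw [hg, ← smul_sub, norm_smul]
      rwa [le_div_iff₀' htn] at hc'
    have h1 : ‖μ • x‖ ≤ K := (pi_norm_le_iff_of_nonneg hK).2 fun i => by
      have := hC i (μ • x) (hclose.trans (hεle.2 i))
      rw [eval_X] at this
      exact this.trans (hCK i)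
    have h2 := hη' (μ • x) (hclose.trans hεle.1)
    rw [eval_smul_of_isHomogeneous hf, norm_mul, norm_pow] at h2
    rw [norm_smul] at h1
    have hμn : 0 < ‖μ‖ ^ d := pow_pos (norm_pos_iff.2 hμ) _
    have h3 : ‖μ‖ ^ d * ‖x‖ ^ d ≤ K ^ d := by
      rw [← mul_pow]
      exact pow_le_pow_left₀ (by positivity) h1 d
    rw [div_mul_eq_mul_div, le_div_iff₀ hη]
    refine le_of_mul_le_mul_left ?_ hμn
    calc ‖μ‖ ^ d * (‖x‖ ^ d * η) = (‖μ‖ ^ d * ‖x‖ ^ d) * η := by ring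
      _ ≤ K ^ d * (‖μ‖ ^ d * ‖eval x f‖) := by gcongr
      _ = _ := by ring
  · intro p hp w hw hB
    obtain ⟨hp1, hp0, l, hl⟩ := hp
    have hc0 : c ≠ 0 := by
      rintro rfl
      simp [dotForm_apply] at hp1
    have hinj : ∀ w, hessL f p w = 0 → w = 0 := by
      obtain ⟨μ, hμ, hg⟩ := hscale p c l hl hp0
      intro w hw
      refine hN (μ • p) (by rw [hg]; exact htN) w ?_
      funext i
      have h1 := congrFun hw i
      simp only [hessL, ContinuousLinearMap.pi_apply, Pi.zero_apply] at h1 ⊢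
      rw [gradAt_smul (hf.pderiv (i := i)), dotForm_smul_left, h1, mul_zero]
    obtain ⟨α, hα⟩ : ∃ α : ℂ, hessL f p w = α • c := by
      rw [exists_eq_smul_iff hc0]
      intro i j
      have h1 := hB (c i • Pi.single j 1 - c j • Pi.single i 1) (by
        simp [dotForm_apply, Pi.single_apply, mul_sub, mul_comm])
      rw [hessB_apply] at h1
      simp [dotForm_apply, Pi.single_apply, mul_sub] at h1
      linear_combination h1
    have heul : hessL f p p = ((d - 1 : ℕ) * l) • c := by
      rw [mul_smul, ← hl]
      funext i
      simp only [hessL, ContinuousLinearMap.pi_apply]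
      rw [dotForm_gradAt_self (hf.pderiv (i := i))]
      rfl
    have hl0 : ((d - 1 : ℕ) : ℂ) * l ≠ 0 := by
      refine mul_ne_zero (by exact_mod_cast (by omega : d - 1 ≠ 0)) ?_
      rintro rfl
      have h1 := dotForm_gradAt_self hf p
      rw [hl, zero_smul] at h1
      have : (d : ℂ) ≠ 0 := by exact_mod_cast hd0.ne'
      exact mul_ne_zero this hp0 (by rw [← h1]; simp [dotForm_apply])
    have h2 := hinj (w - (α / ((d - 1 : ℕ) * l)) • p) (by
      rw [map_sub, map_smul, hα, heul, smul_smul, div_mul_cancel₀ _ hl0, sub_self])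
    rw [sub_eq_zero] at h2
    rw [h2, map_smul, hp1, smul_eq_mul, mul_one] at hw
    rw [h2, hw, zero_smul]

end

section
open Set Filter Topology

lemma nonempty_homeomorph_of_isQuotientMap {X Y T : Type*} [TopologicalSpace X]
    [TopologicalSpace Y] [TopologicalSpace T] {p : X → Y} {q : X → T} (hp : IsQuotientMap p)
    (hq : IsQuotientMap q) (h : ∀ x y, p x = p y ↔ q x = q y) : Nonempty (Y ≃ₜ T) := by
  have h1 : ∀ x, q (Function.surjInv hp.surjective (p x)) = q x := fun x =>
    (h _ _).1 (Function.surjInv_eq hp.surjective (p x))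
  have h2 : ∀ x, p (Function.surjInv hq.surjective (q x)) = p x := fun x =>
    (h _ _).2 (Function.surjInv_eq hq.surjective (q x))
  refine ⟨⟨⟨fun y => q (Function.surjInv hp.surjective y),
    fun t => p (Function.surjInv hq.surjective t), fun y => ?_, fun t => ?_⟩, ?_, ?_⟩⟩
  · exact (h2 _).trans (Function.surjInv_eq hp.surjective y)
  · exact (h1 _).trans (Function.surjInv_eq hq.surjective t)
  · exact hp.continuous_iff.2 (hq.continuous.congr fun x => (h1 x).symm)
  · exact hq.continuous_iff.2 (hp.continuous.congr fun x => (h2 x).symm)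

variable {n : ℕ}

lemma exists_hyperplane_coords {c : Fin (n + 1) → ℂ} (hc : c ≠ 0) :
    ∃ (L : (Fin n → ℂ) →L[ℂ] (Fin (n + 1) → ℂ)) (M : (Fin (n + 1) → ℂ) →L[ℂ] (Fin n → ℂ)),
      (∀ y, dotForm c (L y) = 0) ∧ (∀ y, M (L y) = y) ∧ ∀ x, dotForm c x = 0 → L (M x) = x := by
  obtain ⟨i, hi⟩ := Function.ne_iff.1 hc
  simp only [Pi.zero_apply] at hi
  let g : (Fin n → ℂ) →L[ℂ] ℂ := (-(c i)⁻¹) • dotForm fun j => c (i.succAbove j)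
  have hg : ∀ y, c i * g y = -∑ j, c (i.succAbove j) * y j := fun y => by
    simp only [g, _root_.smul_apply, dotForm_apply, smul_eq_mul]
    field_simp
  let L : (Fin n → ℂ) →L[ℂ] (Fin (n + 1) → ℂ) := ContinuousLinearMap.pi
    (Fin.insertNth (α := fun _ => (Fin n → ℂ) →L[ℂ] ℂ) i g fun j => ContinuousLinearMap.proj j)
  have hL1 : ∀ y, L y i = g y := fun y => by simp [L]
  have hL2 : ∀ y j, L y (i.succAbove j) = y j := fun y j => by simp [L]
  refine ⟨L, ContinuousLinearMap.pi fun j => ContinuousLinearMap.proj (i.succAbove j), fun y => ?_,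
    fun y => funext fun j => hL2 y j, fun x hx => funext fun k => ?_⟩
  · rw [dotForm_apply, Fin.sum_univ_succAbove _ i, hL1, hg]
    simp [hL2]
  · rcases Fin.eq_self_or_eq_succAbove i k with rfl | ⟨j, rfl⟩
    · rw [hL1]
      rw [dotForm_apply, Fin.sum_univ_succAbove _ k] at hx
      refine mul_left_cancel₀ hi ?_
      rw [hg]
      exact (eq_neg_of_add_eq_zero_left hx).symm
    · exact hL2 _ j

lemma exists_pullback {m l : ℕ} (L : (Fin m → ℂ) →L[ℂ] (Fin l → ℂ)) {f : MvPolynomial (Fin l) ℂ}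
    {d : ℕ} (hf : f.IsHomogeneous d) :
    ∃ h : MvPolynomial (Fin m) ℂ, h.IsHomogeneous d ∧ ∀ y, eval y h = eval (L y) f := by
  refine ⟨aeval (fun i => ∑ j, C (L (Pi.single j 1) i) * X j) f, ?_, fun y => ?_⟩
  · rw [← one_mul d]
    exact hf.aeval (fun i => ∑ j, C (L (Pi.single j 1) i) * X j) fun i =>
      IsHomogeneous.sum _ _ _ fun j _ => by simpa using (isHomogeneous_C _ _).mul (isHomogeneous_X ℂ j)
  · have h0 : (eval y).comp (algebraMap ℂ (MvPolynomial (Fin m) ℂ)) = RingHom.id ℂ := by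
      ext; simp
    rw [map_aeval, h0]
    change eval _ f = _
    congr 2
    ext i
    conv_rhs => rw [← Finset.univ_sum_single y]
    rw [map_sum, map_sum, Finset.sum_apply]
    refine Finset.sum_congr rfl fun j _ => ?_
    have : Pi.single j (y j) = y j • (Pi.single j 1 : Fin m → ℂ) := by
      rw [← Pi.single_smul, smul_eq_mul, mul_one]
    rw [this, map_smul]
    simp [mul_comm]

lemma nonempty_homeomorph_section {m d : ℕ} {f : MvPolynomial (Fin (m + 2)) ℂ}
    {h : MvPolynomial (Fin (m + 1)) ℂ} {c : Fin (m + 2) → ℂ} (hf : f.IsHomogeneous d) (hd : 0 < d)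
    (hh : h.IsHomogeneous d) {L : (Fin (m + 1) → ℂ) →L[ℂ] (Fin (m + 2) → ℂ)}
    {M : (Fin (m + 2) → ℂ) →L[ℂ] (Fin (m + 1) → ℂ)} (h1 : ∀ y, dotForm c (L y) = 0)
    (h2 : ∀ y, M (L y) = y) (h3 : ∀ x, dotForm c x = 0 → L (M x) = x)
    (hL : ∀ y, eval y h = eval (L y) f) :
    Nonempty ({x : ↥(principalOpen f) | dotForm c (coneRep x).1 = 0} ≃ₜ ↥(principalOpen h)) := by
  let S := {x : ↥(principalOpen f) | dotForm c (coneRep x).1 = 0}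
  have hS : ∀ x : coneProj hf hd ⁻¹' S, dotForm c x.1.1 = 0 := fun x =>
    (MorseData.dotForm_coneRep_coneProj hf hd x.1).1 x.2
  have hq := isOpenQuotientMap_coneProj hf hd
  have hM : ∀ x : coneProj hf hd ⁻¹' S, eval (M x.1.1) h ≠ 0 := fun x => by
    rw [hL, h3 _ (hS x)]
    exact x.1.2
  let r : coneProj hf hd ⁻¹' S → OpenCone h := fun x => ⟨M x.1.1, hM x⟩
  have hr : IsQuotientMap r := by
    refine IsQuotientMap.of_inverse (f := fun y : OpenCone h => (⟨⟨L y.1, (hL y.1) ▸ y.2⟩,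
      (MorseData.dotForm_coneRep_coneProj hf hd _).2 (h1 y.1)⟩ : coneProj hf hd ⁻¹' S)) ?_ ?_
        fun y : OpenCone h => Subtype.ext (h2 y.1)
    · fun_prop
    · fun_prop
  refine nonempty_homeomorph_of_isQuotientMap (p := S.restrictPreimage (coneProj hf hd))
    (IsOpenQuotientMap.isQuotientMap ⟨S.restrictPreimage_surjective hq.surjective,
      hq.continuous.restrictPreimage, hq.isOpenMap.restrictPreimage S⟩)
    ((isOpenQuotientMap_coneProj hh hd).isQuotientMap.comp hr) fun x y => ?_
  rw [Function.comp_apply, Function.comp_apply, coneProj_eq_iff, ← Subtype.coe_inj,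
    Set.restrictPreimage_coe, Set.restrictPreimage_coe, coneProj_eq_iff]
  refine exists_congr fun a => and_congr_right fun _ => ⟨fun h => ?_, fun h => ?_⟩
  · simp only [r, h, map_smul]
  · rw [← h3 _ (hS x), ← h3 _ (hS y), ← map_smul]
    exact congrArg L h

end

section
open Set Filter Topology

lemma exists_hasEulerChar_section {n d : ℕ} {f : MvPolynomial (Fin (n + 1)) ℂ}
    (hf : f.IsHomogeneous d) (hd : 0 < d) {c : Fin (n + 1) → ℂ} (hc : c ≠ 0)
    (ih : ∀ m, n = m + 1 → ∀ h : MvPolynomial (Fin (m + 1)) ℂ, h.IsHomogeneous d →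
      ∃ a, HasEulerChar ↥(principalOpen h) a) :
    ∃ a, HasEulerChar {x : ↥(principalOpen f) | dotForm c (coneRep x).1 = 0} a := by
  obtain ⟨L, M, h1, h2, h3⟩ := exists_hyperplane_coords hc
  rcases n with _ | m
  · have : IsEmpty {x : ↥(principalOpen f) | dotForm c (coneRep x).1 = 0} := ⟨fun x => by
      refine (coneRep x.1).2 ?_
      rw [← h3 _ x.2, Subsingleton.elim (M _) 0, map_zero]
      exact eval_zero_of_isHomogeneous hf hd⟩
    exact ⟨0, hasEulerChar_of_isEmpty⟩
  · obtain ⟨h, hh, hL⟩ := exists_pullback L hf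
    obtain ⟨e⟩ := nonempty_homeomorph_section hf hd hh h1 h2 h3 hL
    obtain ⟨a, ha⟩ := ih m rfl h hh
    exact ⟨a, ha.homeo e.symm⟩

lemma principalOpen_sq {n : ℕ} (f : MvPolynomial (Fin (n + 1)) ℂ) :
    principalOpen (f ^ 2) = principalOpen f := by
  ext x
  simp [principalOpen]

lemma exists_fin_enum {α : Type*} {S : Set α} (hS : S.Finite) :
    ∃ p : Fin S.ncard → α, Function.Injective p ∧ range p = S := by
  have := hS.to_subtype
  let e : S ≃ Fin S.ncard := Finite.equivFin S
  refine ⟨fun i => (e.symm i).1, Subtype.val_injective.comp e.symm.injective, ?_⟩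
  exact (range_comp Subtype.val e.symm).trans (by
    rw [e.symm.surjective.range_eq, image_univ, Subtype.range_coe])

lemma exists_hasEulerChar_principalOpen (n : ℕ) : ∀ (d : ℕ) (f : MvPolynomial (Fin (n + 1)) ℂ),
    0 < d → f.IsHomogeneous d → ∃ a, HasEulerChar ↥(principalOpen f) a := by
  induction n using Nat.strong_induction_on with
  | _ n ih =>
    intro d f hd hf
    rcases eq_or_ne f 0 with rfl | hf0
    · have : IsEmpty ↥(principalOpen (0 : MvPolynomial (Fin (n + 1)) ℂ)) :=
        ⟨fun x => x.2 (map_zero _)⟩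
      exact ⟨0, hasEulerChar_of_isEmpty⟩
    rw [← principalOpen_sq]
    have hd2 : 0 < d * 2 := by omega
    have hf2 := hf.pow 2
    obtain ⟨E, A, hA, -, hc⟩ := exists_generic_poly (pow_ne_zero 2 hf0) (by omega) hf2
    obtain ⟨c, hcA⟩ : ∃ c, eval c (A * X 0) ≠ 0 := by
      by_contra! h
      exact mul_ne_zero hA (X_ne_zero 0) (MvPolynomial.funext fun x => by rw [h, map_zero])
    rw [map_mul, eval_X] at hcA
    have hc0 : c ≠ 0 := fun h => right_ne_zero_of_mul hcA (by rw [h]; rfl)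
    obtain ⟨hT, hN⟩ := hc c (left_ne_zero_of_mul hcA)
    obtain ⟨p, hp, hpr⟩ := exists_fin_enum (finite_critSet hf2 hd2 hc0 hT hN)
    obtain ⟨D⟩ := exists_morseData hf2 hd2 hc0 hT hN hp hpr
    obtain ⟨a, ha⟩ := exists_hasEulerChar_section hf2 hd2 hc0 fun m hm h hh =>
      ih m (by omega) _ h hd2 hh
    exact ⟨_, (D.boxFlow hf2 hd2).hasEulerChar ha⟩

lemma hasEulerChar_affine_cone_of_dvd {m e : ℕ} {q : MvPolynomial (Fin (m + 1)) ℂ} (he : 0 < e)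
    (hq : q.IsHomogeneous e) {i : Fin (m + 1)} (hi : X i ∣ q) :
    HasEulerChar {y : Fin (m + 1) → ℂ | eval y q ≠ 0} 0 := by
  have h0 : ∀ y : OpenCone q, y.1 i ≠ 0 := fun y h => by
    obtain ⟨r, hr⟩ := hi
    exact y.2 ((congrArg (MvPolynomial.eval y.1) hr).trans (by rw [map_mul, eval_X, h, zero_mul]))
  obtain ⟨a, ha⟩ := exists_hasEulerChar_principalOpen m e q he hq
  have hc := continuous_coneProj hq he
  let ψ : ↥(principalOpen q) × ℂ → (Fin (m + 1) → ℂ) := fun p =>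
    (p.2 / (coneRep p.1).1 i) • (coneRep p.1).1
  have hψ1 : ∀ (y : OpenCone q) (s : ℂ), ψ (coneProj hq he y, s) = (s / y.1 i) • y.1 := fun y s => by
    obtain ⟨b, hb, h⟩ := exists_coneRep_coneProj hq he y
    have := h0 y
    simp only [ψ, h, smul_smul, Pi.smul_apply, smul_eq_mul]
    congr 1
    field_simp
  have hψ : Continuous ψ := by
    have h := (isOpenQuotientMap_coneProj hq he).prodMap (IsOpenQuotientMap.id (X := ℂ))
    rw [← h.continuous_comp_iff]
    have : Continuous fun p : OpenCone q × ℂ => (p.2 / p.1.1 i) • p.1.1 :=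
      (continuous_snd.div ((continuous_apply i).comp (continuous_subtype_val.comp continuous_fst))
        fun p => h0 p.1).smul (continuous_subtype_val.comp continuous_fst)
    exact this.congr fun p => (hψ1 p.1 p.2).symm
  have hψ2 : ∀ p : ↥(principalOpen q) × ℂ, p.2 ≠ 0 → eval (ψ p) q ≠ 0 := fun p hp => by
    rw [eval_smul_of_isHomogeneous hq]
    exact mul_ne_zero (pow_ne_zero _ (div_ne_zero hp (h0 (coneRep p.1)))) (coneRep p.1).2
  refine ha.prod_complex_ne_zero.homeo ⟨⟨fun p => ⟨ψ p.1, hψ2 _ p.2⟩,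
    fun y => ⟨(coneProj hq he y, y.1 i), h0 y⟩, fun p => ?_, fun y => ?_⟩, ?_, ?_⟩
  · refine Subtype.ext (Prod.ext ?_ ?_)
    · change coneProj hq he ⟨ψ p.1, _⟩ = p.1.1
      conv_rhs => rw [← coneProj_coneRep hq he p.1.1]
      refine ((coneProj_eq_iff hq he _ _).2 ⟨_, div_ne_zero p.2 (h0 (coneRep p.1.1)), ?_⟩).symm
      rfl
    · exact div_mul_cancel₀ _ (h0 (coneRep p.1.1))
  · refine Subtype.ext ?_
    change ψ (coneProj hq he y, y.1 i) = y.1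
    rw [hψ1, div_self (h0 y), one_smul]
  · exact (hψ.comp continuous_subtype_val).subtype_mk _
  · exact (hc.prodMk ((continuous_apply i).comp continuous_subtype_val)).subtype_mk _

lemma hasEulerChar_affine_cone {m d : ℕ} {h : MvPolynomial (Fin m) ℂ} (hd : 0 < d)
    (hh : h.IsHomogeneous d) : HasEulerChar {y : Fin m → ℂ | eval y h ≠ 0} 0 := by
  rcases m with _ | m
  · have : IsEmpty {y : Fin 0 → ℂ | eval y h ≠ 0} := ⟨fun y => y.2 (by
      rw [Subsingleton.elim y.1 0]
      exact eval_zero_of_isHomogeneous hh hd)⟩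
    exact hasEulerChar_of_isEmpty
  have := hasEulerChar_biUnion_zero (fun i : Fin (m + 1) => {y : Fin (m + 1) → ℂ | y i ≠ 0})
    (fun i => isOpen_ne_fun (continuous_apply i) continuous_const) Finset.univ
    {y | eval y h ≠ 0} (isOpen_ne_fun (continuous_eval_poly h) continuous_const) fun t _ ⟨i, hi⟩ => by
      refine (hasEulerChar_affine_cone_of_dvd (q := h * ∏ i ∈ t, X i) (e := d + ∑ i ∈ t, 1) (i := i)
        (by omega) (hh.mul (IsHomogeneous.prod _ _ _ fun i _ => isHomogeneous_X ℂ i))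
        ((Finset.dvd_prod_of_mem _ hi).mul_left _)).of_eq ?_ rfl
      ext y
      simp [Finset.prod_ne_zero_iff, and_comm]
  refine this.of_eq ?_ rfl
  refine inter_eq_right.2 fun y hy => ?_
  by_contra h0
  simp only [Finset.mem_univ, iUnion_true, mem_iUnion, not_exists, mem_ofPred_eq, not_not] at h0
  exact hy (by rw [show y = 0 from funext h0]; exact eval_zero_of_isHomogeneous hh hd)

end

section
open Set Filter Topology

/-- Radial rescaling trades the complement of a cone for a sublevel complement. -/
lemma nonempty_homeomorph_norm_gt {m d : ℕ} {h : MvPolynomial (Fin m) ℂ} (hd : 0 < d)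
    (hh : h.IsHomogeneous d) {C : ℝ} (hC : 0 < C) :
    Nonempty ({y : Fin m → ℂ | eval y h ≠ 0} ≃ₜ {y : Fin m → ℂ | C < ‖eval y h‖}) := by
  let r : ℝ → ℝ := fun u => ((u + C) / u) ^ ((d : ℝ)⁻¹)
  let s : ℝ → ℝ := fun u => ((u - C) / u) ^ ((d : ℝ)⁻¹)
  have hpow : ∀ a : ℝ, 0 ≤ a → (a ^ ((d : ℝ)⁻¹)) ^ d = a := fun a ha =>
    Real.rpow_inv_natCast_pow ha hd.ne'
  have hr : ∀ y : Fin m → ℂ, eval y h ≠ 0 →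
      ‖eval ((r ‖eval y h‖ : ℂ) • y) h‖ = ‖eval y h‖ + C := fun y hy => by
    have hp := norm_pos_iff.2 hy
    rw [eval_smul_of_isHomogeneous hh, norm_mul, norm_pow, Complex.norm_real,
      Real.norm_of_nonneg (by positivity), hpow _ (by positivity), div_mul_cancel₀ _ hp.ne']
  have hs : ∀ y : Fin m → ℂ, C < ‖eval y h‖ →
      ‖eval ((s ‖eval y h‖ : ℂ) • y) h‖ = ‖eval y h‖ - C := fun y hy => by
    have hp := hC.trans hy
    have h1 : 0 ≤ (‖eval y h‖ - C) / ‖eval y h‖ := div_nonneg (by linarith) hp.le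
    rw [eval_smul_of_isHomogeneous hh, norm_mul, norm_pow, Complex.norm_real,
      Real.norm_of_nonneg (Real.rpow_nonneg h1 _), hpow _ h1, div_mul_cancel₀ _ hp.ne']
  have hrs : ∀ u : ℝ, 0 < u → s (u + C) * r u = 1 := fun u hu => by
    simp only [r, s]
    rw [← Real.mul_rpow (by rw [add_sub_cancel_right]; positivity) (by positivity),
      add_sub_cancel_right, div_mul_div_cancel₀ (by positivity), div_self hu.ne', Real.one_rpow]
  have hc := continuous_eval_poly h
  refine ⟨⟨⟨fun y => ⟨(r ‖eval y.1 h‖ : ℂ) • y.1, ?_⟩, fun y => ⟨(s ‖eval y.1 h‖ : ℂ) • y.1, ?_⟩,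
    fun y => Subtype.ext ?_, fun y => Subtype.ext ?_⟩, ?_, ?_⟩⟩
  · rw [mem_ofPred_eq, hr _ y.2]
    linarith [norm_pos_iff.2 y.2]
  · rw [mem_ofPred_eq, ← norm_pos_iff, hs _ y.2]
    exact sub_pos.2 y.2
  · change (s ‖eval ((r ‖eval y.1 h‖ : ℂ) • y.1) h‖ : ℂ) • (r ‖eval y.1 h‖ : ℂ) • y.1 = y.1
    rw [hr _ y.2, smul_smul, ← Complex.ofReal_mul, hrs _ (norm_pos_iff.2 y.2), Complex.ofReal_one,
      one_smul]
  · change (r ‖eval ((s ‖eval y.1 h‖ : ℂ) • y.1) h‖ : ℂ) • (s ‖eval y.1 h‖ : ℂ) • y.1 = y.1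
    have := hrs _ (sub_pos.2 y.2)
    rw [sub_add_cancel, mul_comm] at this
    rw [hs _ y.2, smul_smul, ← Complex.ofReal_mul, this, Complex.ofReal_one, one_smul]
  · refine Continuous.subtype_mk (Continuous.smul (Complex.continuous_ofReal.comp ?_)
      continuous_subtype_val) _
    have h1 : Continuous fun y : {y : Fin m → ℂ | eval y h ≠ 0} => ‖eval y.1 h‖ :=
      (hc.comp continuous_subtype_val).norm
    exact ((h1.add continuous_const).div h1 fun y => norm_ne_zero_iff.2 y.2).rpow_const
      fun _ => Or.inr (by positivity)
  · refine Continuous.subtype_mk (Continuous.smul (Complex.continuous_ofReal.comp ?_)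
      continuous_subtype_val) _
    have h1 : Continuous fun y : {y : Fin m → ℂ | C < ‖eval y h‖} => ‖eval y.1 h‖ :=
      (hc.comp continuous_subtype_val).norm
    exact ((h1.sub continuous_const).div h1 fun y => (hC.trans y.2).ne').rpow_const
      fun _ => Or.inr (by positivity)

namespace MorseData
variable {n : ℕ}
variable {f : MvPolynomial (Fin (n + 1)) ℂ} {c : Fin (n + 1) → ℂ} {k : ℕ} (D : MorseData f c k)
variable {d : ℕ} (hf : f.IsHomogeneous d) (hd : 0 < d)

include hf hd in
lemma exists_shift : ∃ Φ : ℝ → (Fin (n + 1) → ℂ) → (Fin (n + 1) → ℂ),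
    (∀ x ∈ {x | eval x f ≠ 0}, Φ 0 x = x) ∧
    (∀ t, ∀ x ∈ {x | eval x f ≠ 0}, Φ t x ∈ {x | eval x f ≠ 0}) ∧
    (∀ x ∈ {x | eval x f ≠ 0}, ∀ t, HasDerivAt (Φ · x) (D.U (Φ t x)) t) ∧
    ContinuousOn (Function.uncurry Φ) (univ ×ˢ {x | eval x f ≠ 0}) := by
  have hε := D.ε_pos
  refine exists_flow (isOpen_openCone f) (v := D.U) (B := fun x => exhaust f x + 1)
    (fun x hx => (D.contDiffAt_U hf hd hx).contDiffWithinAt)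
    (fun x hx => ((contDiffAt_exhaust f hx).add contDiffAt_const).contDiffWithinAt) (fun x _ => ?_)
    (fun R => ?_) (C := 2 * (n + 1) ^ 2 * D.ε⁻¹) fun x hx => ?_
  · unfold exhaust; positivity
  · simpa only [← le_sub_iff_add_le] using isCompact_exhaust_le f (R - 1)
  · have hx0 := ne_zero_of_eval_ne_zero hf hd hx
    have hp := norm_pos_iff.2 hx0
    have h1 := abs_fderiv_exhaust_le_add f hx (v := D.U x) (C := D.ε⁻¹ / ‖x‖) (ρ := 0)
      (by positivity) (by rw [div_mul_cancel₀ _ hp.ne']; exact D.norm_U_le hx hx0)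
      (by simp [D.gradAt_dotForm_U])
    rw [fderiv_add_const]
    refine h1.trans ?_
    have h2 : ∑ i, ‖x i‖ ^ 2 ≤ (n + 1) * ‖x‖ ^ 2 := by
      calc _ ≤ ∑ _i : Fin (n + 1), ‖x‖ ^ 2 :=
            Finset.sum_le_sum fun i _ => pow_le_pow_left₀ (norm_nonneg _) (norm_le_pi_norm x i) 2
        _ = _ := by simp
    have h3 : ‖x‖ ≤ exhaust f x + 1 := by
      have h4 := norm_sq_le_sum x
      have h5 : 0 ≤ (‖eval x f‖ ^ 2)⁻¹ := by positivity
      rw [exhaust]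
      nlinarith
    calc _ ≤ 2 * (n + 1) * (D.ε⁻¹ / ‖x‖) * ((n + 1) * ‖x‖ ^ 2) + 2 * 0 * (‖eval x f‖ ^ 2)⁻¹ := by
          gcongr
      _ = 2 * (n + 1) ^ 2 * D.ε⁻¹ * ‖x‖ := by field_simp; ring
      _ ≤ _ := by gcongr

/-- Along the transversal field the linear form grows at unit speed, at a high level. -/
lemma shift_spec {y : ℝ → Fin (n + 1) → ℂ} (hy : ∀ t, eval (y t) f ≠ 0)
    (hy' : ∀ t, HasDerivAt y (D.U (y t)) t) (hcap : D.cap < ‖eval (y 0) f‖) {a : ℝ}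
    (ha : a ∈ Icc (0 : ℝ) 1) (hl : dotForm c (y 0) = a) (hf : f.IsHomogeneous d) (hd : 0 < d) :
    (∀ t, eval (y t) f = eval (y 0) f) ∧
      ∀ t : ℝ, a + t ∈ Icc (0 : ℝ) 1 → dotForm c (y t) = (a + t : ℝ) := by
  have h1 : ∀ t, HasDerivAt (fun t => eval (y t) f) 0 t := fun t => by
    simpa only [D.gradAt_dotForm_U] using HasDerivAt.eval_poly f (hy' t)
  have hconst : ∀ t, eval (y t) f = eval (y 0) f := fun t =>
    is_const_of_deriv_eq_zero (fun t => (h1 t).differentiableAt) (fun t => (h1 t).deriv) t 0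
  refine ⟨hconst, ?_⟩
  have h2 : ∀ t, HasDerivAt (fun t => dotForm c (y t)) ((1 - D.chiSum (y t) : ℝ) : ℂ) t :=
    fun t => by
      have := HasDerivAt.dotForm c (hy' t)
      rw [D.dotForm_U (hy t) (ne_zero_of_eval_ne_zero hf hd (hy t))] at this
      exact_mod_cast this
  have hre : ∀ t, HasDerivAt (fun t => (dotForm c (y t)).re) (1 - D.chiSum (y t)) t := fun t => by
    exact (Complex.reCLM.hasFDerivAt.comp_hasDerivAt t (h2 t)).congr_deriv (by simp)
  have him : ∀ t, HasDerivAt (fun t => (dotForm c (y t)).im) 0 t := fun t => by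
    exact (Complex.imCLM.hasFDerivAt.comp_hasDerivAt t (h2 t)).congr_deriv (by simp)
  have him0 : ∀ t, (dotForm c (y t)).im = 0 := fun t => by
    have := is_const_of_deriv_eq_zero (fun t => (him t).differentiableAt) (fun t => (him t).deriv) t 0
    simpa [hl] using this
  have hmono : Monotone fun t => (dotForm c (y t)).re :=
    monotone_of_hasDerivAt_nonneg hre fun t => sub_nonneg.2 (D.chiSum_le_one _)
  have hanti : Monotone fun t => t - (dotForm c (y t)).re :=
    monotone_of_hasDerivAt_nonneg (fun t => (hasDerivAt_id t).sub (hre t)) fun t => by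
      simpa using D.chiSum_nonneg (y t)
  have hre0 : (dotForm c (y 0)).re = a := by simp [hl]
  have hbd : ∀ t, a + t ∈ Icc (0 : ℝ) 1 → (dotForm c (y t)).re ∈ Icc (0 : ℝ) 1 := by
    intro t ht
    rcases le_total 0 t with h | h <;>
    · have h3 := hmono h
      have h4 := hanti h
      simp only [hre0] at h3 h4
      constructor <;> linarith [ht.1, ht.2, ha.1, ha.2]
  have hchi : ∀ t, a + t ∈ Icc (0 : ℝ) 1 → D.chiSum (y t) = 0 := fun t ht => by
    refine Finset.sum_eq_zero fun i _ => D.chi_eq_zero_of_far hf ?_ i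
    have h5 : ‖dotForm c (y t)‖ ≤ 1 := by
      rw [← Complex.re_add_im (dotForm c (y t)), him0]
      simpa [abs_of_nonneg (hbd t ht).1] using (hbd t ht).2
    rw [far, hconst]
    exact (mul_le_of_le_one_right D.cap_pos.le (pow_le_one₀ (norm_nonneg _) h5)).trans_lt hcap
  intro t ht
  have h6 := (convex_uIcc 0 t).norm_image_sub_le_of_norm_hasDerivWithin_le (C := 0)
    (f := fun t => (dotForm c (y t)).re - t) (f' := fun t => 1 - D.chiSum (y t) - 1)
    (fun s _ => ((hre s).sub (hasDerivAt_id s)).hasDerivWithinAt) (fun s hs => by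
      rw [hchi s ?_]
      · simp
      · rcases mem_uIcc.1 hs with h | h <;>
          constructor <;> linarith [ht.1, ht.2, ha.1, ha.2, h.1, h.2])
    left_mem_uIcc right_mem_uIcc
  rw [zero_mul, norm_le_zero_iff, hre0, sub_zero, sub_eq_zero, sub_eq_iff_eq_add] at h6
  exact Complex.ext (by simpa using h6) (by simpa using him0 t)

include hf hd in
lemma hasEulerChar_high_level (hc : c ≠ 0) :
    HasEulerChar {x | dotForm c x = 1 ∧ D.cap < ‖eval x f‖} 0 := by
  obtain ⟨Φ, h0, hΩ, hΦ, hΦc⟩ := D.exists_shift hf hd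
  obtain ⟨L, M, h1, h2, h3⟩ := exists_hyperplane_coords hc
  obtain ⟨h, hh, hL⟩ := exists_pullback L hf
  obtain ⟨e⟩ := nonempty_homeomorph_norm_gt hd hh D.cap_pos
  have hne : ∀ x, D.cap < ‖eval x f‖ → eval x f ≠ 0 := fun x hx =>
    norm_pos_iff.1 (D.cap_pos.trans hx)
  have hspec : ∀ x, D.cap < ‖eval x f‖ → ∀ a ∈ Icc (0 : ℝ) 1, dotForm c x = a →
      (∀ t, eval (Φ t x) f = eval x f) ∧
        ∀ t : ℝ, a + t ∈ Icc (0 : ℝ) 1 → dotForm c (Φ t x) = (a + t : ℝ) := fun x hx a ha hl => by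
    have hx' := hne x hx
    have := D.shift_spec (y := fun t => Φ t x) (fun t => hΩ t x hx') (hΦ x hx')
      (by rwa [h0 x hx']) ha (by rwa [h0 x hx']) hf hd
    rwa [h0 x hx'] at this
  have hinv : ∀ s x, eval x f ≠ 0 → Φ s (Φ (-s) x) = x := fun s x hx => by
    have := integralCurve_unique (t₀ := -s) (isOpen_openCone f) (v := D.U)
      (fun x hx => (D.contDiffAt_U hf hd hx).contDiffWithinAt)
      (f := fun t => Φ (t + s) (Φ (-s) x)) (g := fun t => Φ t x)
      (fun t => hΩ _ _ (hΩ _ _ hx))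
      (fun t => (hΦ _ (hΩ _ _ hx) (t + s)).comp_add_const t s) (hΦ x hx)
      (by simp only [neg_add_cancel]; exact h0 _ (hΩ _ _ hx))
    simpa [h0 x hx] using congrFun this 0
  have hcont : ∀ t, ContinuousOn (Φ t) {x | D.cap < ‖eval x f‖} := fun t =>
    hΦc.comp (f := fun x => (t, x)) (by fun_prop) fun x hx => ⟨mem_univ _, hne x hx⟩
  have hdown : ∀ x, dotForm c x = 1 ∧ D.cap < ‖eval x f‖ →
      eval (Φ (-1) x) f = eval x f ∧ dotForm c (Φ (-1) x) = 0 := fun x hx => by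
    obtain ⟨h4, h5⟩ := hspec x hx.2 1 (by simp) (by simp [hx.1])
    exact ⟨h4 _, by simpa using h5 (-1) (by simp)⟩
  have hup : ∀ y, D.cap < ‖eval y h‖ →
      eval (Φ 1 (L y)) f = eval y h ∧ dotForm c (Φ 1 (L y)) = 1 := fun y hy => by
    rw [hL] at hy
    obtain ⟨h4, h5⟩ := hspec (L y) hy 0 (by simp) (by simp [h1])
    exact ⟨(h4 _).trans (hL y).symm, by simpa using h5 1 (by simp)⟩
  have hMx : ∀ x, dotForm c x = 1 ∧ D.cap < ‖eval x f‖ →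
      D.cap < ‖eval (M (Φ (-1) x)) h‖ := fun x hx => by
    rw [hL, h3 _ (hdown _ hx).2, (hdown _ hx).1]
    exact hx.2
  refine (((hasEulerChar_affine_cone hd hh).homeo e).homeo
    ⟨⟨fun y => ⟨Φ 1 (L y.1), (hup _ y.2).2, by rw [(hup _ y.2).1]; exact y.2⟩,
      fun x => ⟨M (Φ (-1) x.1), hMx x.1 x.2⟩, fun y => Subtype.ext ?_, fun x => Subtype.ext ?_⟩, ?_, ?_⟩)
  · have := hinv (-1) (L y.1) (hne _ (by rw [← hL]; exact y.2))
    rw [neg_neg] at this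
    change M (Φ (-1) (Φ 1 (L y.1))) = y.1
    rw [this, h2]
  · change Φ 1 (L (M (Φ (-1) x.1))) = x.1
    rw [h3 _ (hdown _ x.2).2, hinv 1 _ (hne _ x.2.2)]
  · exact ((hcont 1).comp_continuous (L.continuous.comp continuous_subtype_val)
      fun y => by rw [mem_ofPred_eq, Function.comp_apply, ← hL]; exact y.2).subtype_mk _
  · exact (M.continuous.comp ((hcont (-1)).comp_continuous continuous_subtype_val
      fun x => x.2.2)).subtype_mk _

end MorseData
end

section
open Set Filter Topology

namespace BoxFlow
variable {X : Type} [TopologicalSpace X] [T3Space X] {E : Type*} [NormedAddCommGroup E]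
  [NormedSpace ℝ E] {ι : Type*} (F : BoxFlow X E ι)

lemma nbhd_homotopyEquiv : Nonempty (ContinuousMap.HomotopyEquiv F.nbhd F.attr) := by
  have hmem : ∀ (s : ℝ) (x : F.nbhd), F.flowTo |s| x ∈ F.nbhd := fun s x => by
    unfold flowTo
    split_ifs with h
    · exact F.flow_nbhd _ (div_nonneg (abs_nonneg s) (by linarith)) _ x.2
    · exact F.attr_subset (F.limit_mem (F.nbhd_subset_basin x.2))
  obtain ⟨e⟩ := homotopyEquiv_of_deformation (X := F.nbhd) (S := Subtype.val ⁻¹' F.attr)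
    (H := fun s x => ⟨F.flowTo |s| x, hmem s x⟩) (by
      rw [continuousOn_iff_continuous_domRestrict]
      refine Continuous.subtype_mk ?_ _
      refine F.continuousOn_flowTo.comp_continuous
        (f := fun p : ↥(Icc (0 : ℝ) 1 ×ˢ (univ : Set F.nbhd)) => (|p.1.1|, (p.1.2 : X)))
        (by fun_prop) fun p => ?_
      have h1 : |p.1.1| ≤ 1 := by rw [abs_of_nonneg p.2.1.1]; exact p.2.1.2
      rcases lt_or_eq_of_le h1 with h | h
      · exact Or.inl h
      · exact Or.inr ⟨h, F.nbhd_subset_basin p.1.2.2⟩)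
    (fun x => by simp) (fun x => by simpa using F.limit_mem (F.nbhd_subset_basin x.2))
    (fun s _ x hx => by simpa [F.flowTo_attr |s| hx] using hx)
  exact ⟨e.trans (preimageValHomeo F.attr_subset).toHomotopyEquiv⟩

end BoxFlow

lemma attachCells_homeomorph {A A' : Type} [TopologicalSpace A] [TopologicalSpace A'] (e : A ≃ₜ A')
    {m k : ℕ} (φ : Fin k → C(Metric.sphere (0 : EuclideanSpace ℝ (Fin m)) 1, A)) :
    Nonempty (AttachCells A m k φ ≃ₜ
      AttachCells A' m k fun i => (e : C(A, A')).comp (φ i)) := by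
  refine ⟨⟨Quot.congr (e.toEquiv.sumCongr (Equiv.refl _)) fun x y => ?_, ?_, ?_⟩⟩
  · refine exists_congr fun i => exists_congr fun v => and_congr ?_ ?_
    · rcases x with x | x <;> simp
    · rcases y with y | y <;> simp
  · exact continuous_quot_lift _ (continuous_quot_mk.comp (e.continuous.sumMap continuous_id))
  · exact continuous_quot_lift _ (continuous_quot_mk.comp (e.symm.continuous.sumMap continuous_id))

namespace MorseData
variable {n : ℕ}
variable {f : MvPolynomial (Fin (n + 1)) ℂ} {c : Fin (n + 1) → ℂ} {k : ℕ} (D : MorseData f c k)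
variable {d : ℕ} (hf : f.IsHomogeneous d) (hd : 0 < d)

include hf hd in
lemma hasEulerChar_overlap (hc : c ≠ 0) :
    HasEulerChar ↥({x : ↥(principalOpen f) | dotForm c (coneRep x).1 ≠ 0} ∩
      {x | D.far d (coneRep x).1}) 0 := by
  have h := isOpenQuotientMap_coneProj hf hd
  have h1 : ∀ x : ↥({x : ↥(principalOpen f) | dotForm c (coneRep x).1 ≠ 0} ∩
      {x | D.far d (coneRep x).1}),
      dotForm c ((dotForm c (coneRep x.1).1)⁻¹ • (coneRep x.1).1) = 1 ∧
      D.cap < ‖eval ((dotForm c (coneRep x.1).1)⁻¹ • (coneRep x.1).1) f‖ := fun x => by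
    have h2 : dotForm c ((dotForm c (coneRep x.1).1)⁻¹ • (coneRep x.1).1) = 1 := by
      rw [map_smul, smul_eq_mul, inv_mul_cancel₀ x.2.1]
    refine ⟨h2, ?_⟩
    have h3 := (D.far_smul hf (inv_ne_zero x.2.1) (coneRep x.1).1).2 x.2.2
    simpa [far, h2] using h3
  have h4 : ∀ x : {x | dotForm c x = 1 ∧ D.cap < ‖eval x f‖}, eval x.1 f ≠ 0 := fun x =>
    norm_pos_iff.1 (D.cap_pos.trans x.2.2)
  have h5 : ∀ x : {x | dotForm c x = 1 ∧ D.cap < ‖eval x f‖}, coneProj hf hd ⟨x.1, h4 x⟩ ∈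
      ({x : ↥(principalOpen f) | dotForm c (coneRep x).1 ≠ 0} ∩
      {x | D.far d (coneRep x).1}) := fun x => by
    refine ⟨?_, ?_⟩
    · rw [mem_ofPred_eq, ne_eq, dotForm_coneRep_coneProj, x.2.1]; exact one_ne_zero
    · rw [mem_ofPred_eq, far_coneRep_coneProj, far, x.2.1]; simpa using x.2.2
  refine (D.hasEulerChar_high_level hf hd hc).homeo ⟨⟨fun x => ⟨_, h5 x⟩, fun x => ⟨_, h1 x⟩,
    fun x => Subtype.ext ?_, fun x => Subtype.ext ?_⟩, ?_, ?_⟩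
  · obtain ⟨b, hb, h6⟩ := exists_coneRep_coneProj hf hd ⟨x.1, h4 x⟩
    simp only [h6, map_smul, x.2.1, smul_eq_mul, mul_one, smul_smul, inv_mul_cancel₀ hb, one_smul]
  · conv_rhs => rw [← coneProj_coneRep hf hd x.1]
    exact ((coneProj_eq_iff hf hd _ _).2 ⟨_, inv_ne_zero x.2.1, rfl⟩).symm
  · exact ((continuous_coneProj hf hd).comp (continuous_subtype_val.subtype_mk _)).subtype_mk _
  · refine Continuous.subtype_mk ?_ _
    have : ContinuousOn (fun x : ↥(principalOpen f) => (dotForm c (coneRep x).1)⁻¹ • (coneRep x).1)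
        {x | dotForm c (coneRep x).1 ≠ 0} := by
      intro x hx
      refine ContinuousAt.continuousWithinAt ?_
      rw [← coneProj_coneRep hf hd x, ← h.continuousAt_comp_iff]
      have : (fun x : ↥(principalOpen f) => (dotForm c (coneRep x).1)⁻¹ • (coneRep x).1) ∘
          coneProj hf hd = fun y => (dotForm c y.1)⁻¹ • y.1 := by
        ext1 y
        obtain ⟨b, hb, h6⟩ := exists_coneRep_coneProj hf hd y
        simp only [Function.comp_apply, h6, map_smul, smul_eq_mul, smul_smul, mul_inv]
        rw [mul_right_comm, inv_mul_cancel₀ hb, one_mul]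
      rw [this]
      refine ContinuousAt.smul (f := fun y : OpenCone f => (dotForm c y.1)⁻¹)
        (ContinuousAt.inv₀ ?_ hx) continuous_subtype_val.continuousAt
      exact ((dotForm c).continuous.comp continuous_subtype_val).continuousAt
    exact this.comp_continuous continuous_subtype_val fun x => x.2.1

include D hf hd in
lemma hasEulerChar_compl_hyperplane (hc : c ≠ 0) :
    HasEulerChar ↥(principalOpen f \ hyperplane c) ((-1) ^ n * k) := by
  obtain ⟨a, ha⟩ := exists_hasEulerChar_section hf hd hc fun m _ h hh =>
    exists_hasEulerChar_principalOpen m d h hd hh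
  let F := D.boxFlow hf hd
  have ha' : HasEulerChar F.attr a := ha
  obtain ⟨e⟩ := F.nbhd_homotopyEquiv
  have hO : IsOpen {x : ↥(principalOpen f) | dotForm c (coneRep x).1 ≠ 0} :=
    (isClosed_dotForm_coneRep hf hd).isOpen_compl
  have hu : {x : ↥(principalOpen f) | dotForm c (coneRep x).1 ≠ 0} ∪ F.nbhd = univ :=
    eq_univ_of_forall fun x => or_iff_not_imp_left.2 fun h => F.attr_subset (not_not.1 h)
  have h := HasEulerChar.of_union hO F.isOpen_nbhd
    (((F.hasEulerChar ha').homeo (Homeomorph.Set.univ _).symm).of_eq hu.symm rfl)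
    (ha'.congr e.symm) (D.hasEulerChar_overlap hf hd hc)
  have ho : {x : ↥(principalOpen f) | dotForm c (coneRep x).1 ≠ 0} =
      Subtype.val ⁻¹' (principalOpen f \ hyperplane c) := by
    ext x
    rw [mem_ofPred_eq, dotForm_apply]
    exact (and_iff_right x.2).symm
  exact ((h.of_eq ho rfl).homeo (preimageValHomeo sdiff_subset)).of_eq rfl (by ring)

include D hf hd in
lemma exists_attachCells :
    ∃ φ : Fin k → C(Metric.sphere (0 : EuclideanSpace ℝ (Fin n)) 1,
        ↥(principalOpen f ∩ hyperplane c)),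
      Nonempty (ContinuousMap.HomotopyEquiv ↥(principalOpen f)
        (AttachCells ↥(principalOpen f ∩ hyperplane c) n k φ)) := by
  obtain ⟨φ, ⟨e⟩⟩ := (D.boxFlow hf hd).exists_attachCells
  have he : (D.boxFlow hf hd).attr =
      Subtype.val ⁻¹' (principalOpen f ∩ hyperplane c) := by
    ext x
    change dotForm c (coneRep x).1 = 0 ↔ _
    rw [dotForm_apply]
    exact (and_iff_right x.2).symm
  obtain ⟨e'⟩ := attachCells_homeomorph
    ((Homeomorph.setCongr he).trans (preimageValHomeo inter_subset_left)) φ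
  exact ⟨_, ⟨e.trans e'.toHomotopyEquiv⟩⟩

end MorseData
end

section
open Set Filter Topology
variable {n d : ℕ} {f : MvPolynomial (Fin (n + 1)) ℂ}

lemma IsZariskiClosed.union {S S' : Set (Proj n)} (h : IsZariskiClosed S)
    (h' : IsZariskiClosed S') : IsZariskiClosed (S ∪ S') := by
  obtain ⟨T, hT, rfl⟩ := h
  obtain ⟨T', hT', rfl⟩ := h'
  refine ⟨image2 (· * ·) T T', ?_, ?_⟩
  · rintro _ ⟨p, hp, q, hq, rfl⟩
    obtain ⟨m, hm⟩ := hT p hp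
    obtain ⟨m', hm'⟩ := hT' q hq
    exact ⟨_, hm.mul hm'⟩
  · ext x
    simp only [mem_union, mem_ofPred_eq, forall_mem_image2, map_mul, mul_eq_zero]
    refine ⟨fun h p hp q hq => h.imp (· p hp) (· q hq), fun h => ?_⟩
    by_contra! h'
    obtain ⟨⟨p, hp, hp'⟩, q, hq, hq'⟩ := h'
    exact (h p hp q hq).elim hp' hq'

lemma IsZariskiOpenDense.inter {U V : Set (Proj n)} (hU : IsZariskiOpenDense U)
    (hV : IsZariskiOpenDense V) : IsZariskiOpenDense (U ∩ V) := by
  refine ⟨by rw [compl_inter]; exact hU.1.union hV.1, fun W hW hW' => ?_⟩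
  rw [inter_assoc]
  exact hU.2 _ (by rw [compl_inter]; exact hV.1.union hW) (hV.2 W hW hW')

lemma isZariskiOpenDense_ne_zero (hf0 : f ≠ 0) (hf : f.IsHomogeneous d) :
    IsZariskiOpenDense {x | eval x.rep f ≠ 0} := by
  refine ⟨⟨{f}, by simpa using ⟨d, hf⟩, by ext; simp⟩, fun W ⟨T, hT, hW⟩ ⟨w, hw⟩ => ?_⟩
  have hWT : ∀ x, x ∈ W ↔ ∃ g ∈ T, eval x.rep g ≠ 0 := fun x => by
    rw [← notMem_compl_iff, hW, mem_ofPred_eq]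
    push Not
    rfl
  obtain ⟨g, hg, hgw⟩ := (hWT w).1 hw
  obtain ⟨m, hm⟩ := hT g hg
  obtain ⟨v, hv⟩ : ∃ v, eval v (f * g * X 0) ≠ 0 := by
    by_contra! h
    refine mul_ne_zero (mul_ne_zero hf0 ?_) (X_ne_zero 0)
      (MvPolynomial.funext fun x => by rw [h, map_zero])
    rintro rfl
    exact hgw (map_zero _)
  simp only [map_mul, eval_X, mul_ne_zero_iff] at hv
  obtain ⟨⟨h1, h2⟩, h3⟩ := hv
  have hv0 : v ≠ 0 := fun h => h3 (by rw [h]; rfl)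
  obtain ⟨a, ha, h⟩ := exists_rep_eq_smul v hv0
  exact ⟨Projectivization.mk ℂ v hv0, (mk_mem_principalOpen hf hv0).2 h1,
    (hWT _).2 ⟨g, hg, (mk_mem_principalOpen hm hv0).2 h2⟩⟩

lemma critSet_sq (f : MvPolynomial (Fin (n + 1)) ℂ) (c : Fin (n + 1) → ℂ) :
    critSet (f ^ 2) c = critSet f c := by
  ext x
  refine and_congr_right fun _ => ?_
  rw [map_pow, pow_ne_zero_iff two_ne_zero]
  refine and_congr_right fun hx => ?_
  have : gradAt (f ^ 2) x = (2 * eval x f) • gradAt f x := by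
    ext i; simp [gradAt, pow_two, two_mul, add_mul]
  rw [this]
  have h2 : 2 * eval x f ≠ 0 := mul_ne_zero two_ne_zero hx
  refine ⟨fun ⟨l, h⟩ => ⟨(2 * eval x f)⁻¹ * l, ?_⟩, fun ⟨l, h⟩ => ⟨_, by rw [h, smul_smul]⟩⟩
  rw [mul_smul, ← h, inv_smul_smul₀ h2]

lemma mem_gradFiber_mk (hf : f.IsHomogeneous d) (hd : 0 < d) {c : Fin (n + 1) → ℂ} (hc : c ≠ 0)
    (x : Proj n) : x ∈ gradFiber f (Projectivization.mk ℂ c hc) ↔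
      eval x.rep f ≠ 0 ∧ ∃ l : ℂ, gradAt f x.rep = l • c := by
  refine and_congr_right fun hx => ⟨fun ⟨h, h'⟩ => ?_, fun ⟨l, hl⟩ => ?_⟩
  · obtain ⟨a, ha⟩ := (Projectivization.mk_eq_mk_iff' ..).1 h'
    exact ⟨a, ha.symm⟩
  · have h0 : gradAt f x.rep ≠ 0 := fun h => by
      have := dotForm_gradAt_self hf x.rep
      rw [h, dotForm_apply] at this
      simp [hd.ne', hx.out] at this
    exact ⟨h0, (Projectivization.mk_eq_mk_iff' ..).2 ⟨l, hl.symm⟩⟩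

lemma ncard_critSet (hf : f.IsHomogeneous d) (hd : 0 < d) {c : Fin (n + 1) → ℂ} (hc : c ≠ 0) :
    (critSet f c).ncard = (gradFiber f (Projectivization.mk ℂ c hc)).ncard := by
  have hm := mem_gradFiber_mk hf hd hc
  have : critSet f c = (fun x : Proj n => (dotForm c x.rep)⁻¹ • x.rep) ''
      gradFiber f (Projectivization.mk ℂ c hc) := by
    refine Subset.antisymm (fun y ⟨h1, h2, l, hl⟩ => ?_) ?_
    · have hy := ne_zero_of_eval_ne_zero hf hd h2
      obtain ⟨a, ha, h⟩ := exists_rep_eq_smul y hy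
      refine ⟨_, (hm _).2 ⟨(mk_mem_principalOpen hf hy).2 h2, a ^ (d - 1) * l, ?_⟩, ?_⟩
      · rw [h, gradAt_smul hf, hl, smul_smul]
      · simp only [h, map_smul, h1, smul_eq_mul, mul_one, inv_smul_smul₀ ha]
    · rintro _ ⟨x, hx, rfl⟩
      obtain ⟨h1, l, hl⟩ := (hm x).1 hx
      exact (inv_smul_mem_critSet hf hd h1 hl).2
  rw [this, InjOn.ncard_image]
  intro x hx y hy h
  obtain ⟨h1, l, hl⟩ := (hm x).1 hx
  have h0 := (inv_smul_mem_critSet hf hd h1 hl).1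
  rw [← x.mk_rep, ← y.mk_rep]
  refine (Projectivization.mk_eq_mk_iff' ..).2 ⟨dotForm c x.rep * (dotForm c y.rep)⁻¹, ?_⟩
  rw [mul_smul]
  exact (congrArg (dotForm c x.rep • ·) h.symm).trans (smul_inv_smul₀ h0 _)

end

/-- Theorem 1 of the paper.  For any non-constant homogeneous
polynomial `f ∈ ℂ[x₀,…,x_n]`, and any generic hyperplane `H` in `ℙⁿ` (generic:
belonging to a Zariski open and dense family of hyperplanes), the complement
`D(f)` is homotopy equivalent to a CW complex obtained from `D(f) ∩ H` by
attaching `d(f)` cells of dimension `n`; in particular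
`d(f) = (-1)ⁿ · χ(D(f) \ H)`. -/
theorem gradient_degree_attaching_cells_euler
    (n d : ℕ) (f : MvPolynomial (Fin (n + 1)) ℂ)
    (hf0 : f ≠ 0) (hd : 0 < d) (hf : f.IsHomogeneous d) :
    ∃ G : Set (Proj n), IsZariskiOpenDense G ∧
      ∀ (c : Fin (n + 1) → ℂ) (hc : c ≠ 0), Projectivization.mk ℂ c hc ∈ G →
        ∀ k : ℕ, HasGradDegree f k →
          (∃ φ : Fin k → C(Metric.sphere (0 : EuclideanSpace ℝ (Fin n)) 1,
                ↥(principalOpen f ∩ hyperplane c)),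
            Nonempty (ContinuousMap.HomotopyEquiv (↥(principalOpen f))
              (AttachCells (↥(principalOpen f ∩ hyperplane c)) n k φ))) ∧
          HasEulerChar (↥(principalOpen f \ hyperplane c)) ((-1 : ℤ) ^ n * k) := by
  have hd2 : 0 < d * 2 := by omega
  have hf2 := hf.pow 2
  obtain ⟨E, A, hA, hAh, hgen⟩ := exists_generic_poly (pow_ne_zero 2 hf0) (by omega) hf2
  have hG := isZariskiOpenDense_ne_zero hA hAh
  by_cases h : ∃ k, HasGradDegree f k
  · obtain ⟨_, U, hU, hkU⟩ := h
    refine ⟨_, hG.inter hU, fun c hc hcG k ⟨V, hV, hkV⟩ => ?_⟩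
    obtain ⟨hT, hN⟩ := hgen c ((mk_mem_principalOpen hAh hc).1 hcG.1)
    obtain ⟨u, h1, h2⟩ := hV.2 U hU.1 ⟨_, hcG.2⟩
    have hk : (critSet (f ^ 2) c).ncard = k := by
      rw [critSet_sq, ncard_critSet hf hd hc, (hkU _ hcG.2).2, ← (hkU u h2).2, (hkV u h1).2]
    obtain ⟨p, hp, hpr⟩ := exists_fin_enum (finite_critSet hf2 hd2 hc hT hN)
    obtain ⟨D⟩ := exists_morseData hf2 hd2 hc hT hN hp hpr
    subst hk
    rw [← principalOpen_sq f]
    exact ⟨D.exists_attachCells hf2 hd2, D.hasEulerChar_compl_hyperplane hf2 hd2 hc⟩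
  · exact ⟨_, hG, fun c hc _ k hk => absurd ⟨k, hk⟩ h⟩

end
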